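/- For every ε > 0 there is a constant C_ε such that for all X ≥ 1 and each choice of sign ±, one has |N_3^±(X) − C^±·X/(12·ζ(3)) − K^±·(4·ζ(1/3)/(5·Γ(2/3)³·ζ(5/3)))·X^{5/6}| ≤ C_ε·X^{7/9+ε}, where C^+ = 1, K^+ = 1, C^- = 3, K^- = √3. -/

import Mathlib

/-- A cubic field: a number field of degree 3 over `ℚ`. -/
structure CubicField where
  carrier : Type
  [field : Field carrier]
  [nf : NumberField carrier]
  deg : Module.finrank ℚ carrier = 3

attribute [instance] CubicField.field CubicField.nf

/-- Two cubic fields are identified if they are isomorphic. -/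
instance CubicField.setoid : Setoid CubicField where
  r A B := Nonempty (A.carrier ≃+* B.carrier)
  iseqv := ⟨fun _ => ⟨RingEquiv.refl _⟩, fun ⟨e⟩ => ⟨e.symm⟩, fun ⟨e⟩ ⟨f⟩ => ⟨e.trans f⟩⟩

/-- The number of isomorphism classes of cubic fields whose discriminant satisfies `P`. -/
noncomputable def countCubic (P : ℤ → Prop) : ℕ :=
  Nat.card {C : Quotient CubicField.setoid //
    ∃ K : CubicField, ⟦K⟧ = C ∧ P (NumberField.discr K.carrier)}

open MeasureTheory Filter Topology Finset Set Real Matrix UpperHalfPlane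
open ENNReal (ofReal)
open ENNReal hiding rpow_natCast rpow_mul rpow_add rpow_neg rpow_neg_one rpow_le_rpow
  rpow_le_rpow_iff rpow_one rpow_sub rpow_lt_rpow rpow_zero one_rpow rpow_two
  rpow_le_rpow_of_exponent_le one_le_rpow
open scoped ENNReal UpperHalfPlane Modular ComplexConjugate MatrixGroups

/-- Integral binary matrices. -/
local notation "Mat" => Matrix (Fin 2) (Fin 2) ℤ

/-- Three-dimensional real space. -/
local notation "ℝ³" => ℝ × ℝ × ℝ

noncomputable section

/-- A binary cubic form `a x³ + b x² y + c x y² + d y³`. -/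
@[ext] structure Cub (R : Type*) where
  a : R
  b : R
  c : R
  d : R

namespace Cub

/-- Binary cubic forms are quadruples of coefficients. -/
def equivProd (R : Type*) : Cub R ≃ R × R × R × R where
  toFun f := (f.a, f.b, f.c, f.d)
  invFun t := ⟨t.1, t.2.1, t.2.2.1, t.2.2.2⟩
  left_inv _ := rfl
  right_inv _ := rfl

instance : Countable (Cub ℤ) := (equivProd ℤ).injective.countable

instance {R : Type*} : DecidableEq (Cub R) := Classical.decEq _

variable {R : Type*} [CommRing R]

/-- The value of a form at a vector. -/
def ev (f : Cub R) (x y : R) : R := f.a * x ^ 3 + f.b * x ^ 2 * y + f.c * x * y ^ 2 + f.d * y ^ 3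

/-- The partial derivative in the first variable. -/
def evx (f : Cub R) (x y : R) : R := 3 * f.a * x ^ 2 + 2 * f.b * x * y + f.c * y ^ 2

/-- The partial derivative in the second variable. -/
def evy (f : Cub R) (x y : R) : R := f.b * x ^ 2 + 2 * f.c * x * y + 3 * f.d * y ^ 2

/-- The discriminant of a form. -/
def disc (f : Cub R) : R :=
  f.b ^ 2 * f.c ^ 2 - 4 * f.a * f.c ^ 3 - 4 * f.b ^ 3 * f.d - 27 * f.a ^ 2 * f.d ^ 2
    + 18 * f.a * f.b * f.c * f.d

/-- The linear substitution `f((x, y) M)`. -/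
def sub (M : Matrix (Fin 2) (Fin 2) R) (f : Cub R) : Cub R where
  a := f.ev (M 0 0) (M 0 1)
  b := f.evx (M 0 0) (M 0 1) * M 1 0 + f.evy (M 0 0) (M 0 1) * M 1 1
  c := f.evx (M 1 0) (M 1 1) * M 0 0 + f.evy (M 1 0) (M 1 1) * M 0 1
  d := f.ev (M 1 0) (M 1 1)

/-- Scaling of a form. -/
def scal (k : R) (f : Cub R) : Cub R := ⟨k * f.a, k * f.b, k * f.c, k * f.d⟩

/-- The image of a form under a ring homomorphism. -/
def map {S : Type*} [CommRing S] (φ : R →+* S) (f : Cub R) : Cub S := ⟨φ f.a, φ f.b, φ f.c, φ f.d⟩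

lemma sub_mul (M N : Matrix (Fin 2) (Fin 2) R) (f : Cub R) :
    sub (M * N) f = sub M (sub N f) := by
  ext <;> simp only [sub, ev, evx, evy, mul_apply, Fin.sum_univ_two] <;> ring

lemma sub_one (f : Cub R) : sub 1 f = f := by
  ext <;> simp [sub, ev, evx, evy]

lemma sub_scal_matrix (k : R) (f : Cub R) : sub (k • (1 : Matrix (Fin 2) (Fin 2) R)) f
    = scal (k ^ 3) f := by
  ext <;> simp [sub, scal, ev, evx, evy, Matrix.smul_apply] <;> ring

lemma sub_scal (M : Matrix (Fin 2) (Fin 2) R) (k : R) (f : Cub R) :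
    sub M (scal k f) = scal k (sub M f) := by
  ext <;> simp only [sub, scal, ev, evx, evy] <;> ring

lemma scal_scal (k l : R) (f : Cub R) : scal k (scal l f) = scal (k * l) f := by
  ext <;> simp only [scal] <;> ring

lemma scal_one (f : Cub R) : scal 1 f = f := by ext <;> simp [scal]

lemma scal_injective [NoZeroDivisors R] {k : R} (hk : k ≠ 0) :
    Function.Injective (scal k) := by
  intro f g h
  simp only [scal, Cub.mk.injEq, mul_eq_mul_left_iff, hk, or_false] at h
  ext <;> tauto

lemma disc_sub (M : Matrix (Fin 2) (Fin 2) R) (f : Cub R) :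
    (sub M f).disc = M.det ^ 6 * f.disc := by
  simp only [sub, disc, ev, evx, evy, det_fin_two]; ring

lemma disc_scal (k : R) (f : Cub R) : (scal k f).disc = k ^ 4 * f.disc := by
  simp only [disc, scal]; ring

lemma ev_sub (M : Matrix (Fin 2) (Fin 2) R) (f : Cub R) (x y : R) :
    (sub M f).ev x y = f.ev (x * M 0 0 + y * M 1 0) (x * M 0 1 + y * M 1 1) := by
  simp only [sub, ev, evx, evy]; ring

lemma evx_sub (M : Matrix (Fin 2) (Fin 2) R) (f : Cub R) (x y : R) :
    (sub M f).evx x y = M 0 0 * f.evx (x * M 0 0 + y * M 1 0) (x * M 0 1 + y * M 1 1)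
      + M 0 1 * f.evy (x * M 0 0 + y * M 1 0) (x * M 0 1 + y * M 1 1) := by
  simp only [sub, ev, evx, evy]; ring

lemma evy_sub (M : Matrix (Fin 2) (Fin 2) R) (f : Cub R) (x y : R) :
    (sub M f).evy x y = M 1 0 * f.evx (x * M 0 0 + y * M 1 0) (x * M 0 1 + y * M 1 1)
      + M 1 1 * f.evy (x * M 0 0 + y * M 1 0) (x * M 0 1 + y * M 1 1) := by
  simp only [sub, ev, evx, evy]; ring

lemma ev_scal (k : R) (f : Cub R) (x y : R) : (scal k f).ev x y = k * f.ev x y := by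
  simp only [scal, ev]; ring

lemma map_sub {S : Type*} [CommRing S] (φ : R →+* S) (M : Matrix (Fin 2) (Fin 2) R) (f : Cub R) :
    (sub M f).map φ = sub (M.map φ) (f.map φ) := by
  ext <;> simp [sub, map, ev, evx, evy, map_ofNat]

lemma ev_map {S : Type*} [CommRing S] (φ : R →+* S) (f : Cub R) (x y : R) :
    (f.map φ).ev (φ x) (φ y) = φ (f.ev x y) := by
  simp [map, ev]

/-- An integral form is irreducible if it has no nontrivial integral (equivalently rational) zero. -/
def Irr (f : Cub ℤ) : Prop := ∀ x y : ℤ, f.ev x y = 0 → x = 0 ∧ y = 0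

/-- Divisibility of all coefficients. -/
def Dvd (k : R) (f : Cub R) : Prop := k ∣ f.a ∧ k ∣ f.b ∧ k ∣ f.c ∧ k ∣ f.d

lemma dvd_iff {k : R} {f : Cub R} : Dvd k f ↔ ∃ g, f = scal k g := by
  constructor
  · rintro ⟨⟨a, ha⟩, ⟨b, hb⟩, ⟨c, hc⟩, ⟨d, hd⟩⟩
    exact ⟨⟨a, b, c, d⟩, by ext <;> simp [scal, *]⟩
  · rintro ⟨g, rfl⟩
    exact ⟨⟨_, rfl⟩, ⟨_, rfl⟩, ⟨_, rfl⟩, ⟨_, rfl⟩⟩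

lemma irr_scal {k : ℤ} (hk : k ≠ 0) (f : Cub ℤ) : Irr (scal k f) ↔ Irr f := by
  simp [Irr, ev_scal, hk]

lemma irr_sub {M : Mat} (hM : M.det ≠ 0) (f : Cub ℤ) :
    Irr (sub M f) ↔ Irr f := by
  have key : ∀ (M : Mat), M.det ≠ 0 → ∀ f : Cub ℤ, Irr f → Irr (sub M f) := by
    intro M hM f hf x y h
    rw [ev_sub] at h
    obtain ⟨h1, h2⟩ := hf _ _ h
    rw [det_fin_two] at hM
    constructor
    · have : x * (M 0 0 * M 1 1 - M 0 1 * M 1 0) = 0 := by linear_combination M 1 1 * h1 - M 1 0 * h2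
      simpa [hM] using this
    · have : y * (M 0 0 * M 1 1 - M 0 1 * M 1 0) = 0 := by linear_combination M 0 0 * h2 - M 0 1 * h1
      simpa [hM] using this
  refine ⟨fun h => ?_, key M hM f⟩
  have h2 := key M.adjugate (by simpa [det_adjugate] using hM) _ h
  rw [← sub_mul, adjugate_mul, sub_scal_matrix, irr_scal (pow_ne_zero _ hM)] at h2
  exact h2

end Cub

/-- The group `GL₂(ℤ)` as a set of integral matrices. -/
abbrev UMat := {M : Mat // M.det = 1 ∨ M.det = -1}

namespace Cub

/-- The representatives of the sublattices of index `p`. -/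
def hrep (p : ℕ) : Option (Fin p) → Mat
  | none => !![1, 0; 0, (p : ℤ)]
  | some j => !![(p : ℤ), 0; (j : ℤ), 1]

/-- Integral matrices of determinant `±p`. -/
abbrev HMat (p : ℕ) := {M : Mat // M.det = p ∨ M.det = -p}

lemma det_hrep (p : ℕ) (j : Option (Fin p)) : (hrep p j).det = p := by
  rcases j with _ | j <;> simp [hrep, det_fin_two]

/-- Every matrix of determinant `±p` factors uniquely through a representative. -/
def hmatEquiv (p : ℕ) [hp : Fact p.Prime] : UMat × Option (Fin p) ≃ HMat p :=
  Equiv.ofBijective (fun x => ⟨x.1.1 * hrep p x.2, by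
    rw [det_mul, det_hrep]; rcases x.1.2 with h | h <;> simp [h]⟩) (by
    have hp0 : (p : ℤ) ≠ 0 := by exact_mod_cast hp.out.ne_zero
    have hpp : Prime (p : ℤ) := Nat.prime_iff_prime_int.mp hp.out
    constructor
    · rintro ⟨⟨h, hh⟩, j⟩ ⟨⟨h', hh'⟩, j'⟩ heq
      simp only [Subtype.mk.injEq] at heq
      have hjj : j = j' := by
        rw [det_fin_two] at hh hh'
        rw [← ext_iff] at heq
        rcases j with _ | j <;> rcases j' with _ | j'
        · rfl
        · exfalso
          simp [Fin.forall_fin_two, mul_apply, Fin.sum_univ_two, hrep] at heq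
          obtain ⟨⟨h1, h2⟩, h3, h4⟩ := heq
          have : (p : ℤ) ∣ h' 0 0 * h' 1 1 - h' 0 1 * h' 1 0 :=
            ⟨h' 0 0 * h 1 1 - h 0 1 * h' 1 0, by rw [← h2, ← h4]; ring⟩
          have := Int.isUnit_iff.mpr hh'
          exact hpp.not_isUnit (isUnit_of_dvd_unit ‹(p : ℤ) ∣ _› this)
        · exfalso
          simp [Fin.forall_fin_two, mul_apply, Fin.sum_univ_two, hrep] at heq
          obtain ⟨⟨h1, h2⟩, h3, h4⟩ := heq
          have : (p : ℤ) ∣ h 0 0 * h 1 1 - h 0 1 * h 1 0 :=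
            ⟨h 0 0 * h' 1 1 - h' 0 1 * h 1 0, by rw [h2, h4]; ring⟩
          have := Int.isUnit_iff.mpr hh
          exact hpp.not_isUnit (isUnit_of_dvd_unit ‹(p : ℤ) ∣ _› this)
        · simp [Fin.forall_fin_two, mul_apply, Fin.sum_univ_two, hrep] at heq
          obtain ⟨⟨h1, h2⟩, h3, h4⟩ := heq
          rw [← h2] at h1
          rw [← h4] at h3
          have e1 : (p : ℤ) ∣ h 0 1 * ((j : ℤ) - j') := ⟨h' 0 0 - h 0 0, by linear_combination h1⟩
          have e2 : (p : ℤ) ∣ h 1 1 * ((j : ℤ) - j') := ⟨h' 1 0 - h 1 0, by linear_combination h3⟩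
          have e3 : (p : ℤ) ∣ (h 0 0 * h 1 1 - h 0 1 * h 1 0) * ((j : ℤ) - j') := by
            have := dvd_sub (e2.mul_left (h 0 0)) (e1.mul_left (h 1 0))
            convert this using 1 <;> first | rfl | ring
          have e4 : (p : ℤ) ∣ (j : ℤ) - j' := by
            rcases hh with hh | hh <;> rw [hh] at e3
            · simpa using e3
            · rwa [neg_one_mul, dvd_neg] at e3
          congr 1
          obtain ⟨t, ht⟩ := e4
          have := j.2
          have := j'.2
          have : t = 0 := by
            by_contra h0
            rcases lt_or_gt_of_ne h0 with h0 | h0 <;> nlinarith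
          rw [this] at ht
          exact Fin.ext (by omega)
      subst hjj
      have : (hrep p j).det ≠ 0 := by rw [det_hrep]; exact hp0
      have hcancel : h = h' := by
        have h1 := congrArg (· * (hrep p j).adjugate) heq
        simp only [mul_assoc, mul_adjugate, Matrix.mul_smul, Matrix.mul_one] at h1
        exact smul_right_injective _ this h1
      subst hcancel; rfl
    · rintro ⟨m, hm⟩
      have key : ∀ j : Option (Fin p), ∀ h : Mat, h * hrep p j = m →
          ∃ x : UMat × Option (Fin p), x.1.1 * hrep p x.2 = m := by
        intro j h hj
        refine ⟨(⟨h, ?_⟩, j), hj⟩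
        rw [← hj, det_mul, det_hrep] at hm
        rcases hm with hm | hm
        · left; exact mul_right_cancel₀ hp0 (by linarith)
        · right; exact mul_right_cancel₀ hp0 (by linarith)
      suffices ∃ x : UMat × Option (Fin p), x.1.1 * hrep p x.2 = m by
        obtain ⟨x, hx⟩ := this; exact ⟨x, Subtype.ext hx⟩
      have hdet : (p : ℤ) ∣ m 0 0 * m 1 1 - m 0 1 * m 1 0 := by
        rw [det_fin_two] at hm
        rcases hm with hm | hm <;> simp [hm]
      have main : ∀ j : ℤ, (p : ℤ) ∣ m 0 0 - j * m 0 1 → (p : ℤ) ∣ m 1 0 - j * m 1 1 →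
          ∃ x : UMat × Option (Fin p), x.1.1 * hrep p x.2 = m := by
        intro j h1 h2
        have hjlt : (j % p).toNat < p := by
          have h3 := Int.emod_lt_of_pos j (b := p) (by have := hp.out.pos; exact_mod_cast this)
          have h4 := Int.emod_nonneg j hp0
          omega
        have hj4 := Int.emod_nonneg j hp0
        have hj5 : (p : ℤ) ∣ j - j % p := Int.dvd_self_sub_emod
        obtain ⟨t, ht⟩ := hj5
        obtain ⟨k, hk⟩ := h1
        obtain ⟨l, hl⟩ := h2
        refine key (some ⟨(j % p).toNat, hjlt⟩) !![k + t * m 0 1, m 0 1; l + t * m 1 1, m 1 1] ?_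
        rw [← ext_iff]
        simp [Fin.forall_fin_two, mul_apply, Fin.sum_univ_two, hrep, Int.toNat_of_nonneg hj4]
        exact ⟨by linear_combination (-1) * hk - m 0 1 * ht, by linear_combination (-1) * hl - m 1 1 * ht⟩
      have inv : ∀ b : ℤ, ¬ (p : ℤ) ∣ b → ∃ i, (p : ℤ) ∣ i * b - 1 := by
        intro b hb
        have : IsCoprime (p : ℤ) b := (Prime.coprime_iff_not_dvd hpp).mpr hb
        obtain ⟨u, v, huv⟩ := this
        exact ⟨v, -u, by linear_combination huv⟩
      by_cases hb : (p : ℤ) ∣ m 0 1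
      · by_cases hd : (p : ℤ) ∣ m 1 1
        · obtain ⟨k, hk⟩ := hb
          obtain ⟨l, hl⟩ := hd
          refine key none !![m 0 0, k; m 1 0, l] ?_
          rw [← ext_iff]
          simp [Fin.forall_fin_two, mul_apply, Fin.sum_univ_two, hrep]
          exact ⟨by linarith, by linarith⟩
        · obtain ⟨i, hi⟩ := inv _ hd
          refine main (i * m 1 0) ?_ ?_
          · have : (p : ℤ) ∣ m 1 1 * (m 0 0 - i * m 1 0 * m 0 1) := by
              have e := dvd_sub hdet (hi.mul_left (m 0 1 * m 1 0))
              convert e using 1 <;> first | rfl | ring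
            exact (hpp.dvd_or_dvd this).resolve_left hd
          · have := hi.mul_left (-m 1 0)
            convert this using 1 <;> first | rfl | ring
      · obtain ⟨i, hi⟩ := inv _ hb
        refine main (i * m 0 0) ?_ ?_
        · have := hi.mul_left (-m 0 0)
          convert this using 1 <;> first | rfl | ring
        · have : (p : ℤ) ∣ m 0 1 * (m 1 0 - i * m 0 0 * m 1 1) := by
            have e := dvd_add hdet (hi.mul_left (m 0 0 * m 1 1))
            rw [← dvd_neg]
            convert e using 1 <;> first | rfl | ring
          exact (hpp.dvd_or_dvd this).resolve_left hb)

/-- The involution `m ↦ p m⁻¹` on matrices of determinant `±p`. -/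
def hinv (p : ℕ) [hp : Fact p.Prime] : HMat p ≃ HMat p :=
  have aux : ∀ M : Mat, (M.det = p ∨ M.det = -p) →
      (Int.sign M.det • M.adjugate).det = M.det ∧ Int.sign M.det ^ 2 = 1 := by
    intro M hM
    have h0 : 0 < (p : ℤ) := by exact_mod_cast hp.out.pos
    have : Int.sign M.det ^ 2 = 1 := by
      rcases hM with h | h <;> simp [h, Int.sign_eq_one_of_pos h0]
    refine ⟨?_, this⟩
    simp only [det_fin_two, Matrix.smul_apply, adjugate_fin_two, smul_eq_mul] at this ⊢
    simp
    linear_combination (M 0 0 * M 1 1 - M 0 1 * M 1 0) * this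
  have inv : ∀ M : Mat, (M.det = p ∨ M.det = -p) →
      Int.sign (Int.sign M.det • M.adjugate).det • (Int.sign M.det • M.adjugate).adjugate = M := by
    intro M hM
    obtain ⟨h1, h2⟩ := aux M hM
    rw [h1, adjugate_smul]
    ext i j
    fin_cases i <;> fin_cases j <;> simp [adjugate_fin_two] <;> linear_combination (M _ _) * h2
  { toFun := fun M => ⟨Int.sign M.1.det • M.1.adjugate, by rw [(aux M.1 M.2).1]; exact M.2⟩
    invFun := fun M => ⟨Int.sign M.1.det • M.1.adjugate, by rw [(aux M.1 M.2).1]; exact M.2⟩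
    left_inv := fun M => Subtype.ext (inv M.1 M.2)
    right_inv := fun M => Subtype.ext (inv M.1 M.2) }

lemma hinv_mul (p : ℕ) [hp : Fact p.Prime] (M : HMat p) :
    (hinv p M).1 * M.1 = (p : ℤ) • 1 ∧ M.1 * (hinv p M).1 = (p : ℤ) • 1 := by
  have h0 : 0 < (p : ℤ) := by exact_mod_cast hp.out.pos
  simp only [hinv, Equiv.coe_fn_mk, Matrix.smul_mul, Matrix.mul_smul, adjugate_mul,
    mul_adjugate, smul_smul]
  rcases M.2 with h | h <;> simp [h, Int.sign_eq_one_of_pos h0]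

lemma scal_eq_sub_iff (p : ℕ) [hp : Fact p.Prime] (M : HMat p) (f f' : Cub ℤ) :
    scal (p : ℤ) f' = sub M.1 f ↔ scal ((p : ℤ) ^ 2) f = sub (hinv p M).1 f' := by
  have hp0 : (p : ℤ) ≠ 0 := by exact_mod_cast hp.out.ne_zero
  obtain ⟨h1, h2⟩ := hinv_mul p M
  constructor
  · intro h
    have := congrArg (sub (hinv p M).1) h
    rw [← sub_mul, h1, sub_scal_matrix, sub_scal] at this
    apply scal_injective hp0
    rw [scal_scal, this]; ring_nf
  · intro h
    have := congrArg (sub M.1) h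
    rw [← sub_mul, h2, sub_scal_matrix, sub_scal] at this
    apply scal_injective (pow_ne_zero 2 hp0)
    rw [scal_scal, this]; ring_nf

open Classical in
/-- The number of roots of a form on the projective line over `𝔽_p`, expressed through sublattices
of index `p`. -/
def om (p : ℕ) (f : Cub ℤ) : ℕ :=
  (univ.filter fun j : Option (Fin p) => Dvd (p : ℤ) (sub (hrep p j) f)).card

open Classical in
/-- The number of integral superlattices of index `p`. -/
def ovr (p : ℕ) (f : Cub ℤ) : ℕ :=
  (univ.filter fun j : Option (Fin p) => Dvd ((p : ℤ) ^ 2) (sub (hrep p j) f)).card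

/-- Non-maximality of the cubic ring of a form at `p`. -/
def NonMax (p : ℕ) (f : Cub ℤ) : Prop :=
  Dvd (p : ℤ) f ∨ ∃ x y : ℤ, ¬ ((p : ℤ) ∣ x ∧ (p : ℤ) ∣ y) ∧ (p : ℤ) ^ 2 ∣ f.ev x y ∧
    (p : ℤ) ∣ f.evx x y ∧ (p : ℤ) ∣ f.evy x y

lemma dvd_sub_none {p : ℕ} {f : Cub ℤ} :
    Dvd (p : ℤ) (sub (hrep p none) f) ↔ (p : ℤ) ∣ f.a := by
  simp only [Dvd, sub, hrep, ev, evx, evy, of_apply, cons_val', cons_val_zero,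
    cons_val_one, cons_val_fin_one]
  constructor
  · grind
  · intro h
    refine ⟨by simpa using h, ?_, ?_, ?_⟩
    · exact ⟨f.b, by ring⟩
    · exact ⟨f.c * p, by ring⟩
    · exact ⟨f.d * p ^ 2, by ring⟩

lemma dvd_sub_some {p : ℕ} {f : Cub ℤ} {j : Fin p} :
    Dvd (p : ℤ) (sub (hrep p (some j)) f) ↔ (p : ℤ) ∣ f.ev j 1 := by
  simp only [Dvd, sub, hrep, of_apply, cons_val', cons_val_zero,
    cons_val_one, cons_val_fin_one]
  constructor
  · grind
  · intro h
    refine ⟨?_, ?_, ?_, h⟩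
    · exact ⟨f.a * p ^ 2, by simp only [ev]; ring⟩
    · exact ⟨3 * f.a * p * j + f.b * p, by simp only [evx, evy]; ring⟩
    · exact ⟨f.evx j 1, by ring⟩

lemma dvd_sq_sub_none {p : ℕ} (hp : p.Prime) {f : Cub ℤ} :
    Dvd ((p : ℤ) ^ 2) (sub (hrep p none) f) ↔ (p : ℤ) ^ 2 ∣ f.a ∧ (p : ℤ) ∣ f.b := by
  have hp0 : (p : ℤ) ≠ 0 := by exact_mod_cast hp.ne_zero
  simp only [Dvd, sub, hrep, ev, evx, evy, of_apply, cons_val', cons_val_zero,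
    cons_val_one, cons_val_fin_one]
  constructor
  · rintro ⟨h, ⟨k, hk⟩, -⟩
    exact ⟨by simpa using h, k, mul_left_cancel₀ hp0 (by linear_combination hk)⟩
  · rintro ⟨h, k, hk⟩
    refine ⟨by simpa using h, ?_, ?_, ?_⟩
    · exact ⟨k, by rw [hk]; ring⟩
    · exact ⟨f.c, by ring⟩
    · exact ⟨f.d * p, by ring⟩

lemma dvd_sq_sub_some {p : ℕ} (hp : p.Prime) {f : Cub ℤ} {j : Fin p} :
    Dvd ((p : ℤ) ^ 2) (sub (hrep p (some j)) f) ↔ (p : ℤ) ^ 2 ∣ f.ev j 1 ∧ (p : ℤ) ∣ f.evx j 1 := by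
  have hp0 : (p : ℤ) ≠ 0 := by exact_mod_cast hp.ne_zero
  simp only [Dvd, sub, hrep, of_apply, cons_val', cons_val_zero,
    cons_val_one, cons_val_fin_one]
  constructor
  · rintro ⟨-, -, ⟨k, hk⟩, h⟩
    exact ⟨h, k, mul_left_cancel₀ hp0 (by linear_combination hk)⟩
  · rintro ⟨h, k, hk⟩
    refine ⟨?_, ?_, ?_, h⟩
    · exact ⟨f.a * p, by simp only [ev]; ring⟩
    · exact ⟨3 * f.a * j + f.b, by simp only [evx, evy]; ring⟩
    · exact ⟨k, by rw [hk]; ring⟩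

lemma exists_inv {p : ℕ} (hp : p.Prime) {b : ℤ} (hb : ¬ (p : ℤ) ∣ b) :
    ∃ i, (p : ℤ) ∣ i * b - 1 := by
  have hpp : Prime (p : ℤ) := Nat.prime_iff_prime_int.mp hp
  have : IsCoprime (p : ℤ) b := (Prime.coprime_iff_not_dvd hpp).mpr hb
  obtain ⟨u, v, huv⟩ := this
  exact ⟨v, -u, by linear_combination huv⟩

lemma nonMax_iff {p : ℕ} (hp : p.Prime) (f : Cub ℤ) :
    NonMax p f ↔ Dvd (p : ℤ) f ∨ ∃ j, Dvd ((p : ℤ) ^ 2) (sub (hrep p j) f) := by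
  have hpp : Prime (p : ℤ) := Nat.prime_iff_prime_int.mp hp
  have hp0 : (p : ℤ) ≠ 0 := hpp.ne_zero
  refine or_congr_right ⟨?_, ?_⟩
  · rintro ⟨x, y, hxy, h1, h2, h3⟩
    by_cases hy : (p : ℤ) ∣ y
    · have hx : ¬ (p : ℤ) ∣ x := fun h => hxy ⟨h, hy⟩
      obtain ⟨t, rfl⟩ := hy
      refine ⟨none, (dvd_sq_sub_none hp).2 ?_⟩
      have hb : (p : ℤ) ∣ f.b := by
        have : (p : ℤ) ∣ f.b * x ^ 2 := by
          have := dvd_sub h3 (Dvd.intro (2 * f.c * x * t + 3 * f.d * p * t ^ 2) rfl)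
          convert this using 1 <;> first | rfl | (simp only [evy]; ring)
        rcases hpp.dvd_or_dvd this with h | h
        · exact h
        · exact absurd (hpp.dvd_of_dvd_pow h) hx
      refine ⟨?_, hb⟩
      obtain ⟨k, hk⟩ := hb
      have : (p : ℤ) ^ 2 ∣ f.a * x ^ 3 := by
        have := dvd_sub h1 (Dvd.intro (k * x ^ 2 * t + f.c * x * t ^ 2 + f.d * p * t ^ 3) rfl)
        convert this using 1 <;> first | rfl | (simp only [ev, hk]; ring)
      exact (IsCoprime.pow (Prime.coprime_iff_not_dvd hpp |>.mpr hx)).dvd_of_dvd_mul_right this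
    · obtain ⟨i, hi⟩ := exists_inv hp hy
      have hjlt : ((x * i) % p).toNat < p := by
        have h3 := Int.emod_lt_of_pos (x * i) (b := p) (by have := hp.pos; exact_mod_cast this)
        grind
      have h4 := Int.emod_nonneg (x * i) hp0
      refine ⟨some ⟨_, hjlt⟩, (dvd_sq_sub_some hp).2 ?_⟩
      simp only [Int.toNat_of_nonneg h4]
      have hj5 : (p : ℤ) ∣ x * i - (x * i) % p := Int.dvd_self_sub_emod
      set j := (x * i) % p
      obtain ⟨l, hl⟩ := hi
      obtain ⟨t, ht⟩ := hj5
      -- `x = j y + p s`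
      obtain ⟨s, hs⟩ : ∃ s, x = j * y + p * s := ⟨t * y - x * l, by linear_combination (-x) * hl + y * ht⟩
      have hfx : (p : ℤ) ∣ y ^ 2 * f.evx j 1 := by
        have := dvd_sub h2 (Dvd.intro (3 * f.a * (2 * j * y * s + p * s ^ 2) + 2 * f.b * s * y) rfl)
        convert this using 1 <;> first | rfl | (simp only [evx, hs]; ring)
      have hfx' : (p : ℤ) ∣ f.evx j 1 := by
        rcases hpp.dvd_or_dvd hfx with h | h
        · exact absurd (hpp.dvd_of_dvd_pow h) hy
        · exact h
      refine ⟨?_, hfx'⟩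
      obtain ⟨k, hk⟩ := hfx'
      have : (p : ℤ) ^ 2 ∣ f.ev j 1 * y ^ 3 := by
        have := dvd_sub h1 (Dvd.intro (k * y ^ 2 * s + (3 * f.a * j + f.b) * y * s ^ 2
          + p * f.a * s ^ 3) rfl)
        convert this using 1
        · rfl
        rw [hs]
        simp only [ev, evx] at hk ⊢
        grind
      exact (IsCoprime.pow (Prime.coprime_iff_not_dvd hpp |>.mpr hy)).dvd_of_dvd_mul_right this
  · rintro ⟨_ | j, hj⟩
    · obtain ⟨h1, h2⟩ := (dvd_sq_sub_none hp).1 hj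
      refine ⟨1, 0, fun h => hpp.not_dvd_one h.1, by simpa [ev] using h1, ?_, by simpa [evy] using h2⟩
      have : (p : ℤ) ∣ f.a := (dvd_pow_self _ two_ne_zero).trans h1
      simpa [evx] using this.mul_left 3
    · obtain ⟨h1, h2⟩ := (dvd_sq_sub_some hp).1 hj
      refine ⟨j, 1, fun h => hpp.not_dvd_one h.2, h1, h2, ?_⟩
      have h3 : (p : ℤ) ∣ f.ev j 1 := (dvd_pow_self _ two_ne_zero).trans h1
      have := dvd_sub (h3.mul_left 3) (h2.mul_left j)
      convert this using 1
      · rfl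
      simp only [ev, evx, evy]; ring

lemma nonMax_of_scal_eq {p : ℕ} (hp : p.Prime) {k : ℤ} (hk : ¬ (p : ℤ) ∣ k)
    {M : Mat} (hM : ¬ (p : ℤ) ∣ M.det) {f f' : Cub ℤ}
    (h : scal k f' = sub M f) (hf : NonMax p f) : NonMax p f' := by
  have hpp : Prime (p : ℤ) := Nat.prime_iff_prime_int.mp hp
  have hcop : IsCoprime (p : ℤ) k := Prime.coprime_iff_not_dvd hpp |>.mpr hk
  rcases hf with hf | ⟨x, y, hxy, h1, h2, h3⟩
  · left
    obtain ⟨g, rfl⟩ := dvd_iff.1 hf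
    rw [sub_scal] at h
    simp only [scal, Cub.mk.injEq] at h
    obtain ⟨ha, hb, hc, hd⟩ := h
    exact ⟨hcop.dvd_of_dvd_mul_left ⟨_, ha⟩, hcop.dvd_of_dvd_mul_left ⟨_, hb⟩,
      hcop.dvd_of_dvd_mul_left ⟨_, hc⟩, hcop.dvd_of_dvd_mul_left ⟨_, hd⟩⟩
  · right
    rw [det_fin_two] at hM
    set D := M 0 0 * M 1 1 - M 0 1 * M 1 0 with hD
    set x' := x * M 1 1 - y * M 1 0
    set y' := y * M 0 0 - x * M 0 1
    have e1 : x' * M 0 0 + y' * M 1 0 = D * x := by simp only [x', y', hD]; ring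
    have e2 : x' * M 0 1 + y' * M 1 1 = D * y := by simp only [x', y', hD]; ring
    have g1 : k * f'.ev x' y' = D ^ 3 * f.ev x y := by
      rw [← ev_scal, h, ev_sub, e1, e2]; simp only [ev]; ring
    have g2 : k * f'.evx x' y' = D ^ 2 * (M 0 0 * f.evx x y + M 0 1 * f.evy x y) := by
      have : (scal k f').evx x' y' = k * f'.evx x' y' := by simp only [evx, scal]; ring
      rw [← this, h, evx_sub, e1, e2]; simp only [evx, evy]; ring
    have g3 : k * f'.evy x' y' = D ^ 2 * (M 1 0 * f.evx x y + M 1 1 * f.evy x y) := by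
      have : (scal k f').evy x' y' = k * f'.evy x' y' := by simp only [evy, scal]; ring
      rw [← this, h, evy_sub, e1, e2]; simp only [evx, evy]; ring
    refine ⟨x', y', ?_, ?_, ?_, ?_⟩
    · rintro ⟨hx, hy⟩
      refine hxy ⟨?_, ?_⟩
      · exact (hpp.dvd_or_dvd (e1 ▸ dvd_add (hx.mul_right _) (hy.mul_right _))).resolve_left hM
      · exact (hpp.dvd_or_dvd (e2 ▸ dvd_add (hx.mul_right _) (hy.mul_right _))).resolve_left hM
    · exact hcop.pow_left.dvd_of_dvd_mul_left (g1 ▸ h1.mul_left _)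
    · exact hcop.dvd_of_dvd_mul_left
        (g2 ▸ (dvd_add (h2.mul_left _) (h3.mul_left _)).mul_left _)
    · exact hcop.dvd_of_dvd_mul_left
        (g3 ▸ (dvd_add (h2.mul_left _) (h3.mul_left _)).mul_left _)

lemma ovr_le_one {p : ℕ} (hp : p.Prime) {f : Cub ℤ} (hf : ¬ Dvd (p : ℤ) f) : ovr p f ≤ 1 := by
  have hpp : Prime (p : ℤ) := Nat.prime_iff_prime_int.mp hp
  classical
  rw [ovr, card_le_one]
  intro i hi j hj
  simp at hi hj
  have key0 : ∀ j : Fin p, Dvd ((p : ℤ) ^ 2) (sub (hrep p none) f) →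
      Dvd ((p : ℤ) ^ 2) (sub (hrep p (some j)) f) → False := by
    intro j h0 hj
    obtain ⟨h1, h2⟩ := (dvd_sq_sub_none hp).1 h0
    obtain ⟨h3, h4⟩ := (dvd_sq_sub_some hp).1 hj
    have h1' : (p : ℤ) ∣ f.a := (dvd_pow_self _ two_ne_zero).trans h1
    have h3' : (p : ℤ) ∣ f.ev j 1 := (dvd_pow_self _ two_ne_zero).trans h3
    obtain ⟨a, ha⟩ := h1'
    obtain ⟨b, hb⟩ := h2
    have hc : (p : ℤ) ∣ f.c := by
      have := dvd_sub h4 (Dvd.intro (3 * a * j ^ 2 + 2 * b * j) rfl)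
      convert this using 1 <;> first | rfl | (simp only [evx, ha, hb]; ring)
    obtain ⟨c, hc⟩ := hc
    refine hf ⟨⟨a, ha⟩, ⟨b, hb⟩, ⟨c, hc⟩, ?_⟩
    have := dvd_sub h3' (Dvd.intro (a * j ^ 3 + b * j ^ 2 + c * j) rfl)
    convert this using 1 <;> first | rfl | (simp only [ev, ha, hb, hc]; ring)
  rcases i with _ | i <;> rcases j with _ | j
  · rfl
  · grind
  · grind
  · by_contra hne
    obtain ⟨h1, h2⟩ := (dvd_sq_sub_some hp).1 hi
    obtain ⟨h3, h4⟩ := (dvd_sq_sub_some hp).1 hj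
    have h1' : (p : ℤ) ∣ f.ev i 1 := (dvd_pow_self _ two_ne_zero).trans h1
    have h3' : (p : ℤ) ∣ f.ev j 1 := (dvd_pow_self _ two_ne_zero).trans h3
    have hn : ¬ (p : ℤ) ∣ (j : ℤ) - i := by
      rintro ⟨t, ht⟩
      have := i.2
      have := j.2
      have : t = 0 := by
        by_contra h0
        rcases lt_or_gt_of_ne h0 with h0 | h0 <;> nlinarith
      grind
    have canc : ∀ n : ℕ, ∀ z : ℤ, (p : ℤ) ∣ ((j : ℤ) - i) ^ n * z → (p : ℤ) ∣ z := fun n z hz =>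
      (hpp.dvd_or_dvd hz).resolve_left fun h => hn (hpp.dvd_of_dvd_pow h)
    have ha : (p : ℤ) ∣ f.a := by
      apply canc 3
      have := dvd_sub ((h4.mul_left ((j : ℤ) - i))) ((dvd_sub h3' h1').mul_left 2)
      have := dvd_add this (h2.mul_left ((j : ℤ) - i))
      convert this using 1 <;> first | rfl | (simp only [ev, evx]; ring)
    obtain ⟨a, ha⟩ := ha
    have hb : (p : ℤ) ∣ f.b := by
      apply canc 2
      have := dvd_sub (dvd_sub h3' h1') (h2.mul_left ((j : ℤ) - i))
      have := dvd_sub this (Dvd.intro (a * ((j : ℤ) - i) ^ 2 * (j + 2 * i)) rfl)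
      convert this using 1 <;> first | rfl | (simp only [ev, evx, ha]; ring)
    obtain ⟨b, hb⟩ := hb
    have hc : (p : ℤ) ∣ f.c := by
      have := dvd_sub h4 (Dvd.intro (3 * a * j ^ 2 + 2 * b * j) rfl)
      convert this using 1 <;> first | rfl | (simp only [evx, ha, hb]; ring)
    obtain ⟨c, hc⟩ := hc
    refine hf ⟨⟨a, ha⟩, ⟨b, hb⟩, ⟨c, hc⟩, ?_⟩
    have := dvd_sub h3' (Dvd.intro (a * j ^ 3 + b * j ^ 2 + c * j) rfl)
    convert this using 1 <;> first | rfl | (simp only [ev, ha, hb, hc]; ring)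

/-- The number of zeros of a form in the plane over `ℤ/p`. -/
def zc (p : ℕ) [NeZero p] (f : Cub ℤ) : ℕ :=
  (univ.filter fun v : ZMod p × ZMod p => (f.map (Int.castRingHom (ZMod p))).ev v.1 v.2 = 0).card

lemma om_eq (p : ℕ) (f : Cub ℤ) [NeZero p] :
    om p f = (univ.filter fun x : ZMod p =>
      (f.map (Int.castRingHom (ZMod p))).ev x 1 = 0).card + if (p : ℤ) ∣ f.a then 1 else 0 := by
  classical
  have h1 : (univ.filter fun x : ZMod p =>
      (f.map (Int.castRingHom (ZMod p))).ev x 1 = 0).card =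
      (univ.filter fun j : Fin p => (p : ℤ) ∣ f.ev j 1).card := by
    symm
    refine card_bij (fun j _ => ((j : ℕ) : ZMod p)) ?_ ?_ ?_
    · intro j hj
      simp only [mem_filter, Finset.mem_univ, true_and] at hj ⊢
      have := ev_map (Int.castRingHom (ZMod p)) f j 1
      simp only [map_one] at this
      rw [show ((j : ℕ) : ZMod p) = Int.castRingHom (ZMod p) j by simp, this]
      simpa using (ZMod.intCast_zmod_eq_zero_iff_dvd _ p).2 hj
    · intro i _ j _ h
      have := (ZMod.natCast_eq_natCast_iff' _ _ _).1 h
      rw [Nat.mod_eq_of_lt i.2, Nat.mod_eq_of_lt j.2] at this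
      exact Fin.ext this
    · intro x hx
      refine ⟨⟨x.val, ZMod.val_lt x⟩, ?_, by simp⟩
      simp only [mem_filter, Finset.mem_univ, true_and] at hx ⊢
      have := ev_map (Int.castRingHom (ZMod p)) f x.val 1
      simp only [map_one] at this
      rw [show Int.castRingHom (ZMod p) x.val = x by simp, hx] at this
      exact (ZMod.intCast_zmod_eq_zero_iff_dvd _ p).1 (by simpa using this.symm)
  rw [h1, om, card_filter, card_filter, Fintype.sum_option, add_comm]
  simp only [dvd_sub_none, dvd_sub_some]

lemma zc_eq (p : ℕ) [hp : Fact p.Prime] (f : Cub ℤ) : zc p f = 1 + (p - 1) * om p f := by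
  classical
  set g := f.map (Int.castRingHom (ZMod p)) with hg
  set N := (univ.filter fun x : ZMod p => g.ev x 1 = 0).card with hN
  have h1 : ∀ y : ZMod p, y ≠ 0 → (univ.filter fun x : ZMod p => g.ev x y = 0).card = N := by
    intro y hy
    refine card_bij (fun x _ => x / y) ?_ ?_ ?_
    · intro x hx
      simp only [mem_filter, Finset.mem_univ, true_and] at hx ⊢
      have : y ^ 3 * g.ev (x / y) 1 = g.ev x y := by simp only [ev]; field_simp
      rw [hx] at this
      simpa [hy] using this
    · intro x _ x' _ h
      exact (div_left_inj' hy).1 h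
    · intro x hx
      refine ⟨x * y, ?_, by field_simp⟩
      simp only [mem_filter, Finset.mem_univ, true_and] at hx ⊢
      have : g.ev (x * y) y = y ^ 3 * g.ev x 1 := by simp only [ev]; ring
      rw [this, hx, mul_zero]
  have h2 : (univ.filter fun x : ZMod p => g.ev x 0 = 0).card =
      1 + (p - 1) * if (p : ℤ) ∣ f.a then 1 else 0 := by
    have ha : (p : ℤ) ∣ f.a ↔ g.a = 0 := by
      simp only [hg, map]
      rw [eq_intCast, ZMod.intCast_zmod_eq_zero_iff_dvd]
    have hp1 := hp.out.one_lt
    split_ifs with h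
    · rw [ha] at h
      simp [ev, h, ZMod.card]; omega
    · rw [ha] at h
      simp [ev, h, filter_eq']
  have h3 : zc p f = ∑ y : ZMod p, (univ.filter fun x : ZMod p => g.ev x y = 0).card := by
    rw [zc, card_filter, ← univ_product_univ, sum_product_right]
    simp only [card_filter, hg]
  rw [h3, ← add_sum_erase _ _ (mem_univ 0), h2,
    sum_congr rfl (fun y hy => h1 y (ne_of_mem_erase hy)), sum_const,
    card_erase_of_mem (mem_univ 0), card_univ, ZMod.card, om_eq]
  simp only [smul_eq_mul, hN, hg]
  ring

lemma zc_le {p : ℕ} [hp : Fact p.Prime] {k : ℤ} (hk : ¬ (p : ℤ) ∣ k)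
    {M : Mat} (hM : ¬ (p : ℤ) ∣ M.det) {f f' : Cub ℤ}
    (h : scal k f' = sub M f) : zc p f' ≤ zc p f := by
  classical
  set φ := Int.castRingHom (ZMod p)
  have hk' : φ k ≠ 0 := by
    simpa [φ, ZMod.intCast_zmod_eq_zero_iff_dvd] using hk
  have hM' : φ M.det ≠ 0 := by
    rw [eq_intCast, Ne, ZMod.intCast_zmod_eq_zero_iff_dvd]; exact hM
  rw [det_fin_two, _root_.map_sub, map_mul, map_mul] at hM'
  refine card_le_card_of_injOn (fun v => (v.1 * φ (M 0 0) + v.2 * φ (M 1 0),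
    v.1 * φ (M 0 1) + v.2 * φ (M 1 1))) ?_ ?_
  · intro v hv
    simp at hv ⊢
    have h1 : (scal k f').map φ = scal (φ k) (f'.map φ) := by ext <;> simp [map, scal]
    have h2 := ev_sub (M.map φ) (f.map φ) v.1 v.2
    rw [← map_sub, ← h, h1, ev_scal, hv, mul_zero] at h2
    exact h2.symm
  · intro v _ w _ hvw
    simp at hvw
    obtain ⟨e1, e2⟩ := hvw
    ext
    · apply mul_left_cancel₀ hM'
      linear_combination φ (M 1 1) * e1 - φ (M 1 0) * e2
    · apply mul_left_cancel₀ hM'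
      linear_combination φ (M 0 0) * e2 - φ (M 0 1) * e1

lemma scal_adjugate {k : ℤ} {M : Mat} {f f' : Cub ℤ}
    (h : scal k f' = sub M f) : scal (M.det ^ 3) f = sub M.adjugate (scal k f') := by
  rw [h, ← sub_mul, adjugate_mul, sub_scal_matrix]

lemma om_of_scal_eq {p : ℕ} (hp : p.Prime) {k : ℤ} (hk : ¬ (p : ℤ) ∣ k)
    {M : Mat} (hM : ¬ (p : ℤ) ∣ M.det) {f f' : Cub ℤ}
    (h : scal k f' = sub M f) : om p f' = om p f := by
  have := Fact.mk hp
  have hpp : Prime (p : ℤ) := Nat.prime_iff_prime_int.mp hp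
  have h1 := zc_le hk hM h
  have hM3 : ¬ (p : ℤ) ∣ M.det ^ 3 := fun h => hM (hpp.dvd_of_dvd_pow h)
  have hM2 : ¬ (p : ℤ) ∣ M.adjugate.det := by simpa [det_adjugate] using hM
  have h2 : zc p f ≤ zc p (scal k f') :=
    zc_le hM3 hM2 (scal_adjugate h)
  have h3 : zc p (scal k f') ≤ zc p f' := by
    have h1 : ¬ (p : ℤ) ∣ 1 := hpp.not_dvd_one
    have hk1 : ¬ (p : ℤ) ∣ (k • (1 : Mat)).det := by
      rw [det_smul, det_one, mul_one]
      exact fun h => hk (hpp.dvd_of_dvd_pow h)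
    refine zc_le (k := k ^ 2) (fun h => hk (hpp.dvd_of_dvd_pow h)) hk1 ?_
    rw [sub_scal_matrix, scal_scal]; congr 1; ring
  have h4 := le_antisymm h1 (h2.trans h3)
  rw [zc_eq, zc_eq] at h4
  have := hp.one_lt
  exact Nat.eq_of_mul_eq_mul_left (by omega) (Nat.add_left_cancel h4)

lemma nonMax_iff_of_scal_eq {p : ℕ} (hp : p.Prime) {k : ℤ} (hk : ¬ (p : ℤ) ∣ k)
    {M : Mat} (hM : ¬ (p : ℤ) ∣ M.det) {f f' : Cub ℤ}
    (h : scal k f' = sub M f) : NonMax p f' ↔ NonMax p f := by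
  have hpp : Prime (p : ℤ) := Nat.prime_iff_prime_int.mp hp
  refine ⟨fun h' => ?_, nonMax_of_scal_eq hp hk hM h⟩
  have hM3 : ¬ (p : ℤ) ∣ M.det ^ 3 := fun h => hM (hpp.dvd_of_dvd_pow h)
  have hM2 : ¬ (p : ℤ) ∣ M.adjugate.det := by simpa [det_adjugate] using hM
  refine nonMax_of_scal_eq hp hM3 hM2 (scal_adjugate h) ?_
  have hk1 : ¬ (p : ℤ) ∣ (k • (1 : Mat)).det := by
    rw [det_smul, det_one, mul_one]
    exact fun h => hk (hpp.dvd_of_dvd_pow h)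
  refine nonMax_of_scal_eq (k := k ^ 2) hp (fun h => hk (hpp.dvd_of_dvd_pow h)) hk1 ?_ h'
  rw [sub_scal_matrix, scal_scal]; congr 1; ring

lemma om_le_three {p : ℕ} (hp : p.Prime) {f : Cub ℤ} (hf : ¬ Dvd (p : ℤ) f) : om p f ≤ 3 := by
  classical
  have := Fact.mk hp
  have hz : ∀ n : ℤ, (p : ℤ) ∣ n ↔ (Int.castRingHom (ZMod p) n) = 0 := fun n => by
    rw [eq_intCast, ZMod.intCast_zmod_eq_zero_iff_dvd]
  rw [om_eq]
  set g := f.map (Int.castRingHom (ZMod p)) with hg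
  have hg0 : g.a ≠ 0 ∨ g.b ≠ 0 ∨ g.c ≠ 0 ∨ g.d ≠ 0 := by
    by_contra! h
    exact hf ⟨(hz _).2 h.1, (hz _).2 h.2.1, (hz _).2 h.2.2.1, (hz _).2 h.2.2.2⟩
  have hroot : ∀ P : Polynomial (ZMod p), P ≠ 0 → (∀ x, P.eval x = g.ev x 1) →
      (univ.filter fun x : ZMod p => g.ev x 1 = 0).card ≤ P.natDegree := by
    intro P hP hx
    have : (univ.filter fun x : ZMod p => g.ev x 1 = 0) ⊆ P.roots.toFinset := by
      intro x hx'
      simp at hx'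
      simp [hP, hx, hx']
    exact (Finset.card_le_card this).trans ((Multiset.toFinset_card_le _).trans P.card_roots')
  open Polynomial in
  set P : (ZMod p)[X] := C g.a * X ^ 3 + C g.b * X ^ 2 + C g.c * X + C g.d with hP
  have hev : ∀ x, P.eval x = g.ev x 1 := by intro x; simp [hP, ev]
  have hP0 : P ≠ 0 := by
    intro h0
    have h3 := congrArg (Polynomial.coeff · 3) h0
    have h2 := congrArg (Polynomial.coeff · 2) h0
    have h1 := congrArg (Polynomial.coeff · 1) h0
    have h00 := congrArg (Polynomial.coeff · 0) h0
    simp [hP, Polynomial.coeff_X, Polynomial.coeff_C] at h3 h2 h1 h00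
    tauto
  split_ifs with ha
  · rw [hz] at ha
    have : P.natDegree ≤ 2 := by
      have : P = Polynomial.C 0 * Polynomial.X ^ 3 + Polynomial.C g.b * Polynomial.X ^ 2
        + Polynomial.C g.c * Polynomial.X + Polynomial.C g.d := by
        rw [hP, show g.a = 0 from ha]
      rw [this]
      simp
      compute_degree
    have := (hroot P hP0 hev).trans this
    omega
  · have : P.natDegree ≤ 3 := by rw [hP]; compute_degree
    exact (hroot P hP0 hev).trans this

lemma om_le (p : ℕ) (f : Cub ℤ) : om p f ≤ p + 1 := by
  classical
  refine (card_filter_le _ _).trans ?_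
  simp [Fintype.card_option]

lemma ovr_scal {p : ℕ} (hp : p.Prime) (f : Cub ℤ) : ovr p (scal p f) = om p f := by
  classical
  have hp0 : (p : ℤ) ≠ 0 := by exact_mod_cast hp.ne_zero
  rw [ovr, om]
  congr 1
  refine filter_congr fun j _ => ?_
  rw [sub_scal]
  simp only [Dvd, scal, pow_two, mul_dvd_mul_iff_left hp0]

/-- An orbit weight: its sum over every orbit of irreducible forms of the right sign is one,
and it is homogeneous of degree zero. -/
structure OrbitWeight (σ : ℤ) (u : Cub ℤ → ℝ≥0∞) : Prop where
  tsum_eq : ∀ f, Irr f → 0 < σ * f.disc → ∑' g : UMat, u (sub g.1 f) = 1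
  scal_eq : ∀ k : ℤ, k ≠ 0 → ∀ f, u (scal k f) = u f

open Classical in
/-- The weight of a form in the sieve sums: irreducible forms with bounded discriminant, nonmaximal
at the primes of `Q`, weighted by the number of sublattices for the primes of `E`. -/
def wt (σ : ℤ) (Y : ℝ) (Q E : Finset ℕ) (f : Cub ℤ) : ℝ≥0∞ :=
  if Irr f ∧ 0 < σ * f.disc ∧ ((σ * f.disc : ℤ) : ℝ) < Y ∧ ∀ p ∈ Q, NonMax p f then
    ∏ p ∈ E, (om p f : ℝ≥0∞) else 0

/-- The weighted sieve sum. -/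
def sieveSum (σ : ℤ) (u : Cub ℤ → ℝ≥0∞) (Y : ℝ) (Q E : Finset ℕ) : ℝ≥0∞ :=
  ∑' f, wt σ Y Q E f * u f

section

variable {σ : ℤ} {u : Cub ℤ → ℝ≥0∞}

open Classical in
lemma OrbitWeight.tsum_pair (hu : OrbitWeight σ u) {k : ℤ} (hk : k ≠ 0) {F : Cub ℤ} (hF : Irr F)
    (hd : 0 < σ * F.disc) :
    ∑' g : UMat, ∑' f', (if scal k f' = sub g.1 F then u f' else 0) =
      if Dvd k F then 1 else 0 := by
  split_ifs with h
  · obtain ⟨G, rfl⟩ := dvd_iff.1 h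
    have hG : Irr G := (irr_scal hk G).1 hF
    have hGd : 0 < σ * G.disc := by
      rw [disc_scal] at hd
      have : 0 < k ^ 4 := by positivity
      nlinarith
    rw [← hu.tsum_eq G hG hGd]
    refine tsum_congr fun g => ?_
    rw [tsum_eq_single (sub g.1 G)]
    · rw [if_pos (by rw [sub_scal])]
    · intro b hb
      rw [if_neg]
      rw [sub_scal]
      exact fun h => hb (scal_injective hk h)
  · simp only [ENNReal.tsum_eq_zero, ite_eq_right_iff]
    intro g f' h'
    exfalso
    apply h
    have hg : g.1.det ^ 3 = 1 ∨ g.1.det ^ 3 = -1 := by rcases g.2 with h | h <;> simp [h]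
    have h2 : sub g.1.adjugate (scal k f') = scal (g.1.det ^ 3) F := by
      rw [h', ← sub_mul, adjugate_mul, sub_scal_matrix]
    rw [sub_scal] at h2
    have h3 : F = scal (g.1.det ^ 3) (scal k (sub g.1.adjugate f')) := by
      rw [h2, scal_scal]
      rcases hg with h | h <;> simp [h, scal_one]
    rw [scal_scal, mul_comm, ← scal_scal] at h3
    exact dvd_iff.2 ⟨_, h3⟩

lemma good_sub_hrep {p : ℕ} (hp : p.Prime) (j : Option (Fin p)) {f : Cub ℤ} (hf : Irr f)
    (hd : 0 < σ * f.disc) : Irr (sub (hrep p j) f) ∧ 0 < σ * (sub (hrep p j) f).disc := by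
  have h0 : (p : ℤ) ≠ 0 := by exact_mod_cast hp.ne_zero
  refine ⟨(irr_sub (by rwa [det_hrep]) f).2 hf, ?_⟩
  rw [disc_sub, det_hrep]
  have : 0 < (p : ℤ) ^ 6 := by positivity
  nlinarith

open Classical in
/-- Unfolding a sum over representatives `hrep` to a sum over all matrices of determinant `±p`. -/
lemma OrbitWeight.tsum_unfold (hu : OrbitWeight σ u) {p : ℕ} [hp : Fact p.Prime] {k : ℤ}
    (hk : k ≠ 0) {A : Cub ℤ → ℝ≥0∞} (hA : ∀ f, A f ≠ 0 → Irr f ∧ 0 < σ * f.disc) :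
    ∑' f, A f * ((Finset.univ.filter fun j : Option (Fin p) => Dvd k (sub (hrep p j) f)).card : ℝ≥0∞)
      * u f
    = ∑' f, ∑' m : HMat p, ∑' f', (if scal k f' = sub m.1 f then A f * u f * u f' else 0) := by
  refine tsum_congr fun f => ?_
  by_cases hf : A f = 0
  · simp [hf]
  obtain ⟨hi, hd⟩ := hA f hf
  have h1 : ((univ.filter fun j : Option (Fin p) => Dvd k (sub (hrep p j) f)).card : ℝ≥0∞)
      = ∑ j : Option (Fin p), if Dvd k (sub (hrep p j) f) then (1 : ℝ≥0∞) else 0 := by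
    rw [card_filter]; push_cast; rfl
  have h2 : ∀ j : Option (Fin p), (if Dvd k (sub (hrep p j) f) then (1 : ℝ≥0∞) else 0)
      = ∑' g : UMat, ∑' f', (if scal k f' = sub (g.1 * hrep p j) f then u f' else 0) := by
    intro j
    obtain ⟨h3, h4⟩ := good_sub_hrep (σ := σ) hp.out j hi hd
    rw [← hu.tsum_pair hk h3 h4]
    simp only [sub_mul]
  rw [h1, sum_congr rfl fun j _ => h2 j, ← tsum_fintype (L := .unconditional _),
    ENNReal.tsum_comm, ← ENNReal.tsum_prod,
    ← (hmatEquiv p).tsum_eq, mul_right_comm, ← ENNReal.tsum_mul_left]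
  refine tsum_congr fun x => ?_
  rw [← ENNReal.tsum_mul_left]
  refine tsum_congr fun f' => ?_
  rw [mul_ite, mul_zero]
  rfl

/-- Exchanging sublattices of index `p` with superlattices. -/
lemma OrbitWeight.swap (hu : OrbitWeight σ u) {p : ℕ} (hp : p.Prime) {A A' : Cub ℤ → ℝ≥0∞}
    (hA : ∀ f, A f ≠ 0 → Irr f ∧ 0 < σ * f.disc) (hA' : ∀ f, A' f ≠ 0 → Irr f ∧ 0 < σ * f.disc)
    (h : ∀ (m : HMat p) (f f' : Cub ℤ), scal (p : ℤ) f' = sub m.1 f → A f = A' f') :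
    ∑' f, A f * (om p f : ℝ≥0∞) * u f = ∑' f, A' f * (ovr p f : ℝ≥0∞) * u f := by
  classical
  have := Fact.mk hp
  have hp0 : (p : ℤ) ≠ 0 := by exact_mod_cast hp.ne_zero
  have e1 := hu.tsum_unfold (p := p) hp0 hA
  have e2 := hu.tsum_unfold (p := p) (pow_ne_zero 2 hp0) hA'
  have e1' : ∑' f, A f * (om p f : ℝ≥0∞) * u f = _ := e1
  have e2' : ∑' f, A' f * (ovr p f : ℝ≥0∞) * u f = _ := e2
  rw [e1', e2', ENNReal.tsum_comm]
  have e3 : ∀ f, ∑' m : HMat p, ∑' f', (if scal ((p : ℤ) ^ 2) f' = sub m.1 f then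
      A' f * u f * u f' else 0) = ∑' m : HMat p, ∑' f', (if scal ((p : ℤ) ^ 2) f' =
        sub (hinv p m).1 f then A' f * u f * u f' else 0) := fun f =>
    ((hinv p).tsum_eq fun m : HMat p => ∑' f', (if scal ((p : ℤ) ^ 2) f' = sub m.1 f then
      A' f * u f * u f' else 0)).symm
  simp only [e3]
  rw [ENNReal.tsum_comm (f := fun f (m : HMat p) => ∑' f', (if scal ((p : ℤ) ^ 2) f' =
        sub (hinv p m).1 f then A' f * u f * u f' else 0))]
  refine tsum_congr fun m => ?_
  rw [ENNReal.tsum_comm]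
  refine tsum_congr fun f' => tsum_congr fun f => ?_
  by_cases h1 : scal (p : ℤ) f' = sub m.1 f
  · rw [if_pos h1, if_pos ((scal_eq_sub_iff p m f f').1 h1), h m f f' h1]; ring
  · rw [if_neg h1, if_neg (fun h2 => h1 ((scal_eq_sub_iff p m f f').2 h2))]

lemma wt_ne_zero {Y : ℝ} {Q E : Finset ℕ} {f : Cub ℤ} (h : wt σ Y Q E f ≠ 0) :
    Irr f ∧ 0 < σ * f.disc := by
  rw [wt] at h
  split_ifs at h with h1
  · exact ⟨h1.1, h1.2.1⟩
  · exact absurd rfl h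

lemma wt_insert_right {Y : ℝ} {Q E : Finset ℕ} {p : ℕ} (hp : p ∉ E) (f : Cub ℤ) :
    wt σ Y Q (insert p E) f = wt σ Y Q E f * (om p f : ℝ≥0∞) := by
  simp only [wt, prod_insert hp]
  split_ifs <;> ring

open Classical in
lemma wt_insert_left (Y : ℝ) (Q E : Finset ℕ) (p : ℕ) (f : Cub ℤ) :
    wt σ Y (insert p Q) E f = wt σ Y Q E f * if NonMax p f then 1 else 0 := by
  simp only [wt, Finset.forall_mem_insert]
  split_ifs <;> first | (exfalso; tauto) | simp

lemma wt_of_scal_eq {Y : ℝ} {Q E : Finset ℕ} {p : ℕ} (hp : p.Prime) (hQ : ∀ q ∈ Q, q.Prime)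
    (hE : ∀ q ∈ E, q.Prime) (hpQ : p ∉ Q) (hpE : p ∉ E) {k : ℕ} (hk : k ∣ p ^ 2)
    {M : Mat} {r : ℕ} (hM : M.det = p ^ r ∨ M.det = - p ^ r) {s : ℕ}
    (hs : (p : ℤ) ^ (6 * r) = k ^ 4 * (p : ℤ) ^ s) {f f' : Cub ℤ} (h : scal (k : ℤ) f' = sub M f) :
    wt σ (Y / p ^ s) Q E f = wt σ Y Q E f' := by
  have hp0 : (p : ℤ) ≠ 0 := by exact_mod_cast hp.ne_zero
  have hk0 : (k : ℤ) ≠ 0 := by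
    rintro h0
    have : k = 0 := by exact_mod_cast h0
    subst this
    exact hp.ne_zero (by simpa using hk)
  have hM0 : M.det ≠ 0 := by rcases hM with h | h <;> rw [h] <;> simp [hp.ne_zero]
  have hnd : ∀ q : ℕ, q.Prime → q ≠ p → ¬ (q : ℤ) ∣ k ∧ ¬ (q : ℤ) ∣ M.det := by
    intro q hq hqp
    have h1 : ∀ r, ¬ (q : ℤ) ∣ (p : ℤ) ^ r := by
      intro r h
      have : q ∣ p ^ r := by exact_mod_cast h
      exact hqp ((Nat.prime_dvd_prime_iff_eq hq hp).1 (hq.dvd_of_dvd_pow this))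
    refine ⟨fun h => h1 2 (h.trans (by exact_mod_cast hk)), ?_⟩
    rcases hM with h | h <;> rw [h]
    · exact h1 r
    · rw [dvd_neg]; exact h1 r
  have hirr : Irr f ↔ Irr f' := by
    rw [← irr_scal hk0 f', h, irr_sub hM0]
  have hdisc : f'.disc = (p : ℤ) ^ s * f.disc := by
    have h1 := congrArg disc h
    have h2 : M.det ^ 6 = (p : ℤ) ^ (6 * r) := by
      rcases hM with h | h <;> rw [h] <;> ring
    rw [disc_scal, disc_sub, h2, hs, mul_assoc] at h1
    exact mul_left_cancel₀ (pow_ne_zero 4 hk0) h1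
  have hps : 0 < (p : ℤ) ^ s := by
    have := hp.pos
    positivity
  have hpos : 0 < σ * f.disc ↔ 0 < σ * f'.disc := by
    rw [hdisc, mul_left_comm, mul_pos_iff_of_pos_left hps]
  have hlt : ((σ * f.disc : ℤ) : ℝ) < Y / p ^ s ↔ ((σ * f'.disc : ℤ) : ℝ) < Y := by
    have : (0 : ℝ) < (p : ℝ) ^ s := by exact_mod_cast hps
    rw [lt_div_iff₀ this, hdisc]
    push_cast
    rw [show (σ : ℝ) * f.disc * (p : ℝ) ^ s = σ * ((p : ℝ) ^ s * f.disc) by ring]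
  have hnm : (∀ q ∈ Q, NonMax q f) ↔ ∀ q ∈ Q, NonMax q f' := by
    refine forall₂_congr fun q hq => ?_
    obtain ⟨h1, h2⟩ := hnd q (hQ q hq) (fun e => hpQ (e ▸ hq))
    exact (nonMax_iff_of_scal_eq (hQ q hq) h1 h2 h).symm
  have hom : ∏ q ∈ E, (om q f : ℝ≥0∞) = ∏ q ∈ E, (om q f' : ℝ≥0∞) := by
    refine prod_congr rfl fun q hq => ?_
    obtain ⟨h1, h2⟩ := hnd q (hE q hq) (fun e => hpE (e ▸ hq))
    rw [om_of_scal_eq (hE q hq) h1 h2 h]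
  classical
  simp only [wt, hirr, hpos, hlt, hnm, hom]

lemma OrbitWeight.sieveSum_insert (hu : OrbitWeight σ u) {Y : ℝ} {Q E : Finset ℕ} {p : ℕ}
    (hp : p.Prime) (hQ : ∀ q ∈ Q, q.Prime) (hE : ∀ q ∈ E, q.Prime) (hpQ : p ∉ Q) (hpE : p ∉ E) :
    sieveSum σ u (Y / p ^ 2) Q (insert p E) = ∑' f, wt σ Y Q E f * (ovr p f : ℝ≥0∞) * u f := by
  rw [sieveSum]
  simp only [wt_insert_right hpE]
  refine hu.swap hp (fun f => wt_ne_zero) (fun f => wt_ne_zero) fun m f f' h => ?_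
  exact wt_of_scal_eq hp hQ hE hpQ hpE (k := p) (r := 1) (s := 2) (dvd_pow_self p two_ne_zero)
    (by simpa using m.2) (by ring) h

open Classical in
lemma OrbitWeight.tsum_dvd (hu : OrbitWeight σ u) {Y : ℝ} {Q E : Finset ℕ} {p : ℕ}
    (hp : p.Prime) (hQ : ∀ q ∈ Q, q.Prime) (hE : ∀ q ∈ E, q.Prime) (hpQ : p ∉ Q) (hpE : p ∉ E)
    (B : Cub ℤ → ℝ≥0∞) :
    ∑' f, wt σ Y Q E f * (if Dvd (p : ℤ) f then B f else 0) * u f =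
      ∑' f, wt σ (Y / p ^ 4) Q E f * B (scal (p : ℤ) f) * u f := by
  have hp0 : (p : ℤ) ≠ 0 := by exact_mod_cast hp.ne_zero
  rw [← (scal_injective (R := ℤ) hp0).tsum_eq]
  · refine tsum_congr fun f => ?_
    rw [if_pos (dvd_iff.2 ⟨f, rfl⟩), hu.scal_eq _ hp0]
    congr 2
    symm
    refine wt_of_scal_eq hp hQ hE hpQ hpE (k := p ^ 2) (M := (p : ℤ) • 1) (r := 2) (s := 4)
      dvd_rfl ?_ ?_ ?_
    · left; rw [det_smul]; simp
    · push_cast; ring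
    · rw [sub_scal_matrix, scal_scal]; congr 1
  · intro f hf
    by_cases h : Dvd (p : ℤ) f
    · obtain ⟨g, rfl⟩ := dvd_iff.1 h
      exact ⟨g, rfl⟩
    · simp [h] at hf

/-- The recursion for the sieve sums. -/
lemma OrbitWeight.sieveSum_rec (hu : OrbitWeight σ u) {Y : ℝ} {Q E : Finset ℕ} {p : ℕ}
    (hp : p.Prime) (hQ : ∀ q ∈ Q, q.Prime) (hE : ∀ q ∈ E, q.Prime) (hpQ : p ∉ Q) (hpE : p ∉ E) :
    sieveSum σ u Y (insert p Q) E + sieveSum σ u (Y / p ^ 4) Q (insert p E) =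
      sieveSum σ u (Y / p ^ 2) Q (insert p E) + sieveSum σ u (Y / p ^ 4) Q E := by
  classical
  rw [hu.sieveSum_insert hp hQ hE hpQ hpE, sieveSum, sieveSum, sieveSum]
  have h1 := hu.tsum_dvd (Y := Y) hp hQ hE hpQ hpE fun _ => 1
  have h2 := hu.tsum_dvd (Y := Y) hp hQ hE hpQ hpE fun f => (ovr p f : ℝ≥0∞)
  simp only [ovr_scal hp, mul_one] at h1 h2
  simp only [wt_insert_right hpE, wt_insert_left]
  rw [← h1, ← h2, ← ENNReal.tsum_add, ← ENNReal.tsum_add]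
  refine tsum_congr fun f => ?_
  rw [← add_mul, ← mul_add, ← add_mul, ← mul_add]
  congr 2
  have hn := nonMax_iff hp f
  by_cases hd : Dvd (p : ℤ) f
  · simp [hd, hn, add_comm]
  · have h3 := ovr_le_one hp hd
    simp only [hd, false_or] at hn
    by_cases h4 : NonMax p f
    · obtain ⟨j, hj⟩ := hn.1 h4
      have : 0 < ovr p f := Finset.card_pos.2 ⟨j, by simpa using hj⟩
      have : ovr p f = 1 := by omega
      simp [h4, hd, this]
    · have : ovr p f = 0 := by
        rw [ovr, Finset.card_eq_zero, Finset.filter_eq_empty_iff]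
        intro j _ hj
        exact h4 (hn.2 ⟨j, hj⟩)
      simp [h4, hd, this]

lemma OrbitWeight.sieveSum_insert_le (hu : OrbitWeight σ u) {Y : ℝ} {Q : Finset ℕ} {p : ℕ}
    (hp : p.Prime) (hQ : ∀ q ∈ Q, q.Prime) (hpQ : p ∉ Q) :
    sieveSum σ u Y (insert p Q) ∅ ≤ 3 * sieveSum σ u (Y / p ^ 2) Q ∅ +
      (p + 1) * sieveSum σ u (Y / p ^ 6) Q ∅ + sieveSum σ u (Y / p ^ 4) Q ∅ := by
  classical
  have h1 : sieveSum σ u (Y / p ^ 2) Q {p} ≤ 3 * sieveSum σ u (Y / p ^ 2) Q ∅ +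
      (p + 1) * sieveSum σ u (Y / p ^ 6) Q ∅ := by
    have h2 := hu.tsum_dvd (Y := Y / p ^ 2) hp hQ (E := ∅) (by simp) hpQ (by simp) fun _ => 1
    simp only [mul_one] at h2
    rw [div_div, ← pow_add] at h2
    simp only [sieveSum]
    rw [← h2, ← ENNReal.tsum_mul_left, ← ENNReal.tsum_mul_left, ← ENNReal.tsum_add]
    refine ENNReal.tsum_le_tsum fun f => ?_
    rw [← insert_empty_eq, wt_insert_right (by simp)]
    have h3 : (om p f : ℝ≥0∞) ≤ 3 + (p + 1) * if Dvd (p : ℤ) f then 1 else 0 := by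
      split_ifs with hd
      · have : (om p f : ℝ≥0∞) ≤ ((p + 1 : ℕ) : ℝ≥0∞) := by exact_mod_cast om_le p f
        refine this.trans ?_
        push_cast
        rw [mul_one]
        exact le_add_self
      · rw [mul_zero, add_zero]
        exact_mod_cast om_le_three hp hd
    calc _ ≤ wt σ (Y / p ^ 2) Q ∅ f * (3 + (p + 1) * if Dvd (p : ℤ) f then 1 else 0) * u f := by
          gcongr
      _ = _ := by ring
  have h4 := hu.sieveSum_rec (Y := Y) hp hQ (E := ∅) (by simp) hpQ (by simp)
  calc _ ≤ _ := le_self_add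
    _ = _ := h4
    _ ≤ _ := by
      rw [insert_empty_eq]
      gcongr

end

lemma NonMax.sq_dvd_disc {p : ℕ} (hp : p.Prime) {f : Cub ℤ} (h : NonMax p f) :
    (p : ℤ) ^ 2 ∣ f.disc := by
  have hp0 : (p : ℤ) ≠ 0 := by exact_mod_cast hp.ne_zero
  rcases (nonMax_iff hp f).1 h with h | ⟨j, h⟩
  · obtain ⟨g, rfl⟩ := dvd_iff.1 h
    exact ⟨p ^ 2 * g.disc, by rw [disc_scal]; ring⟩
  · obtain ⟨g, hg⟩ := dvd_iff.1 h
    refine ⟨g.disc, mul_left_cancel₀ (pow_ne_zero 6 hp0) ?_⟩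
    have := congrArg disc hg
    rw [disc_sub, det_hrep, disc_scal] at this
    rw [this]; ring

open Classical in
/-- The weighted count of maximal forms. -/
def maxSum (σ : ℤ) (u : Cub ℤ → ℝ≥0∞) (X : ℝ) : ℝ≥0∞ :=
  ∑' f, (if Irr f ∧ 0 < σ * f.disc ∧ ((σ * f.disc : ℤ) : ℝ) < X ∧ ∀ p : ℕ, p.Prime → ¬ NonMax p f
    then 1 else 0) * u f

/-- The asymptotic level-of-distribution estimate for the sublattice sums. -/
def LevelEstimate (σ : ℤ) (u : Cub ℤ → ℝ≥0∞) (α β : ℝ) : Prop :=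
  ∃ B C : ℝ, 1 ≤ B ∧ 0 ≤ C ∧ ∀ Y : ℝ, 0 < Y → ∀ E : Finset ℕ, (∀ p ∈ E, p.Prime) →
    sieveSum σ u Y ∅ E ≠ ⊤ ∧
    |(sieveSum σ u Y ∅ E).toReal - α * Y * ∏ p ∈ E, (1 + (p : ℝ)⁻¹)
      - β * Y ^ (5 / 6 : ℝ) * ∏ p ∈ E, (1 + (p : ℝ) ^ (-(1 : ℝ) / 3))| ≤
    C * B ^ E.card * ((∏ p ∈ E, (p : ℝ) ^ (1 / 2 : ℝ)) * Y ^ (37 / 48 : ℝ)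
      + (∏ p ∈ E, (p : ℝ)) * Y ^ (1 / 2 : ℝ))

section

variable {σ : ℤ} {u : Cub ℤ → ℝ≥0∞}

lemma sieveSum_mono (Y : ℝ) (Q E : Finset ℕ) : sieveSum σ u Y Q E ≤ sieveSum σ u Y ∅ E := by
  refine ENNReal.tsum_le_tsum fun f => ?_
  gcongr
  classical
  simp only [wt]
  split_ifs with h1 h2
  · exact le_rfl
  · exact absurd ⟨h1.1, h1.2.1, h1.2.2.1, by simp⟩ h2
  · exact zero_le
  · exact le_rfl

lemma sieveSum_rpow {p : ℕ} (hp : p.Prime) {Y : ℝ} (hY : 0 < Y) (k : ℕ) (s : ℝ) :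
    (Y / (p : ℝ) ^ k) ^ s = Y ^ s * (p : ℝ) ^ (-(k * s)) := by
  have : (0 : ℝ) < p := by exact_mod_cast hp.pos
  rw [div_rpow hY.le (by positivity), ← rpow_natCast, ← rpow_mul this.le,
    rpow_neg this.le, div_eq_mul_inv]

/-- The estimate after imposing nonmaximality at finitely many primes. -/
lemma LevelEstimate.sieve (hu : OrbitWeight σ u) {α β : ℝ} (h : LevelEstimate σ u α β) :
    ∃ B C : ℝ, 1 ≤ B ∧ 0 ≤ C ∧ ∀ Q : Finset ℕ, (∀ p ∈ Q, p.Prime) → ∀ E : Finset ℕ,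
      (∀ p ∈ E, p.Prime) → Disjoint Q E → ∀ Y : ℝ, 0 < Y →
    |(sieveSum σ u Y Q E).toReal
      - α * Y * (∏ p ∈ Q, ((p : ℝ) ^ (-2 : ℝ) + (p : ℝ) ^ (-3 : ℝ) - (p : ℝ) ^ (-5 : ℝ))) *
        ∏ p ∈ E, (1 + (p : ℝ)⁻¹)
      - β * Y ^ (5 / 6 : ℝ) * (∏ p ∈ Q, ((p : ℝ) ^ (-(5 : ℝ) / 3) + (p : ℝ) ^ (-2 : ℝ)
        - (p : ℝ) ^ (-(11 : ℝ) / 3))) * ∏ p ∈ E, (1 + (p : ℝ) ^ (-(1 : ℝ) / 3))| ≤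
    C * B ^ E.card * (3 * B) ^ Q.card * ((∏ p ∈ E, (p : ℝ) ^ (1 / 2 : ℝ)) *
      (∏ p ∈ Q, (p : ℝ) ^ (-(25 : ℝ) / 24)) * Y ^ (37 / 48 : ℝ)
      + (∏ p ∈ E, (p : ℝ)) * Y ^ (1 / 2 : ℝ)) := by
  obtain ⟨B, C, hB, hC, H⟩ := h
  refine ⟨B, C, hB, hC, ?_⟩
  intro Q
  induction Q using Finset.induction_on with
  | empty =>
    intro _ E hE _ Y hY
    simpa using (H Y hY E hE).2
  | insert p Q hpQ ih =>
    intro hQ' E hE hQE Y hY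
    have hp : p.Prime := hQ' p (mem_insert_self _ _)
    have hQ : ∀ q ∈ Q, q.Prime := fun q hq => hQ' q (mem_insert_of_mem hq)
    rw [Finset.disjoint_insert_left] at hQE
    obtain ⟨hpE, hQE⟩ := hQE
    have hE' : ∀ q ∈ insert p E, q.Prime := by
      simp; exact ⟨hp, hE⟩
    have hQE' : Disjoint Q (insert p E) := disjoint_insert_right.2 ⟨hpQ, hQE⟩
    have hp0 : (0 : ℝ) < p := by exact_mod_cast hp.pos
    have hp1 : (1 : ℝ) ≤ p := by exact_mod_cast hp.one_le
    have fin : ∀ Y : ℝ, 0 < Y → ∀ Q E : Finset ℕ, (∀ q ∈ E, q.Prime) →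
        sieveSum σ u Y Q E ≠ ⊤ := fun Y hY Q E hE =>
      ne_top_of_le_ne_top (H Y hY E hE).1 (sieveSum_mono Y Q E)
    have hY2 : 0 < Y / (p : ℝ) ^ 2 := by positivity
    have hY4 : 0 < Y / (p : ℝ) ^ 4 := by positivity
    have hrec := congrArg ENNReal.toReal (hu.sieveSum_rec (Y := Y) hp hQ hE hpQ hpE)
    rw [toReal_add (fin _ hY _ _ hE) (fin _ hY4 _ _ hE'),
      toReal_add (fin _ hY2 _ _ hE') (fin _ hY4 _ _ hE)] at hrec
    have i1 := ih hQ _ hE' hQE' _ hY2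
    have i2 := ih hQ _ hE hQE _ hY4
    have i3 := ih hQ _ hE' hQE' _ hY4
    set s0 := (sieveSum σ u Y (insert p Q) E).toReal
    set s1 := (sieveSum σ u (Y / p ^ 2) Q (insert p E)).toReal
    set s2 := (sieveSum σ u (Y / p ^ 4) Q E).toReal
    set s3 := (sieveSum σ u (Y / p ^ 4) Q (insert p E)).toReal
    rw [prod_insert hpE, prod_insert hpE, prod_insert hpE,
      prod_insert hpE, card_insert_of_notMem hpE] at i1 i3
    rw [prod_insert hpQ, prod_insert hpQ, prod_insert hpQ,
      card_insert_of_notMem hpQ]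
    set a1 := ∏ p ∈ E, (1 + (p : ℝ)⁻¹)
    set a2 := ∏ p ∈ E, (1 + (p : ℝ) ^ (-(1 : ℝ) / 3))
    set q1 := ∏ p ∈ Q, ((p : ℝ) ^ (-2 : ℝ) + (p : ℝ) ^ (-3 : ℝ) - (p : ℝ) ^ (-5 : ℝ))
    set q2 := ∏ p ∈ Q, ((p : ℝ) ^ (-(5 : ℝ) / 3) + (p : ℝ) ^ (-2 : ℝ) - (p : ℝ) ^ (-(11 : ℝ) / 3))
    set e1 := ∏ p ∈ E, (p : ℝ) ^ (1 / 2 : ℝ) with he1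
    set e2 := ∏ p ∈ E, (p : ℝ) with he2
    set q3 := ∏ p ∈ Q, (p : ℝ) ^ (-(25 : ℝ) / 24) with hq3
    have he1' : 0 ≤ e1 := prod_nonneg fun _ _ => by positivity
    have he2' : 0 ≤ e2 := prod_nonneg fun _ _ => by positivity
    have hq3' : 0 ≤ q3 := prod_nonneg fun _ _ => by positivity
    simp only [sieveSum_rpow hp hY] at i1 i2 i3
    have hdiv : ∀ k : ℕ, Y / (p : ℝ) ^ k = Y * (p : ℝ) ^ (-(k : ℝ)) := by
      intro k
      have := sieveSum_rpow hp hY k 1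
      simpa using this
    rw [hdiv] at i1 i2 i3
    push_cast at i1 i2 i3
    have hinv : (p : ℝ)⁻¹ = (p : ℝ) ^ (-1 : ℝ) := (rpow_neg_one _).symm
    set D := C * B ^ E.card * (3 * B) ^ Q.card with hD
    have hD0 : 0 ≤ D := by positivity
    have hmain1 : Y * (p : ℝ) ^ (-(2 : ℝ)) * (1 + (p : ℝ)⁻¹) + Y * (p : ℝ) ^ (-(4 : ℝ))
        - Y * (p : ℝ) ^ (-(4 : ℝ)) * (1 + (p : ℝ)⁻¹)
        = Y * ((p : ℝ) ^ (-2 : ℝ) + (p : ℝ) ^ (-3 : ℝ) - (p : ℝ) ^ (-5 : ℝ)) := by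
      rw [hinv, show (-3 : ℝ) = -2 + -1 by norm_num, show (-5 : ℝ) = -4 + -1 by norm_num,
        rpow_add hp0, rpow_add hp0]
      ring
    have hmain2 : (p : ℝ) ^ (-(2 * (5 / 6 : ℝ))) * (1 + (p : ℝ) ^ (-(1 : ℝ) / 3))
        + (p : ℝ) ^ (-(4 * (5 / 6 : ℝ)))
        - (p : ℝ) ^ (-(4 * (5 / 6 : ℝ))) * (1 + (p : ℝ) ^ (-(1 : ℝ) / 3))
        = (p : ℝ) ^ (-(5 : ℝ) / 3) + (p : ℝ) ^ (-2 : ℝ) - (p : ℝ) ^ (-(11 : ℝ) / 3) := by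
      rw [show (-(11 : ℝ) / 3) = -(4 * (5 / 6 : ℝ)) + -1 / 3 by norm_num,
        show (-2 : ℝ) = -(2 * (5 / 6 : ℝ)) + -1 / 3 by norm_num,
        show (-(5 : ℝ) / 3) = -(2 * (5 / 6 : ℝ)) by norm_num,
        rpow_add hp0, rpow_add hp0]
      ring
    have le_of : ∀ s t : ℝ, s ≤ t → (p : ℝ) ^ s ≤ (p : ℝ) ^ t := fun s t h =>
      rpow_le_rpow_of_exponent_le hp1 h
    set Z1 := Y ^ (37 / 48 : ℝ)
    set Z2 := Y ^ (1 / 2 : ℝ)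
    have hZ1 : 0 ≤ Z1 := by positivity
    have hZ2 : 0 ≤ Z2 := by positivity
    set M := e1 * ((p : ℝ) ^ (-(25 : ℝ) / 24) * q3) * Z1 + e2 * Z2 with hM
    have hM0 : 0 ≤ M := by positivity
    have b1 : C * B ^ (E.card + 1) * (3 * B) ^ Q.card * ((p : ℝ) ^ (1 / 2 : ℝ) * e1 * q3 *
        (Z1 * (p : ℝ) ^ (-(2 * (37 / 48 : ℝ)))) + p * e2 * (Z2 * (p : ℝ) ^ (-(2 * (1 / 2 : ℝ)))))
        ≤ B * D * M := by
      have h1 : (p : ℝ) ^ (1 / 2 : ℝ) * (p : ℝ) ^ (-(2 * (37 / 48 : ℝ)))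
          = (p : ℝ) ^ (-(25 : ℝ) / 24) := by
        rw [← rpow_add hp0]; norm_num
      have h2 : (p : ℝ) * (p : ℝ) ^ (-(2 * (1 / 2 : ℝ))) = 1 := by
        rw [show (-(2 * (1 / 2 : ℝ))) = -1 by norm_num, rpow_neg_one, mul_inv_cancel₀ hp0.ne']
      apply le_of_eq
      rw [hM, hD]
      linear_combination C * B ^ (E.card + 1) * (3 * B) ^ Q.card * (e1 * q3 * Z1 * h1 + e2 * Z2 * h2)
    have b2 : D * (e1 * q3 * (Z1 * (p : ℝ) ^ (-(4 * (37 / 48 : ℝ)))) +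
        e2 * (Z2 * (p : ℝ) ^ (-(4 * (1 / 2 : ℝ))))) ≤ B * D * M := by
      have h1 : (p : ℝ) ^ (-(4 * (37 / 48 : ℝ))) ≤ (p : ℝ) ^ (-(25 : ℝ) / 24) :=
        le_of _ _ (by norm_num)
      have h2 : (p : ℝ) ^ (-(4 * (1 / 2 : ℝ))) ≤ 1 := by
        simpa using le_of (-(4 * (1 / 2 : ℝ))) 0 (by norm_num)
      calc _ ≤ D * (e1 * q3 * (Z1 * (p : ℝ) ^ (-(25 : ℝ) / 24)) + e2 * (Z2 * 1)) := by gcongr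
        _ = 1 * D * M := by rw [hM]; ring
        _ ≤ B * D * M := by gcongr
    have b3 : C * B ^ (E.card + 1) * (3 * B) ^ Q.card * ((p : ℝ) ^ (1 / 2 : ℝ) * e1 * q3 *
        (Z1 * (p : ℝ) ^ (-(4 * (37 / 48 : ℝ)))) + p * e2 * (Z2 * (p : ℝ) ^ (-(4 * (1 / 2 : ℝ)))))
        ≤ B * D * M := by
      refine le_trans ?_ b1
      have h1 := le_of (-(4 * (37 / 48 : ℝ))) (-(2 * (37 / 48 : ℝ))) (by norm_num)
      have h2 := le_of (-(4 * (1 / 2 : ℝ))) (-(2 * (1 / 2 : ℝ))) (by norm_num)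
      gcongr
    have j1 := i1.trans b1
    have j2 := i2.trans b2
    have j3 := i3.trans b3
    have hs0 : s0 = s1 + s2 - s3 := by linarith
    have hid : s0 - α * Y * (((p : ℝ) ^ (-2 : ℝ) + (p : ℝ) ^ (-3 : ℝ) - (p : ℝ) ^ (-5 : ℝ)) * q1) * a1
        - β * Y ^ (5 / 6 : ℝ) * (((p : ℝ) ^ (-(5 : ℝ) / 3) + (p : ℝ) ^ (-2 : ℝ)
          - (p : ℝ) ^ (-(11 : ℝ) / 3)) * q2) * a2
        = (s1 - α * (Y * (p : ℝ) ^ (-(2 : ℝ))) * q1 * ((1 + (p : ℝ)⁻¹) * a1)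
          - β * (Y ^ (5 / 6 : ℝ) * (p : ℝ) ^ (-(2 * (5 / 6 : ℝ)))) * q2 *
            ((1 + (p : ℝ) ^ (-(1 : ℝ) / 3)) * a2))
        + (s2 - α * (Y * (p : ℝ) ^ (-(4 : ℝ))) * q1 * a1
          - β * (Y ^ (5 / 6 : ℝ) * (p : ℝ) ^ (-(4 * (5 / 6 : ℝ)))) * q2 * a2)
        - (s3 - α * (Y * (p : ℝ) ^ (-(4 : ℝ))) * q1 * ((1 + (p : ℝ)⁻¹) * a1)
          - β * (Y ^ (5 / 6 : ℝ) * (p : ℝ) ^ (-(4 * (5 / 6 : ℝ)))) * q2 *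
            ((1 + (p : ℝ) ^ (-(1 : ℝ) / 3)) * a2)) := by
      rw [hs0, ← hmain2]
      linear_combination α * q1 * a1 * hmain1
    rw [hid]
    calc _ ≤ B * D * M + B * D * M + B * D * M :=
          (abs_sub _ _).trans (add_le_add ((abs_add_le _ _).trans (add_le_add j1 j2)) j3)
      _ = _ := by rw [hD]; ring

end

lemma tendsto_euler {s : ℝ} (hs : 1 < s) : (riemannZeta s).re ≠ 0 ∧
    Tendsto (fun n : ℕ => ∏ p ∈ n.primesBelow, (1 - (p : ℝ) ^ (-s))) atTop
      (𝓝 ((riemannZeta s).re)⁻¹) := by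
  have hs' : 1 < (s : ℂ).re := by simpa using hs
  have h1 := riemannZeta_eulerProduct hs'
  have h2 : ∀ n : ℕ, ∏ p ∈ n.primesBelow, (1 - (p : ℂ) ^ (-(s : ℂ)))⁻¹ =
      ((∏ p ∈ n.primesBelow, (1 - (p : ℝ) ^ (-s)) : ℝ) : ℂ)⁻¹ := by
    intro n
    push_cast
    rw [Finset.prod_inv_distrib]
    congr 1
    refine prod_congr rfl fun p _ => ?_
    rw [Complex.ofReal_cpow (by positivity)]
    push_cast
    rfl
  simp only [h2] at h1
  have h0 := riemannZeta_ne_zero_of_one_lt_re hs'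
  have h3 := h1.inv₀ h0
  simp only [inv_inv] at h3
  have h4 := (Complex.continuous_re.tendsto _).comp h3
  have him : (riemannZeta s).im = 0 := by
    have h5 := (Complex.continuous_im.tendsto _).comp h1
    refine tendsto_nhds_unique h5 ?_
    have : (Complex.im ∘ fun n : ℕ => ((∏ p ∈ n.primesBelow, (1 - (p : ℝ) ^ (-s)) : ℝ) : ℂ)⁻¹)
        = fun _ => 0 := by
      funext n
      simp only [Function.comp, ← Complex.ofReal_inv, Complex.ofReal_im]
    rw [this]
    exact tendsto_const_nhds
  have hre : riemannZeta s = ((riemannZeta s).re : ℂ) := Complex.ext (by simp) (by simp [him])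
  refine ⟨fun h => h0 (by rw [hre, h]; simp), ?_⟩
  rw [hre, ← Complex.ofReal_inv] at h4
  exact h4

section

variable {σ : ℤ} {u : Cub ℤ → ℝ≥0∞}

lemma sieveSum_eq_zero {Y : ℝ} (hY : Y ≤ 1) (Q E : Finset ℕ) : sieveSum σ u Y Q E = 0 := by
  rw [sieveSum, ENNReal.tsum_eq_zero]
  intro f
  rw [wt, if_neg, zero_mul]
  rintro ⟨-, h1, h2, -⟩
  have : (1 : ℝ) ≤ ((σ * f.disc : ℤ) : ℝ) := by exact_mod_cast h1
  linarith

lemma LevelEstimate.sieveSum_empty_le {α β : ℝ} (h : LevelEstimate σ u α β) :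
    ∃ C : ℝ, 0 ≤ C ∧ ∀ Y : ℝ, 0 < Y → sieveSum σ u Y ∅ ∅ ≤ ofReal (C * Y) := by
  obtain ⟨B, C, hB, hC, H⟩ := h
  refine ⟨|α| + |β| + 2 * C, by positivity, fun Y hY => ?_⟩
  rcases le_or_gt Y 1 with h1 | h1
  · rw [sieveSum_eq_zero h1]; exact zero_le
  · obtain ⟨hfin, h⟩ := H Y hY ∅ (by simp)
    rw [← ofReal_toReal hfin]
    refine ofReal_le_ofReal ?_
    simp at h
    have e : ∀ s : ℝ, s ≤ 1 → Y ^ s ≤ Y := fun s hs => by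
      simpa using rpow_le_rpow_of_exponent_le h1.le hs
    have h2 := (abs_le.1 h).2
    have a1 : α * Y ≤ |α| * Y := by gcongr; exact le_abs_self _
    have a2 : β * Y ^ (5 / 6 : ℝ) ≤ |β| * Y := by
      have := le_abs_self β
      have := e (5 / 6) (by norm_num)
      gcongr
    have a3 : C * (Y ^ (37 / 48 : ℝ) + Y ^ (1 / 2 : ℝ)) ≤ C * (Y + Y) := by
      have := e (37 / 48) (by norm_num)
      have := e (1 / 2) (by norm_num)
      gcongr
    linarith

lemma sieveSum_le (hu : OrbitWeight σ u) {C : ℝ} (hC : 0 ≤ C)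
    (h : ∀ Y : ℝ, 0 < Y → sieveSum σ u Y ∅ ∅ ≤ ofReal (C * Y)) (Q : Finset ℕ)
    (hQ : ∀ p ∈ Q, p.Prime) : ∀ Y : ℝ, 0 < Y →
    sieveSum σ u Y Q ∅ ≤ ofReal (C * 4 ^ Q.card * (∏ p ∈ Q, (p : ℝ) ^ (-2 : ℝ)) * Y) := by
  induction Q using Finset.induction_on with
  | empty => intro Y hY; simpa using h Y hY
  | insert p Q hpQ ih =>
    intro Y hY
    simp at hQ
    obtain ⟨hp, hQ⟩ := hQ
    have hp0 : (0 : ℝ) < p := by exact_mod_cast hp.pos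
    have hp1 : (2 : ℝ) ≤ p := by exact_mod_cast hp.two_le
    set D := C * 4 ^ Q.card * ∏ p ∈ Q, (p : ℝ) ^ (-2 : ℝ) with hD
    have hD0 : 0 ≤ D := by
      have : 0 ≤ ∏ p ∈ Q, (p : ℝ) ^ (-2 : ℝ) := prod_nonneg fun _ _ => by positivity
      positivity
    refine (hu.sieveSum_insert_le hp hQ hpQ).trans ?_
    have i2 := ih hQ (Y / p ^ 2) (by positivity)
    have i4 := ih hQ (Y / p ^ 4) (by positivity)
    have i6 := ih hQ (Y / p ^ 6) (by positivity)
    have e3 : (3 : ℝ≥0∞) = ofReal 3 := by simp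
    have ep : (p + 1 : ℝ≥0∞) = ofReal (p + 1) := by
      rw [ofReal_add hp0.le zero_le_one]; simp
    calc _ ≤ ofReal 3 * ofReal (D * (Y / p ^ 2)) + ofReal (p + 1) *
          ofReal (D * (Y / p ^ 6)) + ofReal (D * (Y / p ^ 4)) := by
          rw [e3, ep]; gcongr
      _ = ofReal (3 * (D * (Y / p ^ 2)) + (p + 1) * (D * (Y / p ^ 6)) +
          D * (Y / p ^ 4)) := by
        rw [← ofReal_mul (by norm_num), ← ofReal_mul (by positivity),
          ← ofReal_add (by positivity) (by positivity),
          ← ofReal_add (by positivity) (by positivity)]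
      _ ≤ _ := by
        refine ofReal_le_ofReal ?_
        rw [card_insert_of_notMem hpQ, prod_insert hpQ,
          show (p : ℝ) ^ (-2 : ℝ) = ((p : ℝ) ^ 2)⁻¹ by rw [rpow_neg hp0.le]; norm_num]
        have key : 3 * (1 / (p : ℝ) ^ 2) + (p + 1) * (1 / (p : ℝ) ^ 6) + 1 / (p : ℝ) ^ 4 ≤
            4 * ((p : ℝ) ^ 2)⁻¹ := by
          rw [← sub_nonneg]
          have : 4 * ((p : ℝ) ^ 2)⁻¹ - (3 * (1 / (p : ℝ) ^ 2) + (p + 1) * (1 / (p : ℝ) ^ 6)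
            + 1 / (p : ℝ) ^ 4) = (p ^ 4 - p - 1 - p ^ 2) / (p : ℝ) ^ 6 := by
            field_simp; ring
          rw [this]
          apply div_nonneg _ (by positivity)
          nlinarith [mul_nonneg hp0.le hp0.le, sq_nonneg ((p : ℝ) ^ 2 - 2)]
        calc _ = (D * Y) * (3 * (1 / (p : ℝ) ^ 2) + (p + 1) * (1 / (p : ℝ) ^ 6) + 1 / (p : ℝ) ^ 4) := by
              ring
          _ ≤ (D * Y) * (4 * ((p : ℝ) ^ 2)⁻¹) := by gcongr
          _ = _ := by rw [hD]; ring

lemma maxSum_eq {X : ℝ} (hfin : sieveSum σ u X ∅ ∅ ≠ ⊤) {N : ℕ} (hN : X ≤ N) :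
    (maxSum σ u X).toReal = ∑ Q ∈ N.primesBelow.powerset, (-1) ^ Q.card *
      (sieveSum σ u X Q ∅).toReal := by
  classical
  have h0 : ∀ f, wt σ X ∅ ∅ f * u f ≠ ⊤ := ENNReal.ne_top_of_tsum_ne_top hfin
  have hsum : Summable fun f => (wt σ X ∅ ∅ f * u f).toReal := summable_toReal hfin
  have hwt : ∀ (Q : Finset ℕ) (f : Cub ℤ), wt σ X Q ∅ f * u f =
      wt σ X ∅ ∅ f * u f * ∏ p ∈ Q, if NonMax p f then 1 else 0 := by
    intro Q f
    induction Q using Finset.induction_on with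
    | empty => simp
    | insert p Q hp ih =>
      rw [wt_insert_left, prod_insert hp, mul_right_comm, ih]; ring
  have h1 : ∀ Q : Finset ℕ, (sieveSum σ u X Q ∅).toReal =
      ∑' f, (wt σ X ∅ ∅ f * u f).toReal * ∏ p ∈ Q, if NonMax p f then (1 : ℝ) else 0 := by
    intro Q
    rw [sieveSum, tsum_toReal_eq]
    · refine tsum_congr fun f => ?_
      rw [hwt, toReal_mul]
      congr 1
      rw [toReal_prod]
      refine prod_congr rfl fun p _ => ?_
      split_ifs <;> simp
    · exact ENNReal.ne_top_of_tsum_ne_top (ne_top_of_le_ne_top hfin (sieveSum_mono X Q ∅))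
  have h2 : ∀ Q : Finset ℕ, Summable fun f => (wt σ X ∅ ∅ f * u f).toReal *
      ∏ p ∈ Q, if NonMax p f then (1 : ℝ) else 0 := by
    intro Q
    refine Summable.of_nonneg_of_le (fun f => ?_) (fun f => ?_) hsum
    · refine mul_nonneg toReal_nonneg (prod_nonneg fun p _ => ?_)
      split_ifs <;> norm_num
    · refine mul_le_of_le_one_right toReal_nonneg (prod_le_one (fun p _ => ?_)
        fun p _ => ?_) <;> split_ifs <;> norm_num
  simp only [h1, ← tsum_mul_left]
  rw [← Summable.tsum_finsetSum fun Q _ => (h2 Q).mul_left _, maxSum, tsum_toReal_eq]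
  · refine tsum_congr fun f => ?_
    have h3 : ∑ Q ∈ N.primesBelow.powerset, (-1 : ℝ) ^ Q.card * ((wt σ X ∅ ∅ f * u f).toReal *
        ∏ p ∈ Q, if NonMax p f then (1 : ℝ) else 0) = (wt σ X ∅ ∅ f * u f).toReal *
        ∏ p ∈ N.primesBelow, (1 + -if NonMax p f then (1 : ℝ) else 0) := by
      rw [prod_one_add, mul_sum]
      refine sum_congr rfl fun Q _ => ?_
      rw [prod_neg]; ring
    rw [h3, wt]
    by_cases hg : Irr f ∧ 0 < σ * f.disc ∧ ((σ * f.disc : ℤ) : ℝ) < X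
    · obtain ⟨g1, g2, g3⟩ := hg
      have hbd : ∀ p : ℕ, p.Prime → NonMax p f → p ∈ N.primesBelow := by
        intro p hp h
        rw [Nat.mem_primesBelow]
        refine ⟨?_, hp⟩
        have h5 := (h.sq_dvd_disc hp).mul_left σ
        have h6 := Int.le_of_dvd g2 h5
        have h7 : (p : ℤ) ^ 2 < N := by
          have : ((p ^ 2 : ℤ) : ℝ) ≤ ((σ * f.disc : ℤ) : ℝ) := by exact_mod_cast h6
          have : ((p ^ 2 : ℤ) : ℝ) < (N : ℝ) := by linarith
          exact_mod_cast this
        have h8 : (p : ℤ) ≤ (p : ℤ) ^ 2 := by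
          have : (1 : ℤ) ≤ p := by exact_mod_cast hp.one_le
          nlinarith
        omega
      by_cases hm : ∀ p : ℕ, p.Prime → ¬ NonMax p f
      · rw [if_pos ⟨g1, g2, g3, hm⟩, if_pos ⟨g1, g2, g3, by simp⟩,
          prod_eq_one (s := N.primesBelow)]
        · simp
        · intro p hp
          rw [if_neg (hm p (Nat.prime_of_mem_primesBelow hp))]; simp
      · rw [if_neg (fun h => hm h.2.2.2)]
        push Not at hm
        obtain ⟨p, hp, h⟩ := hm
        rw [prod_eq_zero (hbd p hp h) (by simp [h])]
        simp
    · rw [if_neg (fun h => hg ⟨h.1, h.2.1, h.2.2.1⟩), if_neg (fun h => hg ⟨h.1, h.2.1, h.2.2.1⟩)]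
      simp
  · intro f
    have := h0 f
    split_ifs with h
    · rw [wt, if_pos ⟨h.1, h.2.1, h.2.2.1, by simp⟩] at this
      simpa using this
    · simp

end

lemma le_interpolate {x a b t : ℝ} (hx : 0 ≤ x) (ha : x ≤ a) (hb : x ≤ b) (ht : 0 ≤ t)
    (ht1 : t ≤ 1) : x ≤ a ^ t * b ^ (1 - t) := by
  rcases hx.eq_or_lt with rfl | hx
  · have := ha; have := hb; positivity
  calc x = x ^ t * x ^ (1 - t) := by rw [← rpow_add hx]; simp
    _ ≤ _ := by
      have : 0 ≤ 1 - t := by linarith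
      have : 0 ≤ a := hx.le.trans ha
      gcongr

/-- Combining two bounds in the sieve: `q` is a squarefree sieve modulus. -/
lemma min_bound {X q x : ℝ} (hX : 1 ≤ X) (hq : 1 ≤ q) (hx : 0 ≤ x)
    (h1 : x ≤ q ^ (-(25 : ℝ) / 24) * X ^ (37 / 48 : ℝ) + X ^ (1 / 2 : ℝ))
    (h2 : x ≤ X * q ^ (-2 : ℝ) + X ^ (5 / 6 : ℝ) * q ^ (-(5 : ℝ) / 3)) :
    x ≤ 3 * (X ^ (7 / 9 : ℝ) * q ^ (-(25 : ℝ) / 24)) := by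
  have X0 : 0 < X := by linarith
  have q0 : 0 < q := by linarith
  have eX : ∀ s : ℝ, s ≤ 7 / 9 → X ^ s ≤ X ^ (7 / 9 : ℝ) := fun s hs =>
    rpow_le_rpow_of_exponent_le hX hs
  have eq : ∀ s : ℝ, s ≤ -(25 : ℝ) / 24 → q ^ s ≤ q ^ (-(25 : ℝ) / 24) := fun s hs =>
    rpow_le_rpow_of_exponent_le hq hs
  set T := X ^ (7 / 9 : ℝ) * q ^ (-(25 : ℝ) / 24) with hT
  have hA : q ^ (-(25 : ℝ) / 24) * X ^ (37 / 48 : ℝ) ≤ T := by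
    rw [hT, mul_comm]
    have := eX (37 / 48) (by norm_num)
    gcongr
  have hB : ∀ z : ℝ, 0 ≤ z → z ≤ X ^ (1 / 2 : ℝ) → z ≤ X * q ^ (-2 : ℝ) → z ≤ T := by
    intro z hz hz1 hz2
    refine (le_interpolate hz hz1 hz2 (t := 9 / 20) (by norm_num) (by norm_num)).trans ?_
    rw [mul_rpow X0.le (by positivity), ← rpow_mul X0.le, ← rpow_mul q0.le,
      ← mul_assoc, ← rpow_add X0]
    have := eX (1 / 2 * (9 / 20) + (1 - 9 / 20)) (by norm_num)
    have := eq (-2 * (1 - 9 / 20)) (by norm_num)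
    rw [hT]; gcongr
  have hC : ∀ z : ℝ, 0 ≤ z → z ≤ X ^ (1 / 2 : ℝ) → z ≤ X ^ (5 / 6 : ℝ) * q ^ (-(5 : ℝ) / 3) →
      z ≤ T := by
    intro z hz hz1 hz2
    refine (le_interpolate hz hz1 hz2 (t := 1 / 5) (by norm_num) (by norm_num)).trans ?_
    rw [mul_rpow (by positivity) (by positivity), ← rpow_mul X0.le, ← rpow_mul q0.le,
      ← rpow_mul X0.le, ← mul_assoc, ← rpow_add X0]
    have := eX (1 / 2 * (1 / 5) + 5 / 6 * (1 - 1 / 5)) (by norm_num)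
    have := eq (-5 / 3 * (1 - 1 / 5)) (by norm_num)
    rw [hT]; gcongr
  have m1 : min (X ^ (1 / 2 : ℝ)) (X * q ^ (-2 : ℝ)) ≤ T :=
    hB _ (by positivity) (min_le_left _ _) (min_le_right _ _)
  have m2 : min (X ^ (1 / 2 : ℝ)) (X ^ (5 / 6 : ℝ) * q ^ (-(5 : ℝ) / 3)) ≤ T :=
    hC _ (by positivity) (min_le_left _ _) (min_le_right _ _)
  have hT0 : 0 ≤ T := by positivity
  rcases min_choice (X ^ (1 / 2 : ℝ)) (X * q ^ (-2 : ℝ)) with e1 | e1 <;> rw [e1] at m1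
  · linarith
  · rcases min_choice (X ^ (1 / 2 : ℝ)) (X ^ (5 / 6 : ℝ) * q ^ (-(5 : ℝ) / 3)) with e2 | e2 <;>
      rw [e2] at m2 <;> linarith

section

variable {σ : ℤ} {u : Cub ℤ → ℝ≥0∞}

lemma LevelEstimate.maxSum (hu : OrbitWeight σ u) {α β : ℝ} (h : LevelEstimate σ u α β) :
    ∃ C : ℝ, ∀ X : ℝ, 1 ≤ X → maxSum σ u X ≠ ⊤ ∧
      |(maxSum σ u X).toReal - α * X * ((riemannZeta (2 : ℝ)).re⁻¹ * (riemannZeta (3 : ℝ)).re⁻¹)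
        - β * X ^ (5 / 6 : ℝ) * ((riemannZeta ((5 / 3 : ℝ) : ℝ)).re⁻¹ *
          (riemannZeta (2 : ℝ)).re⁻¹)| ≤ C * X ^ (7 / 9 : ℝ) := by
  obtain ⟨C0, hC0, hS⟩ := h.sieveSum_empty_le
  obtain ⟨B, C, hB, hC, H⟩ := h.sieve hu
  have hSle := sieveSum_le hu hC0 hS
  set K := max 4 (3 * B) with hK
  set D := C + C0 + |α| + |β| with hD
  have hD0 : 0 ≤ D := by positivity
  have hKs : Summable fun n : ℕ => K * (n : ℝ) ^ (-(25 : ℝ) / 24) := by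
    refine Summable.mul_left _ ?_
    exact summable_nat_rpow.2 (by norm_num)
  refine ⟨3 * D * exp (∑' n : ℕ, K * (n : ℝ) ^ (-(25 : ℝ) / 24)), fun X hX => ?_⟩
  have X0 : 0 < X := by linarith
  have hfin : sieveSum σ u X ∅ ∅ ≠ ⊤ := ne_top_of_le_ne_top ofReal_ne_top (hS X X0)
  constructor
  · refine ne_top_of_le_ne_top hfin (ENNReal.tsum_le_tsum fun f => ?_)
    gcongr
    rw [wt]
    split_ifs with g1 g2
    · simp
    · exact absurd ⟨g1.1, g1.2.1, g1.2.2.1, by simp⟩ g2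
    · exact zero_le
    · exact le_rfl
  have bound : ∀ N : ℕ, X ≤ N → |(Cub.maxSum σ u X).toReal
      - α * X * ((∏ p ∈ N.primesBelow, (1 - (p : ℝ) ^ (-(2 : ℝ)))) *
        ∏ p ∈ N.primesBelow, (1 - (p : ℝ) ^ (-(3 : ℝ))))
      - β * X ^ (5 / 6 : ℝ) * ((∏ p ∈ N.primesBelow, (1 - (p : ℝ) ^ (-(5 / 3 : ℝ)))) *
        ∏ p ∈ N.primesBelow, (1 - (p : ℝ) ^ (-(2 : ℝ))))| ≤
      3 * D * exp (∑' n : ℕ, K * (n : ℝ) ^ (-(25 : ℝ) / 24)) * X ^ (7 / 9 : ℝ) := by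
    intro N hN
    have hpp : ∀ p ∈ N.primesBelow, (0 : ℝ) < p := fun p hp => by
      exact_mod_cast (Nat.prime_of_mem_primesBelow hp).pos
    have f1 : (∏ p ∈ N.primesBelow, (1 - (p : ℝ) ^ (-(2 : ℝ)))) *
        ∏ p ∈ N.primesBelow, (1 - (p : ℝ) ^ (-(3 : ℝ))) = ∑ Q ∈ N.primesBelow.powerset,
        (-1) ^ Q.card * ∏ p ∈ Q, ((p : ℝ) ^ (-2 : ℝ) + (p : ℝ) ^ (-3 : ℝ) - (p : ℝ) ^ (-5 : ℝ)) := by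
      rw [← prod_mul_distrib]
      simp only [← prod_neg]
      rw [← prod_one_add]
      refine prod_congr rfl fun p hp => ?_
      rw [show (-5 : ℝ) = -2 + -3 by norm_num, rpow_add (hpp p hp)]; ring
    have f2 : (∏ p ∈ N.primesBelow, (1 - (p : ℝ) ^ (-(5 / 3 : ℝ)))) *
        ∏ p ∈ N.primesBelow, (1 - (p : ℝ) ^ (-(2 : ℝ))) = ∑ Q ∈ N.primesBelow.powerset,
        (-1) ^ Q.card * ∏ p ∈ Q, ((p : ℝ) ^ (-(5 : ℝ) / 3) + (p : ℝ) ^ (-2 : ℝ)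
          - (p : ℝ) ^ (-(11 : ℝ) / 3)) := by
      rw [← prod_mul_distrib]
      simp only [← prod_neg]
      rw [← prod_one_add]
      refine prod_congr rfl fun p hp => ?_
      rw [show (-(11 : ℝ) / 3) = -5 / 3 + -2 by norm_num, rpow_add (hpp p hp),
        show (-(5 / 3 : ℝ)) = -5 / 3 by norm_num]; ring
    rw [maxSum_eq hfin hN, f1, f2, mul_sum, mul_sum, ← sum_sub_distrib,
      ← sum_sub_distrib]
    refine (abs_sum_le_sum_abs _ _).trans ?_
    have term : ∀ Q ∈ N.primesBelow.powerset, |(-1) ^ Q.card * (sieveSum σ u X Q ∅).toReal -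
        α * X * ((-1) ^ Q.card * ∏ p ∈ Q, ((p : ℝ) ^ (-2 : ℝ) + (p : ℝ) ^ (-3 : ℝ)
          - (p : ℝ) ^ (-5 : ℝ))) - β * X ^ (5 / 6 : ℝ) * ((-1) ^ Q.card *
          ∏ p ∈ Q, ((p : ℝ) ^ (-(5 : ℝ) / 3) + (p : ℝ) ^ (-2 : ℝ) - (p : ℝ) ^ (-(11 : ℝ) / 3)))| ≤
        3 * D * X ^ (7 / 9 : ℝ) * ∏ p ∈ Q, (K * (p : ℝ) ^ (-(25 : ℝ) / 24)) := by
      intro Q hQN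
      have hQ : ∀ p ∈ Q, p.Prime := fun p hp =>
        Nat.prime_of_mem_primesBelow (mem_powerset.1 hQN hp)
      have hQ1 : ∀ p ∈ Q, (1 : ℝ) ≤ p := fun p hp => by exact_mod_cast (hQ p hp).one_le
      have hi := H Q hQ ∅ (by simp) (by simp) X X0
      have hi2 := hSle Q hQ X X0
      simp only [Finset.prod_empty, Finset.card_empty, pow_zero, mul_one, one_mul] at hi
      set s := (sieveSum σ u X Q ∅).toReal with hs
      set m1 := ∏ p ∈ Q, ((p : ℝ) ^ (-2 : ℝ) + (p : ℝ) ^ (-3 : ℝ) - (p : ℝ) ^ (-5 : ℝ)) with hm1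
      set m2 := ∏ p ∈ Q, ((p : ℝ) ^ (-(5 : ℝ) / 3) + (p : ℝ) ^ (-2 : ℝ)
        - (p : ℝ) ^ (-(11 : ℝ) / 3)) with hm2
      set q : ℝ := ∏ p ∈ Q, (p : ℝ) with hq
      have hqr : ∀ t : ℝ, ∏ p ∈ Q, (p : ℝ) ^ t = q ^ t := fun t =>
        finsetProd_rpow _ _ (fun p hp => by linarith [hQ1 p hp]) _
      have hq1 : 1 ≤ q := by
        have : ∏ p ∈ Q, (1 : ℝ) ≤ q := prod_le_prod (fun _ _ => zero_le_one) hQ1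
        simpa using this
      have hs2 : s ≤ C0 * 4 ^ Q.card * q ^ (-2 : ℝ) * X := by
        rw [hqr] at hi2
        exact toReal_le_of_le_ofReal (by positivity) hi2
      have hs0 : 0 ≤ s := toReal_nonneg
      have cmp : ∀ p ∈ Q, ∀ s t : ℝ, s ≤ t → (p : ℝ) ^ s ≤ (p : ℝ) ^ t := fun p hp s t h =>
        rpow_le_rpow_of_exponent_le (hQ1 p hp) h
      have hm1' : |m1| ≤ 2 ^ Q.card * q ^ (-2 : ℝ) := by
        have h0 : 0 ≤ m1 := prod_nonneg fun p hp => by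
          have := cmp p hp (-5) (-2) (by norm_num)
          have : 0 ≤ (p : ℝ) ^ (-3 : ℝ) := by positivity
          linarith
        rw [abs_of_nonneg h0, ← hqr, ← prod_const, ← prod_mul_distrib]
        refine prod_le_prod (fun p hp => ?_) fun p hp => ?_
        · have := cmp p hp (-5) (-2) (by norm_num)
          have : 0 ≤ (p : ℝ) ^ (-3 : ℝ) := by positivity
          linarith
        · have := cmp p hp (-3) (-2) (by norm_num)
          have : 0 ≤ (p : ℝ) ^ (-5 : ℝ) := by positivity
          linarith
      have hm2' : |m2| ≤ 2 ^ Q.card * q ^ (-(5 : ℝ) / 3) := by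
        have h0 : ∀ p ∈ Q, 0 ≤ (p : ℝ) ^ (-(5 : ℝ) / 3) + (p : ℝ) ^ (-2 : ℝ)
            - (p : ℝ) ^ (-(11 : ℝ) / 3) := fun p hp => by
          have := cmp p hp (-(11 : ℝ) / 3) (-2) (by norm_num)
          have : 0 ≤ (p : ℝ) ^ (-(5 : ℝ) / 3) := by positivity
          linarith
        rw [abs_of_nonneg (prod_nonneg h0), ← hqr, ← prod_const,
          ← prod_mul_distrib]
        refine prod_le_prod h0 fun p hp => ?_
        have := cmp p hp (-2) (-(5 : ℝ) / 3) (by norm_num)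
        have : 0 ≤ (p : ℝ) ^ (-(11 : ℝ) / 3) := by positivity
        linarith
      have hK4 : (4 : ℝ) ^ Q.card ≤ K ^ Q.card := pow_le_pow_left₀ (by norm_num) (le_max_left _ _) _
      have hK2 : (2 : ℝ) ^ Q.card ≤ K ^ Q.card :=
        (pow_le_pow_left₀ (by norm_num) (by norm_num) _).trans hK4
      have hKB : (3 * B) ^ Q.card ≤ K ^ Q.card :=
        pow_le_pow_left₀ (by positivity) (le_max_right _ _) _
      have hK0 : 0 < K ^ Q.card := by positivity
      set z := s - α * X * m1 - β * X ^ (5 / 6 : ℝ) * m2 with hz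
      have e0 : (-1) ^ Q.card * s - α * X * ((-1) ^ Q.card * m1)
          - β * X ^ (5 / 6 : ℝ) * ((-1) ^ Q.card * m2) = (-1) ^ Q.card * z := by
        rw [hz]; ring
      rw [e0, abs_mul, abs_pow, abs_neg, abs_one, one_pow, one_mul, prod_mul_distrib,
        prod_const, hqr]
      rw [hqr] at hi
      have z1 : |z| ≤ D * K ^ Q.card * (q ^ (-(25 : ℝ) / 24) * X ^ (37 / 48 : ℝ)
          + X ^ (1 / 2 : ℝ)) := by
        refine hi.trans ?_
        have : C ≤ D := by rw [hD]; linarith [abs_nonneg α, abs_nonneg β]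
        gcongr
      have z2 : |z| ≤ D * K ^ Q.card * (X * q ^ (-2 : ℝ) + X ^ (5 / 6 : ℝ) * q ^ (-(5 : ℝ) / 3)) := by
        have t1 : |z| ≤ s + |α| * X * |m1| + |β| * X ^ (5 / 6 : ℝ) * |m2| := by
          refine (abs_sub _ _).trans (add_le_add ((abs_sub _ _).trans ?_) ?_)
          · rw [abs_of_nonneg hs0, abs_mul, abs_mul, abs_of_pos X0]
          · rw [abs_mul, abs_mul, abs_of_nonneg (by positivity : (0 : ℝ) ≤ X ^ (5 / 6 : ℝ))]
        have t2 : s ≤ C0 * K ^ Q.card * q ^ (-2 : ℝ) * X := hs2.trans (by gcongr)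
        have t3 : |α| * X * |m1| ≤ |α| * X * (K ^ Q.card * q ^ (-2 : ℝ)) := by
          have := hm1'.trans (mul_le_mul_of_nonneg_right hK2 (by positivity))
          gcongr
        have t4 : |β| * X ^ (5 / 6 : ℝ) * |m2| ≤ |β| * X ^ (5 / 6 : ℝ) *
            (K ^ Q.card * q ^ (-(5 : ℝ) / 3)) := by
          have := hm2'.trans (mul_le_mul_of_nonneg_right hK2 (by positivity : 0 ≤ q ^ (-(5 : ℝ) / 3)))
          gcongr
        have t5 : 0 ≤ K ^ Q.card * (X * q ^ (-2 : ℝ)) := by positivity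
        have t6 : 0 ≤ K ^ Q.card * (X ^ (5 / 6 : ℝ) * q ^ (-(5 : ℝ) / 3)) := by positivity
        have t7 : C0 + |α| ≤ D := by rw [hD]; linarith [abs_nonneg β]
        have t8 : |β| ≤ D := by rw [hD]; linarith [abs_nonneg α]
        have t9 := mul_le_mul_of_nonneg_right t7 t5
        have t10 := mul_le_mul_of_nonneg_right t8 t6
        linarith
      rcases hD0.eq_or_lt with hD0 | hD0
      · rw [← hD0] at z1 ⊢; simpa using z1
      have hDK : 0 < D * K ^ Q.card := by positivity
      have := min_bound hX hq1 (x := |z| / (D * K ^ Q.card)) (by positivity)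
        (by rwa [div_le_iff₀' hDK]) (by rwa [div_le_iff₀' hDK])
      rw [div_le_iff₀' hDK] at this
      linarith
    refine (sum_le_sum term).trans ?_
    rw [← mul_sum, ← prod_one_add, mul_right_comm]
    gcongr
    calc _ ≤ ∏ p ∈ N.primesBelow, exp (K * (p : ℝ) ^ (-(25 : ℝ) / 24)) := by
          refine prod_le_prod (fun p _ => by positivity) fun p _ => ?_
          rw [add_comm]; exact add_one_le_exp _
      _ = exp (∑ p ∈ N.primesBelow, K * (p : ℝ) ^ (-(25 : ℝ) / 24)) := (exp_sum _ _).symm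
      _ ≤ _ := exp_le_exp.2 (hKs.sum_le_tsum _ fun n _ => by positivity)
  have l2 := (tendsto_euler (s := 2) (by norm_num)).2
  have l3 := (tendsto_euler (s := 3) (by norm_num)).2
  have l53 := (tendsto_euler (s := 5 / 3) (by norm_num)).2
  refine le_of_tendsto (((tendsto_const_nhds.sub ((l2.mul l3).const_mul (α * X))).sub
    ((l53.mul l2).const_mul (β * X ^ (5 / 6 : ℝ)))).abs) ?_
  filter_upwards [eventually_ge_atTop ⌈X⌉₊] with N hN
  exact bound N ((Nat.le_ceil X).trans (by exact_mod_cast hN))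

end

/-- The multiplication table of the cubic ring attached to a form. -/
structure Tab {A : Type*} [CommRing A] (f : Cub ℤ) (ω θ : A) : Prop where
  wt : ω * θ = -(f.a * f.d : A)
  ww : ω ^ 2 = -(f.a * f.c : A) - f.b * ω + f.a * θ
  tt : θ ^ 2 = -(f.b * f.d : A) - f.d * ω + f.c * θ

section

variable {A : Type*} [CommRing A] {f : Cub ℤ} {ω θ : A}

lemma Tab.cubic (h : Tab f ω θ) : ω ^ 3 + f.b * ω ^ 2 + f.a * f.c * ω + f.a ^ 2 * f.d = 0 := by
  linear_combination ω * h.ww + f.a * h.wt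

lemma Tab.cubic' (h : Tab f ω θ) : θ ^ 3 - f.c * θ ^ 2 + f.b * f.d * θ - f.a * f.d ^ 2 = 0 := by
  linear_combination θ * h.tt - f.d * h.wt

/-- Normalizing a basis of a cubic ring. -/
lemma exists_tab {b : Module.Basis (Fin 3) ℤ A} (hb : b 0 = 1) :
    ∃ (f : Cub ℤ) (n m : ℤ), Tab f (b 1 + n) (b 2 + m) := by
  have rep : ∀ x : A, ∃ e p q : ℤ, x = e + p * b 1 + q * b 2 := by
    intro x
    refine ⟨b.repr x 0, b.repr x 1, b.repr x 2, ?_⟩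
    have := b.sum_repr x
    rw [Fin.sum_univ_three, hb] at this
    simp at this
    exact this.symm
  have uniq : ∀ e p q : ℤ, (e + p * b 1 + q * b 2 : A) = 0 → e = 0 ∧ p = 0 ∧ q = 0 := by
    intro e p q h
    have h2 := Fintype.linearIndependent_iff.1 b.linearIndependent ![e, p, q] (by
      rw [Fin.sum_univ_three, hb]; simpa using h)
    exact ⟨by simpa using h2 0, by simpa using h2 1, by simpa using h2 2⟩
  obtain ⟨e, p, q, h1⟩ := rep (b 1 * b 2)
  set ω := b 1 - q with hω
  set θ := b 2 - p with hθ
  obtain ⟨e2, p2, q2, h2⟩ := rep (ω ^ 2)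
  obtain ⟨e3, p3, q3, h3⟩ := rep (θ ^ 2)
  have c1 : ω * θ = ((e + p * q : ℤ) : A) := by
    rw [hω, hθ]; push_cast; linear_combination h1
  set N : ℤ := e + p * q
  have c2 : ω ^ 2 = ((e2 + p2 * q + q2 * p : ℤ) : A) + p2 * ω + q2 * θ := by
    rw [h2, hω, hθ]; push_cast; ring
  have c3 : θ ^ 2 = ((e3 + p3 * q + q3 * p : ℤ) : A) + p3 * ω + q3 * θ := by
    rw [h3, hω, hθ]; push_cast; ring
  set E2 : ℤ := e2 + p2 * q + q2 * p
  set E3 : ℤ := e3 + p3 * q + q3 * p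
  have uniq' : ∀ e p' q' : ℤ, (e + p' * ω + q' * θ : A) = 0 → e = 0 ∧ p' = 0 ∧ q' = 0 := by
    intro e p' q' h
    obtain ⟨g1, g2, g3⟩ := uniq (e - p' * q - q' * p) p' q' (by
      rw [← h, hω, hθ]; push_cast; ring)
    subst g2 g3
    simpa using g1
  obtain ⟨_, r2, r3⟩ := uniq' (p2 * N + q2 * E3) (q2 * p3 - N) (E2 + q2 * q3) (by
    push_cast
    linear_combination ω * c1 - θ * c2 - (p2 : A) * c1 - (q2 : A) * c3)
  obtain ⟨_, s2, _⟩ := uniq' (p3 * E2 + q3 * N) (E3 + p3 * p2) (p3 * q2 - N) (by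
    push_cast
    linear_combination θ * c1 - ω * c3 - (p3 : A) * c2 - (q3 : A) * c1)
  refine ⟨⟨q2, -p2, q3, -p3⟩, -q, -p, ?_⟩
  have hn : b 1 + ((-q : ℤ) : A) = ω := by rw [hω]; push_cast; ring
  have hm : b 2 + ((-p : ℤ) : A) = θ := by rw [hθ]; push_cast; ring
  rw [hn, hm]
  have hN : N = q2 * p3 := by linarith
  have hE2 : E2 = -(q2 * q3) := by linarith
  have hE3 : E3 = -(p3 * p2) := by linarith
  refine ⟨?_, ?_, ?_⟩
  · rw [c1, hN]; push_cast; ring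
  · rw [c2, hE2]; push_cast; ring
  · rw [c3, hE3]; push_cast; ring

lemma ext_of_ev {f g : Cub ℤ} (h : ∀ x y, f.ev x y = g.ev x y) : f = g := by
  have h1 := h 1 0
  have h2 := h 0 1
  have h3 := h 1 1
  have h4 := h 1 (-1)
  simp only [ev] at h1 h2 h3 h4
  ext <;> linarith

/-- Two normalized bases of a cubic ring are related by the substitution action. -/
lemma Tab.compare {f' : Cub ℤ} {ω' θ' : A} (h : Tab f ω θ) (h' : Tab f' ω' θ')
    (hind : ∀ e p q : ℤ, (e + p * ω + q * θ : A) = 0 → e = 0 ∧ p = 0 ∧ q = 0)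
    {M : Mat} {n m : ℤ} (h1 : ω' = n + M 0 0 * ω + M 0 1 * θ)
    (h2 : θ' = m + M 1 0 * ω + M 1 1 * θ) : sub M f = scal M.det f' := by
  refine ext_of_ev fun u v => ?_
  rw [ev_sub, ev_scal, det_fin_two]
  set U := u * M 0 0 + v * M 1 0 with hU
  set V := u * M 0 1 + v * M 1 1 with hV
  set k := u * n + v * m with hk
  have e1 : (u * ω' + v * θ' : A) = k + U * ω + V * θ := by
    rw [h1, h2, hU, hV, hk]; push_cast; ring
  have e2 : (u * ω' + v * θ' : A) ^ 2 = (k + U * ω + V * θ) ^ 2 := by rw [e1]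
  obtain ⟨-, g2, g3⟩ := hind
    ((-u ^ 2 * (f'.a * f'.c) - v ^ 2 * (f'.b * f'.d) - 2 * u * v * (f'.a * f'.d))
      + (-u ^ 2 * f'.b - v ^ 2 * f'.d) * n + (u ^ 2 * f'.a + v ^ 2 * f'.c) * m
      - (k ^ 2 - U ^ 2 * (f.a * f.c) - V ^ 2 * (f.b * f.d) - 2 * U * V * (f.a * f.d)))
    ((-u ^ 2 * f'.b - v ^ 2 * f'.d) * M 0 0 + (u ^ 2 * f'.a + v ^ 2 * f'.c) * M 1 0
      - (2 * k * U - U ^ 2 * f.b - V ^ 2 * f.d))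
    ((-u ^ 2 * f'.b - v ^ 2 * f'.d) * M 0 1 + (u ^ 2 * f'.a + v ^ 2 * f'.c) * M 1 1
      - (2 * k * V + U ^ 2 * f.a + V ^ 2 * f.c)) (by
    push_cast
    linear_combination e2 - u ^ 2 * h'.ww - 2 * u * v * h'.wt - v ^ 2 * h'.tt + U ^ 2 * h.ww +
      2 * U * V * h.wt + V ^ 2 * h.tt - (-u ^ 2 * f'.b - v ^ 2 * f'.d : A) * h1
      - (u ^ 2 * f'.a + v ^ 2 * f'.c : A) * h2)
  have key : U * ((-u ^ 2 * f'.b - v ^ 2 * f'.d) * M 0 1 + (u ^ 2 * f'.a + v ^ 2 * f'.c) * M 1 1)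
      - V * ((-u ^ 2 * f'.b - v ^ 2 * f'.d) * M 0 0 + (u ^ 2 * f'.a + v ^ 2 * f'.c) * M 1 0)
      = f.ev U V := by
    simp only [ev]
    linear_combination U * g3 - V * g2
  rw [← key, hU, hV]
  simp only [ev]
  ring

end

/-- A cubic ring `A` is represented by a form if it has a normalized basis with the multiplication
table of the form. -/
def Rep (A : Type*) [CommRing A] (f : Cub ℤ) : Prop :=
  ∃ b : Module.Basis (Fin 3) ℤ A, b 0 = 1 ∧ Tab f (b 1) (b 2)

section

variable {A : Type*} [CommRing A]

lemma basis_expand {b : Module.Basis (Fin 3) ℤ A} (hb : b 0 = 1) (x : A) :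
    x = (b.repr x 0 : A) + (b.repr x 1 : A) * b 1 + (b.repr x 2 : A) * b 2 := by
  have := b.sum_repr x
  rw [Fin.sum_univ_three, hb] at this
  simp at this
  exact this.symm

lemma basis_uniq {b : Module.Basis (Fin 3) ℤ A} (hb : b 0 = 1) (e p q : ℤ)
    (h : (e + p * b 1 + q * b 2 : A) = 0) : e = 0 ∧ p = 0 ∧ q = 0 := by
  have h2 := Fintype.linearIndependent_iff.1 b.linearIndependent ![e, p, q] (by
    rw [Fin.sum_univ_three, hb]; simpa using h)
  exact ⟨by simpa using h2 0, by simpa using h2 1, by simpa using h2 2⟩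

lemma basis_repr {b : Module.Basis (Fin 3) ℤ A} (hb : b 0 = 1) (e p q : ℤ) :
    b.repr (e + p * b 1 + q * b 2 : A) = Finsupp.equivFunOnFinite.symm ![e, p, q] := by
  have h : (e + p * b 1 + q * b 2 : A) = e • b 0 + p • b 1 + q • b 2 := by
    rw [hb]; simp [zsmul_eq_mul]
  rw [h, map_add, map_add, map_smul, map_smul, map_smul]
  ext i
  fin_cases i <;> simp

lemma exists_normalized_basis (b₀ : Module.Basis (Fin 3) ℤ A) :
    ∃ b : Module.Basis (Fin 3) ℤ A, b 0 = 1 := by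
  have : Module.Free ℤ A := Module.Free.of_basis b₀
  have : Module.Finite ℤ A := Module.Finite.of_basis b₀
  have hfr : Module.finrank ℤ A = 3 := by simp [Module.finrank_eq_card_basis b₀]
  obtain ⟨l, hl⟩ : ∃ l : A →ₗ[ℤ] ℤ, l 1 = 1 := by
    obtain ⟨g, hg⟩ := (IsPrincipalIdealRing.principal
      (Ideal.span (range fun i => b₀.repr 1 i))).principal
    have hdvd : ∀ i, g ∣ b₀.repr 1 i := by
      intro i
      rw [← Ideal.mem_span_singleton, Ideal.span, ← hg]
      exact Ideal.subset_span ⟨i, rfl⟩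
    choose y hy using hdvd
    have hunit : (1 : A) = (algebraMap ℤ A g) * ∑ i, y i • b₀ i := by
      rw [← Algebra.smul_def, smul_sum]
      conv_lhs => rw [← b₀.sum_repr 1]
      simp only [hy, smul_smul]
    have h1 := congrArg (Algebra.norm ℤ) hunit
    rw [map_one, map_mul, Algebra.norm_algebraMap_of_basis b₀] at h1
    have hgu : IsUnit g := by
      refine isUnit_of_dvd_one (Dvd.dvd.trans ?_ ⟨_, h1⟩)
      exact dvd_pow_self _ (by simp)
    have htop : Ideal.span (range fun i => b₀.repr 1 i) = ⊤ := by
      have : Ideal.span (range fun i => b₀.repr 1 i) = Ideal.span {g} := hg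
      rw [this, Ideal.span_singleton_eq_top]; exact hgu
    have h1m : (1 : ℤ) ∈ Ideal.span (range fun i => b₀.repr 1 i) := by rw [htop]; trivial
    obtain ⟨c, hc⟩ := (Ideal.mem_span_range_iff_exists_fun).1 h1m
    refine ⟨∑ i, c i • b₀.coord i, ?_⟩
    simpa using hc
  have hker : Module.finrank ℤ (LinearMap.ker l) = 2 := by
    have h := (LinearMap.ker l).finrank_quotient_add_finrank
    rw [l.quotKerEquivRange.finrank_eq] at h
    have hr : LinearMap.range l = ⊤ := by
      rw [eq_top_iff]
      intro x _
      exact ⟨x • 1, by rw [map_smul, hl]; simp⟩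
    rw [hr, finrank_top, hfr] at h
    simp at h
    omega
  have bk := Module.finBasisOfFinrankEq ℤ (LinearMap.ker l) hker
  refine ⟨Module.Basis.mkFinCons (1 : A) bk ?_ ?_, by rw [Module.Basis.coe_mkFinCons]; rfl⟩
  · intro c x hx h
    have := congrArg l h
    rw [map_add, map_smul, hl, LinearMap.mem_ker.1 hx] at this
    simpa using this
  · intro z
    exact ⟨-l z, by rw [LinearMap.mem_ker, map_add, map_smul, hl]; simp⟩

lemma exists_basis_of {b : Module.Basis (Fin 3) ℤ A} (hb : b 0 = 1)
    {M : Mat} (hM : M.det = 1 ∨ M.det = -1) (n m : ℤ) :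
    ∃ b' : Module.Basis (Fin 3) ℤ A, b' 0 = 1 ∧ b' 1 = n + M 0 0 * b 1 + M 0 1 * b 2 ∧
      b' 2 = m + M 1 0 * b 1 + M 1 1 * b 2 := by
  rw [det_fin_two] at hM
  set δ := M 0 0 * M 1 1 - M 0 1 * M 1 0 with hδ
  have hδ2 : δ * δ = 1 := by rcases hM with h | h <;> rw [h] <;> norm_num
  set v : Fin 3 → A := ![1, n + M 0 0 * b 1 + M 0 1 * b 2, m + M 1 0 * b 1 + M 1 1 * b 2] with hv
  have hδA : (δ * δ : A) = 1 := by exact_mod_cast congrArg (Int.cast (R := A)) hδ2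
  have hδA' : (δ : A) = M 0 0 * M 1 1 - M 0 1 * M 1 0 := by rw [hδ]; push_cast; ring
  have li : LinearIndependent ℤ v := by
    rw [Fintype.linearIndependent_iff]
    intro g hg
    rw [Fin.sum_univ_three] at hg
    simp only [hv, zsmul_eq_mul, Matrix.cons_val] at hg
    obtain ⟨h0, h1, h2⟩ := basis_uniq hb (g 0 + g 1 * n + g 2 * m) (g 1 * M 0 0 + g 2 * M 1 0)
      (g 1 * M 0 1 + g 2 * M 1 1) (by push_cast; linear_combination hg)
    have g1 : g 1 = 0 := by
      have : g 1 * (δ * δ) = 0 := by rw [hδ]; linear_combination (M 1 1 * h1 - M 1 0 * h2) * δ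
      rwa [hδ2, mul_one] at this
    have g2 : g 2 = 0 := by
      have : g 2 * (δ * δ) = 0 := by rw [hδ]; linear_combination (M 0 0 * h2 - M 0 1 * h1) * δ
      rwa [hδ2, mul_one] at this
    have g0 : g 0 = 0 := by rw [g1, g2] at h0; simpa using h0
    intro i
    fin_cases i <;> assumption
  have sp : ⊤ ≤ Submodule.span ℤ (range v) := by
    have m0 : (1 : A) ∈ Submodule.span ℤ (range v) := Submodule.subset_span ⟨0, rfl⟩
    have m1 : (n + M 0 0 * b 1 + M 0 1 * b 2 : A) ∈ Submodule.span ℤ (range v) :=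
      Submodule.subset_span ⟨1, rfl⟩
    have m2 : (m + M 1 0 * b 1 + M 1 1 * b 2 : A) ∈ Submodule.span ℤ (range v) :=
      Submodule.subset_span ⟨2, rfl⟩
    have comb : ∀ e p q : ℤ, (e * 1 + p * (n + M 0 0 * b 1 + M 0 1 * b 2) +
        q * (m + M 1 0 * b 1 + M 1 1 * b 2) : A) ∈ Submodule.span ℤ (range v) := by
      intro e p q
      refine add_mem (add_mem ?_ ?_) ?_ <;> rw [← zsmul_eq_mul]
      exacts [Submodule.smul_mem _ _ m0, Submodule.smul_mem _ _ m1, Submodule.smul_mem _ _ m2]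
    intro x _
    rw [basis_expand hb x]
    generalize b.repr x 0 = e
    generalize b.repr x 1 = p
    generalize b.repr x 2 = q
    convert comb (e - δ * (p * M 1 1 - q * M 1 0) * n - δ * (q * M 0 0 - p * M 0 1) * m)
      (δ * (p * M 1 1 - q * M 1 0)) (δ * (q * M 0 0 - p * M 0 1)) using 1
    push_cast
    linear_combination (-(p * b 1 + q * b 2 : A)) * hδA + (p * b 1 + q * b 2 : A) * δ * hδA'
  refine ⟨Module.Basis.mk li sp, ?_, ?_, ?_⟩ <;> simp [hv]

lemma exists_rep (b₀ : Module.Basis (Fin 3) ℤ A) : ∃ f, Rep A f := by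
  obtain ⟨b, hb⟩ := exists_normalized_basis b₀
  obtain ⟨f, n, m, h⟩ := exists_tab hb
  obtain ⟨b', h0, h1, h2⟩ := exists_basis_of hb (M := 1) (by simp) n m
  refine ⟨f, b', h0, ?_⟩
  rw [h1, h2]
  simpa [add_comm] using h

lemma sub_smul_unit {δ : ℤ} (hδ : δ = 1 ∨ δ = -1) (M : Mat) (f : Cub ℤ) :
    sub (δ • M) f = scal δ (sub M f) := by
  have : δ • M = (δ • (1 : Mat)) * M := by simp
  rw [this, sub_mul, sub_scal_matrix]
  rcases hδ with rfl | rfl <;> norm_num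

lemma det_smul_unit {δ : ℤ} (hδ : δ = 1 ∨ δ = -1) (M : Mat) :
    (δ • M).det = M.det := by
  rw [det_smul]
  rcases hδ with rfl | rfl <;> norm_num

lemma Rep.sub_eq {f f' : Cub ℤ} (h : Rep A f) (h' : Rep A f') : ∃ g : UMat, f' = sub g.1 f := by
  obtain ⟨b, hb, ht⟩ := h
  obtain ⟨b', hb', ht'⟩ := h'
  set M : Mat :=
    !![b.repr (b' 1) 1, b.repr (b' 1) 2; b.repr (b' 2) 1, b.repr (b' 2) 2] with hM
  have hc := ht.compare (M := M) ht' (basis_uniq hb) (n := b.repr (b' 1) 0) (m := b.repr (b' 2) 0)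
    (by simpa [hM] using basis_expand hb (b' 1)) (by simpa [hM] using basis_expand hb (b' 2))
  have hdet : M.det = 1 ∨ M.det = -1 := by
    have hu := b.isUnit_det b'
    rw [Module.Basis.det_apply, det_fin_three] at hu
    have z1 : b.repr (b' 0) 0 = 1 := by rw [hb', ← hb]; simp
    have z2 : b.repr (b' 0) 1 = 0 := by rw [hb', ← hb]; simp
    have z3 : b.repr (b' 0) 2 = 0 := by rw [hb', ← hb]; simp
    simp only [Module.Basis.toMatrix_apply, z1, z2, z3] at hu
    rw [Int.isUnit_iff] at hu
    rw [det_fin_two]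
    simp only [hM, of_apply, cons_val', cons_val_zero, cons_val_one,
      cons_val_fin_one]
    rcases hu with h | h
    · left; linarith
    · right; linarith
  refine ⟨⟨M.det • M, by rw [det_smul_unit hdet]; exact hdet⟩, ?_⟩
  rw [sub_smul_unit hdet, hc, scal_scal]
  have : M.det * M.det = 1 := by rcases hdet with h | h <;> rw [h] <;> norm_num
  rw [this, scal_one]

lemma Rep.sub {f : Cub ℤ} (h : Rep A f) (g : UMat) : Rep A (sub g.1 f) := by
  obtain ⟨b, hb, ht⟩ := h
  set δ := g.1.det with hδ
  have hδ1 : δ = 1 ∨ δ = -1 := g.2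
  set M := δ • g.1 with hM
  have hMd : M.det = 1 ∨ M.det = -1 := by rw [hM, det_smul_unit hδ1]; exact g.2
  obtain ⟨b₁, h0, h1, h2⟩ := exists_basis_of hb hMd 0 0
  obtain ⟨f', n, m, h'⟩ := exists_tab h0
  obtain ⟨b', h0', h1', h2'⟩ := exists_basis_of hb hMd n m
  have e1 : b₁ 1 + n = b' 1 := by rw [h1, h1']; push_cast; ring
  have e2 : b₁ 2 + m = b' 2 := by rw [h2, h2']; push_cast; ring
  rw [e1, e2] at h'
  have hc := ht.compare (M := M) h' (basis_uniq hb) h1' h2'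
  refine ⟨b', h0', ?_⟩
  convert h'
  have hd : M.det = δ := by rw [hM, det_smul_unit hδ1]
  rw [hd, hM, sub_smul_unit hδ1] at hc
  refine scal_injective (k := δ) ?_ hc
  rcases hδ1 with h | h <;> rw [h] <;> norm_num

lemma Rep.of_ringEquiv {B : Type*} [CommRing B] {f : Cub ℤ} (h : Rep A f) (e : A ≃+* B) :
    Rep B f := by
  obtain ⟨b, hb, ht⟩ := h
  refine ⟨b.map e.toAddEquiv.toIntLinearEquiv, ?_, ?_⟩
  · simp [hb]
  · refine ⟨?_, ?_, ?_⟩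
    · simpa using congrArg e ht.wt
    · simpa using congrArg e ht.ww
    · simpa using congrArg e ht.tt

lemma Rep.discr {f : Cub ℤ} {b : Module.Basis (Fin 3) ℤ A} (hb : b 0 = 1)
    (ht : Tab f (b 1) (b 2)) : Algebra.discr ℤ b = f.disc := by
  have tr : ∀ x : A, Algebra.trace ℤ A x =
      b.repr x 0 + b.repr (x * b 1) 1 + b.repr (x * b 2) 2 := by
    intro x
    rw [Algebra.trace_eq_matrix_trace b, trace, Fin.sum_univ_three]
    simp [Algebra.leftMulMatrix_eq_repr_mul, hb]
  have r0 : ∀ e p q : ℤ, b.repr (e + p * b 1 + q * b 2 : A) 0 = e := fun e p q => by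
    rw [basis_repr hb]; rfl
  have r1 : ∀ e p q : ℤ, b.repr (e + p * b 1 + q * b 2 : A) 1 = p := fun e p q => by
    rw [basis_repr hb]; rfl
  have r2 : ∀ e p q : ℤ, b.repr (e + p * b 1 + q * b 2 : A) 2 = q := fun e p q => by
    rw [basis_repr hb]; rfl
  have e1 : b 1 = ((0 : ℤ) + (1 : ℤ) * b 1 + (0 : ℤ) * b 2 : A) := by simp
  have e2 : b 2 = ((0 : ℤ) + (0 : ℤ) * b 1 + (1 : ℤ) * b 2 : A) := by simp
  have e3 : b 1 * b 1 = ((-(f.a * f.c) : ℤ) + (-f.b : ℤ) * b 1 + (f.a : ℤ) * b 2 : A) := by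
    push_cast; linear_combination ht.ww
  have e4 : b 2 * b 2 = ((-(f.b * f.d) : ℤ) + (-f.d : ℤ) * b 1 + (f.c : ℤ) * b 2 : A) := by
    push_cast; linear_combination ht.tt
  have e5 : b 1 * b 2 = ((-(f.a * f.d) : ℤ) + (0 : ℤ) * b 1 + (0 : ℤ) * b 2 : A) := by
    push_cast; linear_combination ht.wt
  have t0 : Algebra.trace ℤ A 1 = 3 := by
    rw [Algebra.trace_eq_matrix_trace b]; simp
  have t1 : Algebra.trace ℤ A (b 1) = -f.b := by
    rw [tr, e3, e5, r1, r2]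
    have := r0 0 1 0
    rw [← e1] at this
    rw [this]; ring
  have t2 : Algebra.trace ℤ A (b 2) = f.c := by
    rw [tr, e4, mul_comm (b 2), e5, r1, r2]
    have := r0 0 0 1
    rw [← e2] at this
    rw [this]; ring
  have lin : ∀ e p q : ℤ, Algebra.trace ℤ A (e + p * b 1 + q * b 2 : A) = 3 * e - p * f.b + q * f.c := by
    intro e p q
    have : (e + p * b 1 + q * b 2 : A) = e • (1 : A) + p • b 1 + q • b 2 := by
      simp [zsmul_eq_mul]
    rw [this, map_add, map_add, map_smul, map_smul, map_smul, t0, t1, t2]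
    simp only [smul_eq_mul]; ring
  rw [Algebra.discr_def, det_fin_three]
  simp only [Algebra.traceMatrix_apply, Algebra.traceForm_apply, hb, one_mul, mul_one,
    mul_comm (b 2) (b 1), e5, t0]
  rw [e3, e4]
  simp only [lin, t1, t2]
  simp only [disc]
  ring

end

end Cub

namespace Cub

open NumberField

lemma exists_umat_of_zero {f : Cub ℤ} (h : ¬ Irr f) : ∃ g : UMat, (sub g.1 f).a = 0 := by
  unfold Irr at h
  push Not at h
  obtain ⟨x, y, hxy, hne⟩ := h
  have hg : Int.gcd x y ≠ 0 := by
    intro h0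
    rw [Int.gcd_eq_zero_iff] at h0
    exact hne h0.1 h0.2
  obtain ⟨g, u, v, hgpos, hcop, hx, hy⟩ := Int.exists_gcd_one' (Nat.pos_of_ne_zero hg)
  rw [← Int.isCoprime_iff_gcd_eq_one] at hcop
  obtain ⟨r, s, hrs⟩ := hcop
  refine ⟨⟨!![u, v; -s, r], ?_⟩, ?_⟩
  · left
    simp
    linarith
  · have hgz : (g : ℤ) ≠ 0 := by exact_mod_cast hgpos.ne'
    have : (g : ℤ) ^ 3 * f.ev u v = 0 := by
      rw [← hxy, hx, hy]; simp only [ev]; ring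
    have h2 := (mul_eq_zero.1 this).resolve_left (pow_ne_zero _ hgz)
    simpa [sub] using h2

lemma Rep.irr {A : Type*} [CommRing A] [IsDomain A] {f : Cub ℤ} (h : Rep A f) : Irr f := by
  by_contra hn
  obtain ⟨g, hg⟩ := exists_umat_of_zero hn
  obtain ⟨b, hb, ht⟩ := h.sub g
  have := ht.wt
  rw [hg] at this
  simp at this
  rcases this with h | h
  · exact b.ne_zero 1 h
  · exact b.ne_zero 2 h

section

variable {K : Type*} [Field K] [NumberField K]

lemma exists_div {ω : 𝓞 K} {p B C D : ℤ} (hp : p ≠ 0)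
    (h : ω ^ 3 + p * B * ω ^ 2 + p ^ 2 * C * ω + p ^ 3 * D = 0) : ∃ z : 𝓞 K, ω = p * z := by
  have hpK : (p : K) ≠ 0 := by exact_mod_cast hp
  have hK : (ω : K) ^ 3 + p * B * (ω : K) ^ 2 + p ^ 2 * C * ω + p ^ 3 * D = 0 := by
    have := congrArg (algebraMap (𝓞 K) K) h
    simpa using this
  have hint : IsIntegral ℤ ((ω : K) / p) := by
    refine ⟨.X ^ 3 + (.C B * .X ^ 2 + .C C * .X + .C D), ?_, ?_⟩
    · refine Polynomial.monic_X_pow_add ?_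
      refine lt_of_le_of_lt Polynomial.degree_quadratic_le (by norm_num)
    · simp only [Polynomial.eval₂_add, Polynomial.eval₂_mul, Polynomial.eval₂_pow,
        Polynomial.eval₂_X, Polynomial.eval₂_C, algebraMap_int_eq, Int.coe_castRingHom]
      field_simp
      linear_combination hK
  obtain ⟨z, hz⟩ := (IsIntegralClosure.isIntegral_iff (A := 𝓞 K)).1 hint
  refine ⟨z, RingOfIntegers.ext ?_⟩
  have : algebraMap (𝓞 K) K (p * z) = p * ((ω : K) / p) := by rw [map_mul, hz, map_intCast]
  refine Eq.trans ?_ this.symm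
  field_simp

lemma Rep.not_of_dvd {f : Cub ℤ} (h : Rep (𝓞 K) f) {p : ℤ} (hp0 : p ≠ 0) (hp : ¬ IsUnit p)
    (hb : p ∣ f.b) (hc : p ^ 2 ∣ f.a * f.c) (hd : p ^ 3 ∣ f.a ^ 2 * f.d) : False := by
  obtain ⟨b, h0, ht⟩ := h
  obtain ⟨B, hB⟩ := hb
  obtain ⟨C, hC⟩ := hc
  obtain ⟨D, hD⟩ := hd
  obtain ⟨z, hz⟩ := exists_div (ω := b 1) (p := p) (B := B) (C := C) (D := D) hp0 (by
    rw [← ht.cubic]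
    have e1 : (f.b : 𝓞 K) = p * B := by exact_mod_cast congrArg (Int.cast (R := 𝓞 K)) hB
    have e2 : (f.a * f.c : 𝓞 K) = p ^ 2 * C := by exact_mod_cast congrArg (Int.cast (R := 𝓞 K)) hC
    have e3 : (f.a ^ 2 * f.d : 𝓞 K) = p ^ 3 * D := by
      exact_mod_cast congrArg (Int.cast (R := 𝓞 K)) hD
    rw [e1, e2, e3])
  have h1 : b.repr (b 1) 1 = p * b.repr z 1 := by
    conv_lhs => rw [hz, ← zsmul_eq_mul, map_smul]
    simp
  rw [b.repr_self, Finsupp.single_eq_same] at h1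
  exact hp (isUnit_of_dvd_one ⟨_, h1⟩)

lemma Rep.not_nonMax {f : Cub ℤ} (h : Rep (𝓞 K) f) {p : ℕ} (hp : p.Prime) : ¬ NonMax p f := by
  have hp0 : (p : ℤ) ≠ 0 := by exact_mod_cast hp.ne_zero
  have hpu : ¬ IsUnit (p : ℤ) := (Nat.prime_iff_prime_int.mp hp).not_isUnit
  have key : ∀ {f : Cub ℤ}, Rep (𝓞 K) f → (p : ℤ) ^ 2 ∣ f.a → (p : ℤ) ∣ f.b → False := by
    rintro f h ⟨A, hA⟩ hb
    refine h.not_of_dvd hp0 hpu hb ?_ ?_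
    · rw [hA]; exact ⟨A * f.c, by ring⟩
    · rw [hA]; exact ⟨p * A ^ 2 * f.d, by ring⟩
  rw [nonMax_iff hp]
  rintro (⟨⟨A, hA⟩, ⟨B, hB⟩, ⟨C, hC⟩, ⟨D, hD⟩⟩ | ⟨j | j, hj⟩)
  · refine h.not_of_dvd hp0 hpu ⟨B, hB⟩ ?_ ?_
    · rw [hA, hC]; exact ⟨A * C, by ring⟩
    · rw [hA, hD]; exact ⟨A ^ 2 * D, by ring⟩
  · rw [dvd_sq_sub_none hp] at hj
    exact key h hj.1 hj.2
  · rw [dvd_sq_sub_some hp] at hj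
    refine key (h.sub ⟨!![(j : ℤ), 1; -1, 0], by simp [det_fin_two_of]⟩) ?_ ?_
    · simpa [Cub.sub] using hj.1
    · simpa [Cub.sub] using hj.2

lemma Rep.disc_eq {f : Cub ℤ} (h : Rep (𝓞 K) f) : f.disc = NumberField.discr K := by
  obtain ⟨b, h0, ht⟩ := h
  rw [← Rep.discr h0 ht, discr_eq_discr]

lemma exists_rep_ringOfIntegers (hK : Module.finrank ℚ K = 3) : ∃ f, Rep (𝓞 K) f := by
  have : Module.finrank ℤ (𝓞 K) = 3 := by rw [RingOfIntegers.rank, hK]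
  exact exists_rep (Module.finBasisOfFinrankEq ℤ (𝓞 K) this)

end

end Cub

namespace Cub

open NumberField Polynomial

lemma nonMax_of_scal_det {p : ℕ} (hp : p.Prime) :
    ∀ (n : ℕ) (M : Mat) (g : ℤ) (f F : Cub ℤ), M.det.natAbs = n → M.det ≠ 0 →
      scal M.det f = scal g (sub M F) → ((p : ℤ) ∣ g ∨ (p : ℤ) ∣ M.det) → NonMax p f := by
  have hpp : Prime (p : ℤ) := Nat.prime_iff_prime_int.mp hp
  have hp0 : (p : ℤ) ≠ 0 := hpp.ne_zero
  intro n
  induction n using Nat.strong_induction_on with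
  | _ n ih =>
    intro M g f F hn hM h hdvd
    by_cases hall : ∀ i j, (p : ℤ) ∣ M i j
    · choose N hN using hall
      have hMN : M = (p : ℤ) • (of N) := by
        ext i j; simp [hN i j]
      have hdet : M.det = p ^ 2 * (of N).det := by
        rw [hMN, det_smul]; simp
      have hN0 : (of N).det ≠ 0 := by
        intro h0; rw [h0, mul_zero] at hdet; exact hM hdet
      refine ih _ ?_ (of N) (g * p) f F rfl hN0 ?_ (Or.inl ⟨g, mul_comm _ _⟩)
      · rw [← hn, hdet, Int.natAbs_mul]
        have h1 : 0 < (of N).det.natAbs := Int.natAbs_pos.2 hN0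
        have h2 : 1 < ((p : ℤ) ^ 2).natAbs := by
          rw [Int.natAbs_pow, Int.natAbs_natCast]
          exact Nat.one_lt_pow (by norm_num) hp.one_lt
        nlinarith
      · refine scal_injective (pow_ne_zero 2 hp0) ?_
        rw [scal_scal, ← hdet, h]
        have : M = ((p : ℤ) • (1 : Mat)) * of N := by
          rw [hMN, smul_mul, one_mul]
        rw [this, sub_mul, sub_scal_matrix, scal_scal, scal_scal]
        congr 1; ring
    · by_cases hd : (p : ℤ) ∣ M.det
      · right
        have hev : ∀ x y, M.det * f.ev x y =
            g * F.ev (x * M 0 0 + y * M 1 0) (x * M 0 1 + y * M 1 1) := by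
          intro x y
          rw [← ev_scal, h, ev_scal, ev_sub]
        have hevx : ∀ x y, M.det * f.evx x y = g * (M 0 0 * F.evx (x * M 0 0 + y * M 1 0)
            (x * M 0 1 + y * M 1 1) + M 0 1 * F.evy (x * M 0 0 + y * M 1 0)
            (x * M 0 1 + y * M 1 1)) := by
          intro x y
          have e1 : (scal M.det f).evx x y = M.det * f.evx x y := by simp only [scal, evx]; ring
          have e2 : (scal g (sub M F)).evx x y = g * (sub M F).evx x y := by
            simp only [scal, evx]; ring
          rw [← e1, h, e2, evx_sub]
        have hevy : ∀ x y, M.det * f.evy x y = g * (M 1 0 * F.evx (x * M 0 0 + y * M 1 0)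
            (x * M 0 1 + y * M 1 1) + M 1 1 * F.evy (x * M 0 0 + y * M 1 0)
            (x * M 0 1 + y * M 1 1)) := by
          intro x y
          have e1 : (scal M.det f).evy x y = M.det * f.evy x y := by simp only [scal, evy]; ring
          have e2 : (scal g (sub M F)).evy x y = g * (sub M F).evy x y := by
            simp only [scal, evy]; ring
          rw [← e1, h, e2, evy_sub]
        have key : ∀ x y u v : ℤ, x * M 0 0 + y * M 1 0 = M.det * u →
            x * M 0 1 + y * M 1 1 = M.det * v →
            (p : ℤ) ^ 2 ∣ f.ev x y ∧ (p : ℤ) ∣ f.evx x y ∧ (p : ℤ) ∣ f.evy x y := by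
          intro x y u v h1 h2
          refine ⟨?_, ?_, ?_⟩
          · refine (pow_dvd_pow_of_dvd hd 2).trans ⟨g * F.ev u v, ?_⟩
            apply mul_left_cancel₀ hM
            rw [hev, h1, h2]; simp only [ev]; ring
          · refine hd.trans ⟨g * (M 0 0 * F.evx u v + M 0 1 * F.evy u v), ?_⟩
            apply mul_left_cancel₀ hM
            rw [hevx, h1, h2]; simp only [evx, evy]; ring
          · refine hd.trans ⟨g * (M 1 0 * F.evx u v + M 1 1 * F.evy u v), ?_⟩
            apply mul_left_cancel₀ hM
            rw [hevy, h1, h2]; simp only [evx, evy]; ring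
        by_cases h1 : (p : ℤ) ∣ M 1 1 ∧ (p : ℤ) ∣ -M 0 1
        · refine ⟨-M 1 0, M 0 0, fun h2 => hall ?_, key _ _ 0 1 ?_ ?_⟩
          · rw [dvd_neg] at h1 h2
            intro i j
            fin_cases i <;> fin_cases j
            exacts [h2.2, h1.2, h2.1, h1.1]
          · ring
          · rw [det_fin_two]; ring
        · refine ⟨M 1 1, -M 0 1, h1, key _ _ 1 0 ?_ ?_⟩
          · rw [det_fin_two]; ring
          · ring
      · left
        have hg := hdvd.resolve_right hd
        simp only [scal, Cub.mk.injEq] at h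
        obtain ⟨h1, h2, h3, h4⟩ := h
        refine ⟨?_, ?_, ?_, ?_⟩
        · exact (hpp.dvd_or_dvd (h1 ▸ hg.mul_right _ : (p : ℤ) ∣ M.det * f.a)).resolve_left hd
        · exact (hpp.dvd_or_dvd (h2 ▸ hg.mul_right _ : (p : ℤ) ∣ M.det * f.b)).resolve_left hd
        · exact (hpp.dvd_or_dvd (h3 ▸ hg.mul_right _ : (p : ℤ) ∣ M.det * f.c)).resolve_left hd
        · exact (hpp.dvd_or_dvd (h4 ▸ hg.mul_right _ : (p : ℤ) ∣ M.det * f.d)).resolve_left hd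

/-- An order with maximal form is the full ring. -/
lemma Tab.rep {A : Type*} [CommRing A] {f F : Cub ℤ} (hF : Rep A F) {ω θ : A} (h : Tab f ω θ)
    (hind : ∀ e p q : ℤ, (e + p * ω + q * θ : A) = 0 → e = 0 ∧ p = 0 ∧ q = 0)
    (hmax : ∀ p : ℕ, p.Prime → ¬ NonMax p f) : Rep A f := by
  have hF' := hF
  obtain ⟨b, hb, ht⟩ := hF
  set M : Mat :=
    !![b.repr ω 1, b.repr ω 2; b.repr θ 1, b.repr θ 2] with hM
  have h1 : ω = b.repr ω 0 + M 0 0 * b 1 + M 0 1 * b 2 := by simpa [hM] using basis_expand hb ω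
  have h2 : θ = b.repr θ 0 + M 1 0 * b 1 + M 1 1 * b 2 := by simpa [hM] using basis_expand hb θ
  have hc := ht.compare (M := M) h (basis_uniq hb) h1 h2
  have hdet0 : M.det ≠ 0 := by
    intro h0
    have h0A : (M 0 0 * M 1 1 - M 0 1 * M 1 0 : A) = 0 := by
      rw [det_fin_two] at h0; exact_mod_cast congrArg (Int.cast (R := A)) h0
    obtain ⟨-, a1, a2⟩ := hind (-(M 1 1 * b.repr ω 0 - M 0 1 * b.repr θ 0)) (M 1 1) (-M 0 1) (by
      push_cast
      linear_combination (M 1 1 : A) * h1 - M 0 1 * h2 + b 1 * h0A)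
    obtain ⟨-, a3, a4⟩ := hind (-(M 1 0 * b.repr ω 0 - M 0 0 * b.repr θ 0)) (M 1 0) (-M 0 0) (by
      push_cast
      linear_combination (M 1 0 : A) * h1 - M 0 0 * h2 - b 2 * h0A)
    rw [neg_eq_zero] at a2 a4
    rw [a2, a4] at h1
    simp at h1
    have := hind (-b.repr ω 0) 1 0 (by push_cast; linear_combination h1)
    simp at this
  have hunit : M.det = 1 ∨ M.det = -1 := by
    by_contra hn
    have : M.det.natAbs ≠ 1 := by
      intro h; rcases Int.natAbs_eq M.det with h' | h' <;> rw [h] at h' <;> simp [h'] at hn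
    obtain ⟨p, hp, hpd⟩ := Nat.exists_prime_and_dvd this
    refine hmax p hp (nonMax_of_scal_det hp _ M 1 f F rfl hdet0 ?_ (Or.inr (Int.natCast_dvd.2 hpd)))
    rw [scal_one, hc]
  have hs := hF'.sub ⟨M.det • M, by rw [det_smul_unit hunit]; exact hunit⟩
  rw [sub_smul_unit hunit, hc, scal_scal] at hs
  have : M.det * M.det = 1 := by rcases hunit with h | h <;> rw [h] <;> norm_num
  rwa [this, scal_one] at hs

lemma Rep.nonempty_ringEquiv {A B : Type*} [CommRing A] [CommRing B] {f : Cub ℤ} (h : Rep A f)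
    (h' : Rep B f) : Nonempty (A ≃+* B) := by
  obtain ⟨b, hb, ht⟩ := h
  obtain ⟨b', hb', ht'⟩ := h'
  set φ := b.equiv b' (Equiv.refl _) with hφ
  have hv : ∀ e p q : ℤ, φ (e + p * b 1 + q * b 2) = e + p * b' 1 + q * b' 2 := by
    intro e p q
    have h1 : (e + p * b 1 + q * b 2 : A) = e • b 0 + p • b 1 + q • b 2 := by
      rw [hb]; simp [zsmul_eq_mul]
    rw [h1]
    simp only [map_add, map_smul, hφ, Module.Basis.equiv_apply, Equiv.refl_apply]
    rw [hb']; simp [zsmul_eq_mul]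
  refine ⟨⟨φ.toEquiv, fun x y => ?_, fun x y => φ.map_add x y⟩⟩
  change φ (x * y) = φ x * φ y
  rw [basis_expand hb x, basis_expand hb y, hv, hv]
  generalize b.repr x 0 = e
  generalize b.repr x 1 = p
  generalize b.repr x 2 = q
  generalize b.repr y 0 = e'
  generalize b.repr y 1 = p'
  generalize b.repr y 2 = q'
  have e1 : (e + p * b 1 + q * b 2 : A) * (e' + p' * b 1 + q' * b 2) =
      ((e * e' - p * p' * (f.a * f.c) - (p * q' + q * p') * (f.a * f.d) - q * q' * (f.b * f.d) : ℤ) : A)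
      + ((e * p' + p * e' - p * p' * f.b - q * q' * f.d : ℤ) : A) * b 1
      + ((e * q' + q * e' + p * p' * f.a + q * q' * f.c : ℤ) : A) * b 2 := by
    push_cast
    linear_combination (p * p' : A) * ht.ww + (p * q' + q * p' : A) * ht.wt + (q * q' : A) * ht.tt
  rw [e1, hv]
  push_cast
  linear_combination (-(p * p') : B) * ht'.ww - (p * q' + q * p' : B) * ht'.wt
    - (q * q' : B) * ht'.tt

lemma Rep.field_equiv {K K' : Type*} [Field K] [NumberField K] [Field K'] [NumberField K']
    {f : Cub ℤ} (h : Rep (𝓞 K) f) (h' : Rep (𝓞 K') f) : Nonempty (K ≃+* K') := by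
  obtain ⟨e⟩ := h.nonempty_ringEquiv h'
  exact ⟨IsFractionRing.ringEquivOfRingEquiv e⟩

lemma Tab.of_map {A B : Type*} [CommRing A] [CommRing B] {φ : A →+* B}
    (hφ : Function.Injective φ) {f : Cub ℤ} {ω θ : A} (h : Tab f (φ ω) (φ θ)) : Tab f ω θ := by
  refine ⟨?_, ?_, ?_⟩ <;> apply hφ <;>
    simp
  exacts [h.wt, h.ww, h.tt]

lemma coeff_eq_zero_of_quadratic {a b c : ℚ} (h : C a * X ^ 2 + C b * X + C c = 0) :
    a = 0 ∧ b = 0 ∧ c = 0 := by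
  have c2 := congrArg (coeff · 2) h
  have c1 := congrArg (coeff · 1) h
  have c0 := congrArg (coeff · 0) h
  simp [coeff_X, coeff_C] at c2 c1 c0
  exact ⟨c2, c1, c0⟩

lemma exists_cubicField {f : Cub ℤ} (hf : Irr f) (hmax : ∀ p : ℕ, p.Prime → ¬ NonMax p f) :
    ∃ K : CubicField, Rep (𝓞 K.carrier) f := by
  have ha : f.a ≠ 0 := by
    intro h
    have := hf 1 0 (by simp [ev, h])
    simp at this
  set P : ℚ[X] := X ^ 3 + (C (f.b : ℚ) * X ^ 2 + C (f.a * f.c : ℚ) * X + C (f.a ^ 2 * f.d : ℚ))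
    with hP
  have hq : degree (C (f.b : ℚ) * X ^ 2 + C (f.a * f.c : ℚ) * X + C (f.a ^ 2 * f.d : ℚ)) < 3 :=
    lt_of_le_of_lt degree_quadratic_le (by norm_num)
  have hmon : P.Monic := monic_X_pow_add hq
  have hdeg : P.natDegree = 3 := by
    rw [hP]
    compute_degree!
  have hirr : Irreducible P := by
    refine (irreducible_iff_roots_eq_zero_of_degree_le_three (by omega) (by omega)).2 ?_
    rw [Multiset.eq_zero_iff_forall_notMem]
    intro t ht
    have h0 := (mem_roots'.1 ht).2
    simp only [hP, IsRoot.def, eval_add, eval_mul, eval_pow, eval_X, eval_C] at h0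
    have hden : (t.den : ℚ) ≠ 0 := by exact_mod_cast t.den_ne_zero
    have h1 := hf t.num (f.a * t.den) (by
      have : ((f.ev t.num (f.a * t.den) : ℤ) : ℚ) = 0 := by
        simp only [ev]
        push_cast
        have hnum : (t.num : ℚ) = t * t.den := (Rat.mul_den_eq_num t).symm
        rw [hnum]
        linear_combination (f.a : ℚ) * t.den ^ 3 * h0
      exact_mod_cast this)
    have h2 := h1.2
    rw [mul_eq_zero] at h2
    rcases h2 with h2 | h2
    · exact ha h2
    · exact hden (by exact_mod_cast h2)
  have : Fact (Irreducible P) := ⟨hirr⟩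
  have hfin : FiniteDimensional ℚ (AdjoinRoot P) :=
    (AdjoinRoot.powerBasis hirr.ne_zero).finite
  have hchar : CharZero (AdjoinRoot P) :=
    charZero_of_injective_algebraMap (algebraMap ℚ (AdjoinRoot P)).injective
  have hnf : NumberField (AdjoinRoot P) := ⟨⟩
  have hfr : Module.finrank ℚ (AdjoinRoot P) = 3 := by
    rw [(AdjoinRoot.powerBasis hirr.ne_zero).finrank, AdjoinRoot.powerBasis_dim, hdeg]
  set r : AdjoinRoot P := AdjoinRoot.root P with hr
  have haK : (f.a : AdjoinRoot P) ≠ 0 := by exact_mod_cast ha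
  have mkC : ∀ z : ℤ, AdjoinRoot.mk P (C (z : ℚ)) = (z : AdjoinRoot P) := by
    intro z; simp
  have hroot : r ^ 3 + f.b * r ^ 2 + f.a * f.c * r + f.a ^ 2 * f.d = 0 := by
    have : AdjoinRoot.mk P (X ^ 3 + (C (f.b : ℚ) * X ^ 2 + C (f.a * f.c : ℚ) * X
        + C (f.a ^ 2 * f.d : ℚ))) = 0 := by rw [← hP]; exact AdjoinRoot.mk_self
    simp at this
    simp only [← Int.cast_mul, ← Int.cast_pow, mkC] at this
    push_cast at this
    linear_combination this
  set s : AdjoinRoot P := (r ^ 2 + f.b * r + f.a * f.c) / f.a with hs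
  have has : f.a * s = r ^ 2 + f.b * r + f.a * f.c := by rw [hs]; field_simp
  have tabK : Tab f r s := by
    refine ⟨?_, ?_, ?_⟩
    · apply mul_left_cancel₀ haK
      linear_combination r * has + hroot
    · linear_combination -has
    · have hw : r * s = -(f.a * f.d) := by
        apply mul_left_cancel₀ haK
        linear_combination r * has + hroot
      apply mul_left_cancel₀ haK
      linear_combination s * has + (r + f.b) * hw
  have hri : IsIntegral ℤ r := by
    refine ⟨X ^ 3 + (C f.b * X ^ 2 + C (f.a * f.c) * X + C (f.a ^ 2 * f.d)),
      monic_X_pow_add (lt_of_le_of_lt degree_quadratic_le (by norm_num)), ?_⟩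
    simp only [eval₂_add, eval₂_mul, eval₂_pow, eval₂_X, eval₂_C]
    simp only [eq_intCast]
    push_cast
    linear_combination tabK.cubic
  have hsi : IsIntegral ℤ s := by
    refine ⟨X ^ 3 + (C (-f.c) * X ^ 2 + C (f.b * f.d) * X + C (-f.a * f.d ^ 2)),
      monic_X_pow_add (lt_of_le_of_lt degree_quadratic_le (by norm_num)), ?_⟩
    simp only [eval₂_add, eval₂_mul, eval₂_pow, eval₂_X, eval₂_C]
    simp only [eq_intCast]
    push_cast
    linear_combination tabK.cubic'
  obtain ⟨ω, hω⟩ := (IsIntegralClosure.isIntegral_iff (A := 𝓞 (AdjoinRoot P))).1 hri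
  obtain ⟨θ, hθ⟩ := (IsIntegralClosure.isIntegral_iff (A := 𝓞 (AdjoinRoot P))).1 hsi
  have inj : Function.Injective (algebraMap (𝓞 (AdjoinRoot P)) (AdjoinRoot P)) :=
    FaithfulSMul.algebraMap_injective _ _
  have tab : Tab f ω θ := Tab.of_map inj (by rw [hω, hθ]; exact tabK)
  have hind : ∀ e p q : ℤ, (e + p * ω + q * θ : 𝓞 (AdjoinRoot P)) = 0 → e = 0 ∧ p = 0 ∧ q = 0 := by
    intro e p q h
    have hK := congrArg (algebraMap (𝓞 (AdjoinRoot P)) (AdjoinRoot P)) h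
    simp only [map_add, map_mul, map_intCast, hω, hθ, map_zero] at hK
    have hz : AdjoinRoot.mk P (C (q : ℚ) * X ^ 2 + C ((f.a * p + q * f.b : ℤ) : ℚ) * X
        + C ((f.a * e + q * (f.a * f.c) : ℤ) : ℚ)) = 0 := by
      simp only [map_add, map_mul, map_pow, AdjoinRoot.mk_X, mkC]
      push_cast
      linear_combination f.a * hK - q * has
    rw [AdjoinRoot.mk_eq_zero] at hz
    have h0 := eq_zero_of_dvd_of_degree_lt hz (by
      rw [degree_eq_natDegree hirr.ne_zero, hdeg]
      exact lt_of_le_of_lt degree_quadratic_le (by norm_num))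
    obtain ⟨c2, c1, c0⟩ := coeff_eq_zero_of_quadratic h0
    rw [Int.cast_eq_zero] at c2 c1 c0
    subst c2
    simp only [zero_mul, add_zero, mul_eq_zero, ha, false_or] at c1 c0
    exact ⟨c0, c1, rfl⟩
  obtain ⟨F, hF⟩ := exists_rep_ringOfIntegers hfr
  exact ⟨⟨AdjoinRoot P, hfr⟩, tab.rep hF hind hmax⟩

end Cub

namespace Cub

lemma exists_ne_zero_row {n : Mat} (hn : n ≠ 0) :
    ∃ x y : ℤ, ¬ (x * n 0 0 + y * n 1 0 = 0 ∧ x * n 0 1 + y * n 1 1 = 0) := by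
  by_contra h
  push Not at h
  apply hn
  have h1 := h 1 0
  have h2 := h 0 1
  simp at h1 h2
  ext i j
  fin_cases i <;> fin_cases j
  exacts [h1.1, h1.2, h2.1, h2.2]

lemma ev_eq_of_sub_eq {g : Mat} {f : Cub ℤ} (h : sub g f = f) (x y : ℤ) :
    f.ev (x * g 0 0 + y * g 1 0) (x * g 0 1 + y * g 1 1) = f.ev x y := by
  rw [← ev_sub, h]

/-- In the basis formed by a vector and its image, the transformation is a companion matrix. -/
lemma ev_companion {g : Mat} {f : Cub ℤ} (h : sub g f = f) :
    let F := sub !![1, 0; g 0 0, g 0 1] f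
    sub !![0, 1; -g.det, g 0 0 + g 1 1] F = F := by
  intro F
  have : sub !![0, 1; -g.det, g 0 0 + g 1 1] F = sub !![1, 0; g 0 0, g 0 1] (sub g f) := by
    rw [← sub_mul, ← sub_mul]
    congr 1
    ext i j
    fin_cases i <;> fin_cases j <;> simp [mul_apply, Fin.sum_univ_two, det_fin_two] <;>
      ring
  rw [this, h]

lemma trace_of_sub_eq {f : Cub ℤ} (hf : Irr f) {g : Mat}
    (hg : g.det = 1 ∨ g.det = -1) (h : sub g f = f) (hne : g ≠ 1) :
    g.det = 1 ∧ g 0 0 + g 1 1 = -1 := by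
  have hc := ev_companion h
  have ha : f.a ≠ 0 := by
    intro h0
    have := hf 1 0 (by simp [ev, h0])
    simp at this
  set F := sub !![1, 0; g 0 0, g 0 1] f with hF
  have hFa : F.a = f.a := by simp [hF, sub, ev]
  set t := g 0 0 + g 1 1 with ht
  obtain ⟨x, y, hxy⟩ := exists_ne_zero_row (sub_ne_zero.2 hne)
  simp only [Matrix.sub_apply, one_apply_eq, one_apply_ne, ne_eq, zero_ne_one,
    one_ne_zero, not_false_eq_true, sub_zero] at hxy
  set X := x * (g 0 0 - 1) + y * g 1 0 with hX
  set Y := x * g 0 1 + y * (g 1 1 - 1) with hY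
  have hev0 : f.ev X Y ≠ 0 := fun h0 => hxy (hf _ _ h0)
  simp only [sub, ev, evx, evy, of_apply, cons_val', cons_val_zero,
    cons_val_one, cons_val_fin_one, Cub.ext_iff] at hc
  obtain ⟨h1, h2, h3, h4⟩ := hc
  rw [← hFa] at ha
  have hdet := det_fin_two g
  rcases hg with hg | hg
  · refine ⟨hg, ?_⟩
    by_contra htn
    rw [hg] at h2 h3 h4 hdet
    have e1 : (3 * F.a * t - 2 * F.c) * (t + 1) = 0 := by
      linear_combination h3 + h2 + (3 * t ^ 2 + 3 * t) * (-h1)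
    have ht1 : t + 1 ≠ 0 := fun h => htn (by linarith)
    have e2 := (mul_eq_zero.1 e1).resolve_right ht1
    have e3 : F.a * ((t + 1) * (t - 2) ^ 2) = 0 := by
      linear_combination (-2) * h4 + (2 * (t ^ 3 - 1) + 6 * t ^ 2) * h1 - 2 * t * h2 + t * (t + 1) * e2
    have e4 : t = 2 := by
      have := (mul_eq_zero.1 ((mul_eq_zero.1 e3).resolve_left ha)).resolve_left ht1
      have := pow_eq_zero_iff (two_ne_zero) |>.1 this
      linarith
    rw [ht] at e4
    have k1 := ev_eq_of_sub_eq h x y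
    have k2 := ev_eq_of_sub_eq h (x + X) (y + Y)
    have k3 := ev_eq_of_sub_eq h (x + 2 * X) (y + 2 * Y)
    have hs : g 1 1 = 2 - g 0 0 := by linarith
    have hqr : g 0 1 * g 1 0 = g 0 0 * (2 - g 0 0) - 1 := by rw [← hs]; linarith
    have x1 : X * g 0 0 + Y * g 1 0 = X := by
      rw [hX, hY, hs]; linear_combination x * hqr
    have x2 : X * g 0 1 + Y * g 1 1 = Y := by
      rw [hX, hY, hs]; linear_combination y * hqr
    have y1 : x * g 0 0 + y * g 1 0 = x + X := by rw [hX]; ring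
    have y2 : x * g 0 1 + y * g 1 1 = y + Y := by rw [hY]; ring
    have z1 : (x + X) * g 0 0 + (y + Y) * g 1 0 = x + 2 * X := by linarith
    have z2 : (x + X) * g 0 1 + (y + Y) * g 1 1 = y + 2 * Y := by linarith
    have w1 : (x + 2 * X) * g 0 0 + (y + 2 * Y) * g 1 0 = x + 3 * X := by linarith
    have w2 : (x + 2 * X) * g 0 1 + (y + 2 * Y) * g 1 1 = y + 3 * Y := by linarith
    rw [y1, y2] at k1
    rw [z1, z2] at k2
    rw [w1, w2] at k3
    apply hev0
    simp only [ev] at k1 k2 k3 ⊢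
    linarith
  · exfalso
    rw [hg] at h2 h3 h4 hdet
    have e1 : t * (3 * F.a * (t + 1) + 2 * F.c) = 0 := by
      linear_combination h3 + h2 - (3 * t + 3 * t ^ 2) * h1
    by_cases ht0 : t = 0
    · have hs : g 1 1 = -g 0 0 := by rw [ht] at ht0; linarith
      have hqr : g 0 1 * g 1 0 = 1 - g 0 0 * g 0 0 := by rw [hs] at hdet; linarith
      have k1 := ev_eq_of_sub_eq h X Y
      have x1 : X * g 0 0 + Y * g 1 0 = -X := by
        rw [hX, hY, hs]; linear_combination x * hqr
      have x2 : X * g 0 1 + Y * g 1 1 = -Y := by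
        rw [hX, hY, hs]; linear_combination y * hqr
      rw [x1, x2] at k1
      apply hev0
      simp only [ev] at k1 ⊢
      linarith
    · have e2 := (mul_eq_zero.1 e1).resolve_left ht0
      have e3 : F.a * (t * (t ^ 2 + 3)) = 0 := by
        linear_combination (-2) * h4 + (2 * (t ^ 3 - 1) + 6 * t ^ 2) * h1 - 2 * t * h2
          + t * (t + 1) * e2
      have := (mul_eq_zero.1 ((mul_eq_zero.1 e3).resolve_left ha)).resolve_left ht0
      nlinarith [sq_nonneg t]

lemma exists_abs_sub_mul_le (d : ℤ) {q : ℤ} (hq : q ≠ 0) : ∃ t : ℤ, |d - 2 * q * t| ≤ |q| := by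
  have hq' : 0 < |q| := abs_pos.2 hq
  have h1 := Int.emod_add_mul_ediv (d + |q|) (2 * |q|)
  have h2 := Int.emod_nonneg (d + |q|) (by positivity : 2 * |q| ≠ 0)
  have h3 := Int.emod_lt_of_pos (d + |q|) (by positivity : 0 < 2 * |q|)
  set k := (d + |q|) / (2 * |q|)
  have h4 : |d - 2 * |q| * k| ≤ |q| := by rw [abs_le]; constructor <;> linarith
  rcases abs_choice q with h | h
  · exact ⟨k, by rw [h] at h4; rw [h]; exact h4⟩
  · exact ⟨-k, by rw [h] at h4 ⊢; convert h4 using 2; ring⟩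

lemma exists_cyclic : ∀ (n : ℕ) (g : Mat) (f : Cub ℤ),
    (g 0 1).natAbs = n → g.det = 1 → g 0 0 + g 1 1 = -1 → sub g f = f →
    ∃ (h : UMat) (a b : ℤ), sub h.1 f = ⟨a, b, -3 * a - b, a⟩ := by
  intro n
  induction n using Nat.strong_induction_on with
  | _ n ih =>
    intro g f hn hdet htr h
    set p := g 0 0 with hp
    set q := g 0 1 with hq
    set r := g 1 0 with hr
    set s := g 1 1 with hs
    have hd : p * s - q * r = 1 := by rw [← hdet, det_fin_two]
    have hd2 : (p - s) ^ 2 + 4 * (q * r) = -3 := by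
      have : s = -1 - p := by linarith
      rw [this] at hd ⊢
      linear_combination (-4) * hd
    have hq0 : q ≠ 0 := by
      intro h0; rw [h0] at hd2; nlinarith [sq_nonneg (p - s)]
    by_cases hq1 : q ^ 2 ≤ 1
    · have hq2 : q = 1 ∨ q = -1 := by
        have : q ≤ 1 := by nlinarith
        have : -1 ≤ q := by nlinarith
        omega
      have hc := ev_companion h
      set F := sub !![1, 0; g 0 0, g 0 1] f with hF
      refine ⟨⟨!![1, 0; p, q], by simpa [det_fin_two_of] using hq2⟩, F.a, F.b, ?_⟩
      change F = _
      rw [hdet, ← hp, ← hs, htr] at hc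
      simp only [sub, ev, evx, evy, of_apply, cons_val', cons_val_zero,
        cons_val_one, cons_val_fin_one, Cub.ext_iff] at hc
      obtain ⟨h1, h2, h3, h4⟩ := hc
      ext
      · rfl
      · rfl
      · simp only; linarith
      · simp only; linarith
    · obtain ⟨t, ht⟩ := exists_abs_sub_mul_le (p - s) hq0
      set h₀ : Mat := !![t, 1; 1, 0] with hh
      set g' : Mat :=
        !![t * q + s, t * p + r - t * (t * q + s); q, p - t * q] with hg'
      have hcomm : g' * h₀ = h₀ * g := by
        ext i j
        fin_cases i <;> fin_cases j <;>
          simp [hg', hh, mul_apply, Fin.sum_univ_two, ← hp, ← hq, ← hr, ← hs] <;> ring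
      have hfix : sub g' (sub h₀ f) = sub h₀ f := by
        rw [← sub_mul, hcomm, sub_mul, h]
      have hlt : (g' 0 1).natAbs < n := by
        rw [← hn, Int.natAbs_lt_iff_sq_lt]
        have e1 : g' 0 1 = t * p + r - t * (t * q + s) := by simp [hg']
        rw [e1]
        set r' := t * p + r - t * (t * q + s)
        have e2 : 4 * (q * r') = -3 - (p - s - 2 * q * t) ^ 2 := by
          linear_combination hd2
        have e3 : (p - s - 2 * q * t) ^ 2 ≤ q ^ 2 := sq_le_sq.2 ht
        have e4 : 0 < q ^ 2 - 1 := by linarith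
        have e5 : (4 * (q * r')) ^ 2 ≤ (3 + q ^ 2) ^ 2 := by
          rw [e2, sq_le_sq, abs_of_nonpos (by nlinarith [sq_nonneg (p - s - 2 * q * t)]),
            abs_of_nonneg (by positivity)]
          linarith
        by_contra hcon
        push Not at hcon
        nlinarith [mul_le_mul_of_nonneg_left hcon (sq_nonneg q)]
      obtain ⟨k, a, b, hk⟩ := ih _ hlt g' (sub h₀ f) rfl (by
        rw [hg', det_fin_two_of]; linear_combination hd) (by
        simp [hg']; linarith) hfix
      refine ⟨⟨k.1 * h₀, ?_⟩, a, b, ?_⟩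
      · have : h₀.det = -1 := by simp [hh, det_fin_two_of]
        rw [det_mul, this]
        rcases k.2 with h | h <;> rw [h] <;> norm_num
      · simpa [sub_mul] using hk

lemma stabilizer_trivial {f : Cub ℤ} (hf : Irr f)
    (hbad : ¬ ∃ (h : UMat) (a b : ℤ), sub h.1 f = ⟨a, b, -3 * a - b, a⟩) :
    Function.Injective fun g : UMat => sub g.1 f := by
  intro g g' hgg
  simp at hgg
  have hg'1 : g'.1.det * g'.1.det = 1 := by rcases g'.2 with h | h <;> rw [h] <;> norm_num
  set i : Mat := g'.1.det • g'.1.adjugate with hi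
  have hii : i * g'.1 = 1 := by
    rw [hi, smul_mul, adjugate_mul, smul_smul, hg'1, one_smul]
  have hii' : g'.1 * i = 1 := by
    rw [hi, Matrix.mul_smul, mul_adjugate, smul_smul, hg'1, one_smul]
  have hfix : sub (i * g.1) f = f := by
    rw [sub_mul, hgg, ← sub_mul, hii, sub_one]
  have hdet : (i * g.1).det = 1 ∨ (i * g.1).det = -1 := by
    have h1 : i.det * g'.1.det = 1 := by rw [← det_mul, hii, det_one]
    have h2 : i.det = 1 ∨ i.det = -1 := Int.isUnit_iff.1 (IsUnit.of_mul_eq_one _ h1)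
    rw [det_mul]
    rcases h2 with h | h <;> rcases g.2 with h' | h' <;> rw [h, h'] <;> norm_num
  by_cases hone : i * g.1 = 1
  · apply Subtype.ext
    have := congrArg (g'.1 * ·) hone
    simpa [← mul_assoc, hii'] using this
  · obtain ⟨h1, h2⟩ := trace_of_sub_eq hf hdet hfix hone
    exact absurd (exists_cyclic _ _ f rfl h1 h2 hfix) hbad

lemma disc_cyclic (a b : ℤ) : (⟨a, b, -3 * a - b, a⟩ : Cub ℤ).disc
    = (b ^ 2 + 3 * a * b + 9 * a ^ 2) ^ 2 := by
  simp only [disc]; ring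

end Cub

namespace Cub

open NumberField

lemma Rep.of_equiv {K K' : Type*} [Field K] [Field K'] [NumberField K] [NumberField K'] {f : Cub ℤ}
    (h : Rep (𝓞 K) f) (e : K ≃+* K') : Rep (𝓞 K') f :=
  h.of_ringEquiv (NumberField.RingOfIntegers.mapRingEquiv e)

lemma rep_out {K : CubicField} {f : Cub ℤ} (h : Rep (𝓞 K.carrier) f) :
    Rep (𝓞 (⟦K⟧ : Quotient CubicField.setoid).out.carrier) f := by
  obtain ⟨e⟩ := Quotient.mk_out (s := CubicField.setoid) K
  exact h.of_equiv e.symm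

lemma eq_of_rep_out {C C' : Quotient CubicField.setoid} {f : Cub ℤ}
    (h : Rep (𝓞 C.out.carrier) f) (h' : Rep (𝓞 C'.out.carrier) f) : C = C' := by
  obtain ⟨e⟩ := h.field_equiv h'
  rw [← C.out_eq, ← C'.out_eq]
  exact Quotient.sound ⟨e⟩

lemma exists_rep_out (C : Quotient CubicField.setoid) : ∃ f, Rep (𝓞 C.out.carrier) f :=
  exists_rep_ringOfIntegers C.out.deg

/-- The isomorphism classes of cubic fields whose discriminant satisfies `P`. -/
abbrev FieldClass (P : ℤ → Prop) : Type 1 :=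
  {C : Quotient CubicField.setoid // ∃ K : CubicField, ⟦K⟧ = C ∧ P (NumberField.discr K.carrier)}

lemma FieldClass.disc {P : ℤ → Prop} (C : FieldClass P) {f : Cub ℤ}
    (h : Rep (𝓞 C.1.out.carrier) f) : P f.disc := by
  obtain ⟨C, K, rfl, hP⟩ := C
  obtain ⟨e⟩ := Quotient.mk_out (s := CubicField.setoid) K
  rw [(h.of_equiv e).disc_eq]
  exact hP

lemma exists_fieldClass {P : ℤ → Prop} {f : Cub ℤ} (hf : Irr f) (hP : P f.disc)
    (hmax : ∀ p : ℕ, p.Prime → ¬ NonMax p f) : ∃ C : FieldClass P, Rep (𝓞 C.1.out.carrier) f := by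
  obtain ⟨K, hK⟩ := exists_cubicField hf hmax
  exact ⟨⟨⟦K⟧, K, rfl, by rwa [← hK.disc_eq]⟩, rep_out hK⟩

open Classical in
/-- The total weight of the forms representing a field. -/
def fieldWeight (u : Cub ℤ → ℝ≥0∞) (C : Quotient CubicField.setoid) : ℝ≥0∞ :=
  ∑' f : Cub ℤ, if Rep (𝓞 C.out.carrier) f then u f else 0

lemma fieldWeight_eq (u : Cub ℤ → ℝ≥0∞) {C : Quotient CubicField.setoid} {f : Cub ℤ}
    (hf : Rep (𝓞 C.out.carrier) f) :
    fieldWeight u C = ∑' x : range (fun g : UMat => sub g.1 f), u x := by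
  classical
  rw [tsum_subtype (range (fun g : UMat => sub g.1 f)) u]
  unfold fieldWeight
  congr 1
  ext f'
  by_cases h : Rep (𝓞 C.out.carrier) f'
  · obtain ⟨g, rfl⟩ := hf.sub_eq h
    rw [if_pos h, indicator_of_mem (mem_range_self g)]
  · rw [if_neg h, indicator_of_notMem]
    rintro ⟨g, rfl⟩
    exact h (hf.sub g)

lemma fieldWeight_le_one {σ : ℤ} {u : Cub ℤ → ℝ≥0∞} (hu : OrbitWeight σ u)
    (C : FieldClass fun d => 0 < σ * d) : fieldWeight u C.1 ≤ 1 := by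
  obtain ⟨f, hf⟩ := exists_rep_out C.1
  rw [fieldWeight_eq u hf, ← hu.tsum_eq f hf.irr (C.disc hf)]
  exact tsum_le_tsum_comp_of_surjective (f := rangeFactorization _)
    rangeFactorization_surjective _

lemma fieldWeight_eq_one {σ : ℤ} {u : Cub ℤ → ℝ≥0∞} (hu : OrbitWeight σ u)
    (C : FieldClass fun d => 0 < σ * d)
    (hC : ¬ ∃ a b : ℤ, Rep (𝓞 C.1.out.carrier) ⟨a, b, -3 * a - b, a⟩) :
    fieldWeight u C.1 = 1 := by
  obtain ⟨f, hf⟩ := exists_rep_out C.1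
  rw [fieldWeight_eq u hf, ← hu.tsum_eq f hf.irr (C.disc hf)]
  refine tsum_range u (stabilizer_trivial hf.irr ?_)
  rintro ⟨h, a, b, hab⟩
  exact hC ⟨a, b, hab ▸ hf.sub h⟩

lemma maxSum_eq_tsum_fieldWeight (σ : ℤ) (u : Cub ℤ → ℝ≥0∞) (X : ℝ) :
    maxSum σ u X
      = ∑' C : FieldClass fun d => 0 < σ * d ∧ ((σ * d : ℤ) : ℝ) < X, fieldWeight u C.1 := by
  classical
  unfold maxSum fieldWeight
  rw [ENNReal.tsum_comm]
  congr 1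
  ext f
  split_ifs with h
  · obtain ⟨C, hC⟩ := exists_fieldClass (P := fun d => 0 < σ * d ∧ ((σ * d : ℤ) : ℝ) < X) h.1
      ⟨h.2.1, h.2.2.1⟩ h.2.2.2
    rw [tsum_eq_single C, if_pos hC, one_mul]
    intro C' hne
    rw [if_neg]
    exact fun h' => hne (Subtype.ext (eq_of_rep_out h' hC))
  · rw [zero_mul, eq_comm, ENNReal.tsum_eq_zero]
    intro C
    rw [if_neg]
    exact fun hC => h ⟨hC.irr, (C.disc hC).1, (C.disc hC).2, fun p hp => hC.not_nonMax hp⟩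

lemma cyclic_box {a b : ℤ} {X : ℝ} (h : ((b ^ 2 + 3 * a * b + 9 * a ^ 2 : ℤ) : ℝ) ^ 2 ≤ X) :
    |(a : ℝ)| ≤ X ^ (1 / 4 : ℝ) ∧ |(b : ℝ)| ≤ 2 * X ^ (1 / 4 : ℝ) := by
  have hX : 0 ≤ X := le_trans (sq_nonneg _) h
  set L := X ^ (1 / 4 : ℝ) with hL
  have hL0 : 0 ≤ L := rpow_nonneg hX _
  have hL4 : (L ^ 2) ^ 2 = X := by
    rw [← pow_mul, hL, ← rpow_natCast, ← rpow_mul hX]; norm_num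
  have h1 : ((b ^ 2 + 3 * a * b + 9 * a ^ 2 : ℤ) : ℝ) ≤ L ^ 2 := by
    refine le_of_sq_le_sq ?_ (by positivity)
    rw [hL4]; exact h
  push_cast at h1
  constructor
  · refine abs_le_of_sq_le_sq ?_ hL0
    nlinarith [sq_nonneg ((b : ℝ) + 3 / 2 * a), sq_nonneg (a : ℝ)]
  · refine abs_le_of_sq_le_sq ?_ (by positivity)
    nlinarith [sq_nonneg (3 * (a : ℝ) + b / 2), sq_nonneg (b : ℝ)]

lemma card_box_le {X : ℝ} (hX : 1 ≤ X) (s : Set (ℤ × ℤ))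
    (hs : ∀ x ∈ s, |(x.1 : ℝ)| ≤ X ^ (1 / 4 : ℝ) ∧ |(x.2 : ℝ)| ≤ 2 * X ^ (1 / 4 : ℝ)) :
    s.Finite ∧ (s.ncard : ℝ) ≤ 15 * X ^ (1 / 2 : ℝ) := by
  set L := X ^ (1 / 4 : ℝ) with hL
  have hL1 : 1 ≤ L := one_le_rpow hX (by norm_num)
  have hL2 : X ^ (1 / 2 : ℝ) = L * L := by
    rw [hL, ← rpow_add (by linarith)]; norm_num
  set n := ⌊L⌋₊
  set m := ⌊2 * L⌋₊
  have hn : (n : ℝ) ≤ L := Nat.floor_le (by linarith)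
  have hm : (m : ℝ) ≤ 2 * L := Nat.floor_le (by linarith)
  let t : Finset (ℤ × ℤ) := Finset.Icc (-n : ℤ) n ×ˢ Finset.Icc (-m : ℤ) m
  have hst : s ⊆ t := by
    intro x hx
    obtain ⟨h1, h2⟩ := hs x hx
    have h1' : x.1.natAbs ≤ n := Nat.le_floor (by rw [Nat.cast_natAbs]; push_cast; exact h1)
    have h2' : x.2.natAbs ≤ m := Nat.le_floor (by rw [Nat.cast_natAbs]; push_cast; exact h2)
    simp only [t, coe_product, mem_prod, mem_coe, Finset.mem_Icc]
    omega
  refine ⟨t.finite_toSet.subset hst, ?_⟩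
  have h3 : s.ncard ≤ t.card := by
    rw [← ncard_coe_finset]; exact ncard_le_ncard hst t.finite_toSet
  have h4 : t.card = (2 * n + 1) * (2 * m + 1) := by
    simp only [t, card_product, Int.card_Icc]
    congr 1 <;> omega
  calc (s.ncard : ℝ) ≤ ((2 * n + 1) * (2 * m + 1) : ℕ) := by rw [← h4]; exact_mod_cast h3
    _ = (2 * n + 1) * (2 * m + 1) := by push_cast; ring
    _ ≤ (3 * L) * (5 * L) := by gcongr <;> linarith
    _ = _ := by rw [hL2]; ring

lemma countCubic_sub_maxSum {σ : ℤ} {u : Cub ℤ → ℝ≥0∞} (hu : OrbitWeight σ u) (hσ : σ ^ 2 = 1)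
    {X : ℝ} (hX : 1 ≤ X) (hfin : maxSum σ u X ≠ ⊤) :
    |(countCubic (fun d => 0 < σ * d ∧ ((σ * d : ℤ) : ℝ) < X) : ℝ) - (maxSum σ u X).toReal|
      ≤ 15 * X ^ (1 / 2 : ℝ) := by
  classical
  set P : ℤ → Prop := fun d => 0 < σ * d ∧ ((σ * d : ℤ) : ℝ) < X with hP
  rw [maxSum_eq_tsum_fieldWeight] at hfin ⊢
  let ι : FieldClass P → FieldClass fun d => 0 < σ * d :=
    fun C => ⟨C.1, C.2.imp fun K h => ⟨h.1, h.2.1⟩⟩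
  have hle : ∀ C : FieldClass P, fieldWeight u C.1 ≤ 1 := fun C => fieldWeight_le_one hu (ι C)
  let bad : Set (FieldClass P) := {C | ∃ a b : ℤ, Rep (𝓞 C.1.out.carrier) ⟨a, b, -3 * a - b, a⟩}
  have hgood : ∀ C ∉ bad, fieldWeight u C.1 = 1 := fun C hC => fieldWeight_eq_one hu (ι C) hC
  have hex : ∀ C : FieldClass P, ∃ x : ℤ × ℤ, C ∈ bad →
      Rep (𝓞 C.1.out.carrier) ⟨x.1, x.2, -3 * x.1 - x.2, x.1⟩ := by
    intro C
    by_cases h : C ∈ bad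
    · obtain ⟨a, b, hab⟩ := h
      exact ⟨(a, b), fun _ => hab⟩
    · exact ⟨0, fun h' => absurd h' h⟩
  choose φ hφ using hex
  have hinj : InjOn φ bad := by
    intro C hC C' hC' hE
    have h1 := hφ C hC
    rw [hE] at h1
    exact Subtype.ext (eq_of_rep_out h1 (hφ C' hC'))
  obtain ⟨hbf, hbc⟩ := card_box_le hX (φ '' bad) (by
    rintro _ ⟨C, hC, rfl⟩
    refine cyclic_box ?_
    have h1 := C.disc (hφ C hC)
    rw [disc_cyclic] at h1
    obtain ⟨h2, h3⟩ := h1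
    set D := ((φ C).2 ^ 2 + 3 * (φ C).1 * (φ C).2 + 9 * (φ C).1 ^ 2) with hD
    have h5 : σ = 1 := by
      rcases sq_eq_sq_iff_eq_or_eq_neg.1 (hσ.trans (one_pow 2).symm) with h | h
      · exact h
      · rw [h] at h2; nlinarith [sq_nonneg D]
    rw [h5] at h3
    push_cast at h3 ⊢
    linarith)
  have hbf' : bad.Finite := hbf.of_finite_image hinj
  rw [hinj.ncard_image] at hbc
  have hS : Finite (FieldClass P) := by
    have h1 := finite_const_le_of_tsum_ne_top hfin one_ne_zero
    refine finite_univ_iff.1 ((h1.union hbf').subset ?_)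
    intro C _
    by_cases h : C ∈ bad
    · exact Or.inr h
    · exact Or.inl (hgood C h).ge
  have : Fintype (FieldClass P) := Fintype.ofFinite _
  have e1 : (countCubic P : ℝ) = ∑ C : FieldClass P, (1 : ℝ) := by
    rw [countCubic, Nat.card_eq_fintype_card]; simp
  rw [e1, tsum_fintype, toReal_sum fun C _ => ((hle C).trans_lt one_lt_top).ne,
    ← sum_sub_distrib]
  refine le_trans ?_ hbc
  refine (abs_sum_le_sum_abs _ _).trans ?_
  have e2 : (bad.ncard : ℝ) = ∑ C : FieldClass P, if C ∈ bad then (1 : ℝ) else 0 := by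
    rw [sum_boole, ← ncard_coe_finset]
    congr 2
    ext; simp
  rw [e2]
  refine sum_le_sum fun C _ => ?_
  split_ifs with h
  · have h1 := toReal_mono one_ne_top (hle C)
    rw [toReal_one] at h1
    rw [abs_of_nonneg (by linarith)]
    linarith [toReal_nonneg (a := fieldWeight u C.1)]
  · rw [hgood C h]; simp

end Cub

namespace Cub

/-- A real form as a complex form. -/
abbrev toComplex (f : Cub ℝ) : Cub ℂ := f.map Complex.ofRealHom

/-- The polar form of `f` at `(t, 1), (t, 1), (conj t, 1)`. -/
def polar (f : Cub ℝ) (t : ℂ) : ℂ := conj t * f.toComplex.evx t 1 + f.toComplex.evy t 1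

/-- The square of the norm of the form `f` with respect to the metric given by `z`. -/
def hN (f : Cub ℝ) (z : ℍ) : ℝ :=
  (3 * Complex.normSq (f.toComplex.ev z 1) + Complex.normSq (f.polar z)) / (4 * z.im ^ 3)

lemma hN_eq (f : Cub ℝ) (z : ℍ) : hN f z = 3 * z.im ^ 3 * f.a ^ 2 + z.im * (f.b + 3 * f.a * z.re) ^ 2
    + (3 * f.a * z.re ^ 2 + 2 * f.b * z.re + f.c) ^ 2 / z.im + 3 * (f.ev z.re 1) ^ 2 / z.im ^ 3 := by
  have hz : (z : ℂ) = ⟨z.re, z.im⟩ := rfl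
  have h0 := z.im_pos.ne'
  simp only [hN, polar, ev, evx, evy, map, hz, Complex.normSq_apply, Complex.ofRealHom_eq_coe]
  simp [pow_succ, pow_zero]
  field_simp
  ring

lemma ev_toComplex_sigma (f : Cub ℝ) (g : GL (Fin 2) ℝ) (t : ℂ) :
    f.toComplex.ev (UpperHalfPlane.σ g t) 1 = UpperHalfPlane.σ g (f.toComplex.ev t 1) := by
  simp [ev, map]

lemma polar_sigma (f : Cub ℝ) (g : GL (Fin 2) ℝ) (t : ℂ) :
    f.polar (UpperHalfPlane.σ g t) = UpperHalfPlane.σ g (f.polar t) := by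
  simp [polar, evx, evy, map, UpperHalfPlane.σ_conj, map_ofNat]

lemma hN_smul (f : Cub ℝ) {g : GL (Fin 2) ℝ} (hg : |g.det.val| = 1) (z : ℍ) :
    hN f (g • z) = hN (sub g.1.transpose f) z := by
  have hD := UpperHalfPlane.denom_ne_zero g z
  set w := UpperHalfPlane.num g z with hw
  set D := UpperHalfPlane.denom g z with hDd
  have hS : ∀ t, Complex.normSq (UpperHalfPlane.σ g t) = Complex.normSq t := by
    intro t
    rw [Complex.normSq_eq_norm_sq, Complex.normSq_eq_norm_sq, UpperHalfPlane.norm_σ]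
  have e1 : (sub g.1.transpose f).toComplex.ev z 1 = f.toComplex.ev (w / D) 1 * D ^ 3 := by
    rw [toComplex, map_sub, ev_sub]
    simp
    rw [mul_comm (z : ℂ), mul_comm (z : ℂ)]
    change f.toComplex.ev w D = _
    simp only [ev]
    field_simp
  have e2 : (sub g.1.transpose f).polar z = f.polar (w / D) * (D ^ 2 * conj D) := by
    rw [polar, toComplex, map_sub, evx_sub, evy_sub]
    simp
    rw [mul_comm (z : ℂ), mul_comm (z : ℂ)]
    change conj (z : ℂ) * ((g 0 0 : ℝ) * f.toComplex.evx w D + (g 1 0 : ℝ) * f.toComplex.evy w D)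
      + ((g 0 1 : ℝ) * f.toComplex.evx w D + (g 1 1 : ℝ) * f.toComplex.evy w D) = _
    have hw' : conj w = (g 0 0 : ℝ) * conj (z : ℂ) + (g 0 1 : ℝ) := by
      simp [hw, UpperHalfPlane.num]
    have hD' : conj D = (g 1 0 : ℝ) * conj (z : ℂ) + (g 1 1 : ℝ) := by
      simp [hDd, UpperHalfPlane.denom]
    have hcD : conj D ≠ 0 := by simpa using hD
    have h3 : f.toComplex.evx w D = f.toComplex.evx (w / D) 1 * D ^ 2 := by
      simp only [evx]; field_simp
    have h4 : f.toComplex.evy w D = f.toComplex.evy (w / D) 1 * D ^ 2 := by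
      simp only [evy]; field_simp
    have h5 : conj (w / D) * conj D = conj w := by
      rw [← map_mul, div_mul_cancel₀ _ hD]
    rw [polar, h3, h4]
    calc _ = ((g 0 0 : ℝ) * conj (z : ℂ) + (g 0 1 : ℝ)) * (f.toComplex.evx (w / D) 1 * D ^ 2)
          + ((g 1 0 : ℝ) * conj (z : ℂ) + (g 1 1 : ℝ)) * (f.toComplex.evy (w / D) 1 * D ^ 2) := by ring
      _ = _ := by rw [← hw', ← hD', ← h5]; ring
  have hn : Complex.normSq D ≠ 0 := by simpa using hD
  have hy := z.im_pos.ne'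
  rw [hN, hN, UpperHalfPlane.coe_smul, ev_toComplex_sigma, polar_sigma, hS, hS,
    UpperHalfPlane.im_smul_eq_div_normSq, hg, ← hw, ← hDd, e1, e2]
  simp
  field_simp

lemma hN_scal (k : ℝ) (f : Cub ℝ) (z : ℍ) : hN (scal k f) z = k ^ 2 * hN f z := by
  simp only [hN_eq, scal, ev]; ring

/-- Whether the form `f` is balanced with respect to the metric given by `z`. -/
def Balanced (f : Cub ℝ) (z : ℍ) : Prop := hN f z ^ 2 ≤ 100 * |f.disc|

lemma continuous_hN (f : Cub ℝ) : Continuous (hN f) := by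
  have : hN f = fun z : ℍ => 3 * z.im ^ 3 * f.a ^ 2 + z.im * (f.b + 3 * f.a * z.re) ^ 2
    + (3 * f.a * z.re ^ 2 + 2 * f.b * z.re + f.c) ^ 2 / z.im + 3 * (f.ev z.re 1) ^ 2 / z.im ^ 3 :=
    funext (hN_eq f)
  rw [this]
  have h1 := continuous_re
  have h2 := continuous_im
  have h3 : Continuous fun z : ℍ => f.ev z.re 1 := by unfold ev; fun_prop
  have h4 : ∀ z : ℍ, z.im ≠ 0 := fun z => z.im_pos.ne'
  exact (((by fun_prop : Continuous fun z : ℍ => 3 * z.im ^ 3 * f.a ^ 2 +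
    z.im * (f.b + 3 * f.a * z.re) ^ 2).add (Continuous.div (by fun_prop) h2 h4)).add
    (Continuous.div (by fun_prop) (h2.pow 3) fun z => pow_ne_zero _ (h4 z)))

/-- The set of metrics with respect to which `f` is balanced. -/
def balSet (f : Cub ℝ) : Set ℍ := {z | Balanced f z}

lemma measurableSet_balSet (f : Cub ℝ) : MeasurableSet (balSet f) :=
  measurableSet_le ((continuous_hN f).measurable.pow_const 2) measurable_const

lemma balanced_smul (f : Cub ℝ) {g : GL (Fin 2) ℝ} (hg : |g.det.val| = 1) (z : ℍ) :
    Balanced f (g • z) ↔ Balanced (sub g.1.transpose f) z := by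
  have h6 : g.1.transpose.det ^ 6 = 1 := by
    have h : |g.1.det| = 1 := hg
    rw [det_transpose, ← Even.pow_abs (by decide), h, one_pow]
  rw [Balanced, Balanced, hN_smul f hg, disc_sub, h6, one_mul]

lemma balanced_scal {k : ℝ} (hk : k ≠ 0) (f : Cub ℝ) (z : ℍ) :
    Balanced (scal k f) z ↔ Balanced f z := by
  have h4 : 0 < k ^ 4 := by positivity
  rw [Balanced, Balanced, hN_scal, disc_scal, abs_mul, abs_of_pos h4]
  have : (k ^ 2 * hN f z) ^ 2 = k ^ 4 * hN f z ^ 2 := by ring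
  rw [this, show 100 * (k ^ 4 * |f.disc|) = k ^ 4 * (100 * |f.disc|) by ring,
    mul_le_mul_iff_right₀ h4]

lemma balSet_sub (f : Cub ℝ) {g : GL (Fin 2) ℝ} (hg : |g.det.val| = 1) :
    balSet (sub g.1.transpose f) = (g • ·) ⁻¹' balSet f := by
  ext z; exact (balanced_smul f hg z).symm

/-- The measure of the set of metrics with respect to which `f` is balanced. -/
def balVol (f : Cub ℝ) : ℝ≥0∞ := volume (balSet f)

lemma balVol_sub (f : Cub ℝ) {g : GL (Fin 2) ℝ} (hg : |g.det.val| = 1) :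
    balVol (sub g.1.transpose f) = balVol f := by
  rw [balVol, balSet_sub f hg, measure_preimage_smul]; rfl

lemma balVol_scal {k : ℝ} (hk : k ≠ 0) (f : Cub ℝ) : balVol (scal k f) = balVol f := by
  rw [balVol, balVol]
  congr 1
  ext z
  exact balanced_scal hk f z

end Cub

namespace UMat

instance : Countable UMat :=
  have : Countable Mat := inferInstanceAs (Countable (Fin 2 → Fin 2 → ℤ))
  Subtype.countable

/-- An integral matrix of determinant `±1` as a real matrix. -/
def toGL (g : UMat) : GL (Fin 2) ℝ :=
  GeneralLinearGroup.mkOfDetNeZero (g.1.map (Int.castRingHom ℝ)) (by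
    rw [← RingHom.mapMatrix_apply, ← RingHom.map_det]
    rcases g.2 with h | h <;> rw [h] <;> norm_num)

lemma coe_toGL (g : UMat) : g.toGL.1 = g.1.map (Int.castRingHom ℝ) := rfl

lemma det_toGL (g : UMat) : g.toGL.1.det = (g.1.det : ℝ) := by
  rw [coe_toGL, ← RingHom.mapMatrix_apply, ← RingHom.map_det]; rfl

lemma abs_det_toGL (g : UMat) : |g.toGL.det.val| = 1 := by
  change |g.toGL.1.det| = 1
  rw [det_toGL]
  rcases g.2 with h | h <;> rw [h] <;> norm_num

/-- The transpose. -/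
def transpose : UMat ≃ UMat where
  toFun g := ⟨g.1.transpose, by rw [det_transpose]; exact g.2⟩
  invFun g := ⟨g.1.transpose, by rw [det_transpose]; exact g.2⟩
  left_inv _ := rfl
  right_inv _ := rfl

lemma mul_adj (g : UMat) : g.1 * (g.1.det • g.1.adjugate) = 1 := by
  have : g.1.det * g.1.det = 1 := by rcases g.2 with h | h <;> rw [h] <;> norm_num
  rw [Matrix.mul_smul, mul_adjugate, smul_smul, this, one_smul]

/-- The inverse. -/
def inv (g : UMat) : UMat := ⟨g.1.det • g.1.adjugate, by
  have h := congrArg det g.mul_adj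
  rw [det_mul, det_one] at h
  exact Int.isUnit_iff.1 (IsUnit.of_mul_eq_one_right _ h)⟩

lemma mul_inv (g : UMat) : g.1 * g.inv.1 = 1 := g.mul_adj

lemma inv_inv (g : UMat) : g.inv.inv = g := by
  apply Subtype.ext
  calc g.inv.inv.1 = g.1 * g.inv.1 * g.inv.inv.1 := by rw [g.mul_inv, one_mul]
    _ = g.1 := by rw [mul_assoc, g.inv.mul_inv, mul_one]

lemma toGL_inv (g : UMat) : g.inv.toGL = g.toGL⁻¹ := by
  rw [eq_inv_iff_mul_eq_one, ← mul_eq_one_comm]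
  ext i j
  have := congrArg (fun M => (M.map (Int.castRingHom ℝ)) i j) g.mul_inv
  simp only [Matrix.map_mul] at this
  simpa [coe_toGL, map_apply, one_apply, apply_ite] using this

/-- Inversion as a permutation. -/
def invEquiv : UMat ≃ UMat := ⟨inv, inv, inv_inv, inv_inv⟩

/-- The inclusion of the special linear group. -/
def ofSL (γ : SL(2, ℤ)) : UMat := ⟨γ.1, Or.inl γ.2⟩

/-- A special matrix composed with a reflection. -/
def ofSLJ (γ : SL(2, ℤ)) : UMat := ⟨!![-1, 0; 0, 1] * γ.1, Or.inr (by
  rw [det_mul, γ.2]; simp [det_fin_two_of])⟩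

lemma toGL_ofSL (γ : SL(2, ℤ)) (z : ℍ) : (ofSL γ).toGL • z = γ • z := by
  rw [ModularGroup.sl_moeb]
  have : (ofSL γ).toGL = (γ : GL (Fin 2) ℝ) := by ext i j; rfl
  rw [this]

lemma toGL_ofSLJ (γ : SL(2, ℤ)) (z : ℍ) : (ofSLJ γ).toGL • z = UpperHalfPlane.J • γ • z := by
  rw [ModularGroup.sl_moeb, ← mul_smul]
  congr 1
  ext i j
  fin_cases i <;> fin_cases j <;>
    simp [coe_toGL, ofSLJ, map_apply, mul_apply, Fin.sum_univ_two, UpperHalfPlane.J,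
      vecMul, dotProduct]

lemma J_smul_mem_fd {z : ℍ} : UpperHalfPlane.J • z ∈ 𝒟 ↔ z ∈ 𝒟 := by
  have h1 : ((UpperHalfPlane.J • z : ℍ) : ℂ) = -conj (z : ℂ) := UpperHalfPlane.coe_J_smul z
  have h2 : (UpperHalfPlane.J • z).re = -z.re := by
    rw [← UpperHalfPlane.coe_re, h1]; simp
  simp only [ModularGroup.fd, Set.mem_ofPred_eq, h1, h2, Complex.normSq_neg, Complex.normSq_conj,
    abs_neg]

lemma cases_SL (g : UMat) : ∃ γ : SL(2, ℤ), g = ofSL γ ∨ g = ofSLJ γ := by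
  rcases g.2 with h | h
  · exact ⟨⟨g.1, h⟩, Or.inl rfl⟩
  · refine ⟨⟨!![-1, 0; 0, 1] * g.1, by rw [det_mul, h]; simp [det_fin_two_of]⟩,
      Or.inr (Subtype.ext ?_)⟩
    change g.1 = !![-1, 0; 0, 1] * (!![-1, 0; 0, 1] * g.1)
    rw [← mul_assoc, show (!![-1, 0; 0, 1] * !![-1, 0; 0, 1] : Mat) = 1 by
      ext i j; fin_cases i <;> fin_cases j <;> simp [mul_apply, Fin.sum_univ_two],
      one_mul]

/-- A point off the boundary has exactly four translates in the fundamental domain. -/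
lemma tsum_indicator_fd {z : ℍ} (hz : ∀ g : UMat, g.toGL • z ∈ 𝒟 → g.toGL • z ∈ 𝒟ᵒ) :
    ∑' g : UMat, Set.indicator 𝒟 (fun _ => (1 : ℝ≥0∞)) (g.toGL • z) = 4 := by
  classical
  obtain ⟨γ, hγ⟩ := ModularGroup.exists_smul_mem_fd z
  have hγo : γ • z ∈ 𝒟ᵒ := by
    have := hz (ofSL γ) (by rwa [toGL_ofSL]); rwa [toGL_ofSL] at this
  have huniq : ∀ γ' : SL(2, ℤ), γ' • z ∈ 𝒟 → γ' = γ ∨ γ' = -γ := by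
    intro γ' h
    have h1 : (γ' * γ⁻¹) • γ • z ∈ 𝒟 := by
      rw [← mul_smul, inv_mul_cancel_right]; exact h
    rcases ModularGroup.eq_one_or_neg_one_of_mem_fdo_mem_fd hγo h1 with h2 | h2
    · exact Or.inl (mul_inv_eq_one.1 h2)
    · right
      rw [mul_inv_eq_iff_eq_mul] at h2
      rw [h2, neg_one_mul]
  have hneg : -γ • z ∈ 𝒟 := by rwa [ModularGroup.SL_neg_smul]
  have hne : γ ≠ -γ := by
    intro h
    have h1 := γ.2
    have h2 : γ.1 = 0 := by
      have : γ.1 = (-γ).1 := congrArg Subtype.val h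
      ext i j
      have h3 := congrFun (congrFun this i) j
      simp at h3
      simp
      omega
    rw [h2] at h1
    simp at h1
  have hSL : Function.Injective ofSL := fun a b h =>
    Subtype.ext (congrArg (fun M : UMat => M.1) h)
  have hSLJ : Function.Injective ofSLJ := by
    intro a b h
    apply Subtype.ext
    have := congrArg (fun M : UMat => !![-1, 0; 0, 1] * M.1) h
    simp only [ofSLJ] at this
    rwa [← Matrix.mul_assoc, ← Matrix.mul_assoc,
      show (!![-1, 0; 0, 1] * !![-1, 0; 0, 1] : Mat) = 1 by
      ext i j; fin_cases i <;> fin_cases j <;> simp [Matrix.mul_apply, Fin.sum_univ_two],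
      Matrix.one_mul, Matrix.one_mul] at this
  have hd : ∀ a b, ofSL a ≠ ofSLJ b := by
    intro a b h
    have h1 : (ofSL a).1.det = 1 := a.2
    have h2 : (ofSLJ b).1.det = -1 := by
      change (!![-1, 0; 0, 1] * b.1).det = -1
      rw [Matrix.det_mul, b.2]; simp [Matrix.det_fin_two_of]
    rw [h, h2] at h1
    norm_num at h1
  have key : ∀ g : UMat, Set.indicator 𝒟 (fun _ => (1 : ℝ≥0∞)) (g.toGL • z)
      = if g ∈ ({ofSL γ, ofSL (-γ), ofSLJ γ, ofSLJ (-γ)} : Finset UMat) then 1 else 0 := by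
    intro g
    rw [Set.indicator_apply]
    refine if_congr ?_ rfl rfl
    simp
    constructor
    · intro h
      obtain ⟨γ', rfl | rfl⟩ := g.cases_SL
      · rw [toGL_ofSL] at h
        rcases huniq γ' h with rfl | rfl <;> simp
      · rw [toGL_ofSLJ, J_smul_mem_fd] at h
        rcases huniq γ' h with rfl | rfl <;> simp
    · rintro (rfl | rfl | rfl | rfl) <;> simpa only [toGL_ofSL, toGL_ofSLJ, J_smul_mem_fd]
  rw [tsum_congr key, tsum_eq_sum (s := {ofSL γ, ofSL (-γ), ofSLJ γ, ofSLJ (-γ)})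
    (fun g hg => if_neg hg), Finset.sum_ite_mem, Finset.inter_self, Finset.sum_const,
    Finset.card_insert_of_notMem, Finset.card_insert_of_notMem, Finset.card_insert_of_notMem,
    Finset.card_singleton]
  · norm_num
  · simpa using hSLJ.ne hne
  · simp [hd]
  · simpa [hd] using hSL.ne hne

lemma volume_fd_diff_fdo : volume (𝒟 \ 𝒟ᵒ) = 0 := by
  rw [volume_eq_lintegral]
  apply setLIntegral_measure_zero
  have hre : ∀ c : ℝ, volume {z : ℂ | z.re = c} = 0 := by
    intro c
    rw [← Complex.volume_preserving_equiv_real_prod.symm.measure_preimage_equiv]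
    have : Complex.measurableEquivRealProd.symm ⁻¹' {z : ℂ | z.re = c} = {c} ×ˢ Set.univ := by
      ext ⟨x, y⟩; simp [Complex.measurableEquivRealProd]
    rw [this, Measure.volume_eq_prod, Measure.prod_prod]
    simp
  have hsub : (UpperHalfPlane.coe '' (𝒟 \ 𝒟ᵒ)) ⊆
      Metric.sphere (0 : ℂ) 1 ∪ ({z : ℂ | z.re = 1 / 2} ∪ {z : ℂ | z.re = -(1 / 2)}) := by
    rintro _ ⟨z, ⟨⟨h1, h2⟩, h3⟩, rfl⟩
    by_contra hcon
    simp only [Set.mem_union, not_or, mem_ofPred_eq, mem_sphere_zero_iff_norm,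
      coe_re] at hcon
    apply h3
    refine ⟨lt_of_le_of_ne h1 fun h => hcon.1 ?_, lt_of_le_of_ne h2 fun h => ?_⟩
    · rw [Complex.normSq_eq_norm_sq] at h
      nlinarith [norm_nonneg (z : ℂ)]
    · rcases abs_choice z.re with h' | h'
      · exact hcon.2.1 (h' ▸ h)
      · exact hcon.2.2 (by linarith)
  refine measure_mono_null hsub (measure_union_null ?_ (measure_union_null (hre _) (hre _)))
  exact Measure.addHaar_sphere _ _ _

lemma measurableSet_fd : MeasurableSet 𝒟 := ModularGroup.isClosed_fd.measurableSet

lemma ae_tsum_indicator_fd :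
    ∀ᵐ z : ℍ, ∑' g : UMat, indicator 𝒟 (fun _ => (1 : ℝ≥0∞)) (g.toGL • z) = 4 := by
  have h : ∀ g : UMat, ∀ᵐ z : ℍ, g.toGL • z ∈ 𝒟 → g.toGL • z ∈ 𝒟ᵒ := by
    intro g
    rw [ae_iff]
    have : {z : ℍ | ¬ (g.toGL • z ∈ 𝒟 → g.toGL • z ∈ 𝒟ᵒ)} = (g.toGL • ·) ⁻¹' (𝒟 \ 𝒟ᵒ) := by
      ext z; simp
    rw [this, measure_preimage_smul, volume_fd_diff_fdo]
  filter_upwards [ae_all_iff.2 h] with z hz using tsum_indicator_fd hz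

/-- Unfolding over the fundamental domain. -/
lemma tsum_setLIntegral_fd {w : ℍ → ℝ≥0∞} (hw : Measurable w) :
    ∑' g : UMat, ∫⁻ z in 𝒟, w (g.toGL • z) = 4 * ∫⁻ z, w z := by
  have hm : ∀ g : GL (Fin 2) ℝ, Measurable (fun z : ℍ => g • z) := fun g => measurable_const_smul g
  have h1 : ∀ g : UMat, ∫⁻ z in 𝒟, w (g.inv.toGL • z)
      = ∫⁻ z, indicator 𝒟 (fun _ => (1 : ℝ≥0∞)) (g.toGL • z) * w z := by
    intro g
    rw [← lintegral_indicator measurableSet_fd]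
    have h2 : MeasurePreserving (fun z : ℍ => g.toGL • z) := measurePreserving_smul g.toGL volume
    rw [← h2.lintegral_comp (f := indicator 𝒟 fun z => w (g.inv.toGL • z))
      ((hw.comp (hm _)).indicator measurableSet_fd)]
    congr 1
    ext z
    by_cases h : g.toGL • z ∈ 𝒟
    · simp [indicator_of_mem h, toGL_inv]
    · simp [indicator_of_notMem h]
  rw [← invEquiv.tsum_eq]
  change ∑' g : UMat, ∫⁻ z in 𝒟, w (g.inv.toGL • z) = _
  rw [tsum_congr h1, ← lintegral_tsum, ← lintegral_const_mul _ hw]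
  · refine lintegral_congr_ae ?_
    filter_upwards [ae_tsum_indicator_fd] with z hz
    rw [ENNReal.tsum_mul_right, hz]
  · exact fun g => (((measurable_const.indicator measurableSet_fd).comp (hm _)).mul hw).aemeasurable

end UMat

namespace Cub

/-- An integral form as a real form. -/
abbrev toReal (f : Cub ℤ) : Cub ℝ := f.map (Int.castRingHom ℝ)

lemma disc_toReal (f : Cub ℤ) : f.toReal.disc = (f.disc : ℝ) := by
  simp [disc, map]

/-- The averaged number of times a form is reduced. -/
def redWeight (c : ℝ≥0∞) (f : Cub ℤ) : ℝ≥0∞ :=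
  (4 * c)⁻¹ * volume (𝒟 ∩ balSet f.toReal)

lemma redWeight_eq (c : ℝ≥0∞) (f : Cub ℤ) : redWeight c f
    = (4 * c)⁻¹ * ∫⁻ z in 𝒟, (balSet f.toReal).indicator 1 z := by
  rw [lintegral_indicator_one (measurableSet_balSet _), Measure.restrict_apply
    (measurableSet_balSet _), inter_comm, redWeight]

lemma tsum_redWeight {c : ℝ≥0∞} (hc0 : c ≠ 0) (hc : c ≠ ⊤) {f : Cub ℤ}
    (hf : balVol f.toReal = c) : ∑' g : UMat, redWeight c (sub g.1 f) = 1 := by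
  have hm : Measurable ((balSet f.toReal).indicator (1 : ℍ → ℝ≥0∞)) :=
    measurable_one.indicator (measurableSet_balSet _)
  simp only [redWeight_eq]
  rw [ENNReal.tsum_mul_left, ← UMat.transpose.tsum_eq]
  have : ∀ g : UMat, ∫⁻ z in 𝒟, (balSet (sub (UMat.transpose g).1 f).toReal).indicator 1 z
      = ∫⁻ z in 𝒟, (balSet f.toReal).indicator (1 : ℍ → ℝ≥0∞) (g.toGL • z) := by
    intro g
    congr 1
    ext z
    have h1 : (sub (UMat.transpose g).1 f).toReal = sub g.toGL.1.transpose f.toReal := by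
      rw [toReal, map_sub]; rfl
    rw [h1, balSet_sub _ g.abs_det_toGL]
    rfl
  rw [tsum_congr this, UMat.tsum_setLIntegral_fd hm, lintegral_indicator_one (measurableSet_balSet _)]
  change _ * (4 * balVol f.toReal) = 1
  rw [hf]
  exact ENNReal.inv_mul_cancel (by simpa using hc0) (mul_ne_top (by norm_num) hc)

lemma orbitWeight_redWeight {σ : ℤ} {c : ℝ≥0∞} (hc0 : c ≠ 0) (hc : c ≠ ⊤)
    (h : ∀ f : Cub ℝ, 0 < (σ : ℝ) * f.disc → balVol f = c) : OrbitWeight σ (redWeight c) where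
  tsum_eq f _ hd := tsum_redWeight hc0 hc (h _ (by rw [disc_toReal]; exact_mod_cast hd))
  scal_eq k hk f := by
    have h1 : balSet (scal k f).toReal = balSet f.toReal := by
      have : (scal k f).toReal = scal (k : ℝ) f.toReal := by
        simp [toReal, scal, map]
      rw [this]
      ext z
      exact balanced_scal (by exact_mod_cast hk) _ z
    rw [redWeight, redWeight, h1]

end Cub

/-- The two quantities differ by at most the third one. -/
def Near (A B E : ℝ≥0∞) : Prop := A ≤ B + E ∧ B ≤ A + E

namespace Near

variable {A B C E F : ℝ≥0∞}

lemma refl (A E : ℝ≥0∞) : Near A A E := ⟨le_self_add, le_self_add⟩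

lemma of_eq (h : A = B) : Near A B E := h ▸ refl A E

lemma symm (h : Near A B E) : Near B A E := ⟨h.2, h.1⟩

lemma mono (h : Near A B E) (hE : E ≤ F) : Near A B F :=
  ⟨h.1.trans (by gcongr), h.2.trans (by gcongr)⟩

lemma trans (h : Near A B E) (h' : Near B C F) : Near A C (E + F) := by
  constructor
  · calc A ≤ B + E := h.1
      _ ≤ C + F + E := by gcongr; exact h'.1
      _ = C + (E + F) := by ring
  · calc C ≤ B + F := h'.2
      _ ≤ A + E + F := by gcongr; exact h.2
      _ = A + (E + F) := by ring

lemma tsum {ι : Type*} {a b e : ι → ℝ≥0∞} (h : ∀ i, Near (a i) (b i) (e i)) :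
    Near (∑' i, a i) (∑' i, b i) (∑' i, e i) := by
  constructor
  · rw [← ENNReal.tsum_add]; exact ENNReal.tsum_le_tsum fun i => (h i).1
  · rw [← ENNReal.tsum_add]; exact ENNReal.tsum_le_tsum fun i => (h i).2

lemma sum {ι : Type*} {s : Finset ι} {a b e : ι → ℝ≥0∞} (h : ∀ i ∈ s, Near (a i) (b i) (e i)) :
    Near (∑ i ∈ s, a i) (∑ i ∈ s, b i) (∑ i ∈ s, e i) := by
  constructor
  · rw [← sum_add_distrib]; exact sum_le_sum fun i hi => (h i hi).1
  · rw [← sum_add_distrib]; exact sum_le_sum fun i hi => (h i hi).2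

lemma mul_left (c : ℝ≥0∞) (h : Near A B E) : Near (c * A) (c * B) (c * E) := by
  constructor
  · rw [← mul_add]; gcongr; exact h.1
  · rw [← mul_add]; gcongr; exact h.2

lemma lintegral {α : Type*} [MeasurableSpace α] {μ : Measure α} {a b e : α → ℝ≥0∞}
    (he : Measurable e) (h : ∀ x, Near (a x) (b x) (e x)) :
    Near (∫⁻ x, a x ∂μ) (∫⁻ x, b x ∂μ) (∫⁻ x, e x ∂μ) := by
  constructor
  · rw [← lintegral_add_right _ he]; exact lintegral_mono fun x => (h x).1
  · rw [← lintegral_add_right _ he]; exact lintegral_mono fun x => (h x).2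

lemma setLIntegral {α : Type*} [MeasurableSpace α] {μ : Measure α} {s : Set α}
    (hs : MeasurableSet s) {a b e : α → ℝ≥0∞}
    (he : Measurable e) (h : ∀ x ∈ s, Near (a x) (b x) (e x)) :
    Near (∫⁻ x in s, a x ∂μ) (∫⁻ x in s, b x ∂μ) (∫⁻ x in s, e x ∂μ) := by
  constructor
  · rw [← lintegral_add_right _ he]; exact setLIntegral_mono' hs fun x hx => (h x hx).1
  · rw [← lintegral_add_right _ he]; exact setLIntegral_mono' hs fun x hx => (h x hx).2

lemma abs_toReal_sub_le (h : Near A B E) (hB : B ≠ ⊤) (hE : E ≠ ⊤) :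
    A ≠ ⊤ ∧ |A.toReal - B.toReal| ≤ E.toReal := by
  have hA : A ≠ ⊤ := ne_top_of_le_ne_top (add_ne_top.2 ⟨hB, hE⟩) h.1
  refine ⟨hA, abs_sub_le_iff.2 ⟨?_, ?_⟩⟩
  · have := toReal_mono (add_ne_top.2 ⟨hB, hE⟩) h.1
    rw [toReal_add hB hE] at this
    linarith
  · have := toReal_mono (add_ne_top.2 ⟨hA, hE⟩) h.2
    rw [toReal_add hA hE] at this
    linarith

end Near

/-- The indicator of `A` changes at most at `h` points. -/
def Tame (h : ℕ) (A : Set ℝ) : Prop :=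
  ∃ S : Finset ℝ, S.card ≤ h ∧ ∀ x y, x ≤ y → (∀ s ∈ S, s ∉ Set.Icc x y) → (x ∈ A ↔ y ∈ A)

lemma card_int_Icc_le {x y : ℝ} (hxy : x ≤ y) :
    ∑' k : ℤ, (Icc x y).indicator (1 : ℝ → ℝ≥0∞) k ≤ ofReal (y - x + 1) := by
  have h1 : ∀ k : ℤ, (Icc x y).indicator (1 : ℝ → ℝ≥0∞) k
      = if k ∈ Finset.Icc ⌈x⌉ ⌊y⌋ then 1 else 0 := by
    intro k
    rw [indicator_apply]
    refine if_congr ?_ rfl rfl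
    simp [Int.ceil_le, Int.le_floor]
  rw [tsum_congr h1, tsum_eq_sum (s := Icc ⌈x⌉ ⌊y⌋) (fun k hk => if_neg hk),
    sum_ite_mem, Finset.inter_self, sum_const, nsmul_one, Int.card_Icc]
  rw [← ofReal_natCast]
  apply ofReal_le_ofReal
  rcases le_total (⌊y⌋ + 1 - ⌈x⌉) 0 with h | h
  · rw [Int.toNat_of_nonpos h]; simp; linarith
  · have : (((⌊y⌋ + 1 - ⌈x⌉).toNat : ℤ) : ℝ) = ((⌊y⌋ + 1 - ⌈x⌉ : ℤ) : ℝ) := by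
      rw [Int.toNat_of_nonneg h]
    rw [Int.cast_natCast] at this
    rw [this]
    push_cast
    linarith [Int.floor_le y, Int.le_ceil x]

lemma tsum_volume_inter_Ico {A : Set ℝ} (hm : MeasurableSet A) :
    ∑' k : ℤ, volume (A ∩ Ico (k : ℝ) (k + 1)) = volume A := by
  rw [← measure_iUnion]
  · rw [← inter_iUnion, iUnion_Ico_intCast, inter_univ]
  · intro i j hij
    exact (pairwise_disjoint_Ico_intCast ℝ hij).mono inter_subset_right inter_subset_right
  · exact fun k => hm.inter measurableSet_Ico

/-- Integer points in a tame set. -/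
lemma Tame.near {h : ℕ} {A : Set ℝ} (hA : Tame h A) (hm : MeasurableSet A) :
    Near (∑' k : ℤ, A.indicator 1 (k : ℝ)) (volume A) (2 * h) := by
  classical
  obtain ⟨S, hS, hc⟩ := hA
  have h1 : ∀ k : ℤ, Near (A.indicator 1 (k : ℝ)) (volume (A ∩ Set.Ico (k : ℝ) (k + 1)))
      (∑ s ∈ S, (Set.Icc (s - 1) s).indicator 1 (k : ℝ)) := by
    intro k
    by_cases hk : ∀ s ∈ S, s ∉ Set.Icc (k : ℝ) (k + 1)
    · apply Near.of_eq
      have h2 : ∀ t ∈ Set.Ico (k : ℝ) (k + 1), (k : ℝ) ∈ A ↔ t ∈ A := fun t ht =>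
        hc k t ht.1 fun s hs h' => hk s hs ⟨h'.1, h'.2.trans ht.2.le⟩
      by_cases h3 : (k : ℝ) ∈ A
      · rw [Set.indicator_of_mem h3, Set.inter_eq_right.2 fun t ht => (h2 t ht).1 h3]
        simp
      · rw [Set.indicator_of_notMem h3]
        have : A ∩ Set.Ico (k : ℝ) (k + 1) = ∅ := by
          ext t; simp only [Set.mem_inter_iff, Set.mem_empty_iff_false, iff_false]
          exact fun ⟨ht, ht'⟩ => h3 ((h2 t ht').2 ht)
        rw [this, measure_empty]
    · push Not at hk
      obtain ⟨s, hs, hs'⟩ := hk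
      have h2 : (1 : ℝ≥0∞) ≤ ∑ s ∈ S, (Set.Icc (s - 1) s).indicator 1 (k : ℝ) := by
        refine le_trans (le_of_eq ?_) (Finset.single_le_sum (fun _ _ => zero_le) hs)
        rw [Set.indicator_of_mem]; · rfl
        exact ⟨by linarith [hs'.2], hs'.1⟩
      constructor
      · refine le_trans ?_ (h2.trans le_add_self)
        exact Set.indicator_le (fun _ _ => le_rfl) _
      · refine le_trans ?_ (h2.trans le_add_self)
        calc volume (A ∩ Set.Ico (k : ℝ) (k + 1)) ≤ volume (Set.Ico (k : ℝ) (k + 1)) :=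
              measure_mono Set.inter_subset_right
          _ = 1 := by simp
  have h2 := Near.tsum h1
  rw [tsum_volume_inter_Ico hm] at h2
  refine h2.mono ?_
  rw [Summable.tsum_finsetSum (fun _ _ => ENNReal.summable)]
  calc ∑ s ∈ S, ∑' k : ℤ, (Set.Icc (s - 1) s).indicator (1 : ℝ → ℝ≥0∞) k
      ≤ ∑ s ∈ S, 2 := by
        refine Finset.sum_le_sum fun s _ => (card_int_Icc_le (by linarith)).trans ?_
        rw [show s - (s - 1) + 1 = 2 by ring]; simp
    _ = 2 * S.card := by rw [Finset.sum_const, nsmul_eq_mul, mul_comm]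
    _ ≤ 2 * h := by gcongr

lemma Tame.near' {h : ℕ} {A : Set ℝ} (hA : Tame h A) (hm : MeasurableSet A) {e : ℝ≥0∞}
    (he : A.Nonempty → 1 ≤ e) :
    Near (∑' k : ℤ, A.indicator 1 (k : ℝ)) (volume A) (2 * h * e) := by
  rcases A.eq_empty_or_nonempty with rfl | hn
  · apply Near.of_eq; simp
  · refine (hA.near hm).mono ?_
    calc (2 * h : ℝ≥0∞) = 2 * h * 1 := by rw [mul_one]
      _ ≤ _ := by gcongr; exact he hn

/-- Points of a lattice coset in a planar region which is tame along lines. -/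
lemma near_tsum_lattice {h : ℕ} {R : Set (ℝ × ℝ)} (hm : MeasurableSet R) {D : ℝ} (hD : 0 ≤ D)
    (hR : ∀ q ∈ R, |q.1| ≤ D ∧ |q.2| ≤ D) (ht : ∀ q v : ℝ × ℝ, Tame h {t : ℝ | q + t • v ∈ R})
    (q v w : ℝ × ℝ) {Δ : ℝ} (hΔ : 0 < Δ) (hvw : v.1 * w.2 - v.2 * w.1 = Δ) {ρ : ℝ}
    (hv : |v.1| ≤ ρ ∧ |v.2| ≤ ρ) (hw : |w.1| ≤ ρ ∧ |w.2| ≤ ρ) :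
    Near (∑' k : ℤ, ∑' t : ℤ, R.indicator 1 (q + (k : ℝ) • w + (t : ℝ) • v))
      ((ofReal Δ)⁻¹ * volume R) (2 * h * ofReal (8 * D * ρ / Δ + 1)) := by
  classical
  set I : Set ℝ := Icc ((-(2 * D * ρ) - (v.1 * q.2 - v.2 * q.1)) / Δ)
    ((2 * D * ρ - (v.1 * q.2 - v.2 * q.1)) / Δ) with hI
  set J : Set ℝ := Icc ((-(2 * D * ρ) - (q.1 * w.2 - q.2 * w.1)) / Δ)
    ((2 * D * ρ - (q.1 * w.2 - q.2 * w.1)) / Δ) with hJ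
  have hρ : 0 ≤ ρ := (abs_nonneg _).trans hv.1
  have hprod : ∀ a b c d : ℝ, |a| ≤ ρ → |b| ≤ D → |c| ≤ ρ → |d| ≤ D → |a * b - c * d| ≤ 2 * D * ρ := by
    intro a b c d ha hb hc hd
    have h1 : |a * b| ≤ ρ * D := by rw [abs_mul]; gcongr
    have h2 : |c * d| ≤ ρ * D := by rw [abs_mul]; gcongr
    linarith [abs_sub (a * b) (c * d)]
  have hk : ∀ k t : ℝ, q + k • w + t • v ∈ R → k ∈ I ∧ t ∈ J := by
    intro k t hp
    obtain ⟨h1, h2⟩ := hR _ hp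
    simp only [Prod.fst_add, Prod.snd_add, Prod.smul_fst, Prod.smul_snd, smul_eq_mul] at h1 h2
    have h3 := abs_le.1 (hprod _ _ _ _ hv.1 h2 hv.2 h1)
    have h4 := abs_le.1 (hprod _ _ _ _ hw.2 h1 hw.1 h2)
    have h5 : k * Δ = v.1 * (q.2 + k * w.2 + t * v.2) - v.2 * (q.1 + k * w.1 + t * v.1)
      - (v.1 * q.2 - v.2 * q.1) := by rw [← hvw]; ring
    have h6 : t * Δ = w.2 * (q.1 + k * w.1 + t * v.1) - w.1 * (q.2 + k * w.2 + t * v.2)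
      - (q.1 * w.2 - q.2 * w.1) := by rw [← hvw]; ring
    refine ⟨⟨?_, ?_⟩, ⟨?_, ?_⟩⟩
    · rw [div_le_iff₀ hΔ]; linarith
    · rw [le_div_iff₀ hΔ]; linarith
    · rw [div_le_iff₀ hΔ]; linarith
    · rw [le_div_iff₀ hΔ]; linarith
  have hmeas : ∀ a b : ℝ × ℝ, MeasurableSet {t : ℝ | a + t • b ∈ R} := fun a b =>
    hm.preimage (by fun_prop)
  have e1 : ∀ k : ℤ, Near (∑' t : ℤ, R.indicator 1 (q + (k : ℝ) • w + (t : ℝ) • v))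
      (volume {t : ℝ | q + (k : ℝ) • w + t • v ∈ R}) (2 * h * I.indicator 1 (k : ℝ)) := by
    intro k
    refine Near.trans (Near.of_eq (E := 0) rfl)
      ((ht (q + (k : ℝ) • w) v).near' (hmeas _ _) (e := I.indicator 1 (k : ℝ)) ?_) |>.mono
        (by rw [zero_add])
    rintro ⟨t, ht'⟩
    rw [indicator_of_mem (hk _ _ ht').1]; rfl
  have e2 : ∀ t : ℝ, Near (∑' k : ℤ, R.indicator (1 : ℝ × ℝ → ℝ≥0∞) (q + (k : ℝ) • w + t • v))
      (volume {s : ℝ | q + s • w + t • v ∈ R}) (2 * h * J.indicator 1 t) := by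
    intro t
    have hset : {s : ℝ | q + s • w + t • v ∈ R} = {s : ℝ | (q + t • v) + s • w ∈ R} := by
      ext s; simp only [mem_ofPred_eq]; rw [add_right_comm]
    have := (ht (q + t • v) w).near' (hmeas _ _) (e := J.indicator 1 t) ?_
    · rw [hset]
      convert this using 4 with k
      simp only [indicator_apply, mem_ofPred_eq, Pi.one_apply]
      rw [add_right_comm]
    · rintro ⟨s, hs⟩
      rw [mem_ofPred_eq, add_right_comm] at hs
      rw [indicator_of_mem (hk _ _ hs).2]; rfl
  have e3 : ∑' k : ℤ, volume {t : ℝ | q + (k : ℝ) • w + t • v ∈ R}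
      = ∫⁻ t : ℝ, ∑' k : ℤ, R.indicator (1 : ℝ × ℝ → ℝ≥0∞) (q + (k : ℝ) • w + t • v) := by
    have hmi : Measurable (R.indicator (1 : ℝ × ℝ → ℝ≥0∞)) := measurable_one.indicator hm
    refine Eq.trans ?_ (lintegral_tsum (f := fun (k : ℤ) t => R.indicator (1 : ℝ × ℝ → ℝ≥0∞)
      (q + (k : ℝ) • w + t • v)) fun k : ℤ => (hmi.comp (show Measurable fun t : ℝ => q + (k : ℝ) • w + t • v by
      fun_prop)).aemeasurable).symm
    refine tsum_congr fun k => ?_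
    rw [← lintegral_indicator_one (hmeas _ _)]
    rfl
  have e4 : ∫⁻ t : ℝ, volume {s : ℝ | q + s • w + t • v ∈ R} = (ofReal Δ)⁻¹ * volume R := by
    set f : ℝ × ℝ →ₗ[ℝ] ℝ × ℝ :=
      toLin (Module.Basis.finTwoProd ℝ) (Module.Basis.finTwoProd ℝ) !![v.1, w.1; v.2, w.2]
      with hf
    have hdet : LinearMap.det f = Δ := by
      rw [hf, LinearMap.det_toLin, det_fin_two_of, ← hvw]; ring
    have happ : ∀ t s : ℝ, f (t, s) = s • w + t • v := by
      intro t s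
      rw [hf, toLin_finTwoProd_apply]
      ext <;> simp <;> ring
    have h1 := Measure.addHaar_preimage_linearMap (volume : Measure (ℝ × ℝ)) (f := f)
      (by rw [hdet]; exact hΔ.ne') ((fun p => p + q) ⁻¹' R)
    rw [measure_preimage_add_right, hdet, abs_of_pos (inv_pos.2 hΔ), ofReal_inv_of_pos hΔ] at h1
    rw [← h1, Measure.volume_eq_prod, Measure.prod_apply]
    · refine lintegral_congr fun t => ?_
      congr 1
      ext s
      simp only [mem_ofPred_eq, Set.mem_preimage, happ]
      rw [add_comm _ q, add_assoc]
    · have : Continuous f := f.continuous_of_finiteDimensional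
      exact (hm.preimage (by fun_prop)).preimage this.measurable
  have hle : ∀ x : ℝ, (-(2 * D * ρ) - x) / Δ ≤ (2 * D * ρ - x) / Δ := by
    intro x; gcongr; nlinarith [mul_nonneg hD hρ]
  have hlen : ∀ x : ℝ, (2 * D * ρ - x) / Δ - (-(2 * D * ρ) - x) / Δ = 4 * D * ρ / Δ := by
    intro x; ring
  have h0 : 0 ≤ 4 * D * ρ / Δ := by positivity
  refine ((Near.tsum e1).trans ((Near.of_eq (E := 0) e3).trans
    ((Near.lintegral ((measurable_one.indicator measurableSet_Icc).const_mul _) e2).trans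
      (Near.of_eq (E := 0) e4)))).mono ?_
  rw [zero_add, add_zero, ENNReal.tsum_mul_left, lintegral_const_mul _
    (measurable_one.indicator measurableSet_Icc), ← mul_add, lintegral_indicator_one measurableSet_Icc]
  gcongr
  calc _ ≤ ofReal (4 * D * ρ / Δ + 1) + ofReal (4 * D * ρ / Δ) := by
        gcongr
        · rw [← hlen]; exact card_int_Icc_le (hle _)
        · rw [volume_Icc, hlen]
    _ = _ := by
        rw [← ofReal_add (by linarith) h0]
        congr 1; ring

/-- The supremum norm of an integral vector. -/
def supN (v : ℤ × ℤ) : ℕ := max v.1.natAbs v.2.natAbs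

lemma supN_pos {v : ℤ × ℤ} (hv : v ≠ 0) : 0 < supN v := by
  rw [Nat.pos_iff_ne_zero]
  intro h
  apply hv
  rw [supN, Nat.max_eq_zero_iff] at h
  exact Prod.ext (Int.natAbs_eq_zero.1 h.1) (Int.natAbs_eq_zero.1 h.2)

lemma supN_smul (g : ℕ) (v : ℤ × ℤ) : supN ((g : ℤ) • v) = g * supN v := by
  simp [supN, Int.natAbs_mul, Nat.mul_max_mul_left]

lemma exists_short_vector {n : ℕ} (hn : 0 < n) (r : ℤ) :
    ∃ v : ℤ × ℤ, v ≠ 0 ∧ (n : ℤ) ∣ v.1 * r + v.2 ∧ supN v ^ 2 ≤ n := by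
  have hm : 0 < n.sqrt := Nat.sqrt_pos.2 hn
  obtain ⟨j, k, hk0, hkm, h⟩ := exists_int_int_abs_mul_sub_le ((r : ℝ) / n) hm
  have hn' : (0 : ℝ) < n := by exact_mod_cast hn
  refine ⟨(k, j * n - k * r), ?_, ⟨j, by ring⟩, ?_⟩
  · intro h0
    have := congrArg Prod.fst h0
    simp at this; omega
  · have h1 : |(k : ℝ) * r - j * n| ≤ n / (n.sqrt + 1) := by
      have : (k : ℝ) * r - j * n = n * ((k : ℝ) * (r / n) - j) := by field_simp
      rw [this, abs_mul, abs_of_pos hn']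
      calc _ ≤ (n : ℝ) * (1 / ((n.sqrt : ℝ) + 1)) := by gcongr
        _ = _ := by ring
    have h2 : (n : ℝ) / (n.sqrt + 1) < n.sqrt + 1 := by
      rw [div_lt_iff₀ (by positivity)]
      exact_mod_cast Nat.lt_succ_sqrt n
    have h3 : |k * r - j * n| < (n.sqrt : ℤ) + 1 := by
      exact_mod_cast h1.trans_lt h2
    have h4 : supN (k, j * n - k * r) ≤ n.sqrt := by
      rw [supN, max_le_iff]
      constructor
      · simp; omega
      · simp; rw [abs_lt] at h3; omega
    calc _ ≤ n.sqrt ^ 2 := Nat.pow_le_pow_left h4 2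
      _ ≤ n := Nat.sqrt_le' n

/-- A reduced basis of the lattice `{(c, d) : n ∣ c r + d}`. -/
lemma exists_reduced_basis {n : ℕ} (hn : 0 < n) (r : ℤ) :
    ∃ v w : ℤ × ℤ, v ≠ 0 ∧ (n : ℤ) ∣ v.1 * r + v.2 ∧ (n : ℤ) ∣ w.1 * r + w.2 ∧
      v.1 * w.2 - v.2 * w.1 = n ∧ supN v ^ 2 ≤ n ∧ supN v * supN w ≤ 2 * n := by
  classical
  have hex : ∃ s, ∃ v : ℤ × ℤ, v ≠ 0 ∧ (n : ℤ) ∣ v.1 * r + v.2 ∧ supN v = s :=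
    let ⟨v, h1, h2, _⟩ := exists_short_vector hn r
    ⟨_, v, h1, h2, rfl⟩
  obtain ⟨v, hv0, hv, hvs⟩ := Nat.find_spec hex
  have hmin : ∀ v' : ℤ × ℤ, v' ≠ 0 → (n : ℤ) ∣ v'.1 * r + v'.2 → supN v ≤ supN v' := by
    intro v' h1 h2
    rw [hvs]
    exact Nat.find_min' hex ⟨v', h1, h2, rfl⟩
  have hsq : supN v ^ 2 ≤ n := by
    obtain ⟨v', h1, h2, h3⟩ := exists_short_vector hn r
    exact (Nat.pow_le_pow_left (hmin v' h1 h2) 2).trans h3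
  obtain ⟨m, hm⟩ := hv
  have hcop : IsCoprime v.1 m := by
    rw [Int.isCoprime_iff_gcd_eq_one]
    obtain ⟨a, ha⟩ : (Int.gcd v.1 m : ℤ) ∣ v.1 := Int.gcd_dvd_left ..
    obtain ⟨b, hb⟩ : (Int.gcd v.1 m : ℤ) ∣ m := Int.gcd_dvd_right ..
    set g := Int.gcd v.1 m
    have hvg : v = (g : ℤ) • ((a, n * b - a * r) : ℤ × ℤ) := by
      refine Prod.ext (by simpa using ha) ?_
      have : v.2 = n * m - v.1 * r := by linarith
      rw [this, hb, ha]
      simp; ring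
    have h0 : ((a, n * b - a * r) : ℤ × ℤ) ≠ 0 := by
      intro h; rw [h, smul_zero] at hvg; exact hv0 hvg
    have h1 := hmin _ h0 ⟨b, by ring⟩
    rw [hvg, supN_smul] at h1
    have h2 := supN_pos h0
    have h3 : g ≤ 1 := by
      by_contra h
      push Not at h
      nlinarith
    have h4 : g ≠ 0 := by
      rintro h
      rw [h] at hvg
      exact hv0 (by rw [hvg]; simp)
    omega
  obtain ⟨a, b, hab⟩ := hcop
  have hv2 : v.2 = n * m - v.1 * r := by linarith
  have key : ∀ j : ℤ, (n : ℤ) ∣ (-b + j * v.1) * r + (b * r + n * a + j * v.2) ∧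
      v.1 * (b * r + n * a + j * v.2) - v.2 * (-b + j * v.1) = n := by
    intro j
    refine ⟨⟨a + j * m, ?_⟩, ?_⟩
    · rw [hv2]; ring
    · have : v.1 * (b * r + n * a + j * v.2) - v.2 * (-b + j * v.1)
          = n * (a * v.1 + b * m) - b * (n * m - v.1 * r) + b * v.2 := by ring
      rw [this, hab, hv2]; ring
  have hfin : ∀ x y z t : ℤ, y.natAbs ≤ x.natAbs → x.natAbs ^ 2 ≤ n → z = z % x → x ≠ 0 →
      (x * t = y * z + n ∨ x * t = y * z - n) →
      x.natAbs * max t.natAbs z.natAbs ≤ 2 * n := by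
    intro x y z t hyx hxn hz hx ht
    have hzx : z.natAbs ≤ x.natAbs := by
      have h1 := Int.emod_nonneg z hx
      have h2 := Int.emod_lt_abs z hx
      rw [← hz] at h1 h2
      rw [Int.abs_eq_natAbs] at h2
      omega
    have h1 : x.natAbs * z.natAbs ≤ n :=
      (Nat.mul_le_mul_left _ hzx).trans (by rwa [← sq])
    have h2 : x.natAbs * t.natAbs ≤ 2 * n := by
      rw [← Int.natAbs_mul]
      have h3 : (y * z).natAbs ≤ n := by
        rw [Int.natAbs_mul]
        exact (Nat.mul_le_mul hyx hzx).trans (by rwa [← sq])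
      rcases ht with h | h <;> rw [h] <;> omega
    rw [← Nat.mul_max_mul_left]
    exact max_le h2 (by omega)
  rcases le_total v.1.natAbs v.2.natAbs with hle | hle
  · have hs : supN v = v.2.natAbs := max_eq_right hle
    have hx : v.2 ≠ 0 := by
      intro h; have := supN_pos hv0; rw [hs, h] at this; simp at this
    obtain ⟨h1, h2⟩ := key (-((b * r + n * a) / v.2))
    have h3 : b * r + n * a + -((b * r + n * a) / v.2) * v.2 = (b * r + n * a) % v.2 := by
      rw [Int.emod_def]; ring
    refine ⟨v, (_, _), hv0, ⟨m, hm⟩, h1, h2, hsq, ?_⟩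
    rw [hs]
    refine hfin v.2 v.1 _ _ hle (hs ▸ hsq) ?_ hx (Or.inr ?_)
    · rw [h3, Int.emod_emod]
    · linarith
  · have hs : supN v = v.1.natAbs := max_eq_left hle
    have hx : v.1 ≠ 0 := by
      intro h; have := supN_pos hv0; rw [hs, h] at this; simp at this
    obtain ⟨h1, h2⟩ := key (-(-b / v.1))
    have h3 : -b + -(-b / v.1) * v.1 = -b % v.1 := by
      rw [Int.emod_def]; ring
    refine ⟨v, (_, _), hv0, ⟨m, hm⟩, h1, h2, hsq, ?_⟩
    rw [hs, supN, max_comm]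
    refine hfin v.1 v.2 _ _ hle (hs ▸ hsq) ?_ hx (Or.inl ?_)
    · rw [h3, Int.emod_emod]
    · linarith

/-- Parametrisation of a lattice coset by a basis. -/
lemma tsum_lattice_coset {n : ℕ} (hn : 0 < n) {r κ : ℤ} {v w : ℤ × ℤ}
    (hv : (n : ℤ) ∣ v.1 * r + v.2) (hw : (n : ℤ) ∣ w.1 * r + w.2)
    (hvw : v.1 * w.2 - v.2 * w.1 = n) (F : ℤ → ℤ → ℝ≥0∞) :
    ∑' c : ℤ, ∑' d : ℤ, (if (n : ℤ) ∣ κ + c * r + d then F c d else 0)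
      = ∑' k : ℤ, ∑' t : ℤ, F (k * w.1 + t * v.1) (-κ + k * w.2 + t * v.2) := by
  have hn' : (n : ℤ) ≠ 0 := by exact_mod_cast hn.ne'
  rw [← ENNReal.tsum_prod (f := fun c d => if (n : ℤ) ∣ κ + c * r + d then F c d else 0),
    ← ENNReal.tsum_prod (f := fun k t => F (k * w.1 + t * v.1) (-κ + k * w.2 + t * v.2))]
  have hsupp : Function.support (fun p : ℤ × ℤ => if (n : ℤ) ∣ κ + p.1 * r + p.2 then F p.1 p.2 else 0)
      ⊆ Set.range (fun q : ℤ × ℤ =>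
        ((q.1 * w.1 + q.2 * v.1, -κ + q.1 * w.2 + q.2 * v.2) : ℤ × ℤ)) := by
    intro p hp
    simp at hp
    obtain ⟨m, hm⟩ := hp.1
    obtain ⟨x, hx⟩ := hv
    obtain ⟨y, hy⟩ := hw
    refine ⟨(v.1 * m - x * p.1, p.1 * y - w.1 * m), Prod.ext ?_ ?_⟩
    · apply mul_left_cancel₀ hn'
      simp only
      linear_combination (p.1 * w.1) * hx - (p.1 * v.1) * hy + p.1 * hvw
    · apply mul_left_cancel₀ hn'
      simp only
      linear_combination n * m * hvw - p.1 * v.2 * hy + p.1 * w.2 * hx - p.1 * r * hvw - n * hm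
  have hinj : Function.Injective (fun q : ℤ × ℤ =>
        ((q.1 * w.1 + q.2 * v.1, -κ + q.1 * w.2 + q.2 * v.2) : ℤ × ℤ)) := by
    intro q q' h
    have h1 := congrArg Prod.fst h
    have h2 := congrArg Prod.snd h
    simp at h1 h2
    refine Prod.ext (mul_left_cancel₀ hn' ?_) (mul_left_cancel₀ hn' ?_)
    · rw [← hvw]; linear_combination v.1 * h2 - v.2 * h1
    · rw [← hvw]; linear_combination w.2 * h1 - w.1 * h2
  rw [← hinj.tsum_eq hsupp]
  refine tsum_congr fun q => if_pos ?_
  obtain ⟨x, hx⟩ := hv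
  obtain ⟨y, hy⟩ := hw
  exact ⟨q.1 * y + q.2 * x, by linear_combination q.1 * hy + q.2 * hx⟩

lemma sum_box_inv (m : ℕ) : ∑ j ∈ Icc 1 m, ∑ v ∈ (Finset.box j : Finset (ℤ × ℤ)),
    (1 / (supN v : ℝ)) = 8 * m := by
  have : ∀ j ∈ Finset.Icc 1 m, ∑ v ∈ (box j : Finset (ℤ × ℤ)), (1 / (supN v : ℝ)) = 8 := by
    intro j hj
    have hj0 : j ≠ 0 := by rw [Finset.mem_Icc] at hj; omega
    have hj' : (j : ℝ) ≠ 0 := by exact_mod_cast hj0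
    rw [sum_congr rfl fun v hv => by rw [show supN v = j from Int.mem_box.1 hv],
      sum_const, Int.card_box hj0]
    simp; field_simp
  rw [sum_congr rfl this]
  simp [mul_comm]

open Classical in
/-- Each vector lies in few of the lattices. -/
lemma card_lattices_le {n : ℕ} (hn : 0 < n) (v : ℤ × ℤ) :
    (((range n).filter fun r : ℕ => (n : ℤ) ∣ v.1 * r + v.2).card : ℝ)
      ≤ ∑ g ∈ n.divisors.filter fun g : ℕ => ∃ v' : ℤ × ℤ, v = (g : ℤ) • v', (g : ℝ) := by
  set g := Int.gcd v.1 n with hg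
  have hgn : g ∣ n := by
    have : (g : ℤ) ∣ n := Int.gcd_dvd_right ..
    exact_mod_cast this
  have hg0 : 0 < g := Nat.pos_of_dvd_of_pos hgn hn
  rcases (filter (fun r : ℕ => (n : ℤ) ∣ v.1 * r + v.2) (range n)).eq_empty_or_nonempty
    with he | ⟨r₀, hr₀⟩
  · rw [he]; simp; exact sum_nonneg fun _ _ => by positivity
  have hgv1 : (g : ℤ) ∣ v.1 := Int.gcd_dvd_left ..
  have hgv2 : (g : ℤ) ∣ v.2 := by
    have h1 := (mem_filter.1 hr₀).2
    exact (Int.dvd_add_right (hgv1.mul_right _)).1 ((Int.natCast_dvd_natCast.2 hgn).trans h1)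
  have hmem : g ∈ n.divisors.filter fun g : ℕ => ∃ v' : ℤ × ℤ, v = (g : ℤ) • v' := by
    rw [mem_filter, Nat.mem_divisors]
    obtain ⟨a, ha⟩ := hgv1
    obtain ⟨b, hb⟩ := hgv2
    exact ⟨⟨hgn, hn.ne'⟩, (a, b), Prod.ext (by simpa using ha) (by simpa using hb)⟩
  refine le_trans ?_ (single_le_sum (f := fun g : ℕ => (g : ℝ)) (fun _ _ => by positivity) hmem)
  obtain ⟨q, hq⟩ := hgn
  have hq0 : 0 < q := by rcases Nat.eq_zero_or_pos q with h | h; · simp [h] at hq; omega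
                         · exact h
  have hcard : (filter (fun r : ℕ => (n : ℤ) ∣ v.1 * r + v.2) (range n)).card
      ≤ (range g).card := by
    refine card_le_card_of_injOn (fun r => r / q) ?_ ?_
    · intro r hr
      simp at hr
      simp
      rw [Nat.div_lt_iff_lt_mul hq0, ← hq]; exact hr.1
    · intro r hr r' hr' h
      simp at hr hr'
      have h1 : (n : ℤ) ∣ v.1 * (r - r') := by
        have := dvd_sub hr.2 hr'.2
        have e : v.1 * (r : ℤ) + v.2 - (v.1 * r' + v.2) = v.1 * (r - r') := by ring
        rwa [e] at this
      have h2 : (q : ℤ) ∣ (r : ℤ) - r' := by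
        have hgz : (g : ℤ) ≠ 0 := by exact_mod_cast hg0.ne'
        obtain ⟨a, ha⟩ := hgv1
        have hnz : (n : ℤ) = g * q := by exact_mod_cast hq
        have h3 : IsCoprime (q : ℤ) a := by
          rw [Int.isCoprime_iff_gcd_eq_one]
          have h4 : g = g * Int.gcd a q := by
            conv_lhs => rw [hg, ha, hnz, Int.gcd_mul_left]
            simp
          rw [Int.gcd_comm]
          exact Nat.eq_of_mul_eq_mul_left hg0 (by omega)
        rw [ha, hnz, mul_assoc] at h1
        exact h3.dvd_of_dvd_mul_left ((mul_dvd_mul_iff_left hgz).1 h1)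
      have h5 : r % q = r' % q := by
        have : (r' : ℤ) ≡ r [ZMOD q] := (Int.modEq_iff_dvd).2 h2
        exact ((Int.natCast_modEq_iff).1 this).symm
      rw [← Nat.div_add_mod r q, ← Nat.div_add_mod r' q, h5]
      simp at h
      rw [h]
  rw [card_range] at hcard
  exact_mod_cast hcard

lemma sum_inv_supN_le {n : ℕ} (hn : 0 < n) (v : ℕ → ℤ × ℤ)
    (hv : ∀ r, v r ≠ 0 ∧ (n : ℤ) ∣ (v r).1 * r + (v r).2 ∧ supN (v r) ^ 2 ≤ n) :
    ∑ r ∈ range n, (1 / (supN (v r) : ℝ)) ≤ 8 * n.divisors.card * √n := by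
  classical
  set m := n.sqrt
  set V : ℕ → Finset (ℤ × ℤ) := fun m => (Finset.Icc 1 m).biUnion fun j => box j with hV
  have hmemV : ∀ m v, v ∈ V m ↔ v ≠ 0 ∧ supN v ≤ m := by
    intro m v
    simp only [hV, Finset.mem_biUnion, Finset.mem_Icc, Int.mem_box]
    constructor
    · rintro ⟨j, hj, h⟩
      change supN v = j at h
      refine ⟨?_, by omega⟩
      rintro rfl
      simp [supN] at h; omega
    · intro ⟨h1, h2⟩
      exact ⟨supN v, ⟨supN_pos h1, h2⟩, rfl⟩
  have hsumV : ∀ m, ∑ v ∈ V m, (1 / (supN v : ℝ)) = 8 * m := by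
    intro m
    rw [hV, sum_biUnion, sum_box_inv]
    intro i _ j _ hij
    rw [Function.onFun, Finset.disjoint_left]
    intro x hx hx'
    rw [Int.mem_box] at hx hx'
    exact hij (hx.symm.trans hx')
  have hmaps : ∀ r ∈ range n, v r ∈ V m := fun r _ =>
    (hmemV _ _).2 ⟨(hv r).1, Nat.le_sqrt'.2 (hv r).2.2⟩
  rw [← sum_fiberwise_of_maps_to hmaps]
  calc ∑ x ∈ V m, ∑ r ∈ range n with v r = x, (1 / (supN (v r) : ℝ))
      ≤ ∑ x ∈ V m, ∑ g ∈ n.divisors, (if ∃ v' : ℤ × ℤ, x = (g : ℤ) • v' then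
          (g : ℝ) * (1 / (supN x : ℝ)) else 0) := by
        refine sum_le_sum fun x _ => ?_
        rw [sum_congr rfl fun r hr => by rw [(mem_filter.1 hr).2], sum_const,
          nsmul_eq_mul, ← sum_filter, ← sum_mul]
        gcongr
        refine le_trans ?_ (card_lattices_le hn x)
        norm_cast
        refine card_le_card fun r hr => ?_
        rw [mem_filter] at hr ⊢
        exact ⟨hr.1, hr.2 ▸ (hv r).2.1⟩
    _ = ∑ g ∈ n.divisors, ∑ x ∈ V m, (if ∃ v' : ℤ × ℤ, x = (g : ℤ) • v' then
          (g : ℝ) * (1 / (supN x : ℝ)) else 0) := sum_comm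
    _ ≤ ∑ g ∈ n.divisors, ∑ x ∈ V m, (1 / (supN x : ℝ)) := by
        refine sum_le_sum fun g hg => ?_
        have hg0 : 0 < g := Nat.pos_of_mem_divisors hg
        have hgz : (g : ℤ) ≠ 0 := by exact_mod_cast hg0.ne'
        rw [← Finset.sum_filter]
        have hsub : (V m).filter (fun x => ∃ v' : ℤ × ℤ, x = (g : ℤ) • v')
            ⊆ (V m).image (fun x => (g : ℤ) • x) := by
          intro x hx
          obtain ⟨hx1, v', rfl⟩ := mem_filter.1 hx
          refine mem_image.2 ⟨v', ?_, rfl⟩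
          rw [hmemV, supN_smul] at hx1
          rw [hmemV]
          exact ⟨fun h => hx1.1 (by rw [h, smul_zero]), (Nat.le_mul_of_pos_left _ hg0).trans hx1.2⟩
        refine (sum_le_sum_of_subset_of_nonneg hsub fun _ _ _ => by positivity).trans ?_
        rw [sum_image fun a _ b _ h => smul_right_injective _ hgz h]
        refine sum_le_sum fun x _ => le_of_eq ?_
        rw [supN_smul]
        have : (g : ℝ) ≠ 0 := by exact_mod_cast hg0.ne'
        push_cast
        rw [one_div, one_div, mul_inv, mul_inv_cancel_left₀ this]
    _ = 8 * n.divisors.card * m := by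
        rw [sum_congr rfl fun g _ => hsumV m, sum_const, nsmul_eq_mul]; ring
    _ ≤ _ := by
        gcongr
        exact nat_sqrt_le_real_sqrt

lemma supN_le_iff {v : ℤ × ℤ} {ρ : ℝ} : (supN v : ℝ) ≤ ρ ↔ |(v.1 : ℝ)| ≤ ρ ∧ |(v.2 : ℝ)| ≤ ρ := by
  rw [supN, Nat.cast_max, max_le_iff, Nat.cast_natAbs, Nat.cast_natAbs, Int.cast_abs, Int.cast_abs]

/-- Averaged over all linear congruences to the modulus `n`, the number of solutions in a planar
region is close to its area. -/
lemma near_sum_congruence {h : ℕ} {R : Set (ℝ × ℝ)} (hm : MeasurableSet R) {D : ℝ} (hD : 0 ≤ D)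
    (hR : ∀ q ∈ R, |q.1| ≤ D ∧ |q.2| ≤ D) (ht : ∀ q v : ℝ × ℝ, Tame h {t : ℝ | q + t • v ∈ R})
    {n : ℕ} (hn : 0 < n) (κ : ℕ → ℤ) :
    Near (∑ r ∈ range n, ∑' c : ℤ, ∑' d : ℤ,
        if (n : ℤ) ∣ κ r + c * r + d then R.indicator 1 ((c : ℝ), (d : ℝ)) else 0)
      (volume R) (2 * h * ofReal (128 * D * n.divisors.card * √n + n)) := by
  have hn' : (0 : ℝ) < n := by exact_mod_cast hn
  choose v w hv0 hv hw hvw hvn hvwn using fun r : ℕ => exists_reduced_basis hn (r : ℤ)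
  have h1 : ∀ r ∈ range n, Near (∑' c : ℤ, ∑' d : ℤ,
        if (n : ℤ) ∣ κ r + c * r + d then R.indicator 1 ((c : ℝ), (d : ℝ)) else 0)
      ((ofReal n)⁻¹ * volume R)
      (2 * h * ofReal (16 * D * (1 / (supN (v r) : ℝ)) + 1)) := by
    intro r _
    rw [tsum_lattice_coset hn (hv r) (hw r) (hvw r)]
    have hs : (0 : ℝ) < supN (v r) := by exact_mod_cast supN_pos (hv0 r)
    have hsn : (supN (v r) : ℝ) ^ 2 ≤ n := by exact_mod_cast hvn r
    have hswn : (supN (v r) : ℝ) * supN (w r) ≤ 2 * n := by exact_mod_cast hvwn r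
    have := near_tsum_lattice hm hD hR ht (0, -(κ r : ℝ)) (((v r).1 : ℝ), ((v r).2 : ℝ))
      (((w r).1 : ℝ), ((w r).2 : ℝ)) hn' (by simpa using congrArg (Int.cast (R := ℝ)) (hvw r)) (ρ := 2 * n / supN (v r))
      (supN_le_iff.1 (by rw [le_div_iff₀ hs]; nlinarith))
      (supN_le_iff.1 (by rw [le_div_iff₀ hs]; linarith))
    have e : 8 * D * (2 * n / supN (v r)) / n + 1 = 16 * D * (1 / (supN (v r) : ℝ)) + 1 := by
      field_simp; ring
    rw [e] at this
    refine Near.trans (Near.of_eq (E := 0) ?_) this |>.mono (by rw [zero_add])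
    refine tsum_congr fun k => tsum_congr fun t => ?_
    congr 1
    simp
  refine ((Near.sum h1).trans (Near.of_eq (E := 0) ?_)).mono ?_
  · rw [sum_const, card_range, nsmul_eq_mul, ← mul_assoc, ofReal_natCast,
      ENNReal.mul_inv_cancel (by exact_mod_cast hn.ne') (natCast_ne_top n), one_mul]
  · rw [add_zero, ← mul_sum, ← ofReal_sum_of_nonneg fun r _ => by positivity]
    gcongr
    rw [sum_add_distrib, ← mul_sum]
    have := sum_inv_supN_le hn v fun r => ⟨hv0 r, hv r, hvn r⟩
    simp only [sum_const, card_range, nsmul_eq_mul, mul_one]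
    nlinarith

/-- The count of cubic congruences, with the two leading coefficients summed as well. -/
lemma near_sum_congruence₃ {h : ℕ} {R : Set ℝ³} (hm : MeasurableSet R) {B C D : ℝ}
    (hB : 0 ≤ B) (hC : 0 ≤ C) (hCD : C ≤ D)
    (hR : ∀ q ∈ R, |q.1| ≤ B ∧ |q.2.1| ≤ C ∧ |q.2.2| ≤ D)
    (ht : ∀ q v : ℝ³, Tame h {t : ℝ | q + t • v ∈ R})
    {n : ℕ} (hn : 0 < n) (κ : ℤ → ℕ → ℤ) :
    Near (∑' b : ℤ, ∑ r ∈ range n, ∑' c : ℤ, ∑' d : ℤ,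
        if (n : ℤ) ∣ κ b r + c * r + d then R.indicator 1 ((b : ℝ), (c : ℝ), (d : ℝ)) else 0)
      (volume R) (2 * h * ofReal ((2 * B + 1) * (128 * D * n.divisors.card * √n + n)
        + 4 * C * D)) := by
  have hD : 0 ≤ D := hC.trans hCD
  have h1 : ∀ b : ℤ, Near (∑ r ∈ range n, ∑' c : ℤ, ∑' d : ℤ,
        if (n : ℤ) ∣ κ b r + c * r + d then R.indicator 1 ((b : ℝ), (c : ℝ), (d : ℝ)) else 0)
      (volume {q : ℝ × ℝ | ((b : ℝ), q) ∈ R})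
      ((2 * h * ofReal (128 * D * n.divisors.card * √n + n)) *
        (Icc (-B) B).indicator 1 (b : ℝ)) := by
    intro b
    by_cases hb : (b : ℝ) ∈ Icc (-B) B
    · rw [indicator_of_mem hb, Pi.one_apply, mul_one]
      refine near_sum_congruence (R := {q : ℝ × ℝ | ((b : ℝ), q) ∈ R})
        (hm.preimage (by fun_prop)) hD ?_ ?_ hn (κ b)
      · intro q hq
        obtain ⟨_, h2, h3⟩ := hR _ hq
        exact ⟨h2.trans hCD, h3⟩
      · intro q v
        have := ht (b, q) (0, v)
        simpa using this
    · have h0 : ∀ q, ((b : ℝ), q) ∉ R := fun q hq => hb (abs_le.1 (hR _ hq).1)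
      apply Near.of_eq
      simp [h0]
  have h2 := Near.tsum h1
  have h3 : ∑' b : ℤ, volume {q : ℝ × ℝ | ((b : ℝ), q) ∈ R}
      = ∫⁻ q : ℝ × ℝ, ∑' b : ℤ, R.indicator (1 : ℝ³ → ℝ≥0∞) ((b : ℝ), q) := by
    have hmi : Measurable (R.indicator (1 : ℝ³ → ℝ≥0∞)) := measurable_one.indicator hm
    refine Eq.trans ?_ (lintegral_tsum (f := fun (b : ℤ) (q : ℝ × ℝ) =>
      R.indicator (1 : ℝ³ → ℝ≥0∞) ((b : ℝ), q)) fun b =>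
        (hmi.comp (by fun_prop)).aemeasurable).symm
    refine tsum_congr fun b => ?_
    exact (lintegral_indicator_one (hm.preimage
      (by fun_prop : Measurable fun q : ℝ × ℝ => ((b : ℝ), q)))).symm
  set J : Set (ℝ × ℝ) := Icc (-C) C ×ˢ Icc (-D) D with hJ
  have hJm : MeasurableSet J := measurableSet_Icc.prod measurableSet_Icc
  have h4 : ∀ q : ℝ × ℝ, Near (∑' b : ℤ, R.indicator (1 : ℝ³ → ℝ≥0∞) ((b : ℝ), q))
      (volume {b : ℝ | (b, q) ∈ R}) (2 * h * J.indicator 1 q) := by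
    intro q
    have htq : Tame h {b : ℝ | (b, q) ∈ R} := by
      have := ht (0, q) (1, 0)
      simpa using this
    exact htq.near' (hm.preimage (by fun_prop)) fun ⟨b, hb⟩ => by
      rw [indicator_of_mem]; · rfl
      exact ⟨abs_le.1 (hR _ hb).2.1, abs_le.1 (hR _ hb).2.2⟩
  have h5 : ∫⁻ q : ℝ × ℝ, volume {b : ℝ | (b, q) ∈ R} = volume R := by
    conv_rhs => rw [Measure.volume_eq_prod, Measure.prod_apply_symm hm]
    rfl
  refine (h2.trans ((Near.of_eq (E := 0) h3).trans ((Near.lintegral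
    ((measurable_one.indicator hJm).const_mul _) h4).trans (Near.of_eq (E := 0) h5)))).mono ?_
  rw [zero_add, add_zero, ENNReal.tsum_mul_left, lintegral_const_mul _ (measurable_one.indicator hJm),
    lintegral_indicator_one hJm, mul_assoc, ← mul_add, 
    ofReal_add (p := (2 * B + 1) * _) (by positivity) (by positivity)]
  have h6 : ∑' b : ℤ, (Icc (-B) B).indicator (1 : ℝ → ℝ≥0∞) (b : ℝ) ≤ ofReal (2 * B + 1) :=
    (card_int_Icc_le (by linarith)).trans (le_of_eq (by congr 1; ring))
  have h7 : volume J = ofReal (4 * C * D) := by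
    rw [hJ, Measure.volume_eq_prod, Measure.prod_prod, volume_Icc, volume_Icc,
      ← ofReal_mul (by linarith)]
    congr 1; ring
  rw [h7, mul_comm (ofReal _) (∑' b : ℤ, _)]
  gcongr 2 * (h : ℝ≥0∞) * (?_ + _)
  rw [ofReal_mul (by positivity)]
  gcongr

namespace Cub

/-- The number of roots of `f(r, 1)` modulo `n`. -/
def nu (n : ℕ) (f : Cub ℤ) : ℕ := ((range n).filter fun r : ℕ => (n : ℤ) ∣ f.ev r 1).card

lemma nu_eq (n : ℕ) [NeZero n] (f : Cub ℤ) :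
    nu n f = Nat.card {x : ZMod n // (f.map (Int.castRingHom (ZMod n))).ev x 1 = 0} := by
  classical
  have hz : ∀ r : ℕ, (n : ℤ) ∣ f.ev r 1 ↔ (f.map (Int.castRingHom (ZMod n))).ev (r : ZMod n) 1 = 0 := by
    intro r
    have := ev_map (Int.castRingHom (ZMod n)) f r 1
    rw [← ZMod.intCast_zmod_eq_zero_iff_dvd, ← eq_intCast (Int.castRingHom (ZMod n)), ← this]
    simp
  rw [Nat.card_eq_fintype_card, Fintype.card_subtype, nu]
  refine card_bij (fun r _ => (r : ZMod n)) ?_ ?_ ?_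
  · intro r hr
    simpa [hz] using (mem_filter.1 hr).2
  · intro r hr s hs h
    have h1 := mem_range.1 (mem_filter.1 hr).1
    have h2 := mem_range.1 (mem_filter.1 hs).1
    have := congrArg ZMod.val h
    rwa [ZMod.val_natCast_of_lt h1, ZMod.val_natCast_of_lt h2] at this
  · intro x hx
    have hx' := (mem_filter.1 hx).2
    refine ⟨x.val, ?_, ZMod.natCast_zmod_val x⟩
    rw [mem_filter, Finset.mem_range, hz, ZMod.natCast_zmod_val]
    exact ⟨x.val_lt, hx'⟩

lemma nu_mul {m n : ℕ} [NeZero m] [NeZero n] (h : m.Coprime n) (f : Cub ℤ) :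
    nu (m * n) f = nu m f * nu n f := by
  have : NeZero (m * n) := ⟨mul_ne_zero (NeZero.ne m) (NeZero.ne n)⟩
  rw [nu_eq, nu_eq, nu_eq, ← Nat.card_prod]
  set e := ZMod.chineseRemainder h
  have hc : ∀ (R : Type) [CommRing R] (φ : ZMod (m * n) →+* R) (x : ZMod (m * n)),
      φ ((f.map (Int.castRingHom (ZMod (m * n)))).ev x 1) = (f.map (Int.castRingHom R)).ev (φ x) 1 := by
    intro R _ φ x
    simp [ev, map]
  have key : ∀ x : ZMod (m * n), (f.map (Int.castRingHom (ZMod (m * n)))).ev x 1 = 0 ↔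
      (f.map (Int.castRingHom (ZMod m))).ev (e x).1 1 = 0 ∧
      (f.map (Int.castRingHom (ZMod n))).ev (e x).2 1 = 0 := by
    intro x
    have h1 := hc _ ((RingHom.fst _ _).comp (e : ZMod (m * n) →+* ZMod m × ZMod n)) x
    have h2 := hc _ ((RingHom.snd _ _).comp (e : ZMod (m * n) →+* ZMod m × ZMod n)) x
    simp at h1 h2
    rw [← h1, ← h2, ← map_eq_zero_iff e e.injective, Prod.ext_iff]
    rfl
  refine Nat.card_congr ((e.toEquiv.subtypeEquiv (q := fun y : ZMod m × ZMod n =>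
    (f.map (Int.castRingHom (ZMod m))).ev y.1 1 = 0 ∧
    (f.map (Int.castRingHom (ZMod n))).ev y.2 1 = 0) key).trans ?_)
  exact {
    toFun := fun x => (⟨x.1.1, x.2.1⟩, ⟨x.1.2, x.2.2⟩)
    invFun := fun x => ⟨(x.1.1, x.2.1), x.1.2, x.2.2⟩
    left_inv := fun _ => rfl
    right_inv := fun _ => rfl }

lemma nu_one (f : Cub ℤ) : nu 1 f = 1 := by simp [nu]

lemma prod_nu {E : Finset ℕ} (hE : ∀ p ∈ E, p.Prime) (f : Cub ℤ) :
    ∏ p ∈ E, nu p f = nu (∏ p ∈ E, p) f := by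
  classical
  induction E using Finset.induction_on with
  | empty => simp [nu_one]
  | insert p E hp ih =>
    have hE' : ∀ q ∈ E, q.Prime := fun q hq => hE q (mem_insert_of_mem hq)
    have hpp := hE p (mem_insert_self _ _)
    have : NeZero p := ⟨hpp.ne_zero⟩
    have : NeZero (∏ q ∈ E, q) := ⟨Finset.prod_ne_zero_iff.2 fun q hq => (hE' q hq).ne_zero⟩
    rw [prod_insert hp, prod_insert hp, ih hE', nu_mul]
    refine Nat.Coprime.prod_right fun q hq => ?_
    exact (Nat.coprime_primes hpp (hE' q hq)).2 fun h => hp (h ▸ hq)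

lemma om_eq_nu {p : ℕ} (hp : p.Prime) (f : Cub ℤ) :
    om p f = nu p f + if (p : ℤ) ∣ f.a then 1 else 0 := by
  classical
  have : NeZero p := ⟨hp.ne_zero⟩
  rw [om_eq, nu_eq, Nat.card_eq_fintype_card, Fintype.card_subtype]

lemma prod_dvd_int_iff {E : Finset ℕ} (hE : ∀ p ∈ E, p.Prime) (a : ℤ) :
    ((∏ p ∈ E, p : ℕ) : ℤ) ∣ a ↔ ∀ p ∈ E, (p : ℤ) ∣ a := by
  constructor
  · intro h p hp
    exact (Int.natCast_dvd_natCast.2 (dvd_prod_of_mem _ hp)).trans h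
  · intro h
    rw [Nat.cast_prod]
    refine prod_dvd_of_coprime (fun p hp q hq hpq => ?_) h
    exact Nat.isCoprime_iff_coprime.2 ((Nat.coprime_primes (hE p hp) (hE q hq)).2 hpq)

open Classical in
/-- Expansion of a product of local weights. -/
lemma prod_om {E : Finset ℕ} (hE : ∀ p ∈ E, p.Prime) (f : Cub ℤ) :
    ∏ p ∈ E, (om p f : ℝ≥0∞) = ∑ S ∈ E.powerset,
      if ((∏ p ∈ S, p : ℕ) : ℤ) ∣ f.a then (nu (∏ p ∈ E \ S, p) f : ℝ≥0∞) else 0 := by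
  have h1 : ∏ p ∈ E, (om p f : ℝ≥0∞) =
      ∏ p ∈ E, ((if (p : ℤ) ∣ f.a then (1 : ℝ≥0∞) else 0) + (nu p f : ℝ≥0∞)) := by
    refine prod_congr rfl fun p hp => ?_
    rw [om_eq_nu (hE p hp), add_comm]; push_cast; rfl
  rw [h1, prod_add]
  refine sum_congr rfl fun S hS => ?_
  have hS' := mem_powerset.1 hS
  rw [prod_ite_zero, ← Nat.cast_prod, prod_nu fun p hp => hE p (sdiff_subset hp)]
  simp only [prod_const_one, prod_dvd_int_iff fun p hp => hE p (hS' hp)]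
  split_ifs <;> simp

lemma om_le_three_mul (p : ℕ) (hp : p.Prime) (f : Cub ℤ) [Decidable (Dvd (p : ℤ) f)] :
    om p f ≤ 3 * (1 + if Dvd (p : ℤ) f then p else 0) := by
  split_ifs with h
  · exact (om_le p f).trans (by have := hp.pos; omega)
  · exact (om_le_three hp h).trans (by omega)

lemma prod_dvd_iff {E : Finset ℕ} (hE : ∀ p ∈ E, p.Prime) (f : Cub ℤ) :
    Dvd ((∏ p ∈ E, p : ℕ) : ℤ) f ↔ ∀ p ∈ E, Dvd (p : ℤ) f := by
  simp only [Dvd, prod_dvd_int_iff hE]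
  constructor
  · intro h p hp; exact ⟨h.1 p hp, h.2.1 p hp, h.2.2.1 p hp, h.2.2.2 p hp⟩
  · intro h; exact ⟨fun p hp => (h p hp).1, fun p hp => (h p hp).2.1, fun p hp => (h p hp).2.2.1,
      fun p hp => (h p hp).2.2.2⟩

open Classical in
lemma prod_om_le {E : Finset ℕ} (hE : ∀ p ∈ E, p.Prime) (f : Cub ℤ) :
    ∏ p ∈ E, (om p f : ℝ≥0∞) ≤ 3 ^ E.card * ∑ S ∈ E.powerset,
      if Dvd ((∏ p ∈ S, p : ℕ) : ℤ) f then ((∏ p ∈ S, p : ℕ) : ℝ≥0∞) else 0 := by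
  calc ∏ p ∈ E, (om p f : ℝ≥0∞) ≤ ∏ p ∈ E, (3 * ((if Dvd (p : ℤ) f then (p : ℝ≥0∞) else 0) + 1)) := by
        gcongr with p hp
        have := om_le_three_mul p (hE p hp) f
        rw [add_comm]
        exact_mod_cast this
    _ = _ := by
      rw [prod_mul_distrib, prod_const, prod_add]
      congr 1
      refine sum_congr rfl fun S hS => ?_
      have hS' := mem_powerset.1 hS
      rw [prod_ite_zero, prod_const_one, mul_one, Nat.cast_prod]
      have := prod_dvd_iff (fun p hp => hE p (hS' hp)) f
      push_cast at this
      push_cast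
      simp only [this]

end Cub

/-- Sign conditions on polynomials of bounded degree cut out tame sets. -/
lemma tame_polynomial {P Q R : Polynomial ℝ} {k : ℕ} (hP : P.natDegree ≤ k) (hQ : Q.natDegree ≤ k)
    (hR : R.natDegree ≤ k) : Tame (3 * k) {t : ℝ | 0 ≤ P.eval t ∧ 0 < Q.eval t ∧ 0 < R.eval t} := by
  classical
  have key : ∀ P : Polynomial ℝ, ∀ x y, x ≤ y → (∀ s ∈ P.roots, s ∉ Set.Icc x y) →
      (0 < P.eval x ↔ 0 < P.eval y) ∧ (0 ≤ P.eval x ↔ 0 ≤ P.eval y) := by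
    intro P x y hxy hs
    by_cases h0 : P = 0
    · simp [h0]
    have hc : ContinuousOn (fun t => P.eval t) (Icc x y) := P.continuous.continuousOn
    have hne : ∀ t ∈ Icc x y, P.eval t ≠ 0 := fun t ht h =>
      hs t ((Polynomial.mem_roots h0).2 h) ht
    have hx := hne x (left_mem_Icc.2 hxy)
    have hy := hne y (right_mem_Icc.2 hxy)
    have h1 : ¬ (P.eval x < 0 ∧ 0 < P.eval y) := fun ⟨ha, hb⟩ => by
      obtain ⟨t, ht, h⟩ := intermediate_value_Icc hxy hc ⟨ha.le, hb.le⟩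
      exact hne t ht h
    have h2 : ¬ (P.eval y < 0 ∧ 0 < P.eval x) := fun ⟨ha, hb⟩ => by
      obtain ⟨t, ht, h⟩ := intermediate_value_Icc' hxy hc ⟨ha.le, hb.le⟩
      exact hne t ht h
    rcases lt_or_gt_of_ne hx with hx | hx <;> rcases lt_or_gt_of_ne hy with hy | hy <;>
      first
        | exact absurd (And.intro (by assumption) (by assumption)) h1
        | exact absurd (And.intro (by assumption) (by assumption)) h2
        | exact ⟨by constructor <;> intro <;> linarith, by constructor <;> intro <;> linarith⟩
  refine ⟨(P.roots + Q.roots + R.roots).toFinset, ?_, ?_⟩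
  · refine (Multiset.toFinset_card_le _).trans ?_
    rw [Multiset.card_add, Multiset.card_add]
    have h1 := P.card_roots'; have h2 := Q.card_roots'; have h3 := R.card_roots'
    omega
  · intro x y hxy hs
    simp only [Multiset.mem_toFinset, Multiset.mem_add] at hs
    have h1 := key P x y hxy fun s h => hs s (Or.inl (Or.inl h))
    have h2 := key Q x y hxy fun s h => hs s (Or.inl (Or.inr h))
    have h3 := key R x y hxy fun s h => hs s (Or.inr h)
    exact and_congr h1.2 (and_congr h2.1 h3.1)

namespace Cub

/-- The region of balanced forms of bounded discriminant. -/
def reg (σ : ℤ) (Y : ℝ) (z : ℍ) : Set (Cub ℝ) :=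
  {f | hN f z ^ 2 ≤ 100 * (σ * f.disc) ∧ 0 < σ * f.disc ∧ σ * f.disc < Y}

/-- The forms in the region with prescribed leading coefficient. -/
def slice (σ : ℤ) (Y : ℝ) (z : ℍ) (a : ℝ) : Set ℝ³ :=
  {q | (⟨a, q.1, q.2.1, q.2.2⟩ : Cub ℝ) ∈ reg σ Y z}

lemma measurableSet_reg (σ : ℤ) (Y : ℝ) :
    MeasurableSet {p : (ℝ × ℝ³) × ℍ | (equivProd ℝ).symm p.1 ∈ reg σ Y p.2} := by
  have hre : Measurable fun p : (ℝ × ℝ³) × ℍ => p.2.re :=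
    (continuous_re.comp continuous_snd).measurable
  have him : Measurable fun p : (ℝ × ℝ³) × ℍ => p.2.im :=
    (continuous_im.comp continuous_snd).measurable
  have h1 : Measurable fun p : (ℝ × ℝ³) × ℍ => hN ((equivProd ℝ).symm p.1) p.2 := by
    simp only [hN_eq, equivProd, Equiv.coe_fn_symm_mk, ev]
    fun_prop
  have h2 : Measurable fun p : (ℝ × ℝ³) × ℍ => ((equivProd ℝ).symm p.1).disc := by
    simp only [disc, equivProd, Equiv.coe_fn_symm_mk]
    fun_prop
  exact (measurableSet_le (h1.pow_const 2) ((h2.const_mul _).const_mul _)).inter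
    ((measurableSet_lt measurable_const (h2.const_mul _)).inter
      (measurableSet_lt (h2.const_mul _) measurable_const))

lemma measurableSet_slice (σ : ℤ) (Y : ℝ) (z : ℍ) (a : ℝ) : MeasurableSet (slice σ Y z a) := by
  have h : Measurable fun q : ℝ³ => (((a, q.1, q.2.1, q.2.2), z) : (ℝ × ℝ³) × ℍ) := by
    fun_prop
  exact h (measurableSet_reg σ Y)

lemma tame_slice (σ : ℤ) (Y : ℝ) (z : ℍ) (a : ℝ) (q v : ℝ³) :
    Tame 12 {t : ℝ | q + t • v ∈ slice σ Y z a} := by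
  open Polynomial in
  set F : Cub ℝ[X] := ⟨C a, C q.1 + X * C v.1, C q.2.1 + X * C v.2.1, C q.2.2 + X * C v.2.2⟩ with hF
  set D : Polynomial ℝ := F.b ^ 2 * F.c ^ 2 - Polynomial.C (4 * a) * F.c ^ 3 - Polynomial.C 4 * F.b ^ 3 * F.d
    - Polynomial.C (27 * a ^ 2) * F.d ^ 2 + Polynomial.C (18 * a) * F.b * F.c * F.d with hD
  set N : Polynomial ℝ := Polynomial.C (3 * z.im ^ 3 * a ^ 2)
    + Polynomial.C z.im * (F.b + Polynomial.C (3 * a * z.re)) ^ 2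
    + Polynomial.C z.im⁻¹ * (Polynomial.C (3 * a * z.re ^ 2) + Polynomial.C (2 * z.re) * F.b + F.c) ^ 2
    + Polynomial.C (3 * (z.im ^ 3)⁻¹) * (Polynomial.C (a * z.re ^ 3) + Polynomial.C (z.re ^ 2) * F.b
      + Polynomial.C z.re * F.c + F.d) ^ 2 with hN'
  have l1 : (Polynomial.C v.1 * Polynomial.X).natDegree ≤ 1 := by compute_degree
  have l2 : (Polynomial.C v.2.1 * Polynomial.X).natDegree ≤ 1 := by compute_degree
  have l3 : (Polynomial.C v.2.2 * Polynomial.X).natDegree ≤ 1 := by compute_degree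
  have hDd : D.natDegree ≤ 4 := by
    rw [hD, hF]; compute_degree
    omega
  have hNd : N.natDegree ≤ 2 := by
    rw [hN', hF]; compute_degree
    omega
  have h1 := tame_polynomial (P := Polynomial.C (100 * (σ : ℝ)) * D - N ^ 2)
    (Q := Polynomial.C (σ : ℝ) * D) (R := Polynomial.C Y - Polynomial.C (σ : ℝ) * D) (k := 4)
    (by
      refine (Polynomial.natDegree_sub_le _ _).trans (max_le ?_ ?_)
      · exact (Polynomial.natDegree_C_mul_le _ _).trans hDd
      · exact Polynomial.natDegree_pow_le.trans (by omega))
    ((Polynomial.natDegree_C_mul_le _ _).trans hDd)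
    (by
      refine (Polynomial.natDegree_sub_le _ _).trans (max_le (by simp) ?_)
      exact (Polynomial.natDegree_C_mul_le _ _).trans hDd)
  convert h1 using 1
  ext t
  have e1 : (⟨a, (q + t • v).1, (q + t • v).2.1, (q + t • v).2.2⟩ : Cub ℝ).disc = D.eval t := by
    simp only [hD, hF, disc, Polynomial.eval_add, Polynomial.eval_sub, Polynomial.eval_mul,
      Polynomial.eval_pow, Polynomial.eval_C, Polynomial.eval_X, Prod.fst_add, Prod.snd_add,
      Prod.smul_fst, Prod.smul_snd, smul_eq_mul]
  have e2 : hN ⟨a, (q + t • v).1, (q + t • v).2.1, (q + t • v).2.2⟩ z = N.eval t := by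
    simp only [hN_eq, hN', hF, ev, Polynomial.eval_add, Polynomial.eval_mul,
      Polynomial.eval_pow, Polynomial.eval_C, Polynomial.eval_X, Prod.fst_add, Prod.snd_add,
      Prod.smul_fst, Prod.smul_snd, smul_eq_mul]
    ring
  show (_ ∧ _ ∧ _) ↔ (_ ∧ _ ∧ _)
  rw [e1, e2]
  simp only [Polynomial.eval_sub, Polynomial.eval_mul, Polynomial.eval_pow, Polynomial.eval_C,
    sub_nonneg, sub_pos, mul_assoc]

/-- The size of the coefficients of a balanced form. -/
lemma coeff_le_of_mem_reg {σ : ℤ} {Y Λ w : ℝ} {z : ℍ} (hΛ : 0 ≤ Λ) (hΛY : Λ ^ 4 = 100 * Y)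
    (hw : 0 < w) (hwz : w ^ 2 = z.im) (hz : 4 / 5 ≤ z.im) (hx : |z.re| ≤ 1 / 2) {f : Cub ℝ}
    (hf : f ∈ reg σ Y z) :
    |f.a| * w ^ 3 ≤ Λ ∧ |f.b| * w ≤ 3 * Λ ∧ |f.c| ≤ 8 * Λ * w ∧ |f.d| ≤ 20 * Λ * w ^ 3 := by
  obtain ⟨h1, h2, h3⟩ := hf
  have key : ∀ {a b : ℝ}, a ^ 2 ≤ b ^ 2 → 0 ≤ b → a ≤ b := fun h hb =>
    (le_abs_self _).trans (abs_le_of_sq_le_sq h hb)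
  have hlt : hN f z ≤ Λ ^ 2 := by
    refine key ?_ (by positivity)
    nlinarith
  rw [hN_eq, ← hwz] at hlt
  set x := z.re
  rw [← hwz] at hz
  have t1 : 0 ≤ 3 * (w ^ 2) ^ 3 * f.a ^ 2 := by positivity
  have t2 : 0 ≤ w ^ 2 * (f.b + 3 * f.a * x) ^ 2 := by positivity
  have t3 : 0 ≤ (3 * f.a * x ^ 2 + 2 * f.b * x + f.c) ^ 2 / w ^ 2 := by positivity
  have t4 : 0 ≤ 3 * (f.ev x 1) ^ 2 / (w ^ 2) ^ 3 := by positivity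
  have ha : |f.a| * w ^ 3 ≤ Λ := by
    refine key ?_ hΛ
    rw [mul_pow, sq_abs]
    nlinarith
  have hb' : |f.b + 3 * f.a * x| * w ≤ Λ := by
    refine key ?_ hΛ
    rw [mul_pow, sq_abs]
    nlinarith
  have hc' : |3 * f.a * x ^ 2 + 2 * f.b * x + f.c| ≤ Λ * w := by
    refine key ?_ (by positivity)
    rw [mul_pow, sq_abs, ← div_le_iff₀ (by positivity)]
    linarith
  have hd' : |f.ev x 1| ≤ Λ * w ^ 3 := by
    refine key ?_ (by positivity)
    rw [mul_pow, sq_abs, ← div_le_iff₀ (by positivity)]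
    have : (f.ev x 1) ^ 2 / (w ^ 3) ^ 2 = (3 * (f.ev x 1) ^ 2 / (w ^ 2) ^ 3) / 3 := by ring
    rw [this]; linarith
  have hax : |3 * f.a * x| ≤ 3 / 2 * |f.a| := by
    rw [abs_mul, abs_mul, abs_of_pos (by norm_num)]
    nlinarith [abs_nonneg f.a]
  have hx2 : |x ^ 2| ≤ 1 / 4 := by
    rw [abs_pow]; nlinarith [abs_nonneg x]
  have hx3 : |x ^ 3| ≤ 1 / 8 := by
    rw [abs_pow]
    calc |x| ^ 3 ≤ (1 / 2) ^ 3 := by gcongr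
      _ = _ := by norm_num
  have hA : |f.a| * w ≤ 5 / 4 * Λ := by
    have := mul_le_mul_of_nonneg_left hz (mul_nonneg (abs_nonneg f.a) hw.le)
    linarith
  have hb : |f.b| * w ≤ 3 * Λ := by
    have : |f.b| ≤ |f.b + 3 * f.a * x| + |3 * f.a * x| := by
      calc |f.b| = |(f.b + 3 * f.a * x) - 3 * f.a * x| := by congr 1; ring
        _ ≤ _ := abs_sub _ _
    have h2 := mul_le_mul_of_nonneg_right (this.trans (add_le_add_right hax _)) hw.le
    linarith
  have hA2 : |f.a| ≤ 25 / 16 * (Λ * w) := by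
    have h1 := mul_le_mul_of_nonneg_right hA hw.le
    have h2 := mul_le_mul_of_nonneg_left hz (abs_nonneg f.a)
    linarith
  have hB2 : |f.b| ≤ 15 / 4 * (Λ * w) := by
    have h1 := mul_le_mul_of_nonneg_right hb hw.le
    have h2 := mul_le_mul_of_nonneg_left hz (abs_nonneg f.b)
    linarith
  have hΛw : 0 ≤ Λ * w := mul_nonneg hΛ hw.le
  have hc : |f.c| ≤ 6 * (Λ * w) := by
    have e : |f.c| ≤ |3 * f.a * x ^ 2 + 2 * f.b * x + f.c| + |3 * f.a * x ^ 2| + |2 * f.b * x| := by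
      calc |f.c| = |(3 * f.a * x ^ 2 + 2 * f.b * x + f.c) - 3 * f.a * x ^ 2 - 2 * f.b * x| := by
            congr 1; ring
        _ ≤ _ := (abs_sub _ _).trans (by gcongr; exact abs_sub _ _)
    rw [abs_mul (3 * f.a), abs_mul (2 * f.b), abs_mul, abs_mul, abs_of_pos (by norm_num : (0 : ℝ) < 3),
      abs_of_pos (by norm_num : (0 : ℝ) < 2)] at e
    have e1 : 3 * |f.a| * |x ^ 2| ≤ 3 * |f.a| * (1 / 4) := by gcongr
    have e2 : 2 * |f.b| * |x| ≤ 2 * |f.b| * (1 / 2) := by gcongr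
    linarith
  have hww : Λ * w ≤ 5 / 4 * (Λ * w ^ 3) := by
    have := mul_le_mul_of_nonneg_left hz hΛw
    linarith
  refine ⟨ha, hb, by linarith, ?_⟩
  have e : |f.d| ≤ |f.ev x 1| + |f.a * x ^ 3| + |f.b * x ^ 2| + |f.c * x| := by
    calc |f.d| = |f.ev x 1 - f.a * x ^ 3 - f.b * x ^ 2 - f.c * x| := by
          congr 1; rw [ev]; ring
      _ ≤ _ := (abs_sub _ _).trans (by gcongr; exact (abs_sub _ _).trans (by gcongr; exact abs_sub _ _))
  rw [abs_mul f.a, abs_mul f.b, abs_mul f.c] at e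
  have e1 : |f.a| * |x ^ 3| ≤ |f.a| * (1 / 8) := by gcongr
  have e2 : |f.b| * |x ^ 2| ≤ |f.b| * (1 / 4) := by gcongr
  have e3 : |f.c| * |x| ≤ |f.c| * (1 / 2) := by gcongr
  linarith

end Cub

lemma card_divisors_prod_primes {E : Finset ℕ} (hE : ∀ p ∈ E, p.Prime) :
    (∏ p ∈ E, p).divisors.card = 2 ^ E.card := by
  classical
  induction E using Finset.induction_on with
  | empty => simp
  | insert p E hp ih =>
    have hE' : ∀ q ∈ E, q.Prime := fun q hq => hE q (mem_insert_of_mem hq)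
    have hpp := hE p (mem_insert_self _ _)
    have hc : p.Coprime (∏ q ∈ E, q) := Nat.Coprime.prod_right fun q hq =>
      (Nat.coprime_primes hpp (hE' q hq)).2 fun h => hp (h ▸ hq)
    rw [prod_insert hp, hc.card_divisors_mul, ih hE', card_insert_of_notMem hp,
      hpp.divisors, card_pair hpp.one_lt.ne, pow_succ, mul_comm]

lemma tsum_ne_zero_abs_le {A : ℝ} :
    ∑' a : ℤ, (if a ≠ 0 ∧ |(a : ℝ)| ≤ A then (1 : ℝ≥0∞) else 0) ≤ ofReal (3 * A) := by
  by_cases hA : A < 1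
  · rw [ENNReal.tsum_eq_zero.2]
    · exact zero_le
    intro a
    rw [if_neg]
    rintro ⟨h1, h2⟩
    have : (1 : ℝ) ≤ |(a : ℝ)| := by exact_mod_cast Int.one_le_abs h1
    linarith
  · push Not at hA
    calc _ ≤ ∑' a : ℤ, (Icc (-A) A).indicator (1 : ℝ → ℝ≥0∞) (a : ℝ) := by
          refine ENNReal.tsum_le_tsum fun a => ?_
          split_ifs with h
          · rw [indicator_of_mem (Set.mem_Icc.2 (abs_le.1 h.2))]; rfl
          · exact zero_le
      _ ≤ _ := (card_int_Icc_le (by linarith)).trans (ofReal_le_ofReal (by linarith))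

namespace Cub

variable {σ : ℤ} {Y Λ w : ℝ} {z : ℍ}

lemma tsum_cub (F : Cub ℤ → ℝ≥0∞) :
    ∑' f, F f = ∑' a : ℤ, ∑' b : ℤ, ∑' c : ℤ, ∑' d : ℤ, F ⟨a, b, c, d⟩ := by
  rw [← (equivProd ℤ).symm.tsum_eq, ENNReal.tsum_prod']
  refine tsum_congr fun a => ?_
  rw [ENNReal.tsum_prod']
  refine tsum_congr fun b => ?_
  rw [ENNReal.tsum_prod']
  rfl

lemma slice_error_le {e n : ℝ} {k : ℕ} (hΛ : 0 ≤ Λ) (hw : 0 < w) (hw2 : 4 / 5 ≤ w ^ 2) (he : 1 ≤ e)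
    (hn : 0 ≤ n) (hne : n ≤ e) (hA : w ^ 3 ≤ Λ) :
    24 * ((2 * (3 * Λ / w) + 1) * (128 * (20 * Λ * w ^ 3) * 2 ^ k * √n + n)
      + 4 * (8 * Λ * w) * (20 * Λ * w ^ 3)) * (3 * (Λ / w ^ 3)) ≤
      2000000 * 2 ^ k * (√e * Λ ^ 3 * w + e * Λ ^ 2) := by
  have h1 : 2 * (3 * Λ / w) + 1 ≤ 8 * Λ / w := by
    rw [← sub_nonneg]
    have : 8 * Λ / w - (2 * (3 * Λ / w) + 1) = (2 * Λ - w) / w := by field_simp; ring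
    rw [this]
    have : 4 / 5 * w ≤ w ^ 3 := by
      have := mul_le_mul_of_nonneg_right hw2 hw.le
      linarith
    apply div_nonneg _ hw.le
    linarith
  have hs : √n ≤ √e := sqrt_le_sqrt hne
  have hs1 : 1 ≤ √e := by rw [one_le_sqrt]; exact he
  have h2k : (1 : ℝ) ≤ 2 ^ k := one_le_pow₀ (by norm_num)
  have hwi : 1 / w ≤ 5 / 4 * w := by
    rw [div_le_iff₀ hw]; linarith
  have hwi4 : 1 / w ^ 4 ≤ 25 / 16 := by
    rw [div_le_iff₀ (by positivity)]
    nlinarith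
  calc _ ≤ 24 * ((8 * Λ / w) * (128 * (20 * Λ * w ^ 3) * 2 ^ k * √e + e)
      + 4 * (8 * Λ * w) * (20 * Λ * w ^ 3)) * (3 * (Λ / w ^ 3)) := by gcongr
    _ = 1474560 * (Λ ^ 3 * 2 ^ k * √e) * (1 / w) + 576 * (Λ ^ 2 * e) * (1 / w ^ 4)
        + 46080 * (Λ ^ 3 * w) := by
      field_simp; ring
    _ ≤ 1474560 * (Λ ^ 3 * 2 ^ k * √e) * (5 / 4 * w) + 576 * (Λ ^ 2 * e) * (25 / 16)
        + 46080 * (Λ ^ 3 * w) := by gcongr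
    _ ≤ 1474560 * (Λ ^ 3 * 2 ^ k * √e) * (5 / 4 * w) + 576 * (Λ ^ 2 * (2 ^ k * e)) * (25 / 16)
        + 46080 * (Λ ^ 3 * (2 ^ k * √e) * w) := by
      gcongr
      · exact le_mul_of_one_le_left (by linarith) h2k
      · exact le_mul_of_one_le_right (by positivity) (one_le_mul_of_one_le_of_one_le h2k hs1)
    _ ≤ _ := by
      have p1 : 0 ≤ Λ ^ 3 * 2 ^ k * √e * w := by positivity
      have p2 : 0 ≤ Λ ^ 2 * (2 ^ k * e) := by positivity
      nlinarith

/-- The count of forms with nonvanishing leading coefficient, at one point of the domain. -/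
lemma near_count (hΛ : 0 ≤ Λ) (hΛY : Λ ^ 4 = 100 * Y)
    (hw : 0 < w) (hwz : w ^ 2 = z.im) (hz : 4 / 5 ≤ z.im) (hx : |z.re| ≤ 1 / 2)
    {E : Finset ℕ} (hE : ∀ p ∈ E, p.Prime) :
    Near (∑' f : Cub ℤ, if f.a ≠ 0 then (∏ p ∈ E, (om p f : ℝ≥0∞)) * (reg σ Y z).indicator 1 f.toReal
        else 0)
      (∑ S ∈ E.powerset, ∑' a : ℤ, if a ≠ 0 ∧ ((∏ p ∈ S, p : ℕ) : ℤ) ∣ a then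
        volume (slice σ Y z a) else 0)
      (ofReal (2000000 * 4 ^ E.card * (√((∏ p ∈ E, p : ℕ) : ℝ) * Λ ^ 3 * w
        + (∏ p ∈ E, p : ℕ) * Λ ^ 2))) := by
  classical
  set e : ℕ := ∏ p ∈ E, p with he
  have he1 : 1 ≤ e := one_le_prod' fun p hp => (hE p hp).one_le
  have h0 : (∑' f : Cub ℤ, if f.a ≠ 0 then (∏ p ∈ E, (om p f : ℝ≥0∞)) * (reg σ Y z).indicator 1 f.toReal
        else 0) = ∑ S ∈ E.powerset, ∑' a : ℤ, if a ≠ 0 ∧ ((∏ p ∈ S, p : ℕ) : ℤ) ∣ a then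
          (∑' b : ℤ, ∑ r ∈ range (∏ p ∈ E \ S, p), ∑' c : ℤ, ∑' d : ℤ,
            if ((∏ p ∈ E \ S, p : ℕ) : ℤ) ∣ (a * r ^ 3 + b * r ^ 2) + c * r + d then
              (slice σ Y z a).indicator 1 ((b : ℝ), (c : ℝ), (d : ℝ)) else 0) else 0 := by
    have : ∀ f : Cub ℤ, (if f.a ≠ 0 then (∏ p ∈ E, (om p f : ℝ≥0∞)) * (reg σ Y z).indicator 1 f.toReal
        else 0) = ∑ S ∈ E.powerset, if f.a ≠ 0 ∧ ((∏ p ∈ S, p : ℕ) : ℤ) ∣ f.a then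
          ∑ r ∈ range (∏ p ∈ E \ S, p), (if ((∏ p ∈ E \ S, p : ℕ) : ℤ) ∣ f.ev r 1 then
            (reg σ Y z).indicator 1 f.toReal else 0) else 0 := by
      intro f
      by_cases ha : f.a = 0
      · simp [ha]
      rw [if_pos ha, prod_om hE, sum_mul]
      refine sum_congr rfl fun S hS => ?_
      by_cases hd : ((∏ p ∈ S, p : ℕ) : ℤ) ∣ f.a
      · rw [if_pos hd, if_pos ⟨ha, hd⟩, ← sum_filter, sum_const, nsmul_eq_mul]; rfl
      · rw [if_neg hd, if_neg (fun h => hd h.2), zero_mul]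
    simp_rw [this]
    rw [Summable.tsum_finsetSum fun _ _ => ENNReal.summable]
    refine sum_congr rfl fun S hS => ?_
    rw [tsum_cub]
    refine tsum_congr fun a => ?_
    split_ifs with h
    · refine tsum_congr fun b => ?_
      simp_rw [Summable.tsum_finsetSum fun _ _ => ENNReal.summable]
      refine sum_congr rfl fun r _ => ?_
      refine tsum_congr fun c => tsum_congr fun d => ?_
      have : (⟨a, b, c, d⟩ : Cub ℤ).ev r 1 = (a * r ^ 3 + b * r ^ 2) + c * r + d := by
        simp [ev]
      rw [this]
      rfl
    · simp
  rw [h0]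
  have hS : ∀ S ∈ E.powerset, Near
      (∑' a : ℤ, if a ≠ 0 ∧ ((∏ p ∈ S, p : ℕ) : ℤ) ∣ a then
          (∑' b : ℤ, ∑ r ∈ range (∏ p ∈ E \ S, p), ∑' c : ℤ, ∑' d : ℤ,
            if ((∏ p ∈ E \ S, p : ℕ) : ℤ) ∣ (a * r ^ 3 + b * r ^ 2) + c * r + d then
              (slice σ Y z a).indicator 1 ((b : ℝ), (c : ℝ), (d : ℝ)) else 0) else 0)
      (∑' a : ℤ, if a ≠ 0 ∧ ((∏ p ∈ S, p : ℕ) : ℤ) ∣ a then volume (slice σ Y z a) else 0)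
      (ofReal (2000000 * 2 ^ E.card * (√(e : ℝ) * Λ ^ 3 * w + e * Λ ^ 2))) := by
    intro S hS
    set n : ℕ := ∏ p ∈ E \ S, p with hn
    have hEn : ∀ p ∈ E \ S, p.Prime := fun p hp => hE p (sdiff_subset hp)
    have hn1 : 0 < n := prod_pos fun p hp => (hEn p hp).pos
    have hne : n ≤ e := prod_le_prod_of_subset_of_one_le' sdiff_subset
      fun p hp _ => (hE p hp).one_le
    have hnd : (n.divisors.card : ℝ) ≤ 2 ^ E.card := by
      rw [hn, card_divisors_prod_primes hEn]
      push_cast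
      exact pow_le_pow_right₀ (by norm_num) (card_le_card sdiff_subset)
    set M : ℝ := (2 * (3 * Λ / w) + 1) * (128 * (20 * Λ * w ^ 3) * n.divisors.card * √n + n)
      + 4 * (8 * Λ * w) * (20 * Λ * w ^ 3) with hM
    have hM0 : 0 ≤ M := by positivity
    have hcoef : ∀ f ∈ reg σ Y z, _ := fun f hf =>
      coeff_le_of_mem_reg (f := f) hΛ hΛY hw hwz hz hx hf
    have ha : ∀ a : ℤ, Near (if a ≠ 0 ∧ ((∏ p ∈ S, p : ℕ) : ℤ) ∣ a then
          (∑' b : ℤ, ∑ r ∈ range n, ∑' c : ℤ, ∑' d : ℤ,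
            if (n : ℤ) ∣ (a * r ^ 3 + b * r ^ 2) + c * r + d then
              (slice σ Y z a).indicator 1 ((b : ℝ), (c : ℝ), (d : ℝ)) else 0) else 0)
        (if a ≠ 0 ∧ ((∏ p ∈ S, p : ℕ) : ℤ) ∣ a then volume (slice σ Y z a) else 0)
        (ofReal (24 * M) * if a ≠ 0 ∧ |(a : ℝ)| ≤ Λ / w ^ 3 then 1 else 0) := by
      intro a
      by_cases h1 : a ≠ 0 ∧ ((∏ p ∈ S, p : ℕ) : ℤ) ∣ a
      · rw [if_pos h1, if_pos h1]
        by_cases h2 : |(a : ℝ)| ≤ Λ / w ^ 3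
        · rw [if_pos ⟨h1.1, h2⟩, mul_one]
          have := near_sum_congruence₃ (measurableSet_slice σ Y z a) (B := 3 * Λ / w)
            (C := 8 * Λ * w) (D := 20 * Λ * w ^ 3) (by positivity) (by positivity)
            (by
              have := mul_le_mul_of_nonneg_left (hwz ▸ hz) (mul_nonneg hΛ hw.le)
              have h3 := mul_nonneg hΛ hw.le
              linarith)
            (fun q hq => ?_) (tame_slice σ Y z a) hn1 (fun b r => a * r ^ 3 + b * r ^ 2)
          · refine this.mono (le_of_eq ?_)
            rw [ofReal_mul (by norm_num), ← hM]
            norm_num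
          · obtain ⟨_, g2, g3, g4⟩ := hcoef _ hq
            exact ⟨(le_div_iff₀ hw).2 g2, g3, g4⟩
        · have : ∀ q, q ∉ slice σ Y z a := fun q hq =>
            h2 ((le_div_iff₀ (by positivity)).2 (hcoef _ hq).1)
          apply Near.of_eq
          have h0 : slice σ Y z a = ∅ := eq_empty_of_forall_notMem this
          simp [h0]
      · rw [if_neg h1, if_neg h1]
        exact Near.of_eq rfl
    refine (Near.tsum ha).mono ?_
    rw [ENNReal.tsum_mul_left]
    by_cases hA : w ^ 3 ≤ Λ
    · refine (mul_le_mul_right tsum_ne_zero_abs_le _).trans ?_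
      rw [← ofReal_mul (by positivity)]
      refine ofReal_le_ofReal (le_trans ?_ (slice_error_le hΛ hw (hwz ▸ hz)
        (by exact_mod_cast he1) (Nat.cast_nonneg n) (by exact_mod_cast hne) hA))
      rw [hM]
      gcongr
    · rw [ENNReal.tsum_eq_zero.2]
      · simp
      intro a
      rw [if_neg]
      rintro ⟨g1, g2⟩
      have g3 : (1 : ℝ) ≤ |(a : ℝ)| := by exact_mod_cast Int.one_le_abs g1
      rw [le_div_iff₀ (by positivity)] at g2
      have : 0 < w ^ 3 := by positivity
      nlinarith
  refine (Near.sum hS).mono (le_of_eq ?_)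
  rw [sum_const, card_powerset, nsmul_eq_mul]
  have : ((2 ^ E.card : ℕ) : ℝ≥0∞) = ofReal (2 ^ E.card) := by
    rw [ofReal_pow (by norm_num)]; simp
  rw [this, ← ofReal_mul (by positivity)]
  congr 1
  rw [show (4 : ℝ) = 2 * 2 by norm_num, mul_pow]
  ring

end Cub

lemma sum_card_divisors_le (N : ℕ) :
    ((∑ n ∈ Ioc 0 N, n.divisors.card : ℕ) : ℝ) ≤ N * (1 + Real.log N) := by
  have h1 : ∑ n ∈ Ioc 0 N, n.divisors.card = ∑ q ∈ Ioc 0 N, N / q := by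
    have : ∀ n ∈ Finset.Ioc 0 N, n.divisors.card = ∑ q ∈ Ioc 0 N, if q ∣ n then 1 else 0 := by
      intro n hn
      rw [Finset.mem_Ioc] at hn
      rw [← card_filter]
      congr 1
      ext q
      simp
      constructor
      · rintro ⟨h, _⟩
        exact ⟨⟨Nat.pos_of_dvd_of_pos h hn.1, (Nat.le_of_dvd hn.1 h).trans hn.2⟩, h⟩
      · rintro ⟨_, h⟩
        exact ⟨h, hn.1.ne'⟩
    rw [sum_congr rfl this, sum_comm]
    refine sum_congr rfl fun q _ => ?_
    rw [← card_filter, Nat.Ioc_filter_dvd_card_eq_div]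
  have h2 : ((∑ q ∈ Ioc 0 N, N / q : ℕ) : ℝ) ≤ N * (harmonic N : ℝ) := by
    rw [harmonic_eq_sum_Icc]
    push_cast
    rw [mul_sum]
    have : Finset.Ioc 0 N = Finset.Icc 1 N := rfl
    rw [this]
    refine sum_le_sum fun q _ => ?_
    exact Nat.cast_div_le
  rw [h1]
  refine h2.trans ?_
  gcongr
  exact harmonic_le_one_add_log N

lemma sum_card_divisors_le_rpow {A : ℝ} (hA : 1 ≤ A) :
    ((∑ n ∈ Ioc 0 ⌊A⌋₊, n.divisors.card : ℕ) : ℝ) ≤ 25 * (A * A ^ (1 / 24 : ℝ)) := by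
  have hf : (⌊A⌋₊ : ℝ) ≤ A := Nat.floor_le (by linarith)
  have hf1 : (1 : ℝ) ≤ (⌊A⌋₊ : ℝ) := by exact_mod_cast (Nat.one_le_floor_iff A).2 hA
  have hl : log (⌊A⌋₊ : ℝ) ≤ log A := log_le_log (by linarith) hf
  have h1 := log_le_rpow_div (by linarith : 0 ≤ A) (by norm_num : (0 : ℝ) < 1 / 24)
  have h2 : 1 ≤ A ^ (1 / 24 : ℝ) := one_le_rpow hA (by norm_num)
  calc _ ≤ _ := sum_card_divisors_le _
    _ ≤ A * (25 * A ^ (1 / 24 : ℝ)) := by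
      have h0 : 0 ≤ log (⌊A⌋₊ : ℝ) := Real.log_nonneg hf1
      gcongr
      have : A ^ (1 / 24 : ℝ) / (1 / 24) = 24 * A ^ (1 / 24 : ℝ) := by ring
      linarith
    _ = _ := by ring

lemma tsum_card_divisors_le (A : ℝ) :
    ∑' a : ℤ, (if a ≠ 0 ∧ |(a : ℝ)| ≤ A then (a.natAbs.divisors.card : ℝ≥0∞) else 0) ≤
      ofReal (50 * (A * A ^ (1 / 24 : ℝ))) := by
  by_cases hA : A < 1
  · rw [ENNReal.tsum_eq_zero.2]
    · exact zero_le
    intro a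
    rw [if_neg]
    rintro ⟨h1, h2⟩
    have : (1 : ℝ) ≤ |(a : ℝ)| := by exact_mod_cast Int.one_le_abs h1
    linarith
  push Not at hA
  have hs : Function.support (fun a : ℤ => if a ≠ 0 ∧ |(a : ℝ)| ≤ A then (a.natAbs.divisors.card : ℝ≥0∞)
      else 0) ⊆ ((Finset.Ioc 0 ⌊A⌋₊).image (fun n : ℕ => (n : ℤ)) ∪
        (Finset.Ioc 0 ⌊A⌋₊).image (fun n : ℕ => -(n : ℤ)) : Finset ℤ) := by
    intro a ha
    rw [Function.mem_support, ne_eq, ite_eq_right_iff, Classical.not_imp] at ha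
    obtain ⟨⟨h1, h2⟩, -⟩ := ha
    have h3 : a.natAbs ∈ Finset.Ioc 0 ⌊A⌋₊ := by
      rw [Finset.mem_Ioc]
      refine ⟨Int.natAbs_pos.2 h1, Nat.le_floor ?_⟩
      rwa [Nat.cast_natAbs, Int.cast_abs]
    rw [mem_coe, Finset.mem_union, Finset.mem_image, Finset.mem_image]
    rcases Int.natAbs_eq a with h | h
    · exact Or.inl ⟨_, h3, h.symm⟩
    · exact Or.inr ⟨_, h3, h.symm⟩
  rw [tsum_eq_sum' hs]
  have key : ∀ s : ℤ → ℤ, (∀ a, (s a).natAbs = a.natAbs) → Function.Injective s →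
      ∑ a ∈ (Finset.Ioc 0 ⌊A⌋₊).image (fun n : ℕ => s n),
      (if a ≠ 0 ∧ |(a : ℝ)| ≤ A then (a.natAbs.divisors.card : ℝ≥0∞) else 0) ≤
      ((∑ n ∈ Ioc 0 ⌊A⌋₊, n.divisors.card : ℕ) : ℝ≥0∞) := by
    intro s hs1 hs2
    rw [sum_image fun x _ y _ h => by simpa using hs2 h]
    push_cast
    refine sum_le_sum fun n _ => ?_
    split_ifs
    · rw [hs1, Int.natAbs_natCast]
    · exact zero_le
  have h0 : ((∑ n ∈ Ioc 0 ⌊A⌋₊, n.divisors.card : ℕ) : ℝ≥0∞) ≤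
      ofReal (25 * (A * A ^ (1 / 24 : ℝ))) := by
    rw [← ofReal_natCast]
    exact ofReal_le_ofReal (sum_card_divisors_le_rpow hA)
  have h50 : ofReal (50 * (A * A ^ (1 / 24 : ℝ))) = ofReal (25 * (A * A ^ (1 / 24 : ℝ)))
      + ofReal (25 * (A * A ^ (1 / 24 : ℝ))) := by
    rw [← ofReal_add (by positivity) (by positivity)]
    congr 1; ring
  rw [h50]
  refine (le_self_add.trans (sum_union_inter).le).trans (add_le_add ?_ ?_)
  · exact (key id (fun _ => rfl) Function.injective_id).trans h0
  · exact (key (fun a => -a) Int.natAbs_neg neg_injective).trans h0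

namespace Cub

variable {Λ w : ℝ}

/-- The box of integral forms with coefficients of the size allowed by reduction theory. -/
def Box (Λ w : ℝ) (f : Cub ℤ) : Prop :=
  |(f.a : ℝ)| ≤ Λ / w ^ 3 ∧ |(f.b : ℝ)| ≤ 3 * Λ / w ∧ |(f.c : ℝ)| ≤ 8 * Λ * w ∧
    |(f.d : ℝ)| ≤ 20 * Λ * w ^ 3

lemma exists_root_of_not_irr {f : Cub ℤ} (ha : f.a ≠ 0) (hd : f.d ≠ 0) (h : ¬ Irr f) :
    ∃ x y : ℤ, x ∣ f.d ∧ y ∣ f.a ∧ x ≠ 0 ∧ y ≠ 0 ∧ f.ev x y = 0 := by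
  simp only [Irr, not_forall] at h
  obtain ⟨x, y, h0, hxy⟩ := h
  have hg : 0 < Int.gcd x y := Int.gcd_pos_iff.2 (by tauto)
  obtain ⟨x', y', hc, hx, hy⟩ := Int.exists_gcd_one hg
  have hg0 : ((Int.gcd x y : ℕ) : ℤ) ≠ 0 := by exact_mod_cast hg.ne'
  have h1 : f.ev x' y' = 0 := by
    have : f.ev x y = (Int.gcd x y : ℤ) ^ 3 * f.ev x' y' := by
      generalize (Int.gcd x y : ℤ) = g at hx hy
      rw [hx, hy]
      simp only [ev]; ring
    rw [this] at h0
    exact (mul_eq_zero.1 h0).resolve_left (pow_ne_zero _ hg0)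
  have hco : IsCoprime x' y' := Int.isCoprime_iff_gcd_eq_one.2 hc
  have hev := h1
  simp only [ev] at hev
  have hy0 : y' ≠ 0 := by
    rintro rfl
    have : x' ≠ 0 := by rintro rfl; simp at hc
    simp [ha, this] at hev
  have hx0 : x' ≠ 0 := by
    rintro rfl
    simp [hd, hy0] at hev
  refine ⟨x', y', ?_, ?_, hx0, hy0, h1⟩
  · refine (hco.pow_right (n := 3)).dvd_of_dvd_mul_right ?_
    exact ⟨-(f.a * x' ^ 2 + f.b * x' * y' + f.c * y' ^ 2), by linear_combination hev⟩
  · refine (hco.symm.pow_right (n := 3)).dvd_of_dvd_mul_right ?_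
    exact ⟨-(f.b * x' ^ 2 + f.c * x' * y' + f.d * y' ^ 2), by linear_combination hev⟩

open Classical in
lemma tsum_not_irr_le {a b d : ℤ} (ha : a ≠ 0) (hd : d ≠ 0) :
    ∑' c : ℤ, (if ¬ Irr ⟨a, b, c, d⟩ then (1 : ℝ≥0∞) else 0) ≤
      4 * (a.natAbs.divisors.card * d.natAbs.divisors.card) := by
  set T : Finset ℤ := ((({1, -1} : Finset ℤ) ×ˢ ({1, -1} : Finset ℤ)) ×ˢ
    (a.natAbs.divisors ×ˢ d.natAbs.divisors)).image fun t =>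
      -(a * (t.1.1 * t.2.2) ^ 3 + b * (t.1.1 * t.2.2) ^ 2 * (t.1.2 * t.2.1) + d * (t.1.2 * t.2.1) ^ 3)
        / ((t.1.1 * t.2.2) * (t.1.2 * t.2.1) ^ 2) with hT
  have hs : Function.support (fun c : ℤ => if ¬ Irr ⟨a, b, c, d⟩ then (1 : ℝ≥0∞) else 0) ⊆ T := by
    intro c hc
    rw [Function.mem_support, ne_eq, ite_eq_right_iff, Classical.not_imp] at hc
    obtain ⟨x, y, hx, hy, hx0, hy0, h0⟩ := exists_root_of_not_irr (f := ⟨a, b, c, d⟩) ha hd hc.1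
    have hsg : ∀ x : ℤ, x ≠ 0 → ∃ s ∈ ({1, -1} : Finset ℤ), x = s * (x.natAbs : ℤ) := by
      intro x _
      rcases Int.natAbs_eq x with h | h
      · exact ⟨1, by simp, by rw [one_mul]; exact h⟩
      · exact ⟨-1, by simp, by rw [neg_one_mul]; exact h⟩
    obtain ⟨s, hs, hxs⟩ := hsg x hx0
    obtain ⟨s', hs', hys⟩ := hsg y hy0
    rw [mem_coe, hT, Finset.mem_image]
    refine ⟨((s, s'), (y.natAbs, x.natAbs)), ?_, ?_⟩
    · rw [mem_product, mem_product, mem_product]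
      exact ⟨⟨hs, hs'⟩, Nat.mem_divisors.2 ⟨Int.natAbs_dvd_natAbs.2 hy, by simpa using ha⟩,
        Nat.mem_divisors.2 ⟨Int.natAbs_dvd_natAbs.2 hx, by simpa using hd⟩⟩
    · simp only [← hxs, ← hys]
      refine Int.ediv_eq_of_eq_mul_right (by positivity) ?_
      simp only [ev] at h0
      linear_combination -h0
  rw [tsum_eq_sum' hs]
  calc _ ≤ ∑ c ∈ T, (1 : ℝ≥0∞) := sum_le_sum fun c _ => by split_ifs <;> simp
    _ = (T.card : ℝ≥0∞) := by simp
    _ ≤ ((4 * (a.natAbs.divisors.card * d.natAbs.divisors.card) : ℕ) : ℝ≥0∞) := by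
      refine Nat.cast_le.2 (card_image_le.trans ?_)
      rw [card_product, card_product, card_product]
      simp
    _ = _ := by push_cast; rfl

end Cub

namespace Cub

variable {Λ w : ℝ}

lemma box_bound_le (hw : 0 < w) (hw2 : 4 / 5 ≤ w ^ 2) (hA : w ^ 3 ≤ Λ) :
    (8 * Λ / w) * (3 * (Λ / w ^ 3) * (18 * Λ * w) + 4 * (50 * ((Λ / w ^ 3) * (Λ / w ^ 3) ^ (1 / 24 : ℝ)) *
      (50 * ((20 * Λ * w ^ 3) * (20 * Λ * w ^ 3) ^ (1 / 24 : ℝ))))) ≤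
      50000000 * Λ ^ (37 / 12 : ℝ) * w := by
  have hΛ : 0 < Λ := (by positivity : 0 < w ^ 3).trans_le hA
  have hwi : 1 / w ≤ 5 / 4 * w := by
    rw [div_le_iff₀ hw]; linarith
  have hwi3 : 1 / w ^ 3 ≤ 25 / 16 * w := by
    rw [div_le_iff₀ (by positivity)]
    have : (4 / 5 : ℝ) * (4 / 5) ≤ w ^ 2 * w ^ 2 := mul_le_mul hw2 hw2 (by norm_num) (by positivity)
    linarith
  have h37 : Λ ^ (37 / 12 : ℝ) = Λ ^ 3 * Λ ^ (1 / 12 : ℝ) := by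
    rw [← rpow_natCast Λ 3, ← rpow_add hΛ]; norm_num
  have hΛ12 : 1 ≤ 2 * Λ ^ (1 / 12 : ℝ) := by
    have h1 : (1 / 2 : ℝ) ≤ Λ := by
      have : 4 / 5 * w ≤ w ^ 3 := by
        have := mul_le_mul_of_nonneg_right hw2 hw.le
        linarith
      have : (4 / 5 : ℝ) ≤ w := by nlinarith
      linarith
    have h2 : (1 / 2 : ℝ) ≤ (1 / 2 : ℝ) ^ (1 / 12 : ℝ) :=
      self_le_rpow_of_le_one (by norm_num) (by norm_num) (by norm_num)
    have h3 := rpow_le_rpow (by norm_num) h1 (by norm_num : (0 : ℝ) ≤ 1 / 12)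
    linarith
  have h20 : (Λ / w ^ 3) ^ (1 / 24 : ℝ) * (20 * Λ * w ^ 3) ^ (1 / 24 : ℝ) ≤ 20 * Λ ^ (1 / 12 : ℝ) := by
    rw [← mul_rpow (by positivity) (by positivity)]
    have : Λ / w ^ 3 * (20 * Λ * w ^ 3) = 20 * Λ ^ 2 := by field_simp
    rw [this, mul_rpow (by norm_num) (by positivity), ← rpow_natCast Λ 2,
      ← rpow_mul hΛ.le]
    norm_num
    gcongr
    exact rpow_le_self_of_one_le (by norm_num) (by norm_num)
  calc _ = 432 * Λ ^ 3 * (1 / w ^ 3) + 1600000 * Λ ^ 3 * ((Λ / w ^ 3) ^ (1 / 24 : ℝ)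
        * (20 * Λ * w ^ 3) ^ (1 / 24 : ℝ)) * (1 / w) := by
        field_simp; ring
    _ ≤ 432 * Λ ^ 3 * (25 / 16 * w) + 1600000 * Λ ^ 3 * (20 * Λ ^ (1 / 12 : ℝ)) * (5 / 4 * w) := by
        gcongr
    _ ≤ 432 * (Λ ^ 3 * (2 * Λ ^ (1 / 12 : ℝ))) * (25 / 16 * w)
        + 1600000 * Λ ^ 3 * (20 * Λ ^ (1 / 12 : ℝ)) * (5 / 4 * w) := by
        gcongr
        exact le_mul_of_one_le_right (by positivity) hΛ12
    _ ≤ _ := by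
      rw [h37]
      have : 0 ≤ Λ ^ 3 * Λ ^ (1 / 12 : ℝ) * w := by positivity
      linarith

open Classical in
/-- Few forms in the box are reducible. -/
lemma tsum_box_not_irr_le (hΛ : 0 < Λ) (hw : 0 < w) (hw2 : 4 / 5 ≤ w ^ 2) :
    ∑' f : Cub ℤ, (if f.a ≠ 0 ∧ ¬ Irr f ∧ Box Λ w f then (1 : ℝ≥0∞) else 0) ≤
      ofReal (50000000 * Λ ^ (37 / 12 : ℝ) * w) := by
  by_cases hA : Λ < w ^ 3
  · rw [ENNReal.tsum_eq_zero.2]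
    · exact zero_le
    intro f
    rw [if_neg]
    rintro ⟨h1, _, h2, _⟩
    have : (1 : ℝ) ≤ |(f.a : ℝ)| := by exact_mod_cast Int.one_le_abs h1
    rw [le_div_iff₀ (by positivity)] at h2
    have : 0 < w ^ 3 := by positivity
    nlinarith
  push Not at hA
  set A := Λ / w ^ 3 with hAd
  set B := 3 * Λ / w with hB
  set C := 8 * Λ * w with hC
  set D := 20 * Λ * w ^ 3 with hD
  have hww : (4 / 5 : ℝ) ≤ w := by nlinarith
  have hw3 : 4 / 5 * w ≤ w ^ 3 := by
    have := mul_le_mul_of_nonneg_right hw2 hw.le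
    linarith [show w ^ 2 * w = w ^ 3 by ring]
  have hcard : ∀ B : ℝ, 0 ≤ B → ∑' b : ℤ, (if |(b : ℝ)| ≤ B then (1 : ℝ≥0∞) else 0) ≤
      ofReal (2 * B + 1) := by
    intro B hB
    refine le_trans (le_of_eq ?_) ((card_int_Icc_le (x := -B) (y := B) (by linarith)).trans
      (le_of_eq (by congr 1; ring)))
    refine tsum_congr fun b => ?_
    rw [indicator_apply]
    simp only [Set.mem_Icc, abs_le, Pi.one_apply]
  have hin : ∀ a b : ℤ, ∑' c : ℤ, ∑' d : ℤ, (if (⟨a, b, c, d⟩ : Cub ℤ).a ≠ 0 ∧ ¬ Irr ⟨a, b, c, d⟩ ∧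
      Box Λ w ⟨a, b, c, d⟩ then (1 : ℝ≥0∞) else 0) ≤
      (if |(b : ℝ)| ≤ B then (1 : ℝ≥0∞) else 0) *
      ((if a ≠ 0 ∧ |(a : ℝ)| ≤ A then (1 : ℝ≥0∞) else 0) * ofReal (2 * C + 1)
        + 4 * ((if a ≠ 0 ∧ |(a : ℝ)| ≤ A then (a.natAbs.divisors.card : ℝ≥0∞) else 0) *
          ofReal (50 * (D * D ^ (1 / 24 : ℝ))))) := by
    intro a b
    by_cases hb : |(b : ℝ)| ≤ B
    swap
    · rw [ENNReal.tsum_eq_zero.2]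
      · exact zero_le
      intro c
      rw [ENNReal.tsum_eq_zero]
      intro d
      rw [if_neg]
      rintro ⟨_, _, _, h, _⟩
      exact hb h
    by_cases ha : a ≠ 0 ∧ |(a : ℝ)| ≤ A
    swap
    · rw [ENNReal.tsum_eq_zero.2]
      · exact zero_le
      intro c
      rw [ENNReal.tsum_eq_zero]
      intro d
      rw [if_neg]
      rintro ⟨h1, _, h2, _⟩
      exact ha ⟨h1, h2⟩
    rw [if_pos hb, if_pos ha, if_pos ha, one_mul, one_mul]
    calc _ ≤ ∑' c : ℤ, ∑' d : ℤ, ((if d = 0 then (if |(c : ℝ)| ≤ C then (1 : ℝ≥0∞) else 0) else 0)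
          + if d ≠ 0 ∧ |(d : ℝ)| ≤ D then (if ¬ Irr ⟨a, b, c, d⟩ then (1 : ℝ≥0∞) else 0) else 0) := by
          refine ENNReal.tsum_le_tsum fun c => ENNReal.tsum_le_tsum fun d => ?_
          by_cases h : (⟨a, b, c, d⟩ : Cub ℤ).a ≠ 0 ∧ ¬ Irr ⟨a, b, c, d⟩ ∧ Box Λ w ⟨a, b, c, d⟩
          · rw [if_pos h]
            obtain ⟨_, h2, _, _, h3, h4⟩ := h
            by_cases hd : d = 0
            · rw [if_pos hd, if_pos h3]; exact le_self_add
            · rw [if_neg hd, if_pos ⟨hd, h4⟩, if_pos h2]; exact le_add_self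
          · rw [if_neg h]; exact zero_le
      _ = (∑' c : ℤ, if |(c : ℝ)| ≤ C then (1 : ℝ≥0∞) else 0) +
          ∑' d : ℤ, if d ≠ 0 ∧ |(d : ℝ)| ≤ D then
            ∑' c : ℤ, (if ¬ Irr ⟨a, b, c, d⟩ then (1 : ℝ≥0∞) else 0) else 0 := by
        simp_rw [ENNReal.tsum_add]
        congr 1
        · refine tsum_congr fun c => ?_
          rw [tsum_eq_single 0 fun d hd => if_neg hd, if_pos rfl]
        · rw [ENNReal.tsum_comm]
          refine tsum_congr fun d => ?_
          split_ifs <;> simp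
      _ ≤ ofReal (2 * C + 1) + ∑' d : ℤ, 4 * a.natAbs.divisors.card *
          (if d ≠ 0 ∧ |(d : ℝ)| ≤ D then (d.natAbs.divisors.card : ℝ≥0∞) else 0) := by
        refine add_le_add (hcard C (by positivity)) (ENNReal.tsum_le_tsum fun d => ?_)
        split_ifs with hd
        · exact (tsum_not_irr_le ha.1 hd.1).trans (by rw [mul_assoc])
        · exact zero_le
      _ ≤ _ := by
        rw [ENNReal.tsum_mul_left, mul_assoc]
        gcongr
        exact tsum_card_divisors_le D
  rw [tsum_cub]
  calc _ ≤ ∑' a : ℤ, ∑' b : ℤ, _ := ENNReal.tsum_le_tsum fun a => ENNReal.tsum_le_tsum fun b => hin a b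
    _ ≤ ofReal (2 * B + 1) * (ofReal (3 * A) * ofReal (2 * C + 1)
        + 4 * (ofReal (50 * (A * A ^ (1 / 24 : ℝ))) *
          ofReal (50 * (D * D ^ (1 / 24 : ℝ))))) := by
      simp_rw [ENNReal.tsum_mul_right]
      rw [ENNReal.tsum_mul_left, ENNReal.tsum_add, ENNReal.tsum_mul_right, ENNReal.tsum_mul_left,
        ENNReal.tsum_mul_right]
      gcongr
      · exact hcard B (by positivity)
      · exact tsum_ne_zero_abs_le
      · exact tsum_card_divisors_le A
    _ = ofReal ((2 * B + 1) * (3 * A * (2 * C + 1) + 4 * (50 * (A * A ^ (1 / 24 : ℝ)) *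
          (50 * (D * D ^ (1 / 24 : ℝ)))))) := by
      have e4 : (4 : ℝ≥0∞) = ofReal 4 := by norm_num
      rw [e4, ← ofReal_mul (by positivity), ← ofReal_mul (by positivity),
        ← ofReal_mul (by norm_num), ← ofReal_add (by positivity) (by positivity),
        ← ofReal_mul (by positivity)]
    _ ≤ _ := by
      refine ofReal_le_ofReal (le_trans ?_ (box_bound_le hw hw2 hA))
      have h1 : 2 * B + 1 ≤ 8 * Λ / w := by
        rw [← sub_nonneg]
        have : 8 * Λ / w - (2 * B + 1) = (2 * Λ - w) / w := by rw [hB]; field_simp; ring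
        rw [this]
        exact div_nonneg (by linarith) hw.le
      have h2 : 2 * C + 1 ≤ 18 * Λ * w := by
        rw [hC]; nlinarith
      gcongr

open Classical in
lemma tsum_om_not_irr_le (hΛ : 0 < Λ) (hw : 0 < w) (hw2 : 4 / 5 ≤ w ^ 2)
    {E : Finset ℕ} (hE : ∀ p ∈ E, p.Prime) :
    ∑' f : Cub ℤ, (if f.a ≠ 0 ∧ ¬ Irr f ∧ Box Λ w f then ∏ p ∈ E, (om p f : ℝ≥0∞) else 0) ≤
      ofReal (50000000 * 6 ^ E.card * Λ ^ (37 / 12 : ℝ) * w) := by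
  have hS : ∀ S ∈ E.powerset, ∑' f : Cub ℤ, (if f.a ≠ 0 ∧ ¬ Irr f ∧ Box Λ w f then
      (if Dvd ((∏ p ∈ S, p : ℕ) : ℤ) f then ((∏ p ∈ S, p : ℕ) : ℝ≥0∞) else 0) else 0) ≤
      ofReal (50000000 * Λ ^ (37 / 12 : ℝ) * w) := by
    intro S hS
    set k : ℕ := ∏ p ∈ S, p with hk
    have hk1 : 0 < k := prod_pos fun p hp => (hE p (mem_powerset.1 hS hp)).pos
    have hkz : (k : ℤ) ≠ 0 := by exact_mod_cast hk1.ne'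
    have hkr : (0 : ℝ) < k := by exact_mod_cast hk1
    have h1 : ∑' f : Cub ℤ, (if f.a ≠ 0 ∧ ¬ Irr f ∧ Box Λ w f then
        (if Dvd (k : ℤ) f then (k : ℝ≥0∞) else 0) else 0) =
        ∑' f : Cub ℤ, (if f.a ≠ 0 ∧ ¬ Irr f ∧ Box (Λ / k) w f then (k : ℝ≥0∞) else 0) := by
      rw [← (scal_injective hkz).tsum_eq]
      · refine tsum_congr fun f => ?_
        have e1 : (scal (k : ℤ) f).a ≠ 0 ↔ f.a ≠ 0 := by simp [scal, hk1.ne']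
        have e2 : Dvd (k : ℤ) (scal (k : ℤ) f) := dvd_iff.2 ⟨f, rfl⟩
        have e3 : Box Λ w (scal (k : ℤ) f) ↔ Box (Λ / k) w f := by
          simp only [Box, scal, Int.cast_mul, Int.cast_natCast, abs_mul, Nat.abs_cast]
          have g : ∀ x y z : ℝ, y = k * z → (k * x ≤ y ↔ x ≤ z) := by
            rintro x y z rfl
            exact mul_le_mul_iff_right₀ hkr
          exact and_congr (g _ _ _ (by field_simp)) (and_congr (g _ _ _ (by field_simp))
            (and_congr (g _ _ _ (by field_simp)) (g _ _ _ (by field_simp))))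
        simp only [irr_scal hkz, e1, e3, if_pos e2]
      · intro f hf
        rw [Function.mem_support, ne_eq, ite_eq_right_iff, Classical.not_imp, ite_eq_right_iff,
          Classical.not_imp] at hf
        obtain ⟨g, hg⟩ := dvd_iff.1 hf.2.1
        exact ⟨g, hg.symm⟩
    rw [h1]
    have h2 : ∀ f : Cub ℤ, (if f.a ≠ 0 ∧ ¬ Irr f ∧ Box (Λ / k) w f then (k : ℝ≥0∞) else 0) =
        k * (if f.a ≠ 0 ∧ ¬ Irr f ∧ Box (Λ / k) w f then 1 else 0) := fun f => by split_ifs <;> simp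
    simp_rw [h2]
    rw [ENNReal.tsum_mul_left]
    refine (mul_le_mul_right (tsum_box_not_irr_le (by positivity) hw hw2) _).trans ?_
    rw [← ofReal_natCast, ← ofReal_mul hkr.le]
    refine ofReal_le_ofReal ?_
    have hk1' : (1 : ℝ) ≤ k := by exact_mod_cast hk1
    have : (k : ℝ) * (Λ / k) ^ (37 / 12 : ℝ) ≤ Λ ^ (37 / 12 : ℝ) := by
      rw [div_rpow hΛ.le hkr.le, mul_div_assoc', div_le_iff₀ (by positivity), mul_comm]
      gcongr
      exact self_le_rpow_of_one_le hk1' (by norm_num)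
    calc _ = 50000000 * (k * (Λ / k) ^ (37 / 12 : ℝ)) * w := by ring
      _ ≤ _ := by gcongr
  calc _ ≤ ∑' f : Cub ℤ, 3 ^ E.card * ∑ S ∈ E.powerset, (if f.a ≠ 0 ∧ ¬ Irr f ∧ Box Λ w f then
      (if Dvd ((∏ p ∈ S, p : ℕ) : ℤ) f then ((∏ p ∈ S, p : ℕ) : ℝ≥0∞) else 0) else 0) := by
        refine ENNReal.tsum_le_tsum fun f => ?_
        by_cases h : f.a ≠ 0 ∧ ¬ Irr f ∧ Box Λ w f
        · simp only [if_pos h]; exact prod_om_le hE f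
        · simp only [if_neg h]; exact zero_le
    _ = 3 ^ E.card * ∑ S ∈ E.powerset, ∑' f : Cub ℤ, (if f.a ≠ 0 ∧ ¬ Irr f ∧ Box Λ w f then
      (if Dvd ((∏ p ∈ S, p : ℕ) : ℤ) f then ((∏ p ∈ S, p : ℕ) : ℝ≥0∞) else 0) else 0) := by
        rw [ENNReal.tsum_mul_left, Summable.tsum_finsetSum fun _ _ => ENNReal.summable]
    _ ≤ 3 ^ E.card * ∑ S ∈ E.powerset, ofReal (50000000 * Λ ^ (37 / 12 : ℝ) * w) := by
        gcongr with S hSE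
        exact hS S hSE
    _ = _ := by
      have e6 : (3 : ℝ≥0∞) ^ E.card * 2 ^ E.card = ofReal (6 ^ E.card) := by
        rw [← mul_pow, ofReal_pow (by norm_num)]; norm_num
      rw [sum_const, card_powerset, nsmul_eq_mul, ← mul_assoc]
      push_cast
      rw [e6, ← ofReal_mul (by positivity)]
      congr 1; ring

end Cub

namespace Cub

open Classical in
lemma wt_mul_indicator {σ : ℤ} (hσ : σ = 1 ∨ σ = -1) (Y : ℝ) (E : Finset ℕ) (f : Cub ℤ) (z : ℍ) :
    wt σ Y ∅ E f * (balSet f.toReal).indicator 1 z =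
      if Irr f then (∏ p ∈ E, (om p f : ℝ≥0∞)) * (reg σ Y z).indicator 1 f.toReal else 0 := by
  by_cases hI : Irr f
  swap
  · simp [wt, hI]
  have h0 : f.toReal.disc = (f.disc : ℝ) := disc_toReal f
  have h1 : (f.toReal ∈ reg σ Y z) ↔ (z ∈ balSet f.toReal ∧ 0 < σ * f.disc ∧
      ((σ * f.disc : ℤ) : ℝ) < Y) := by
    simp only [reg, balSet, Balanced, mem_ofPred_eq, h0]
    have e1 : (0 < σ * f.disc) ↔ (0 : ℝ) < σ * f.disc := by exact_mod_cast Iff.rfl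
    rw [e1, Int.cast_mul]
    refine and_congr_left fun h => ?_
    have : |(f.disc : ℝ)| = σ * f.disc := by
      rcases hσ with rfl | rfl
      · rw [Int.cast_one, one_mul] at h ⊢; exact abs_of_pos h.1
      · rw [Int.cast_neg, Int.cast_one, neg_one_mul] at h ⊢
        exact abs_of_neg (by linarith)
    rw [this]
  by_cases h2 : z ∈ balSet f.toReal <;> by_cases h3 : 0 < σ * f.disc ∧ ((σ * f.disc : ℤ) : ℝ) < Y
  · rw [wt, if_pos ⟨hI, h3.1, h3.2, by simp⟩, if_pos hI, indicator_of_mem h2,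
      indicator_of_mem (h1.2 ⟨h2, h3⟩)]
    rfl
  · rw [wt, if_neg (fun h => h3 ⟨h.2.1, h.2.2.1⟩), if_pos hI,
      indicator_of_notMem (fun h => h3 (h1.1 h).2), zero_mul, mul_zero]
  · rw [if_pos hI, indicator_of_notMem h2, indicator_of_notMem (fun h => h2 (h1.1 h).1),
      mul_zero, mul_zero]
  · rw [if_pos hI, indicator_of_notMem h2, indicator_of_notMem (fun h => h2 (h1.1 h).1),
      mul_zero, mul_zero]

/-- The volume main term above a point of the upper half plane. -/
def mainTerm (σ : ℤ) (Y : ℝ) (e : ℕ) (z : ℍ) : ℝ≥0∞ :=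
  open Classical in ∑' a : ℤ, if a ≠ 0 ∧ (e : ℤ) ∣ a then volume (slice σ Y z a) else 0

lemma near_wt_sum {σ : ℤ} (hσ : σ = 1 ∨ σ = -1) {Y Λ w : ℝ} {z : ℍ} (hΛ : 0 < Λ)
    (hΛY : Λ ^ 4 = 100 * Y) (hw : 0 < w) (hwz : w ^ 2 = z.im) (hz : 4 / 5 ≤ z.im)
    (hx : |z.re| ≤ 1 / 2) {E : Finset ℕ} (hE : ∀ p ∈ E, p.Prime) :
    Near (∑' f : Cub ℤ, wt σ Y ∅ E f * (balSet f.toReal).indicator 1 z)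
      (∑ S ∈ E.powerset, mainTerm σ Y (∏ p ∈ S, p) z)
      (ofReal (52000000 * 6 ^ E.card * ((√((∏ p ∈ E, p : ℕ) : ℝ) * Λ ^ 3
        + Λ ^ (37 / 12 : ℝ)) * w + (∏ p ∈ E, p : ℕ) * Λ ^ 2))) := by
  classical
  have h1 : Near (∑' f : Cub ℤ, wt σ Y ∅ E f * (balSet f.toReal).indicator 1 z)
      (∑' f : Cub ℤ, if f.a ≠ 0 then (∏ p ∈ E, (om p f : ℝ≥0∞)) * (reg σ Y z).indicator 1 f.toReal
        else 0) (ofReal (50000000 * 6 ^ E.card * Λ ^ (37 / 12 : ℝ) * w)) := by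
    refine (Near.tsum (e := fun f : Cub ℤ => if f.a ≠ 0 ∧ ¬ Irr f ∧ Box Λ w f then
      ∏ p ∈ E, (om p f : ℝ≥0∞) else 0) fun f => ?_).mono
      (tsum_om_not_irr_le hΛ hw (hwz ▸ hz) hE)
    rw [wt_mul_indicator hσ]
    by_cases hI : Irr f
    · have ha : f.a ≠ 0 := fun h => by
        have := hI 1 0 (by simp [ev, h])
        simp at this
      rw [if_pos hI, if_pos ha]
      exact Near.refl _ _
    · rw [if_neg hI]
      refine ⟨zero_le, ?_⟩
      rw [zero_add]
      by_cases ha : f.a ≠ 0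
      · by_cases hr : f.toReal ∈ reg σ Y z
        · have hb := coeff_le_of_mem_reg hΛ.le hΛY hw hwz hz hx hr
          have hB : Box Λ w f := by
            refine ⟨?_, ?_, hb.2.2.1, hb.2.2.2⟩
            · rw [le_div_iff₀ (by positivity)]; exact hb.1
            · rw [le_div_iff₀ (by positivity)]; exact hb.2.1
          rw [if_pos ha, if_pos ⟨ha, hI, hB⟩, indicator_of_mem hr]
          simp
        · rw [if_pos ha, indicator_of_notMem hr, mul_zero]; exact zero_le
      · rw [if_neg ha]; exact zero_le
  refine (h1.trans (near_count hΛ.le hΛY hw hwz hz hx hE)).mono ?_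
  rw [← ofReal_add (by positivity) (by positivity)]
  refine ofReal_le_ofReal ?_
  have h46 : (4 : ℝ) ^ E.card ≤ 6 ^ E.card := pow_le_pow_left₀ (by norm_num) (by norm_num) _
  have h5 : 0 ≤ √((∏ p ∈ E, p : ℕ) : ℝ) * Λ ^ 3 * w + (∏ p ∈ E, p : ℕ) * Λ ^ 2 := by positivity
  have h7 : 0 ≤ (6 : ℝ) ^ E.card * (Λ ^ (37 / 12 : ℝ) * w) := by positivity
  have h6 := mul_le_mul_of_nonneg_right h46 h5
  have h8 : 0 ≤ (6 : ℝ) ^ E.card *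
    (√((∏ p ∈ E, p : ℕ) : ℝ) * Λ ^ 3 * w + (∏ p ∈ E, p : ℕ) * Λ ^ 2) := by positivity
  linarith

lemma im_ge_of_mem_fd {z : ℍ} (hz : z ∈ 𝒟) : 4 / 5 ≤ z.im ∧ |z.re| ≤ 1 / 2 := by
  have h := ModularGroup.three_le_four_mul_im_sq_of_mem_fd hz
  refine ⟨?_, hz.2⟩
  nlinarith [z.im_pos]

lemma near_sieveSum {σ : ℤ} (hσ : σ = 1 ∨ σ = -1) (c : ℝ≥0∞) {Y : ℝ} (hY : 1 ≤ Y)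
    {E : Finset ℕ} (hE : ∀ p ∈ E, p.Prime) :
    Near (sieveSum σ (redWeight c) Y ∅ E)
      ((4 * c)⁻¹ * ∫⁻ z in 𝒟, ∑ S ∈ E.powerset, mainTerm σ Y (∏ p ∈ S, p) z)
      ((4 * c)⁻¹ * (ofReal (52000000 * 10000 * 6 ^ E.card *
        (√((∏ p ∈ E, p : ℕ) : ℝ) * Y ^ (37 / 48 : ℝ) + (∏ p ∈ E, p : ℕ) * Y ^ (1 / 2 : ℝ)))
        * ∫⁻ z in 𝒟, ofReal (3 * √z.im))) := by
  have hY0 : 0 < Y := by linarith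
  have e1 : sieveSum σ (redWeight c) Y ∅ E = (4 * c)⁻¹ *
      ∫⁻ z in 𝒟, ∑' f : Cub ℤ, wt σ Y ∅ E f * (balSet f.toReal).indicator 1 z := by
    have hm : ∀ f : Cub ℤ, Measurable ((balSet f.toReal).indicator (1 : ℍ → ℝ≥0∞)) := fun f =>
      measurable_one.indicator (measurableSet_balSet _)
    refine Eq.trans ?_ (congrArg _ (lintegral_tsum (f := fun (f : Cub ℤ) (z : ℍ) =>
      wt σ Y ∅ E f * (balSet f.toReal).indicator 1 z) fun f =>
        ((hm f).const_mul _).aemeasurable).symm)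
    rw [sieveSum, ← ENNReal.tsum_mul_left]
    refine tsum_congr fun f => ?_
    rw [lintegral_const_mul _ (hm f), redWeight_eq, mul_left_comm]
  rw [e1]
  refine Near.mul_left _ ?_
  have hΛ : 0 < (100 * Y) ^ (1 / 4 : ℝ) := by positivity
  set Λ := (100 * Y) ^ (1 / 4 : ℝ) with hΛd
  have hΛY : Λ ^ 4 = 100 * Y := by
    rw [hΛd, ← rpow_natCast, ← rpow_mul (by positivity)]; norm_num
  have p1 : ∀ s : ℝ, s ≤ 8 → Λ ^ s ≤ 10000 * Y ^ (s / 4) := fun s hs => by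
    rw [hΛd, ← rpow_mul (by positivity), mul_rpow (by norm_num) hY0.le,
      show (1 : ℝ) / 4 * s = s / 4 by ring]
    refine mul_le_mul_of_nonneg_right ?_ (by positivity)
    refine (rpow_le_rpow_of_exponent_le (by norm_num) (by linarith : s / 4 ≤ 2)).trans ?_
    norm_num
  have hq : Measurable fun z : ℍ => ofReal (3 * √z.im) := by
    have := continuous_im.measurable
    fun_prop
  rw [← lintegral_const_mul _ hq]
  refine Near.setLIntegral UMat.measurableSet_fd (hq.const_mul _) fun z hz => ?_
  obtain ⟨h1, h2⟩ := im_ge_of_mem_fd hz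
  refine (near_wt_sum hσ hΛ hΛY (sqrt_pos.2 z.im_pos) (sq_sqrt z.im_pos.le) h1 h2 hE).mono ?_
  rw [← ofReal_mul (by positivity)]
  refine ofReal_le_ofReal ?_
  have hw : 4 / 5 ≤ √z.im := le_sqrt_of_sq_le (by linarith)
  set e : ℝ := ((∏ p ∈ E, p : ℕ) : ℝ) with he
  have he1 : 1 ≤ √e := by
    rw [one_le_sqrt, he]
    exact_mod_cast one_le_prod' fun p hp => (hE p hp).one_le
  have q1 : Λ ^ 3 ≤ 10000 * Y ^ (37 / 48 : ℝ) := by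
    rw [← rpow_natCast]
    refine (p1 _ (by norm_num)).trans (mul_le_mul_of_nonneg_left ?_ (by norm_num))
    exact rpow_le_rpow_of_exponent_le hY (by norm_num)
  have q2 : Λ ^ (37 / 12 : ℝ) ≤ √e * (10000 * Y ^ (37 / 48 : ℝ)) := by
    refine ((p1 _ (by norm_num)).trans_eq (by norm_num)).trans
      (le_mul_of_one_le_left (by positivity) he1)
  have q3 : Λ ^ 2 ≤ 10000 * Y ^ (1 / 2 : ℝ) := by
    rw [← rpow_natCast]
    exact (p1 _ (by norm_num)).trans_eq (by norm_num)
  have hs : 0 ≤ √e := by positivity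
  have he0 : 0 ≤ e := by rw [he]; positivity
  have r1 := mul_le_mul_of_nonneg_left q1 hs
  have r3 := mul_le_mul_of_nonneg_left q3 he0
  have r4 : e * Λ ^ 2 ≤ e * (10000 * Y ^ (1 / 2 : ℝ)) * (3 * √z.im) :=
    r3.trans (le_mul_of_one_le_right (by positivity) (by linarith))
  have r5 := mul_le_mul_of_nonneg_right (add_le_add r1 q2) (by linarith : 0 ≤ √z.im)
  calc _ ≤ 52000000 * 6 ^ E.card * ((√e * (10000 * Y ^ (37 / 48 : ℝ)) +
        √e * (10000 * Y ^ (37 / 48 : ℝ))) * √z.im + e * (10000 * Y ^ (1 / 2 : ℝ)) * (3 * √z.im)) :=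
        mul_le_mul_of_nonneg_left (add_le_add r5 r4) (by positivity)
    _ ≤ _ := by
        have : 0 ≤ 52000000 * 6 ^ E.card * (√e * (10000 * Y ^ (37 / 48 : ℝ)) * √z.im) := by positivity
        linarith

end Cub

namespace ZetaThird

/-- The Euler–Maclaurin difference term of the zeta function, cleared of its denominator. -/
def gap (n : ℕ) (s : ℂ) : ℂ :=
  (s - 1) * ((n + 1 : ℕ) : ℂ) ^ (-s) + ((n + 2 : ℕ) : ℂ) ^ (1 - s) - ((n + 1 : ℕ) : ℂ) ^ (1 - s)

lemma norm_gap_le (n : ℕ) {s : ℂ} (hs : 0 < s.re) :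
    ‖gap n s‖ ≤ ‖s - 1‖ * ‖s‖ * ((n + 1 : ℕ) : ℝ) ^ (-s.re - 1) := by
  have hd : ∀ (r : ℂ) (x : ℝ), x ∈ Icc ((n : ℝ) + 1) (n + 2) →
      HasDerivAt (fun x : ℝ => (x : ℂ) ^ r) (r * (x : ℂ) ^ (r - 1)) x := fun r x hx => by
    have hx0 : 0 < x := by linarith [hx.1, (Nat.cast_nonneg n : (0 : ℝ) ≤ n)]
    by_cases hr : r = 0
    · subst hr
      simpa using hasDerivAt_const x (1 : ℂ)
    · have := (hasDerivAt_ofReal_cpow_const' (r := r - 1) hx0.ne' (by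
        intro h; exact hr (by linear_combination h)))
      have h2 := this.const_mul r
      simp at h2
      refine h2.congr_of_eventuallyEq (Eventually.of_forall fun y => ?_)
      field_simp
  have hn : (0 : ℝ) < n + 1 := by positivity
  set K := ‖s‖ * ((n : ℝ) + 1) ^ (-s.re - 1) with hK
  have h1 : ∀ x ∈ Icc ((n : ℝ) + 1) (n + 2),
      ‖((n + 1 : ℝ) : ℂ) ^ (-s) - (x : ℂ) ^ (-s)‖ ≤ K := by
    intro x hx
    have := norm_image_sub_le_of_norm_deriv_le_segment' (f := fun x : ℝ => (x : ℂ) ^ (-s))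
      (f' := fun x : ℝ => -s * (x : ℂ) ^ (-s - 1)) (a := n + 1) (b := n + 2) (C := K)
      (fun y hy => (hd (-s) y hy).hasDerivWithinAt) (fun y hy => ?_) x hx
    · rw [norm_sub_rev]
      refine this.trans (mul_le_of_le_one_right (by positivity) (by linarith [hx.2]))
    · have hy0 : 0 < y := by linarith [hy.1]
      rw [norm_mul, norm_neg, hK, Complex.norm_cpow_eq_rpow_re_of_pos hy0]
      refine mul_le_mul_of_nonneg_left ?_ (norm_nonneg _)
      simp
      exact rpow_le_rpow_of_nonpos hn hy.1 (by linarith)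
  have h2 := norm_image_sub_le_of_norm_deriv_le_segment' (a := (n : ℝ) + 1) (b := n + 2)
    (f := fun x : ℝ => (s - 1) * ((n + 1 : ℝ) : ℂ) ^ (-s) * (x : ℂ) + (x : ℂ) ^ (1 - s))
    (f' := fun x : ℝ => (s - 1) * (((n + 1 : ℝ) : ℂ) ^ (-s) - (x : ℂ) ^ (-s)))
    (C := ‖s - 1‖ * K) (fun y hy => by
      have e := ((Complex.ofRealCLM.hasDerivAt (x := y)).const_mul
        ((s - 1) * ((n + 1 : ℝ) : ℂ) ^ (-s))).add (hd (1 - s) y hy)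
      refine (e.congr_deriv ?_).hasDerivWithinAt
      simp
      ring) (fun y hy => by
      rw [norm_mul]
      exact mul_le_mul_of_nonneg_left (h1 y ⟨hy.1, hy.2.le⟩) (norm_nonneg _)) (n + 2)
      ⟨by linarith, le_rfl⟩
  have e1 : gap n s = ((s - 1) * ((n + 1 : ℝ) : ℂ) ^ (-s) * ((n + 2 : ℝ) : ℂ)
      + ((n + 2 : ℝ) : ℂ) ^ (1 - s)) - ((s - 1) * ((n + 1 : ℝ) : ℂ) ^ (-s) * ((n + 1 : ℝ) : ℂ)
      + ((n + 1 : ℝ) : ℂ) ^ (1 - s)) := by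
    rw [gap]; push_cast; ring
  rw [e1]
  refine h2.trans_eq ?_
  rw [hK]; push_cast; ring

lemma differentiable_gap (n : ℕ) : Differentiable ℂ (gap n) := by
  have h1 : ((n + 1 : ℕ) : ℂ) ≠ 0 := by exact_mod_cast n.succ_ne_zero
  have h2 : ((n + 2 : ℕ) : ℂ) ≠ 0 := by exact_mod_cast (n + 1).succ_ne_zero
  intro s
  unfold gap
  refine ((((differentiableAt_id.sub_const _).mul ?_).add ?_).sub ?_)
  · exact (differentiableAt_id.neg).const_cpow (Or.inl h1)
  · exact (differentiableAt_id.const_sub _).const_cpow (Or.inl h2)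
  · exact (differentiableAt_id.const_sub _).const_cpow (Or.inl h1)

lemma sum_gap (N : ℕ) (s : ℂ) : ∑ n ∈ range N, gap n s =
    (s - 1) * ∑ n ∈ range N, ((n + 1 : ℕ) : ℂ) ^ (-s) + ((N + 1 : ℕ) : ℂ) ^ (1 - s) - 1 := by
  induction N with
  | zero => simp
  | succ N ih => rw [sum_range_succ, ih, sum_range_succ, gap]; ring

lemma summable_bound (K : ℝ) : Summable fun n : ℕ => K * ((n + 1 : ℕ) : ℝ) ^ (-(5 / 4) : ℝ) :=
  ((summable_nat_add_iff 1).2 (summable_nat_rpow.2 (by norm_num))).mul_left K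

/-- A convex region containing both `1 / 3` and a piece of the half plane of convergence. -/
def region : Set ℂ := {s | 1 / 4 < s.re} ∩ Metric.ball 0 3

lemma norm_gap_le_of_mem {s : ℂ} (hs : s ∈ region) (n : ℕ) :
    ‖gap n s‖ ≤ 12 * ((n + 1 : ℕ) : ℝ) ^ (-(5 / 4) : ℝ) := by
  have h1 : 1 / 4 < s.re := hs.1
  have h2 : ‖s‖ < 3 := by simpa using hs.2
  refine (norm_gap_le n (by linarith)).trans ?_
  have h3 : ‖s - 1‖ ≤ 4 := (norm_sub_le _ _).trans (by rw [norm_one]; linarith)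
  have h4 : ‖s - 1‖ * ‖s‖ ≤ 4 * 3 := mul_le_mul h3 h2.le (norm_nonneg _) (by norm_num)
  refine mul_le_mul (by linarith) (rpow_le_rpow_of_exponent_le ?_ (by linarith))
    (by positivity) (by norm_num)
  simp

lemma tsum_gap {s : ℂ} (hs : s ∈ region) : ∑' n, gap n s = riemannZeta₁ s - 1 := by
  have ho : IsOpen region :=
    (isOpen_lt continuous_const Complex.continuous_re).inter Metric.isOpen_ball
  have hc : IsPreconnected region :=
    ((convex_halfSpace_re_gt _).inter (convex_ball _ _)).isPreconnected
  have hd : DifferentiableOn ℂ (fun s => ∑' n, gap n s) region :=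
    Complex.differentiableOn_tsum_of_summable_norm (summable_bound 12)
      (fun n => (differentiable_gap n).differentiableOn) ho
      (fun n s hs => norm_gap_le_of_mem hs n)
  have h2 : (2 : ℂ) ∈ region := ⟨by norm_num, by simp; norm_num⟩
  refine (hd.analyticOnNhd ho).eqOn_of_preconnected_of_eventuallyEq
    ((differentiable_riemannZeta₁.sub_const 1).differentiableOn.analyticOnNhd ho) hc h2 ?_ hs
  have hU : {s : ℂ | 1 < s.re} ∩ region ∈ 𝓝 (2 : ℂ) :=
    ((isOpen_lt continuous_const Complex.continuous_re).inter ho).mem_nhds ⟨by norm_num, h2⟩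
  filter_upwards [hU] with s ⟨hs1, hs⟩
  have hs1 : 1 < s.re := hs1
  have hsum : Summable fun n => gap n s :=
    Summable.of_norm_bounded (summable_bound 12) (norm_gap_le_of_mem hs)
  refine tendsto_nhds_unique hsum.hasSum.tendsto_sum_nat ?_
  simp_rw [sum_gap]
  have hne : s ≠ 1 := by rintro rfl; simp at hs1
  have hz : riemannZeta₁ s = (s - 1) * riemannZeta s := by
    rw [riemannZeta_eq_inv_sub_mul hne, mul_inv_cancel_left₀ (sub_ne_zero.2 hne)]
  rw [hz]
  have t1 : Tendsto (fun N : ℕ => ∑ n ∈ range N, ((n + 1 : ℕ) : ℂ) ^ (-s)) atTop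
      (𝓝 (riemannZeta s)) := by
    rw [zeta_eq_tsum_one_div_nat_add_one_cpow hs1]
    have hS : Summable fun n : ℕ => 1 / (n + 1 : ℂ) ^ s := by
      have := (summable_nat_add_iff 1).2 (Complex.summable_one_div_nat_cpow.2 hs1)
      simpa using this
    refine hS.hasSum.tendsto_sum_nat.congr fun N => sum_congr rfl fun n _ => ?_
    rw [Complex.cpow_neg, one_div]; push_cast; rfl
  have t2 : Tendsto (fun N : ℕ => ((N + 1 : ℕ) : ℂ) ^ (1 - s)) atTop (𝓝 0) := by
    rw [tendsto_zero_iff_norm_tendsto_zero]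
    have : Tendsto (fun N : ℕ => ((N + 1 : ℕ) : ℝ) ^ (-(s.re - 1))) atTop (𝓝 0) :=
      ((tendsto_rpow_neg_atTop (by linarith)).comp tendsto_natCast_atTop_atTop).comp
        (tendsto_add_atTop_nat 1)
    refine this.congr fun N => ?_
    rw [Complex.norm_natCast_cpow_of_pos N.succ_pos]
    simp
  simpa using ((t1.const_mul (s - 1)).add t2).sub_const 1

/-- The partial sums of the Dirichlet series at `1 / 3`. -/
def psum (N : ℕ) : ℝ := ∑ n ∈ range N, ((n + 1 : ℕ) : ℝ) ^ (-(1 / 3) : ℝ)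

lemma tendsto_psum : Tendsto (fun N : ℕ => psum N - 3 / 2 * ((N + 1 : ℕ) : ℝ) ^ (2 / 3 : ℝ))
    atTop (𝓝 (riemannZeta ((1 / 3 : ℝ) : ℂ)).re) := by
  have hr : (((1 / 3 : ℝ) : ℂ)) ∈ region := ⟨by
    change 1 / 4 < (((1 / 3 : ℝ) : ℂ)).re
    rw [Complex.ofReal_re]; norm_num, by
    rw [mem_ball_zero_iff, Complex.norm_real, norm_eq_abs, abs_of_pos] <;> norm_num⟩
  have hsum : Summable fun n => gap n ((1 / 3 : ℝ) : ℂ) :=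
    Summable.of_norm_bounded (summable_bound 12) (norm_gap_le_of_mem hr)
  have h := hsum.hasSum.tendsto_sum_nat
  have hne : ((1 / 3 : ℝ) : ℂ) ≠ 1 := by
    rw [Ne, Complex.ofReal_eq_one]; norm_num
  rw [tsum_gap hr] at h
  have h2 := (Complex.continuous_re.tendsto _).comp ((h.add_const 1).const_mul
    (((1 / 3 : ℝ) : ℂ) - 1)⁻¹)
  rw [sub_add_cancel, ← riemannZeta_eq_inv_sub_mul hne] at h2
  refine h2.congr fun N => ?_
  have e : (((1 / 3 : ℝ) : ℂ) - 1)⁻¹ * (∑ n ∈ range N, gap n ((1 / 3 : ℝ) : ℂ) + 1) =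
      ((psum N - 3 / 2 * ((N + 1 : ℕ) : ℝ) ^ (2 / 3 : ℝ) : ℝ) : ℂ) := by
    rw [sum_gap, psum, sub_add_cancel, mul_add, inv_mul_cancel_left₀ (sub_ne_zero.2 hne)]
    have g1 : ∑ n ∈ range N, ((n + 1 : ℕ) : ℂ) ^ (-((1 / 3 : ℝ) : ℂ)) =
        ((∑ n ∈ range N, ((n + 1 : ℕ) : ℝ) ^ (-(1 / 3) : ℝ) : ℝ) : ℂ) := by
      rw [Complex.ofReal_sum]
      refine sum_congr rfl fun n _ => ?_
      rw [Complex.ofReal_cpow (by positivity)]; push_cast; rfl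
    have g2 : ((N + 1 : ℕ) : ℂ) ^ (1 - ((1 / 3 : ℝ) : ℂ)) =
        ((((N + 1 : ℕ) : ℝ) ^ (2 / 3 : ℝ) : ℝ) : ℂ) := by
      rw [Complex.ofReal_cpow (by positivity)]; norm_num
    rw [g1, g2]; push_cast; ring
  exact congrArg Complex.re e |>.trans (Complex.ofReal_re _)

lemma rpow_diff_bounds {x : ℝ} (hx : 0 < x) :
    3 / 2 * ((x + 1) ^ (2 / 3 : ℝ) - x ^ (2 / 3 : ℝ)) ≤ x ^ (-(1 / 3) : ℝ) ∧
    (x + 1) ^ (-(1 / 3) : ℝ) ≤ 3 / 2 * ((x + 1) ^ (2 / 3 : ℝ) - x ^ (2 / 3 : ℝ)) := by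
  have e2 : ∀ y : ℝ, 0 < y → y ^ (2 / 3 : ℝ) = (y ^ (1 / 3 : ℝ)) ^ 2 := fun y hy => by
    rw [← rpow_natCast, ← rpow_mul hy.le]; norm_num
  have e3 : ∀ y : ℝ, 0 < y → (y ^ (1 / 3 : ℝ)) ^ 3 = y := fun y hy => by
    rw [← rpow_natCast, ← rpow_mul hy.le]; norm_num
  have hx1 : 0 < x + 1 := by linarith
  rw [e2 _ hx, e2 _ hx1, rpow_neg hx.le, rpow_neg hx1.le]
  have hp : 0 < x ^ (1 / 3 : ℝ) := by positivity
  have hq : 0 < (x + 1) ^ (1 / 3 : ℝ) := by positivity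
  have h3 := e3 x hx
  have h4 := e3 _ hx1
  set p := x ^ (1 / 3 : ℝ)
  set q := (x + 1) ^ (1 / 3 : ℝ)
  have hd : q ^ 3 - p ^ 3 = 1 := by rw [h3, h4]; ring
  constructor
  · rw [← one_div, le_div_iff₀ hp]
    have : 0 ≤ (q - p) ^ 2 * (q + p / 2) := by positivity
    linarith
  · rw [← one_div, div_le_iff₀ hq]
    have : 0 ≤ (q - p) ^ 2 * (q / 2 + p) := by positivity
    linarith

lemma psum_bounds (N : ℕ) :
    psum N - 3 / 2 * ((N : ℝ) + 1) ^ (2 / 3 : ℝ) ≤ (riemannZeta ((1 / 3 : ℝ) : ℂ)).re ∧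
    (riemannZeta ((1 / 3 : ℝ) : ℂ)).re ≤ psum N - 3 / 2 * (N : ℝ) ^ (2 / 3 : ℝ) := by
  have hs : ∀ N, psum (N + 1) = psum N + ((N : ℝ) + 1) ^ (-(1 / 3) : ℝ) := fun N => by
    rw [psum, sum_range_succ, ← psum]; push_cast; rfl
  have hm : Monotone fun N : ℕ => psum N - 3 / 2 * ((N + 1 : ℕ) : ℝ) ^ (2 / 3 : ℝ) := by
    refine monotone_nat_of_le_succ fun N => ?_
    have := (rpow_diff_bounds (x := N + 1) (by positivity)).1
    simp only [hs]; push_cast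
    linarith
  have ha : Antitone fun N : ℕ => psum (N + 1) - 3 / 2 * ((N + 1 : ℕ) : ℝ) ^ (2 / 3 : ℝ) := by
    refine antitone_nat_of_succ_le fun N => ?_
    have := (rpow_diff_bounds (x := N + 1) (by positivity)).2
    simp only [hs (N + 1)]; push_cast
    linarith
  have ht : Tendsto (fun N : ℕ => psum (N + 1) - 3 / 2 * ((N + 1 : ℕ) : ℝ) ^ (2 / 3 : ℝ)) atTop
      (𝓝 (riemannZeta ((1 / 3 : ℝ) : ℂ)).re) := by
    have h0 : Tendsto (fun N : ℕ => ((N : ℝ) + 1) ^ (-(1 / 3) : ℝ)) atTop (𝓝 0) :=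
      (tendsto_rpow_neg_atTop (by norm_num)).comp
        (tendsto_atTop_add_const_right _ _ tendsto_natCast_atTop_atTop)
    have := tendsto_psum.add h0
    rw [add_zero] at this
    refine this.congr fun N => ?_
    rw [hs]; ring
  constructor
  · have := hm.ge_of_tendsto tendsto_psum N
    simpa using this
  · rcases N with _ | N
    · have := ha.le_of_tendsto ht 0
      simp only [psum, zero_add, sum_range_one] at this
      refine this.trans ?_
      norm_num [psum]
    · simpa using ha.le_of_tendsto ht N

lemma zeta_neg : (riemannZeta ((1 / 3 : ℝ) : ℂ)).re < 0 := by
  have := (psum_bounds 1).2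
  simp only [psum, sum_range_one, zero_add, Nat.cast_one, one_rpow] at this
  linarith

/-- Partial sums over `n ≤ x` against the main terms. -/
lemma abs_psum_sub_le {x : ℝ} (hx : 0 < x) {N : ℕ} (h1 : (N : ℝ) ≤ x) (h2 : x ≤ N + 1) :
    |psum N - 3 / 2 * x ^ (2 / 3 : ℝ) - (riemannZeta ((1 / 3 : ℝ) : ℂ)).re|
      ≤ 3 * x ^ (-(1 / 4) : ℝ) := by
  have hb := psum_bounds N
  have m1 : (N : ℝ) ^ (2 / 3 : ℝ) ≤ x ^ (2 / 3 : ℝ) :=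
    rpow_le_rpow (by positivity) h1 (by norm_num)
  have m2 : x ^ (2 / 3 : ℝ) ≤ ((N : ℝ) + 1) ^ (2 / 3 : ℝ) :=
    rpow_le_rpow hx.le h2 (by norm_num)
  suffices h : 3 / 2 * (((N : ℝ) + 1) ^ (2 / 3 : ℝ) - (N : ℝ) ^ (2 / 3 : ℝ)) ≤
      3 * x ^ (-(1 / 4) : ℝ) by
    rw [abs_le]; constructor <;> linarith
  rcases N with _ | N
  · have : 1 ≤ x ^ (-(1 / 4) : ℝ) := one_le_rpow_of_pos_of_le_one_of_nonpos hx (by simpa using h2)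
      (by norm_num)
    simp only [Nat.cast_zero, zero_add, one_rpow]
    rw [zero_rpow (by norm_num)]; linarith
  · have hN : (1 : ℝ) ≤ (N + 1 : ℕ) := by simp
    refine (rpow_diff_bounds (x := (N + 1 : ℕ)) (by linarith)).1.trans ?_
    have e1 : ((N + 1 : ℕ) : ℝ) ^ (-(1 / 3) : ℝ) ≤ ((N + 1 : ℕ) : ℝ) ^ (-(1 / 4) : ℝ) :=
      rpow_le_rpow_of_exponent_le hN (by norm_num)
    have e2 : ((N + 1 : ℕ) : ℝ) ^ (-(1 / 4) : ℝ) ≤ (x / 2) ^ (-(1 / 4) : ℝ) :=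
      rpow_le_rpow_of_nonpos (by linarith) (by linarith) (by norm_num)
    have e3 : (x / 2) ^ (-(1 / 4) : ℝ) = 2 ^ (1 / 4 : ℝ) * x ^ (-(1 / 4) : ℝ) := by
      rw [div_rpow hx.le (by norm_num), rpow_neg (by norm_num : (0 : ℝ) ≤ 2), div_inv_eq_mul,
        mul_comm]
    have e4 : (2 : ℝ) ^ (1 / 4 : ℝ) ≤ 2 ^ (1 : ℝ) :=
      rpow_le_rpow_of_exponent_le (by norm_num) (by norm_num)
    rw [rpow_one] at e4
    have : 0 < x ^ (-(1 / 4) : ℝ) := by positivity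
    nlinarith

end ZetaThird

lemma lintegral_comp_affine {F : ℝ → ℝ≥0∞} (hF : Measurable F) {k : ℝ} (hk : k ≠ 0) (β : ℝ) :
    ∫⁻ t, F (k * t + β) = ofReal |k⁻¹| * ∫⁻ t, F t := by
  have h1 : ∫⁻ t, F (k * t + β) = ∫⁻ t, F (t + β) ∂(Measure.map (k * ·) volume) :=
    (lintegral_map (f := fun t => F (t + β)) (by fun_prop) (by fun_prop)).symm
  rw [h1, map_volume_mul_left hk, lintegral_smul_measure, lintegral_add_right_eq_self,
    smul_eq_mul]

lemma lintegral_prod₃ {F : ℝ³ → ℝ≥0∞} (hF : Measurable F) :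
    ∫⁻ q, F q = ∫⁻ x, ∫⁻ y, ∫⁻ z, F (x, y, z) := by
  rw [Measure.volume_eq_prod, lintegral_prod _ hF.aemeasurable]
  refine lintegral_congr fun x => ?_
  rw [Measure.volume_eq_prod, lintegral_prod _ (by fun_prop)]

/-- Change of variables for triangular substitutions in three variables. -/
lemma lintegral_comp_triangular {F : ℝ³ → ℝ≥0∞} (hF : Measurable F) {k₁ k₂ k₃ : ℝ}
    (h₁ : k₁ ≠ 0) (h₂ : k₂ ≠ 0) (h₃ : k₃ ≠ 0) (β : ℝ) {γ : ℝ → ℝ} {δ : ℝ → ℝ → ℝ}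
    (hγ : Measurable γ) (hδ : Measurable fun p : ℝ × ℝ => δ p.1 p.2) :
    ∫⁻ q : ℝ³, F (k₁ * q.1 + β, k₂ * q.2.1 + γ q.1, k₃ * q.2.2 + δ q.1 q.2.1) =
      ofReal |(k₁ * k₂ * k₃)⁻¹| * ∫⁻ q, F q := by
  have hδ' : Measurable fun q : ℝ³ => δ q.1 q.2.1 :=
    hδ.comp (measurable_fst.prodMk (measurable_fst.comp measurable_snd))
  rw [lintegral_prod₃ (F := fun q : ℝ³ =>
      F (k₁ * q.1 + β, k₂ * q.2.1 + γ q.1, k₃ * q.2.2 + δ q.1 q.2.1)) (by fun_prop),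
    lintegral_prod₃ hF]
  have hm2 : Measurable fun p : ℝ × ℝ => ∫⁻ z, F (p.1, p.2, z) :=
    Measurable.lintegral_prod_right' (f := fun p : (ℝ × ℝ) × ℝ => F (p.1.1, p.1.2, p.2)) (by fun_prop)
  have hm1 : Measurable fun x : ℝ => ∫⁻ y, ∫⁻ z, F (x, y, z) :=
    Measurable.lintegral_prod_right' hm2
  have e3 : ∀ x y : ℝ, ∫⁻ z, F (k₁ * x + β, k₂ * y + γ x, k₃ * z + δ x y) =
      ofReal |k₃⁻¹| * ∫⁻ z, F (k₁ * x + β, k₂ * y + γ x, z) := fun x y =>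
    lintegral_comp_affine (F := fun z => F (k₁ * x + β, k₂ * y + γ x, z)) (by fun_prop) h₃ _
  have e2 : ∀ x : ℝ, ∫⁻ y, ∫⁻ z, F (k₁ * x + β, k₂ * y + γ x, z) =
      ofReal |k₂⁻¹| * ∫⁻ y, ∫⁻ z, F (k₁ * x + β, y, z) := fun x =>
    lintegral_comp_affine (F := fun y => ∫⁻ z, F (k₁ * x + β, y, z))
      (hm2.comp (measurable_const.prodMk measurable_id)) h₂ _
  have e1 := lintegral_comp_affine hm1 h₁ β
  have m2 : ∀ x, Measurable fun y : ℝ => ∫⁻ z, F (k₁ * x + β, k₂ * y + γ x, z) := fun x =>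
    hm2.comp (f := fun y : ℝ => (k₁ * x + β, k₂ * y + γ x)) (by fun_prop)
  have m1 : Measurable fun x : ℝ => ∫⁻ y, ∫⁻ z, F (k₁ * x + β, y, z) :=
    hm1.comp (g := fun x : ℝ => ∫⁻ y, ∫⁻ z, F (x, y, z)) (by fun_prop : Measurable fun x : ℝ => k₁ * x + β)
  calc _ = ∫⁻ x, ofReal |k₃⁻¹| * (ofReal |k₂⁻¹| *
        ∫⁻ y, ∫⁻ z, F (k₁ * x + β, y, z)) := by
        refine lintegral_congr fun x => ?_
        simp_rw [e3]
        rw [lintegral_const_mul _ (m2 x), e2]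
    _ = _ := by
        rw [lintegral_const_mul _ (m1.const_mul _), lintegral_const_mul _ m1, e1, mul_inv, mul_inv,
          abs_mul, abs_mul, ofReal_mul (by positivity), ofReal_mul (by positivity)]
        ring

lemma lintegral_upperHalfPlane {F : ℝ → ℝ → ℝ≥0∞} (hF : Measurable fun p : ℝ × ℝ => F p.1 p.2) :
    ∫⁻ z : ℍ, F z.re z.im = ∫⁻ x, ∫⁻ y in Ioi (0 : ℝ), ofReal (y ^ 2)⁻¹ * F x y := by
  have hp : MeasurePreserving UpperHalfPlane.coe (volume.comap UpperHalfPlane.coe)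
      (volume.restrict (.range UpperHalfPlane.coe)) :=
    ⟨UpperHalfPlane.measurable_coe, by rw [measurableEmbedding_coe.map_comap]⟩
  have hm : Measurable fun z : ℂ => F z.re z.im :=
    hF.comp (Complex.measurable_re.prodMk Complex.measurable_im)
  have hmc : Measurable fun z : ℍ => F z.re z.im := hm.comp measurable_coe
  have hr : Set.range UpperHalfPlane.coe = {z : ℂ | 0 < z.im} := by
    ext z
    exact ⟨fun ⟨y, hy⟩ => hy ▸ y.im_pos, fun h => ⟨⟨z, h⟩, rfl⟩⟩
  rw [volume_def, lintegral_withDensity_eq_lintegral_mul _ _ hmc]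
  · have h1 := hp.lintegral_comp_emb measurableEmbedding_coe
      (fun z : ℂ => ofReal (z.im ^ 2)⁻¹ * F z.re z.im)
    refine (lintegral_congr fun z => ?_).trans (h1.trans ?_)
    · rw [Pi.mul_apply]
      congr 1
      rw [ofReal, ENNReal.coe_inj]
      ext
      rw [coe_toNNReal _ (by positivity)]
      simp
    · have h2 := (Complex.volume_preserving_equiv_real_prod.symm).lintegral_comp_emb
        Complex.measurableEquivRealProd.symm.measurableEmbedding
        ({z : ℂ | 0 < z.im}.indicator fun z : ℂ => ofReal (z.im ^ 2)⁻¹ * F z.re z.im)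
      rw [hr, ← lintegral_indicator (measurableSet_lt measurable_const Complex.measurable_im), ← h2,
        Measure.volume_eq_prod, lintegral_prod]
      · refine lintegral_congr fun x => ?_
        rw [← lintegral_indicator measurableSet_Ioi]
        rfl
      · refine Measurable.aemeasurable ?_
        have := Complex.measurable_im
        exact (Measurable.indicator (f := fun z : ℂ => ofReal (z.im ^ 2)⁻¹ * F z.re z.im)
          (by fun_prop) (measurableSet_lt measurable_const this)).comp
          Complex.measurableEquivRealProd.symm.measurable
  · have := continuous_im.measurable
    refine Measurable.coe_nnreal_ennreal ?_
    refine Measurable.pow_const ?_ 2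
    refine Measurable.div measurable_const ?_
    exact this.subtype_mk

lemma lintegral_fd {F : ℝ → ℝ≥0∞} (hF : Measurable F) :
    ∫⁻ z in 𝒟, F z.im = ∫⁻ x in Icc (-(1 / 2) : ℝ) (1 / 2), ∫⁻ y in Ici √(1 - x ^ 2),
      ofReal (y ^ 2)⁻¹ * F y := by
  classical
  have hset : MeasurableSet {p : ℝ × ℝ | 1 ≤ p.1 ^ 2 + p.2 ^ 2 ∧ |p.1| ≤ 1 / 2} :=
    measurableSet_setOfPred.2 ((measurableSet_le measurable_const (by fun_prop :
      Measurable fun p : ℝ × ℝ => p.1 ^ 2 + p.2 ^ 2)).mem.and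
      (measurableSet_le (by fun_prop : Measurable fun p : ℝ × ℝ => |p.1|) measurable_const).mem)
  have h := lintegral_upperHalfPlane (F := fun x y =>
    {p : ℝ × ℝ | 1 ≤ p.1 ^ 2 + p.2 ^ 2 ∧ |p.1| ≤ 1 / 2}.indicator (fun p => F p.2) (x, y))
    (Measurable.indicator (by fun_prop) hset)
  rw [← lintegral_indicator UMat.measurableSet_fd, ← lintegral_indicator measurableSet_Icc]
  refine Eq.trans (lintegral_congr fun z => ?_) (h.trans (lintegral_congr fun x => ?_))
  · rw [indicator_apply, indicator_apply]
    refine if_congr ?_ rfl rfl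
    change 1 ≤ Complex.normSq z ∧ |z.re| ≤ 1 / 2 ↔ 1 ≤ z.re ^ 2 + z.im ^ 2 ∧ |z.re| ≤ 1 / 2
    rw [Complex.normSq_apply, ← pow_two, ← pow_two]
    rfl
  · rw [indicator_apply]
    split_ifs with hx
    · have hx' : |x| ≤ 1 / 2 := abs_le.2 hx
      have hx2 : x ^ 2 ≤ 1 / 4 := by nlinarith [hx.1, hx.2]
      rw [← lintegral_indicator measurableSet_Ioi, ← lintegral_indicator measurableSet_Ici]
      refine lintegral_congr fun y => ?_
      simp only [indicator_apply, Set.mem_Ioi, Set.mem_Ici, mem_ofPred_eq]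
      by_cases hy : √(1 - x ^ 2) ≤ y
      · have h0 : 0 < √(1 - x ^ 2) := sqrt_pos.2 (by linarith)
        have := (Real.sqrt_le_left (by linarith)).1 hy
        rw [if_pos (by linarith), if_pos ⟨by linarith, hx'⟩, if_pos hy]
      · rw [if_neg hy]
        split_ifs with h1 h2
        · exact absurd (sqrt_le_left h1.le |>.2 (by linarith)) hy
        · rw [mul_zero]
        · rfl
    · have : ¬ |x| ≤ 1 / 2 := fun h => hx (abs_le.1 h)
      have h0 : ∀ y, (x, y) ∉ {p : ℝ × ℝ | 1 ≤ p.1 ^ 2 + p.2 ^ 2 ∧ |p.1| ≤ 1 / 2} :=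
        fun y h => this h.2
      simp_rw [indicator_of_notMem (h0 _), mul_zero, lintegral_zero]

namespace Cub

lemma hN_I (f : Cub ℝ) : hN f I = 3 * f.a ^ 2 + f.b ^ 2 + f.c ^ 2 + 3 * f.d ^ 2 := by
  rw [hN_eq]; simp [ev]

/-- The volume of the slices of the normalised region. -/
def sliceVol (σ : ℤ) (u : ℝ) : ℝ≥0∞ := volume (slice σ 1 I u)

lemma measurable_indicator_slice (σ : ℤ) (Y : ℝ) (z : ℍ) :
    Measurable fun p : ℝ × ℝ³ => (slice σ Y z p.1).indicator (1 : ℝ³ → ℝ≥0∞) p.2 := by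
  have h : Measurable fun p : ℝ × ℝ³ => (p, z) := by fun_prop
  exact measurable_one.indicator (h (measurableSet_reg σ Y))

lemma lintegral_slice (σ : ℤ) (Y : ℝ) (z : ℍ) (a : ℝ) :
    ∫⁻ q, (slice σ Y z a).indicator 1 q = volume (slice σ Y z a) :=
  lintegral_indicator_one (measurableSet_slice σ Y z a)

lemma measurable_sliceVol (σ : ℤ) : Measurable (sliceVol σ) := by
  have := Measurable.lintegral_prod_right' (ν := (volume : Measure ℝ³))
    (measurable_indicator_slice σ 1 I)
  simp only [lintegral_slice] at this
  exact this

lemma mem_slice_iff {σ : ℤ} {Y s w : ℝ} {z : ℍ} (hs : 0 < s) (hsY : s ^ 4 = Y) (hw : 0 < w)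
    (hwz : w ^ 2 = z.im) (a : ℝ) (q : ℝ³) : q ∈ slice σ Y z a ↔
    (w / s * q.1 + 3 * a * z.re * w / s,
      (w * s)⁻¹ * q.2.1 + (3 * a * z.re ^ 2 + 2 * q.1 * z.re) * (w * s)⁻¹,
      (w ^ 3 * s)⁻¹ * q.2.2 + (a * z.re ^ 3 + q.1 * z.re ^ 2 + q.2.1 * z.re) * (w ^ 3 * s)⁻¹) ∈
      slice σ 1 I (a * w ^ 3 / s) := by
  obtain ⟨b, c, d⟩ := q
  simp only [slice, reg, mem_ofPred_eq, hN_eq, ← hwz, I_im, I_re]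
  set x := z.re
  have e1 : ∀ f : Cub ℝ, f.disc = f.b ^ 2 * f.c ^ 2 - 4 * f.a * f.c ^ 3 - 4 * f.b ^ 3 * f.d
    - 27 * f.a ^ 2 * f.d ^ 2 + 18 * f.a * f.b * f.c * f.d := fun f => by simp only [disc]
  have e2 : σ * (⟨a * w ^ 3 / s, w / s * b + 3 * a * x * w / s,
      (w * s)⁻¹ * c + (3 * a * x ^ 2 + 2 * b * x) * (w * s)⁻¹,
      (w ^ 3 * s)⁻¹ * d + (a * x ^ 3 + b * x ^ 2 + c * x) * (w ^ 3 * s)⁻¹⟩ : Cub ℝ).disc =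
      σ * (⟨a, b, c, d⟩ : Cub ℝ).disc / Y := by
    rw [e1, e1, ← hsY]; field_simp; ring
  have e3 : 3 * 1 ^ 3 * (a * w ^ 3 / s) ^ 2 + 1 * (w / s * b + 3 * a * x * w / s +
      3 * (a * w ^ 3 / s) * 0) ^ 2 + (3 * (a * w ^ 3 / s) * 0 ^ 2 + 2 * (w / s * b + 3 * a * x * w / s) * 0
      + ((w * s)⁻¹ * c + (3 * a * x ^ 2 + 2 * b * x) * (w * s)⁻¹)) ^ 2 / 1 +
      3 * (ev ⟨a * w ^ 3 / s, w / s * b + 3 * a * x * w / s,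
      (w * s)⁻¹ * c + (3 * a * x ^ 2 + 2 * b * x) * (w * s)⁻¹,
      (w ^ 3 * s)⁻¹ * d + (a * x ^ 3 + b * x ^ 2 + c * x) * (w ^ 3 * s)⁻¹⟩ 0 1) ^ 2 / 1 ^ 3 =
      (3 * (w ^ 2) ^ 3 * a ^ 2 + w ^ 2 * (b + 3 * a * x) ^ 2 + (3 * a * x ^ 2 + 2 * b * x + c) ^ 2 / w ^ 2
      + 3 * (ev ⟨a, b, c, d⟩ x 1) ^ 2 / (w ^ 2) ^ 3) / s ^ 2 := by
    simp only [ev]; field_simp; ring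
  have hY : 0 < Y := by rw [← hsY]; positivity
  rw [e2, e3, div_pow, ← pow_mul s, hsY, ← mul_div_assoc, div_le_div_iff_of_pos_right hY,
    div_lt_one hY, div_pos_iff_of_pos_right hY]

lemma volume_slice {σ : ℤ} {Y s w : ℝ} {z : ℍ} (hs : 0 < s) (hsY : s ^ 4 = Y) (hw : 0 < w)
    (hwz : w ^ 2 = z.im) (a : ℝ) :
    volume (slice σ Y z a) = ofReal (w ^ 3 * s ^ 3) * sliceVol σ (a * w ^ 3 / s) := by
  have h1 := lintegral_comp_triangular
    (F := (slice σ 1 I (a * w ^ 3 / s)).indicator 1)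
    (measurable_one.indicator (measurableSet_slice σ 1 _ _)) (k₁ := w / s) (k₂ := (w * s)⁻¹)
    (k₃ := (w ^ 3 * s)⁻¹) (by positivity) (by positivity) (by positivity) (3 * a * z.re * w / s)
    (γ := fun b => (3 * a * z.re ^ 2 + 2 * b * z.re) * (w * s)⁻¹)
    (δ := fun b c => (a * z.re ^ 3 + b * z.re ^ 2 + c * z.re) * (w ^ 3 * s)⁻¹)
    (by fun_prop) (by fun_prop)
  rw [lintegral_slice] at h1
  have h2 : (w / s * (w * s)⁻¹ * (w ^ 3 * s)⁻¹)⁻¹ = w ^ 3 * s ^ 3 := by field_simp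
  rw [h2, abs_of_pos (by positivity)] at h1
  classical
  rw [sliceVol, ← h1, ← lintegral_slice]
  refine lintegral_congr fun q => ?_
  simp only [indicator_apply]
  exact if_congr (mem_slice_iff hs hsY hw hwz a q) rfl rfl

lemma sliceVol_neg (σ : ℤ) (u : ℝ) : sliceVol σ (-u) = sliceVol σ u := by
  have h1 := lintegral_comp_triangular (F := (slice σ 1 I u).indicator 1)
    (measurable_one.indicator (measurableSet_slice σ 1 _ _)) (k₁ := -1) (k₂ := -1) (k₃ := -1)
    (by norm_num) (by norm_num) (by norm_num) 0 (γ := fun _ => 0) (δ := fun _ _ => 0)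
    (by fun_prop) (by fun_prop)
  rw [lintegral_slice] at h1
  norm_num at h1
  classical
  rw [sliceVol, sliceVol, ← h1, ← lintegral_slice]
  refine lintegral_congr fun q => ?_
  simp only [indicator_apply]
  refine if_congr ?_ rfl rfl
  have e : ∀ x y z t : ℝ, (⟨-x, -y, -z, -t⟩ : Cub ℝ).disc = (⟨x, y, z, t⟩ : Cub ℝ).disc := by
    intro x y z t; simp only [disc]; ring
  simp only [slice, reg, mem_ofPred_eq, hN_I]
  rw [← e u]
  simp

lemma sliceVol_le (σ : ℤ) (u : ℝ) :
    sliceVol σ u ≤ (Icc (-4 : ℝ) 4).indicator (fun _ => 300000) u := by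
  have hb : ∀ q ∈ slice σ 1 I u, |u| ≤ 4 ∧
      q ∈ Icc (-12 : ℝ) 12 ×ˢ (Icc (-32 : ℝ) 32 ×ˢ Icc (-80 : ℝ) 80) := by
    intro q hq
    have h10 : √10 ≤ 4 := (sqrt_le_left (by norm_num)).2 (by norm_num)
    have := coeff_le_of_mem_reg (Λ := √10) (w := 1) (Y := 1) (z := I) (by positivity)
      (by rw [show 4 = 2 * 2 from rfl, pow_mul, sq_sqrt (by norm_num)]; norm_num) one_pos
      (by simp) (by simp; norm_num) (by simp) hq
    simp at this
    refine ⟨by linarith, ?_⟩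
    simp only [mem_prod, Set.mem_Icc, ← abs_le]
    exact ⟨by linarith [this.2.1], by linarith [this.2.2.1], by linarith [this.2.2.2]⟩
  by_cases hu : u ∈ Icc (-4 : ℝ) 4
  · rw [indicator_of_mem hu]
    refine (measure_mono fun q hq => (hb q hq).2).trans ?_
    rw [Measure.volume_eq_prod, Measure.prod_prod, Measure.volume_eq_prod, Measure.prod_prod,
      volume_Icc, volume_Icc, volume_Icc, ← ofReal_mul (by norm_num),
      ← ofReal_mul (by norm_num)]
    rw [show (300000 : ℝ≥0∞) = ofReal 300000 by simp]
    exact ofReal_le_ofReal (by norm_num)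
  · rw [indicator_of_notMem hu]
    have : slice σ 1 I u = ∅ := eq_empty_of_forall_notMem fun q hq =>
      hu (abs_le.1 (hb q hq).1)
    rw [sliceVol, this, measure_empty]

end Cub

lemma lintegral_comp_rpow (G : ℝ → ℝ≥0∞) {k p : ℝ} (hk : 0 < k) (hp : p ≠ 0) :
    ∫⁻ u in Ioi (0 : ℝ), G u =
      ∫⁻ y in Ioi (0 : ℝ), ofReal (k * |p| * y ^ (p - 1)) * G (k * y ^ p) := by
  have himg : (fun y : ℝ => k * y ^ p) '' Ioi 0 = Set.Ioi 0 := by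
    ext u
    constructor
    · rintro ⟨y, hy, rfl⟩
      have hy : 0 < y := hy
      exact Set.mem_Ioi.2 (by positivity)
    · intro hu
      have hu : 0 < u := hu
      refine ⟨(u / k) ^ p⁻¹, mem_Ioi.2 (by positivity), ?_⟩
      simp only
      rw [← rpow_mul (by positivity), inv_mul_cancel₀ hp, rpow_one]
      field_simp
  have hinj : InjOn (fun y : ℝ => k * y ^ p) (Ioi 0) := by
    intro x hx y hy h
    have hx : 0 < x := hx
    have hy : 0 < y := hy
    exact (rpow_left_inj hx.le hy.le hp).1 (mul_left_cancel₀ hk.ne' h)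
  have h := lintegral_image_eq_lintegral_abs_deriv_mul (s := Ioi (0 : ℝ))
    (f := fun y : ℝ => k * y ^ p) (f' := fun y => k * (p * y ^ (p - 1))) measurableSet_Ioi
    (fun y hy => ((hasDerivAt_rpow_const (Or.inl (ne_of_gt hy))).const_mul k).hasDerivWithinAt)
    hinj G
  rw [himg] at h
  rw [h]
  refine setLIntegral_congr_fun measurableSet_Ioi fun y hy => ?_
  have hy : 0 < y := hy
  simp only [abs_mul, abs_of_pos hk, abs_of_pos (rpow_pos_of_pos hy _), mul_assoc]

lemma tsum_int_ne_zero {g : ℤ → ℝ≥0∞} (h0 : g 0 = 0) (hg : ∀ a, g (-a) = g a) :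
    ∑' a : ℤ, g a = 2 * ∑' n : ℕ, g (n + 1) := by
  have h := (ENNReal.summable (f := fun n : ℕ => g (n + 1))).hasSum
  have h' := (ENNReal.summable (f := fun n : ℕ => g n)).hasSum
  have h2 : HasSum (fun n : ℕ => g (-(n + 1 : ℤ))) (∑' n : ℕ, g (n + 1)) := by
    simpa only [hg] using h
  rw [(h'.of_nat_of_neg_add_one h2).tsum_eq, tsum_eq_zero_add' ENNReal.summable]
  simp [h0, two_mul]

open Classical in
lemma tsum_dvd {g : ℤ → ℝ≥0∞} (hg : ∀ a, g (-a) = g a) {e : ℕ} (he : e ≠ 0) :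
    ∑' a : ℤ, (if a ≠ 0 ∧ (e : ℤ) ∣ a then g a else 0) = 2 * ∑' n : ℕ, g (e * (n + 1)) := by
  have hez : (e : ℤ) ≠ 0 := by exact_mod_cast he
  rw [← (mul_right_injective₀ hez).tsum_eq]
  · rw [tsum_int_ne_zero]
    · congr 1
      refine tsum_congr fun n => ?_
      rw [if_pos ⟨mul_ne_zero hez (by positivity), dvd_mul_right _ _⟩]
    · simp
    · intro a
      simp only [mul_neg, hg, neg_ne_zero, dvd_neg]
  · intro a ha
    rw [Function.mem_support, ne_eq, ite_eq_right_iff, Classical.not_imp] at ha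
    obtain ⟨b, rfl⟩ := ha.1.2
    exact ⟨b, rfl⟩

namespace ZetaThird

open Classical in
lemma near_psum {x : ℝ} (hx : 0 < x) :
    Near ((∑' n : ℕ, if (n : ℝ) + 1 ≤ x then ofReal (((n : ℝ) + 1) ^ (-(1 / 3) : ℝ)) else 0) +
      ofReal (-(riemannZeta ((1 / 3 : ℝ) : ℂ)).re))
      (ofReal (3 / 2 * x ^ (2 / 3 : ℝ))) (ofReal (3 * x ^ (-(1 / 4) : ℝ))) := by
  have h1 : (∑' n : ℕ, if (n : ℝ) + 1 ≤ x then ofReal (((n : ℝ) + 1) ^ (-(1 / 3) : ℝ)) else 0)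
      = ofReal (psum ⌊x⌋₊) := by
    have hiff : ∀ n : ℕ, (n : ℝ) + 1 ≤ x ↔ n ∈ Finset.range ⌊x⌋₊ := fun n => by
      rw [Finset.mem_range, ← Nat.succ_le_iff, Nat.le_floor_iff hx.le]; push_cast; rfl
    rw [tsum_eq_sum (s := range ⌊x⌋₊) fun n hn => by rw [if_neg fun h => hn ((hiff n).1 h)],
      psum, ofReal_sum_of_nonneg fun n _ => by positivity]
    refine sum_congr rfl fun n hn => ?_
    rw [if_pos ((hiff n).2 hn)]; push_cast; rfl
  have hp : 0 ≤ psum ⌊x⌋₊ := sum_nonneg fun n _ => by positivity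
  have h2 := abs_le.1 (abs_psum_sub_le hx (Nat.floor_le hx.le) (Nat.lt_floor_add_one x).le)
  have h3 := zeta_neg
  rw [h1, ← ofReal_add hp (by linarith)]
  constructor
  · rw [← ofReal_add (by positivity) (by positivity)]
    exact ofReal_le_ofReal (by linarith)
  · rw [← ofReal_add (by linarith) (by positivity)]
    exact ofReal_le_ofReal (by linarith)

end ZetaThird

namespace Cub

open ZetaThird

open Classical in
lemma near_inner {H : ℝ → ℝ≥0∞} (hH : Measurable H) (hHn : ∀ u, H (-u) = H u) {s y₀ : ℝ}
    (hs : 0 < s) (hy₀ : 0 < y₀) (hy₁ : y₀ ≤ 1) {e : ℕ} (he : 1 ≤ e) :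
    Near ((∫⁻ y in Ici y₀, ofReal (y ^ 2)⁻¹ * ∑' a : ℤ, (if a ≠ 0 ∧ (e : ℤ) ∣ a then
        ofReal (√y ^ 3 * s ^ 3) * H (a * √y ^ 3 / s) else 0)) +
      ofReal (4 / 3 * s ^ (10 / 3 : ℝ) * (e : ℝ) ^ (-(1 / 3) : ℝ) *
        -(riemannZeta ((1 / 3 : ℝ) : ℂ)).re) *
        ∫⁻ u in Ioi (0 : ℝ), ofReal (u ^ (-(2 / 3) : ℝ)) * H u)
      (ofReal (2 * s ^ 4 * (e : ℝ)⁻¹ * y₀⁻¹) * ∫⁻ u in Ioi (0 : ℝ), H u)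
      (ofReal (4 * s ^ (37 / 12 : ℝ)) *
        ∫⁻ u in Ioi (0 : ℝ), ofReal (u ^ (-(11 / 12) : ℝ)) * H u) := by
  have he0 : (0 : ℝ) < e := by exact_mod_cast he
  have he1 : (1 : ℝ) ≤ e := by exact_mod_cast he
  set ζ' := -(riemannZeta ((1 / 3 : ℝ) : ℂ)).re with hζ
  have hζ0 : 0 ≤ ζ' := by have := zeta_neg; linarith
  set t := e * y₀ ^ (3 / 2 : ℝ) / s with ht
  have ht0 : 0 < t := by positivity
  set K := 4 / 3 * s ^ (10 / 3 : ℝ) * (e : ℝ) ^ (-(1 / 3) : ℝ) with hK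
  have hK0 : 0 ≤ K := by positivity
  have hsqrt : ∀ y : ℝ, 0 < y → √y ^ 3 = y ^ (3 / 2 : ℝ) := fun y hy => by
    rw [sqrt_eq_rpow, ← rpow_natCast, ← rpow_mul hy.le]; norm_num
  have s1 : (∫⁻ y in Ici y₀, ofReal (y ^ 2)⁻¹ * ∑' a : ℤ, (if a ≠ 0 ∧ (e : ℤ) ∣ a then
        ofReal (√y ^ 3 * s ^ 3) * H (a * √y ^ 3 / s) else 0)) =
      ∑' n : ℕ, ∫⁻ y in Ioi (0 : ℝ), if y₀ ≤ y then ofReal (2 * s ^ 3 * y ^ (-(1 / 2) : ℝ)) *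
        H (e * (n + 1) / s * y ^ (3 / 2 : ℝ)) else 0 := by
    rw [← lintegral_tsum fun n => (Measurable.ite measurableSet_Ici (by fun_prop)
      measurable_const).aemeasurable]
    rw [← lintegral_indicator measurableSet_Ici, ← lintegral_indicator measurableSet_Ioi]
    refine lintegral_congr fun y => ?_
    simp only [indicator_apply, Set.mem_Ici, Set.mem_Ioi]
    by_cases hy : y₀ ≤ y
    · have hy0 : 0 < y := by linarith
      simp only [if_pos hy, if_pos hy0]
      have heven : ∀ a : ℤ, ofReal (√y ^ 3 * s ^ 3) * H (((-a : ℤ) : ℝ) * √y ^ 3 / s) =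
          ofReal (√y ^ 3 * s ^ 3) * H ((a : ℝ) * √y ^ 3 / s) := fun a => by
        rw [← hHn ((a : ℝ) * √y ^ 3 / s)]; congr 2; push_cast; ring
      rw [tsum_dvd heven (by omega), ← ENNReal.tsum_mul_left, ← ENNReal.tsum_mul_left]
      refine tsum_congr fun n => ?_
      have a1 : ofReal (2 * s ^ 3 * y ^ (-(1 / 2) : ℝ)) = ofReal (y ^ 2)⁻¹ *
          (2 * ofReal (√y ^ 3 * s ^ 3)) := by
        rw [show (2 : ℝ≥0∞) = ofReal 2 by simp, ← ofReal_mul (by norm_num),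
          ← ofReal_mul (by positivity), hsqrt y hy0]
        congr 1
        have : y ^ (-(1 / 2) : ℝ) = y ^ (3 / 2 : ℝ) * (y ^ 2)⁻¹ := by
          rw [← rpow_natCast, ← rpow_neg hy0.le, ← rpow_add hy0]; norm_num
        rw [this]; ring
      rw [a1, mul_assoc, mul_assoc]
      congr 4
      rw [hsqrt y hy0]; push_cast; ring
    · simp [hy]
  have s2 : ∀ n : ℕ, (∫⁻ y in Ioi (0 : ℝ), if y₀ ≤ y then
      ofReal (2 * s ^ 3 * y ^ (-(1 / 2) : ℝ)) *
        H (e * (n + 1) / s * y ^ (3 / 2 : ℝ)) else 0) =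
      ∫⁻ u in Ioi (0 : ℝ), ofReal (K * u ^ (-(2 / 3) : ℝ)) * H u *
        (if (n : ℝ) + 1 ≤ u / t then ofReal (((n : ℝ) + 1) ^ (-(1 / 3) : ℝ)) else 0) := by
    intro n
    have hk : 0 < (e * (n + 1) / s : ℝ) := by positivity
    conv_rhs => rw [lintegral_comp_rpow _ hk (by norm_num : (3 / 2 : ℝ) ≠ 0)]
    refine setLIntegral_congr_fun measurableSet_Ioi fun y hy => ?_
    have hy : 0 < y := hy
    have hiff : (n : ℝ) + 1 ≤ e * (n + 1) / s * y ^ (3 / 2 : ℝ) / t ↔ y₀ ≤ y := by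
      rw [le_div_iff₀ ht0, ht, show ((n : ℝ) + 1) * (e * y₀ ^ (3 / 2 : ℝ) / s) =
        e * (n + 1) / s * y₀ ^ (3 / 2 : ℝ) by ring, mul_le_mul_iff_right₀ hk,
        rpow_le_rpow_iff hy₀.le hy.le (by norm_num)]
    simp only [hiff]
    split_ifs with h
    · have e1 : 2 * s ^ 3 * y ^ (-(1 / 2) : ℝ) = e * (n + 1) / s * |(3 : ℝ) / 2| * y ^ ((3 : ℝ) / 2 - 1)
          * (K * (e * (n + 1) / s * y ^ (3 / 2 : ℝ)) ^ (-(2 / 3) : ℝ)) *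
          ((n : ℝ) + 1) ^ (-(1 / 3) : ℝ) := by
        have hn : (0 : ℝ) < n + 1 := by positivity
        have q1 : (e : ℝ) ^ (-(1 / 3) : ℝ) * (e : ℝ) ^ (-(2 / 3) : ℝ) * e = 1 := by
          rw [← rpow_add he0, ← rpow_add_one he0.ne']; norm_num
        have q2 : ((n : ℝ) + 1) ^ (-(1 / 3) : ℝ) * ((n : ℝ) + 1) ^ (-(2 / 3) : ℝ) * (n + 1) = 1 := by
          rw [← rpow_add hn, ← rpow_add_one hn.ne']; norm_num
        have q3 : s ^ (10 / 3 : ℝ) * (s ^ (-(2 / 3) : ℝ))⁻¹ / s = s ^ 3 := by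
          rw [← rpow_neg hs.le, ← rpow_add hs, ← rpow_sub_one hs.ne',
            ← rpow_natCast]; norm_num
        have q4 : y ^ ((3 : ℝ) / 2 - 1) * (y ^ (3 / 2 : ℝ)) ^ (-(2 / 3) : ℝ) = y ^ (-(1 / 2) : ℝ) := by
          rw [← rpow_mul hy.le, ← rpow_add hy]; norm_num
        rw [hK, mul_rpow (by positivity) (by positivity), div_rpow (by positivity) hs.le,
          mul_rpow he0.le hn.le, abs_of_pos (by norm_num : (0 : ℝ) < 3 / 2)]
        calc 2 * s ^ 3 * y ^ (-(1 / 2) : ℝ) = 2 * (s ^ (10 / 3 : ℝ) * (s ^ (-(2 / 3) : ℝ))⁻¹ / s) *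
              ((e : ℝ) ^ (-(1 / 3) : ℝ) * (e : ℝ) ^ (-(2 / 3) : ℝ) * e) *
              (((n : ℝ) + 1) ^ (-(1 / 3) : ℝ) * ((n : ℝ) + 1) ^ (-(2 / 3) : ℝ) * (n + 1)) *
              (y ^ ((3 : ℝ) / 2 - 1) * (y ^ (3 / 2 : ℝ)) ^ (-(2 / 3) : ℝ)) := by
                rw [q1, q2, q3, q4]; ring
          _ = _ := by ring
      rw [e1, ofReal_mul (by positivity), ofReal_mul (by positivity)]
      ring
    · rw [mul_zero, mul_zero]
  simp_rw [s2] at s1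
  replace s1 := s1.trans (lintegral_tsum (f := fun (n : ℕ) (u : ℝ) =>
    ofReal (K * u ^ (-(2 / 3) : ℝ)) * H u * (if (n : ℝ) + 1 ≤ u / t then
      ofReal (((n : ℝ) + 1) ^ (-(1 / 3) : ℝ)) else 0)) fun n =>
      (((by fun_prop : Measurable fun u : ℝ => ofReal (K * u ^ (-(2 / 3) : ℝ)) * H u)).mul
        (Measurable.ite (measurableSet_le measurable_const (by fun_prop)) measurable_const
          measurable_const)).aemeasurable).symm
  simp_rw [ENNReal.tsum_mul_left] at s1
  have hm : Measurable fun u : ℝ => ofReal (u ^ (-(2 / 3) : ℝ)) * H u := by fun_prop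
  rw [s1, ← lintegral_const_mul _ hm, ← lintegral_add_right _ (hm.const_mul _),
    ← lintegral_const_mul _ hH, ← lintegral_const_mul _ (by fun_prop)]
  refine Near.setLIntegral measurableSet_Ioi (by fun_prop) fun u hu => ?_
  have hu : 0 < u := hu
  have h := (near_psum (x := u / t) (by positivity)).mul_left
    (ofReal (K * u ^ (-(2 / 3) : ℝ)) * H u)
  have f1 : ofReal (K * ζ') * (ofReal (u ^ (-(2 / 3) : ℝ)) * H u) =
      ofReal (K * u ^ (-(2 / 3) : ℝ)) * H u * ofReal ζ' := by
    rw [ofReal_mul hK0, ofReal_mul hK0]; ring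
  rw [f1, ← mul_add]
  have f2 : ofReal (2 * s ^ 4 * (e : ℝ)⁻¹ * y₀⁻¹) * H u =
      ofReal (K * u ^ (-(2 / 3) : ℝ)) * H u *
        ofReal (3 / 2 * (u / t) ^ (2 / 3 : ℝ)) := by
    rw [mul_right_comm (ofReal _), ← ofReal_mul (by positivity)]
    congr 2
    have q1 : (e : ℝ) ^ (-(1 / 3) : ℝ) * ((e : ℝ) ^ (2 / 3 : ℝ))⁻¹ = (e : ℝ)⁻¹ := by
      rw [← rpow_neg he0.le, ← rpow_add he0, ← rpow_neg_one]; norm_num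
    have q2 : (y₀ ^ (3 / 2 : ℝ)) ^ (2 / 3 : ℝ) = y₀ := by
      rw [← rpow_mul hy₀.le]; norm_num
    have q3 : s ^ (10 / 3 : ℝ) * s ^ (2 / 3 : ℝ) = s ^ 4 := by
      rw [← rpow_add hs, ← rpow_natCast]; norm_num
    have q4 : u ^ (-(2 / 3) : ℝ) * u ^ (2 / 3 : ℝ) = 1 := by
      rw [← rpow_add hu]; norm_num
    rw [ht, hK, div_rpow hu.le (by positivity), div_rpow (by positivity) hs.le,
      mul_rpow he0.le (by positivity), q2, ← q1, ← q3]
    calc _ = 2 * (s ^ (10 / 3 : ℝ) * s ^ (2 / 3 : ℝ)) * ((e : ℝ) ^ (-(1 / 3) : ℝ) *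
          ((e : ℝ) ^ (2 / 3 : ℝ))⁻¹) * y₀⁻¹ * (u ^ (-(2 / 3) : ℝ) * u ^ (2 / 3 : ℝ)) := by
            rw [q4, mul_one]
      _ = _ := by field_simp; norm_num
  rw [f2]
  refine h.mono ?_
  rw [mul_right_comm (ofReal _), ← ofReal_mul (by positivity), ← mul_assoc (ofReal _) (ofReal _),
    ← ofReal_mul (by positivity)]
  refine mul_le_mul_left (ofReal_le_ofReal ?_) _
  have q1 : (e : ℝ) ^ (-(1 / 3) : ℝ) * e ^ (1 / 4 : ℝ) ≤ 1 := by
    rw [← rpow_add he0]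
    exact rpow_le_one_of_one_le_of_nonpos he1 (by norm_num)
  have q2 : (y₀ ^ (3 / 2 : ℝ)) ^ (1 / 4 : ℝ) ≤ 1 :=
    rpow_le_one (by positivity) (rpow_le_one hy₀.le hy₁ (by norm_num)) (by norm_num)
  have q3 : s ^ (10 / 3 : ℝ) * (s ^ (1 / 4 : ℝ))⁻¹ = s ^ (37 / 12 : ℝ) := by
    rw [← rpow_neg hs.le, ← rpow_add hs]; norm_num
  have q4 : u ^ (-(2 / 3) : ℝ) * (u ^ (1 / 4 : ℝ))⁻¹ = u ^ (-(11 / 12) : ℝ) := by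
    rw [← rpow_neg hu.le, ← rpow_add hu]; norm_num
  have q5 : (u / t) ^ (-(1 / 4) : ℝ) = (e : ℝ) ^ (1 / 4 : ℝ) * (y₀ ^ (3 / 2 : ℝ)) ^ (1 / 4 : ℝ) *
      (s ^ (1 / 4 : ℝ))⁻¹ * (u ^ (1 / 4 : ℝ))⁻¹ := by
    rw [rpow_neg (by positivity), div_rpow hu.le ht0.le, ht,
      div_rpow (by positivity) hs.le, mul_rpow he0.le (by positivity)]
    field_simp
  calc _ = 4 * (s ^ (10 / 3 : ℝ) * (s ^ (1 / 4 : ℝ))⁻¹) * (u ^ (-(2 / 3) : ℝ) *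
        (u ^ (1 / 4 : ℝ))⁻¹) * ((e : ℝ) ^ (-(1 / 3) : ℝ) * e ^ (1 / 4 : ℝ) *
        (y₀ ^ (3 / 2 : ℝ)) ^ (1 / 4 : ℝ)) := by rw [hK, q5]; ring
    _ ≤ 4 * (s ^ (10 / 3 : ℝ) * (s ^ (1 / 4 : ℝ))⁻¹) * (u ^ (-(2 / 3) : ℝ) *
        (u ^ (1 / 4 : ℝ))⁻¹) * 1 :=
        mul_le_mul_of_nonneg_left (mul_le_one₀ q1 (by positivity) q2) (by positivity)
    _ = _ := by rw [q3, q4]; ring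

end Cub

lemma lintegral_inv_sqrt_one_sub_sq :
    ∫⁻ x in Icc (-(1 / 2) : ℝ) (1 / 2), ofReal (√(1 - x ^ 2))⁻¹ =
      ofReal (π / 3) := by
  have hpos : ∀ x ∈ Icc (-(1 / 2) : ℝ) (1 / 2), 0 < 1 - x ^ 2 := fun x hx => by
    nlinarith [hx.1, hx.2]
  have hc : ContinuousOn (fun x : ℝ => (√(1 - x ^ 2))⁻¹) (Icc (-(1 / 2)) (1 / 2)) :=
    ContinuousOn.inv₀ (by fun_prop) fun x hx => (sqrt_pos.2 (hpos x hx)).ne'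
  have hle : (-(1 / 2) : ℝ) ≤ 1 / 2 := by norm_num
  rw [← ofReal_integral_eq_lintegral_ofReal hc.integrableOn_Icc
    (Eventually.of_forall fun x => by positivity), integral_Icc_eq_integral_Ioc,
    ← intervalIntegral.integral_of_le hle]
  have h := intervalIntegral.integral_eq_sub_of_hasDerivAt (f := arcsin) (a := -(1 / 2))
    (b := 1 / 2) (f' := fun x : ℝ => (√(1 - x ^ 2))⁻¹) (fun x hx => by
      rw [uIcc_of_le hle] at hx
      have := hasDerivAt_arcsin (x := x) (by linarith [hx.1]) (by linarith [hx.2])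
      rwa [one_div] at this) (hc.intervalIntegrable_of_Icc hle)
  rw [h, arcsin_neg, arcsin_eq_of_sin_eq sin_pi_div_six
    ⟨by linarith [pi_pos], by linarith [pi_pos]⟩]
  congr 1; ring

namespace Cub

/-- The `r`-th moment of the volume of the slices. -/
def moment (σ : ℤ) (r : ℝ) : ℝ≥0∞ :=
  ∫⁻ u in Ioi (0 : ℝ), ofReal (u ^ r) * sliceVol σ u

lemma moment_ne_top (σ : ℤ) {r : ℝ} (hr : -1 < r) : moment σ r ≠ ⊤ := by
  have h1 : IntegrableOn (fun u : ℝ => u ^ r) (Ioc 0 4) :=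
    (intervalIntegrable_iff_integrableOn_Ioc_of_le (by norm_num)).1
      (intervalIntegral.intervalIntegrable_rpow' hr)
  have h2 : moment σ r ≤ ∫⁻ u in Ioc (0 : ℝ) 4, ofReal (u ^ r) * 300000 := by
    rw [moment, ← lintegral_indicator measurableSet_Ioi, ← lintegral_indicator measurableSet_Ioc]
    refine lintegral_mono fun u => ?_
    by_cases hu : 0 < u
    · rw [indicator_of_mem (Set.mem_Ioi.2 hu)]
      by_cases hu4 : u ≤ 4
      · rw [indicator_of_mem (Set.mem_Ioc.2 ⟨hu, hu4⟩)]
        refine mul_le_mul_right ((sliceVol_le σ u).trans ?_) _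
        exact indicator_le_self _ _ _
      · have := sliceVol_le σ u
        rw [indicator_of_notMem fun h => hu4 h.2] at this
        simp [le_zero_iff.1 this]
    · rw [indicator_of_notMem (s := Ioi 0) hu]; exact zero_le
  refine (h2.trans_lt ?_).ne
  rw [lintegral_mul_const _ (by fun_prop)]
  exact mul_lt_top h1.lintegral_lt_top (by norm_num)

lemma lintegral_sliceVol (σ : ℤ) : ∫⁻ u in Ioi (0 : ℝ), sliceVol σ u = moment σ 0 := by
  simp [moment]

lemma lintegral_fd_sqrt_im_ne_top : ∫⁻ z in 𝒟, ofReal (3 * √(z : ℍ).im) ≠ ⊤ := by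
  rw [lintegral_fd (F := fun y => ofReal (3 * √y)) (by fun_prop)]
  have h1 : IntegrableOn (fun y : ℝ => 3 * y ^ (-(3 / 2) : ℝ)) (Ioi (1 / 2)) :=
    (integrableOn_Ioi_rpow_of_lt (by norm_num) (by norm_num)).const_mul 3
  have h2 : ∀ x ∈ Icc (-(1 / 2) : ℝ) (1 / 2),
      ∫⁻ y in Ici √(1 - x ^ 2), ofReal (y ^ 2)⁻¹ * ofReal (3 * √y) ≤
        ∫⁻ y in Ioi (1 / 2 : ℝ), ofReal (3 * y ^ (-(3 / 2) : ℝ)) := fun x hx => by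
    have hs : 1 / 2 < √(1 - x ^ 2) := lt_sqrt_of_sq_lt (by nlinarith [hx.1, hx.2])
    refine (lintegral_mono_set fun y hy => hs.trans_le hy).trans (le_of_eq ?_)
    refine setLIntegral_congr_fun measurableSet_Ioi fun y hy => ?_
    have hy : 0 < y := lt_trans (by norm_num) (mem_Ioi.1 hy)
    rw [← ofReal_mul (by positivity), sqrt_eq_rpow, ← rpow_natCast,
      ← rpow_neg hy.le, mul_left_comm, ← rpow_add hy]
    norm_num
  refine ((setLIntegral_mono measurable_const h2).trans_lt ?_).ne
  rw [setLIntegral_const]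
  exact mul_lt_top h1.lintegral_lt_top (by simp)

open Classical in
lemma mainTerm_eq (σ : ℤ) {Y s : ℝ} (hs : 0 < s) (hY : s ^ 4 = Y) (e : ℕ) (z : ℍ) :
    mainTerm σ Y e z = ∑' a : ℤ, (if a ≠ 0 ∧ (e : ℤ) ∣ a then
        ofReal (√z.im ^ 3 * s ^ 3) * sliceVol σ (a * √z.im ^ 3 / s) else 0) := by
  refine tsum_congr fun a => ?_
  rw [volume_slice hs hY (sqrt_pos.2 z.im_pos) (sq_sqrt z.im_pos.le)]

open Classical in
lemma measurable_tsum_sliceVol (σ : ℤ) (s : ℝ) (e : ℕ) :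
    Measurable fun y : ℝ => ∑' a : ℤ, (if a ≠ 0 ∧ (e : ℤ) ∣ a then
        ofReal (√y ^ 3 * s ^ 3) * sliceVol σ (a * √y ^ 3 / s) else 0) := by
  refine Measurable.tsum fun a => ?_
  have := measurable_sliceVol σ
  split_ifs <;> fun_prop

lemma measurable_mainTerm (σ : ℤ) {Y : ℝ} (hY : 0 < Y) (e : ℕ) : Measurable (mainTerm σ Y e) := by
  have h := (measurable_tsum_sliceVol σ (Y ^ (1 / 4 : ℝ)) e).comp
    continuous_im.measurable
  convert h using 1
  funext z
  exact mainTerm_eq σ (by positivity) (by rw [← rpow_natCast, ← rpow_mul hY.le]; norm_num) e z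

lemma near_lintegral_mainTerm (σ : ℤ) {Y : ℝ} (hY : 0 < Y) {e : ℕ} (he : 1 ≤ e) :
    Near ((∫⁻ z in 𝒟, mainTerm σ Y e z) + ofReal (4 / 3 * Y ^ (5 / 6 : ℝ) *
        (e : ℝ) ^ (-(1 / 3) : ℝ) * -(riemannZeta ((1 / 3 : ℝ) : ℂ)).re) * moment σ (-(2 / 3)))
      (ofReal (2 * Y * (e : ℝ)⁻¹ * (π / 3)) * moment σ 0)
      (ofReal (4 * Y ^ (37 / 48 : ℝ)) * moment σ (-(11 / 12))) := by
  have hs : 0 < Y ^ (1 / 4 : ℝ) := by positivity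
  have hsY : (Y ^ (1 / 4 : ℝ)) ^ 4 = Y := by
    rw [← rpow_natCast, ← rpow_mul hY.le]; norm_num
  have h := Near.setLIntegral (μ := volume) (measurableSet_Icc (a := (-(1 / 2) : ℝ)) (b := 1 / 2))
    measurable_const fun x hx => by
      have hx2 : 0 < 1 - x ^ 2 := by nlinarith [hx.1, hx.2]
      exact near_inner (measurable_sliceVol σ) (sliceVol_neg σ) hs (sqrt_pos.2 hx2)
        (sqrt_le_one.2 (by nlinarith)) he
  rw [lintegral_add_right _ measurable_const, setLIntegral_const, setLIntegral_const,
    volume_Icc, lintegral_mul_const _ (by fun_prop)] at h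
  simp_rw [mainTerm_eq σ hs hsY]
  rw [lintegral_fd (measurable_tsum_sliceVol σ _ e)]
  convert h using 1
  · congr 1
    rw [show ((1 : ℝ) / 2 - -(1 / 2)) = 1 by norm_num, ofReal_one, mul_one,
      ← rpow_mul hY.le, moment]
    norm_num
  · rw [lintegral_sliceVol]
    congr 1
    have he0 : (0 : ℝ) < e := by exact_mod_cast he
    rw [ofReal_mul (p := 2 * Y * (e : ℝ)⁻¹) (by positivity), ← lintegral_inv_sqrt_one_sub_sq,
      ← lintegral_const_mul _ (by fun_prop), hsY]
    refine lintegral_congr fun x => ?_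
    rw [ofReal_mul (p := 2 * Y * (e : ℝ)⁻¹) (by positivity)]
  · rw [show ((1 : ℝ) / 2 - -(1 / 2)) = 1 by norm_num, ofReal_one, mul_one,
      ← rpow_mul hY.le, moment]
    norm_num

lemma levelEstimate_redWeight {σ : ℤ} (hσ : σ = 1 ∨ σ = -1) {c : ℝ≥0∞} (hc : c ≠ 0) :
    LevelEstimate σ (redWeight c) ((4 * c)⁻¹.toReal * (2 * (π / 3) * (moment σ 0).toReal))
      ((4 * c)⁻¹.toReal * (4 / 3 * (riemannZeta ((1 / 3 : ℝ) : ℂ)).re *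
        (moment σ (-(2 / 3))).toReal)) := by
  have hζ := ZetaThird.zeta_neg
  set ζ' := (riemannZeta ((1 / 3 : ℝ) : ℂ)).re
  set κ := (4 * c)⁻¹ with hκ
  have hκt : κ ≠ ⊤ := inv_ne_top.2 (mul_ne_zero (by norm_num) hc)
  set v := moment σ 0 with hv
  have hvt : v ≠ ⊤ := moment_ne_top σ (by norm_num)
  set j := moment σ (-(2 / 3)) with hj
  have hjt : j ≠ ⊤ := moment_ne_top σ (by norm_num)
  set q := moment σ (-(11 / 12)) with hq
  have hqt : q ≠ ⊤ := moment_ne_top σ (by norm_num)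
  set i₃ := ∫⁻ z in 𝒟, ofReal (3 * √(z : ℍ).im) with hi₃
  have hit : i₃ ≠ ⊤ := lintegral_fd_sqrt_im_ne_top
  set α := κ.toReal * (2 * (π / 3) * v.toReal) with hα
  set β := κ.toReal * (4 / 3 * ζ' * j.toReal) with hβ
  have hα0 : 0 ≤ α := by positivity
  have hβ0 : β ≤ 0 := by
    have : 0 ≤ κ.toReal * (4 / 3 * -ζ' * j.toReal) :=
      mul_nonneg (by positivity) (mul_nonneg (by linarith) (by positivity))
    rw [hβ]; linarith
  set D := κ.toReal * (52000000 * 10000 * i₃.toReal + 4 * q.toReal) with hD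
  have hD0 : 0 ≤ D := by positivity
  refine ⟨6, α - β + D, by norm_num, by linarith, fun Y hY E hE => ?_⟩
  have hE0 : ∀ p ∈ E, (1 : ℝ) ≤ p := fun p hp => by exact_mod_cast (hE p hp).one_le
  set P := ∏ p ∈ E, (p : ℝ) ^ (1 / 2 : ℝ) with hP
  have hP1 : 1 ≤ P := by
    rw [← prod_const_one (s := E)]
    exact prod_le_prod (fun _ _ => zero_le_one) fun p hp =>
      one_le_rpow (hE0 p hp) (by norm_num)
  have hQ0 : 0 ≤ ∏ p ∈ E, (p : ℝ) := prod_nonneg fun p _ => by positivity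
  have h26 : (2 : ℝ) ^ E.card ≤ 6 ^ E.card := pow_le_pow_left₀ (by norm_num) (by norm_num) _
  have hY48 : 0 ≤ Y ^ (37 / 48 : ℝ) := by positivity
  have hY2 : 0 ≤ Y ^ (1 / 2 : ℝ) := by positivity
  rcases le_or_gt Y 1 with hY1 | hY1
  · rw [sieveSum_eq_zero hY1]
    refine ⟨ENNReal.zero_ne_top, ?_⟩
    have b : ∀ r : ℝ, r ≤ 0 → ∏ p ∈ E, (1 + (p : ℝ) ^ r) ≤ 2 ^ E.card ∧
        0 ≤ ∏ p ∈ E, (1 + (p : ℝ) ^ r) := fun r hr => by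
      refine ⟨?_, prod_nonneg fun p _ => by positivity⟩
      rw [← prod_const]
      exact prod_le_prod (fun p _ => by positivity) fun p hp => by
        linarith [rpow_le_one_of_one_le_of_nonpos (hE0 p hp) hr]
    obtain ⟨b1, b1'⟩ := b (-1) (by norm_num)
    simp only [rpow_neg_one] at b1 b1'
    obtain ⟨b2, b2'⟩ := b (-(1 : ℝ) / 3) (by norm_num)
    have y1 : Y ≤ Y ^ (37 / 48 : ℝ) := by
      simpa using rpow_le_rpow_of_exponent_ge hY hY1 (by norm_num : (37 : ℝ) / 48 ≤ 1)
    have y2 : Y ^ (5 / 6 : ℝ) ≤ Y ^ (37 / 48 : ℝ) :=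
      rpow_le_rpow_of_exponent_ge hY hY1 (by norm_num)
    set P₁ := ∏ p ∈ E, (1 + (p : ℝ)⁻¹)
    set P₂ := ∏ p ∈ E, (1 + (p : ℝ) ^ (-(1 : ℝ) / 3))
    have z1 : Y * P₁ ≤ Y ^ (37 / 48 : ℝ) * 6 ^ E.card :=
      mul_le_mul y1 (b1.trans h26) b1' hY48
    have z2 : Y ^ (5 / 6 : ℝ) * P₂ ≤ Y ^ (37 / 48 : ℝ) * 6 ^ E.card :=
      mul_le_mul y2 (b2.trans h26) b2' hY48
    have z1' : 0 ≤ Y * P₁ := by positivity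
    have z2' : 0 ≤ Y ^ (5 / 6 : ℝ) * P₂ := by positivity
    have w1 := mul_le_mul_of_nonneg_left z1 hα0
    have w2 := mul_le_mul_of_nonneg_left z2 (neg_nonneg.2 hβ0)
    have w1' := mul_nonneg hα0 z1'
    have w2' := mul_nonneg (neg_nonneg.2 hβ0) z2'
    calc |(0 : ℝ≥0∞).toReal - α * Y * P₁ - β * Y ^ (5 / 6 : ℝ) * P₂|
        ≤ (α - β) * (Y ^ (37 / 48 : ℝ) * 6 ^ E.card) := by
          rw [toReal_zero, abs_le]; constructor <;> linarith
      _ ≤ (α - β + D) * (6 ^ E.card * (P * Y ^ (37 / 48 : ℝ))) := by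
          refine mul_le_mul (by linarith) ?_ (by positivity) (by linarith)
          rw [mul_comm]
          exact mul_le_mul_of_nonneg_left (le_mul_of_one_le_left hY48 hP1) (by positivity)
      _ ≤ (α - β + D) * (6 ^ E.card * (P * Y ^ (37 / 48 : ℝ) +
            (∏ p ∈ E, (p : ℝ)) * Y ^ (1 / 2 : ℝ))) := by
          have : 0 ≤ (∏ p ∈ E, (p : ℝ)) * Y ^ (1 / 2 : ℝ) := mul_nonneg hQ0 hY2
          refine mul_le_mul_of_nonneg_left (mul_le_mul_of_nonneg_left ?_ (by positivity))
            (by linarith)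
          linarith
      _ = _ := by ring
  have hN := near_sieveSum hσ c hY1.le hE
  rw [lintegral_finsetSum _ fun S _ => measurable_mainTerm σ hY _] at hN
  have hM := (Near.sum (s := E.powerset) fun S hS => near_lintegral_mainTerm σ hY
    (e := ∏ p ∈ S, p) (prod_pos fun p hp => (hE p (mem_powerset.1 hS hp)).pos)).mul_left κ
  rw [sum_add_distrib, mul_add, ← sum_mul, ← sum_mul, ← sum_mul,
    ← ofReal_sum_of_nonneg fun S _ => by
      exact mul_nonneg (by positivity) (by linarith),
    ← ofReal_sum_of_nonneg fun S _ => by positivity,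
    ← ofReal_sum_of_nonneg fun S _ => by positivity] at hM
  have key := Near.trans ⟨(add_le_add_left hN.1 _).trans_eq (add_right_comm _ _ _),
    (add_le_add_left hN.2 _).trans_eq (add_right_comm _ _ _)⟩ hM
  have a1 : ∑ S ∈ E.powerset, 4 / 3 * Y ^ (5 / 6 : ℝ) * ((∏ p ∈ S, p : ℕ) : ℝ) ^ (-(1 / 3) : ℝ) *
      -ζ' = 4 / 3 * Y ^ (5 / 6 : ℝ) * -ζ' * ∏ p ∈ E, (1 + (p : ℝ) ^ (-(1 : ℝ) / 3)) := by
    rw [prod_one_add, mul_sum]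
    refine sum_congr rfl fun S _ => ?_
    rw [finsetProd_rpow _ _ fun p _ => p.cast_nonneg]
    push_cast; ring_nf
  have a2 : ∑ S ∈ E.powerset, 2 * Y * ((∏ p ∈ S, p : ℕ) : ℝ)⁻¹ * (π / 3) =
      2 * Y * (π / 3) * ∏ p ∈ E, (1 + (p : ℝ)⁻¹) := by
    rw [prod_one_add, mul_sum]
    refine sum_congr rfl fun S _ => ?_
    rw [Finset.prod_inv_distrib]
    push_cast; ring
  rw [a1, a2, sum_const, card_powerset, nsmul_eq_mul] at key
  obtain ⟨hT, habs⟩ := key.abs_toReal_sub_le (by finiteness) (by finiteness)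
  have hT' := (add_ne_top.1 hT).1
  refine ⟨hT', ?_⟩
  have hsq : √((∏ p ∈ E, p : ℕ) : ℝ) = P := by
    rw [hP, finsetProd_rpow _ _ fun p _ => p.cast_nonneg, sqrt_eq_rpow]
    push_cast; rfl
  have hP₁ : 0 ≤ ∏ p ∈ E, (1 + (p : ℝ)⁻¹) := prod_nonneg fun p _ => by positivity
  have hP₂ : 0 ≤ ∏ p ∈ E, (1 + (p : ℝ) ^ (-(1 : ℝ) / 3)) :=
    prod_nonneg fun p _ => by positivity
  rw [toReal_add hT' (by finiteness), toReal_add (by finiteness) (by finiteness)]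
    at habs
  simp only [toReal_mul] at habs
  rw [toReal_ofReal (mul_nonneg (mul_nonneg (by positivity) (by linarith)) hP₂),
    toReal_ofReal (by positivity), toReal_ofReal (by positivity),
    toReal_ofReal (by positivity), hsq] at habs
  push_cast at habs
  set P₁ := ∏ p ∈ E, (1 + (p : ℝ)⁻¹)
  set P₂ := ∏ p ∈ E, (1 + (p : ℝ) ^ (-(1 : ℝ) / 3))
  set R := P * Y ^ (37 / 48 : ℝ) + (∏ p ∈ E, (p : ℝ)) * Y ^ (1 / 2 : ℝ) with hR
  have hYR : Y ^ (37 / 48 : ℝ) ≤ R := by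
    have h1 := le_mul_of_one_le_left hY48 hP1
    have h2 := mul_nonneg hQ0 hY2
    linarith
  have hR0 : 0 ≤ R := hY48.trans hYR
  calc _ = _ := by congr 1; rw [hα, hβ]; ring
    _ ≤ _ := habs
    _ ≤ κ.toReal * (52000000 * 10000 * 6 ^ E.card * R * i₃.toReal) +
        κ.toReal * (6 ^ E.card * (4 * R) * q.toReal) := by
      gcongr
    _ = D * (6 ^ E.card * R) := by rw [hD]; ring
    _ ≤ (α - β + D) * (6 ^ E.card * R) :=
      mul_le_mul_of_nonneg_right (by linarith) (by positivity)
    _ = _ := by ring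

/-- Every real form of nonzero discriminant can be moved to a normal form. -/
lemma normalForm_induction {P : Cub ℝ → Prop} (ht : ∀ t f, P (sub !![1, 0; t, 1] f) → P f)
    (hS : ∀ f, P (sub !![0, 1; 1, 0] f) → P f)
    (hd : ∀ s : ℝ, 0 < s → ∀ f, P (sub !![s, 0; 0, s⁻¹] f) → P f)
    (hk : ∀ k : ℝ, k ≠ 0 → ∀ f, P (scal k f) → P f) {σ : ℝ} (hσ : σ ^ 2 = 1)
    (h0 : P ⟨0, 1, 0, -σ⟩) (f : Cub ℝ) (hf : 0 < σ * f.disc) : P f := by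
  have step3 : ∀ b d : ℝ, 0 < -σ * d * b → P ⟨0, b, 0, d⟩ := fun b d h => by
    have hb : b ≠ 0 := fun hb => by simp [hb] at h
    have h' : 0 < -σ * d / b := by
      rw [show -σ * d / b = -σ * d * b / b ^ 2 by field_simp]; positivity
    set s := (-σ * d / b) ^ (1 / 4 : ℝ) with hs
    have hs0 : 0 < s := by positivity
    have hs4 : s ^ 4 = -σ * d / b := by
      rw [hs, ← rpow_natCast, ← rpow_mul h'.le]; norm_num
    refine hd s hs0 _ (hk (b * s)⁻¹ (by positivity) _ ?_)
    have hdb : d = -σ * s ^ 4 * b := by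
      rw [hs4]; field_simp; linear_combination -d * hσ
    convert h0 using 1
    ext <;> simp [scal, sub, ev, evx, evy]
    · field_simp
    · rw [hdb]; field_simp
  have step2 : ∀ g : Cub ℝ, g.a = 0 → 0 < σ * g.disc → P g := fun g hg hD => by
    obtain ⟨a, b, c, d⟩ := g
    simp only at hg
    subst hg
    have hb : b ≠ 0 := fun hb => by simp [disc, hb] at hD
    refine ht (-c / (2 * b)) _ ?_
    have e : sub !![1, 0; -c / (2 * b), 1] ⟨0, b, c, d⟩ = ⟨0, b, 0, d - c ^ 2 / (4 * b)⟩ := by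
      ext <;> simp [sub, ev, evx, evy] <;> field_simp <;> ring
    rw [e]
    refine step3 _ _ ?_
    have : -σ * (d - c ^ 2 / (4 * b)) * b = σ * (⟨0, b, c, d⟩ : Cub ℝ).disc / (4 * b ^ 2) := by
      simp only [disc]; field_simp; ring
    rw [this]; positivity
  by_cases ha : f.a = 0
  · exact step2 f ha hf
  obtain ⟨θ, -, hθ⟩ := intermediate_value_uIcc (a := 0) (b := π)
    (f := fun θ => f.ev (cos θ) (sin θ)) (by unfold ev; fun_prop) (Set.mem_uIcc.2
      (by norm_num [ev]; exact le_total f.a 0) : (0 : ℝ) ∈ _)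
  simp only [ev] at hθ
  have hs : sin θ ≠ 0 := fun h => by
    have := sin_sq_add_cos_sq θ
    rw [h] at this hθ
    have h2 : f.a * cos θ ^ 3 * cos θ = 0 := by
      linear_combination cos θ * hθ
    exact ha (by linear_combination h2 - f.a * (cos θ ^ 2 + 1) * this)
  set t := cos θ / sin θ with ht'
  refine ht t _ (hS _ (step2 _ ?_ ?_))
  · simp [sub, ev, evx, evy]
    rw [ht']; field_simp; linear_combination hθ
  · rw [disc_sub, disc_sub]; norm_num; exact hf

lemma balVol_eq {σ : ℤ} (hσ : (σ : ℝ) ^ 2 = 1) (f : Cub ℝ) (hf : 0 < (σ : ℝ) * f.disc) :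
    balVol f = balVol ⟨0, 1, 0, -σ⟩ := by
  have key : ∀ (M : Matrix (Fin 2) (Fin 2) ℝ) (_ : |M.det| = 1) (g : Cub ℝ),
      balVol (sub M g) = balVol g := fun M hM g => by
    have h := balVol_sub g (g := GeneralLinearGroup.mkOfDetNeZero M.transpose
      (by rw [det_transpose]; intro h0; simp [h0] at hM)) (by
        simpa [GeneralLinearGroup.mkOfDetNeZero] using hM)
    simpa [GeneralLinearGroup.mkOfDetNeZero] using h
  refine normalForm_induction (P := fun f => balVol f = balVol ⟨0, 1, 0, -σ⟩)
    (fun t g h => ?_) (fun g h => ?_) (fun s hs g h => ?_) (fun k hk g h => ?_) hσ rfl f hf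
  · rwa [key _ (by simp)] at h
  · rwa [key _ (by simp)] at h
  · rwa [key _ (by simp [hs.ne'])] at h
  · rwa [balVol_scal hk] at h

/-- The depressed cubics of bounded discriminant. -/
def depressed (σ : ℤ) : Set (ℝ × ℝ) :=
  {p | 0 < (σ : ℝ) * (-4 * p.1 ^ 3 - 27 * p.2 ^ 2) ∧ (σ : ℝ) * (-4 * p.1 ^ 3 - 27 * p.2 ^ 2) < 1}

lemma measurableSet_depressed (σ : ℤ) : MeasurableSet (depressed σ) :=
  (by fun_prop : Measurable fun p : ℝ × ℝ => (σ : ℝ) * (-4 * p.1 ^ 3 - 27 * p.2 ^ 2)) measurableSet_Ioo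

lemma measurable_strip (σ : ℤ) : Measurable fun p : (ℝ × ℝ) × ℝ³ =>
    ((Set.Ico 0 1).indicator 1 (-3 * p.1.1 + (√p.1.2)⁻¹ * p.2.1) *
      (slice σ 1 I (√p.1.2 ^ 3)).indicator 1 p.2 : ℝ≥0∞) := by
  have h1 : Measurable fun p : (ℝ × ℝ) × ℝ³ =>
      ((Set.Ico 0 1).indicator 1 (-3 * p.1.1 + (√p.1.2)⁻¹ * p.2.1) : ℝ≥0∞) :=
    (measurable_one.indicator measurableSet_Ico).comp (by fun_prop :
      Measurable fun p : (ℝ × ℝ) × ℝ³ => -3 * p.1.1 + (√p.1.2)⁻¹ * p.2.1)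
  have h2 := (measurable_indicator_slice σ 1 I).comp
    (by fun_prop : Measurable fun p : (ℝ × ℝ) × ℝ³ => (√p.1.2 ^ 3, p.2))
  exact h1.mul h2

lemma lintegral_strip (σ : ℤ) (y : ℝ) :
    ∫⁻ x, ∫⁻ q : ℝ³, ((Set.Ico 0 1).indicator 1 (-3 * x + (√y)⁻¹ * q.1) *
      (slice σ 1 UpperHalfPlane.I (√y ^ 3)).indicator 1 q : ℝ≥0∞) =
      ofReal (1 / 3) * sliceVol σ (√y ^ 3) := by
  have hI : Measurable ((Set.Ico (0 : ℝ) 1).indicator (1 : ℝ → ℝ≥0∞)) :=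
    measurable_one.indicator measurableSet_Ico
  have hm : Measurable fun p : ℝ × ℝ³ => ((p.1, y), p.2) := by fun_prop
  rw [lintegral_lintegral_swap (f := fun x (q : ℝ³) => ((Set.Ico 0 1).indicator 1
      (-3 * x + (√y)⁻¹ * q.1) * (slice σ 1 UpperHalfPlane.I (√y ^ 3)).indicator 1 q : ℝ≥0∞))
      ((measurable_strip σ).comp hm).aemeasurable, sliceVol,
    ← lintegral_slice, ← lintegral_const_mul _ (measurable_one.indicator (measurableSet_slice ..))]
  refine lintegral_congr fun q => ?_
  rw [lintegral_mul_const _ (by fun_prop), lintegral_comp_affine hI (by norm_num),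
    lintegral_indicator_one measurableSet_Ico]
  norm_num [abs_of_neg]

/-- Unfolding: monic cubics up to translation, counted with their balanced points. -/
lemma balVol_mul_depressed {σ : ℤ} (hσ : (σ : ℝ) ^ 2 = 1) :
    balVol ⟨0, 1, 0, -σ⟩ * volume (depressed σ) = ofReal (2 / 9) * moment σ (-(2 / 3)) := by
  classical
  set E : Set (ℝ³ × ℍ) := {p | p.1.1 ∈ Ico (0 : ℝ) 1 ∧ p.1 ∈ slice σ 1 p.2 1} with hE
  have hI : MeasurableSet {x : ℝ | x ∈ Ico (0 : ℝ) 1} := measurableSet_Ico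
  have hEm : MeasurableSet E := by
    have h1 : Measurable fun p : ℝ³ × ℍ => p.1.1 := by fun_prop
    have h2 : Measurable fun p : ℝ³ × ℍ =>
      ((((1 : ℝ), p.1), p.2) : (ℝ × ℝ³) × ℍ) := by fun_prop
    exact (h1 hI).inter (h2 (measurableSet_reg σ 1))
  have hswap := lintegral_lintegral_swap (μ := volume) (ν := volume)
    (f := fun (q : ℝ³) (z : ℍ) => (E.indicator 1 (q, z) : ℝ≥0∞))
    (measurable_one.indicator hEm).aemeasurable
  have hl : ∀ q : ℝ³, ∫⁻ z : ℍ, (E.indicator 1 (q, z) : ℝ≥0∞) =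
      balVol ⟨0, 1, 0, -σ⟩ * (Ico (0 : ℝ) 1 ×ˢ depressed σ).indicator 1
        (1 * q.1 + 0, 1 * q.2.1 + -(q.1 ^ 2 / 3), 1 * q.2.2 + (2 * q.1 ^ 3 / 27 - q.1 * q.2.1 / 3)) := by
    intro q
    have hd : (⟨1, q.1, q.2.1, q.2.2⟩ : Cub ℝ).disc = -4 * (1 * q.2.1 + -(q.1 ^ 2 / 3)) ^ 3 -
        27 * (1 * q.2.2 + (2 * q.1 ^ 3 / 27 - q.1 * q.2.1 / 3)) ^ 2 := by
      simp only [disc]; ring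
    by_cases h : (1 * q.1 + 0, 1 * q.2.1 + -(q.1 ^ 2 / 3),
        1 * q.2.2 + (2 * q.1 ^ 3 / 27 - q.1 * q.2.1 / 3)) ∈ Ico (0 : ℝ) 1 ×ˢ depressed σ
    · rw [indicator_of_mem h, Pi.one_apply, mul_one]
      obtain ⟨h1, h2⟩ := h
      simp only [depressed, mem_ofPred_eq, one_mul, add_zero] at h1 h2
      rw [one_mul, one_mul] at hd
      rw [← hd] at h2
      rw [← balVol_eq hσ _ h2.1, balVol, ← lintegral_indicator_one (measurableSet_balSet _)]
      refine lintegral_congr fun z => ?_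
      rw [indicator_apply, indicator_apply]
      refine if_congr ?_ rfl rfl
      simp only [hE, balSet, Balanced, slice, reg, mem_ofPred_eq, h1, h2, and_true, true_and]
      have : |(⟨1, q.1, q.2.1, q.2.2⟩ : Cub ℝ).disc| = σ * (⟨1, q.1, q.2.1, q.2.2⟩ : Cub ℝ).disc := by
        rw [← abs_of_pos h2.1, abs_mul, (sq_eq_sq_iff_abs_eq_abs _ 1).1 (hσ.trans (one_pow 2).symm), abs_one, one_mul]
      rw [this]
    · rw [indicator_of_notMem h, mul_zero]
      refine (lintegral_congr fun z => ?_).trans lintegral_zero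
      refine indicator_of_notMem (fun h' => h ?_) _
      obtain ⟨h1, -, h2⟩ := h'
      refine ⟨by simpa using h1, ?_⟩
      simp only [hd] at h2
      exact h2
  have hr : ∀ z : ℍ, ∫⁻ q, (E.indicator 1 (q, z) : ℝ≥0∞) = ofReal (√z.im ^ 3) *
      ∫⁻ q, (Set.Ico 0 1).indicator 1 (-3 * z.re + (√z.im)⁻¹ * q.1) *
        (slice σ 1 I (√z.im ^ 3)).indicator 1 q := by
    intro z
    have hw : 0 < √z.im := sqrt_pos.2 z.im_pos
    have h := lintegral_comp_triangular (F := fun q => (Set.Ico 0 1).indicator 1 (-3 * z.re + (√z.im)⁻¹ * q.1) * (slice σ 1 I (√z.im ^ 3)).indicator 1 q)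
      (((measurable_one.indicator measurableSet_Ico).comp (by fun_prop : Measurable fun q : ℝ³ =>
        -3 * z.re + (√z.im)⁻¹ * q.1)).mul (measurable_one.indicator (measurableSet_slice σ 1 _ _)))
      (k₁ := √z.im) (k₂ := (√z.im)⁻¹) (k₃ := (√z.im ^ 3)⁻¹) (by positivity) (by positivity)
      (by positivity) (3 * z.re * √z.im)
      (γ := fun b => (3 * z.re ^ 2 + 2 * b * z.re) * (√z.im)⁻¹)
      (δ := fun b c => (z.re ^ 3 + b * z.re ^ 2 + c * z.re) * (√z.im ^ 3)⁻¹)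
      (by fun_prop) (by fun_prop)
    rw [show |(√z.im * (√z.im)⁻¹ * (√z.im ^ 3)⁻¹)⁻¹| = √z.im ^ 3 by
      rw [abs_of_pos (by positivity)]; field_simp] at h
    rw [← h]
    refine lintegral_congr fun q => ?_
    have hi : -3 * z.re + (√z.im)⁻¹ * (√z.im * q.1 + 3 * z.re * √z.im) = q.1 := by field_simp; ring
    have hm := mem_slice_iff (σ := σ) (z := z) one_pos (one_pow 4) hw (sq_sqrt z.im_pos.le) 1 q
    simp at hm
    simp only [indicator_apply, Pi.one_apply, hi, ← hm, hE, mem_ofPred_eq, ite_and, mul_ite,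
      mul_one, mul_zero]
    split_ifs <;> rfl
  have hm2 : MeasurableSet (Ico (0 : ℝ) 1 ×ˢ depressed σ) :=
    measurableSet_Ico.prod (measurableSet_depressed σ)
  simp_rw [hl, hr] at hswap
  replace hswap := (lintegral_const_mul _ ((measurable_one.indicator hm2).comp (by fun_prop :
    Measurable fun q : ℝ³ => (1 * q.1 + 0, 1 * q.2.1 + -(q.1 ^ 2 / 3),
      1 * q.2.2 + (2 * q.1 ^ 3 / 27 - q.1 * q.2.1 / 3))))).symm.trans hswap
  simp only [Function.comp_def] at hswap
  have ht := lintegral_comp_triangular (F := (Ico (0 : ℝ) 1 ×ˢ depressed σ).indicator 1)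
    (measurable_one.indicator hm2) one_ne_zero one_ne_zero one_ne_zero 0
    (γ := fun b => -(b ^ 2 / 3)) (δ := fun b c => 2 * b ^ 3 / 27 - b * c / 3) (by fun_prop) (by fun_prop)
  have hq := lintegral_upperHalfPlane (F := fun x y => ofReal (√y ^ 3) *
      ∫⁻ q, (Set.Ico 0 1).indicator 1 (-3 * x + (√y)⁻¹ * q.1) *
        (slice σ 1 I (√y ^ 3)).indicator 1 q)
    ((by fun_prop : Measurable fun p : ℝ × ℝ => ofReal (√p.2 ^ 3)).mul
      (measurable_strip σ).lintegral_prod_right')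
  have hv : volume (Ico (0 : ℝ) 1 ×ˢ depressed σ) = volume (depressed σ) := by
    rw [Measure.volume_eq_prod, Measure.prod_prod]; simp
  rw [ht, hq, lintegral_indicator_one hm2, hv] at hswap
  simp only [mul_one, inv_one, abs_one, ofReal_one, one_mul] at hswap
  obtain ⟨T, hT⟩ : ∃ T : ℝ → ℝ → ℝ≥0∞, T = fun x y => ∫⁻ q : ℝ³, (Set.Ico 0 1).indicator 1
      (-3 * x + (√y)⁻¹ * q.1) * (slice σ 1 I (√y ^ 3)).indicator 1 q := ⟨_, rfl⟩
  have hmT : Measurable fun p : ℝ × ℝ => T p.1 p.2 := by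
    rw [hT]; exact (measurable_strip σ).lintegral_prod_right'
  have hs : ∀ y, ∫⁻ x, T x y = ofReal (1 / 3) * sliceVol σ (√y ^ 3) := fun y => by
    rw [hT]; exact lintegral_strip σ y
  rw [hswap]
  refine (lintegral_congr fun x => setLIntegral_congr_fun (g := fun y => ofReal (y ^ 2)⁻¹ *
    (ofReal (√y ^ 3) * T x y)) measurableSet_Ioi fun y _ => by rw [hT]).trans ?_
  rw [lintegral_lintegral_swap (by fun_prop), moment]
  conv_rhs => rw [lintegral_comp_rpow _ one_pos (by norm_num : (3 / 2 : ℝ) ≠ 0),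
    ← lintegral_const_mul' _ _ ofReal_ne_top]
  refine setLIntegral_congr_fun measurableSet_Ioi fun y hy => ?_
  have hy : 0 < y := hy
  have hsq : √y ^ 3 = y ^ (3 / 2 : ℝ) := by
    rw [sqrt_eq_rpow, ← rpow_natCast, ← rpow_mul hy.le]; norm_num
  rw [lintegral_const_mul' _ _ ofReal_ne_top, lintegral_const_mul' _ _ ofReal_ne_top,
    hs, hsq, one_mul, one_mul, ← rpow_mul hy.le]
  simp only [← mul_assoc]
  rw [← ofReal_mul (by positivity), ← ofReal_mul (by positivity),
    ← ofReal_mul (by positivity), ← ofReal_mul (by positivity)]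
  congr 2
  have e1 : y ^ (3 / 2 - 1 : ℝ) * y ^ (3 / 2 * -(2 / 3) : ℝ) = (y ^ 2)⁻¹ * y ^ (3 / 2 : ℝ) := by
    rw [← rpow_natCast, ← rpow_neg hy.le, ← rpow_add hy, ← rpow_add hy]
    norm_num
  rw [← e1, abs_of_pos (by norm_num)]
  ring

end Cub

lemma lintegral_comp_cube (G : ℝ → ℝ≥0∞) :
    ∫⁻ v, ofReal (|v| ^ (-(2 / 3) : ℝ)) * G v = 3 * ∫⁻ c, G (c ^ 3) := by
  have h3 : Odd 3 := by decide
  have hr : (fun x : ℝ => x ^ 3) '' univ = univ := by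
    rw [image_univ, range_eq_univ]
    intro v
    rcases le_total 0 v with hv | hv
    · exact ⟨_, rpow_inv_natCast_pow hv three_ne_zero⟩
    · refine ⟨-(-v) ^ ((3 : ℕ) : ℝ)⁻¹, (h3.neg_pow _).trans ?_⟩
      rw [rpow_inv_natCast_pow (neg_nonneg.2 hv) three_ne_zero, neg_neg]
  have h := lintegral_image_eq_lintegral_abs_deriv_mul (s := univ) (f := fun x : ℝ => x ^ 3)
    (f' := fun x => 3 * x ^ 2) MeasurableSet.univ
    (fun x _ => (hasDerivAt_pow 3 x).hasDerivWithinAt.congr_deriv (by norm_num)) h3.strictMono_pow.injective.injOn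
    (fun v => ofReal (|v| ^ (-(2 / 3) : ℝ)) * G v)
  rw [hr, setLIntegral_univ, setLIntegral_univ] at h
  rw [h, ← lintegral_const_mul' _ _ (by simp)]
  refine lintegral_congr_ae ?_
  filter_upwards [compl_mem_ae_iff.2 (measure_singleton (0 : ℝ))] with x hx
  have hx : 0 < |x| := abs_pos.2 hx
  have e : (|x| ^ 3) ^ (-(2 / 3) : ℝ) = (|x| ^ 2)⁻¹ := by
    rw [← rpow_natCast, ← rpow_natCast, ← rpow_mul hx.le, ← rpow_neg hx.le]
    norm_num
  rw [← mul_assoc, ← ofReal_mul (abs_nonneg _), abs_pow, e, abs_mul, abs_pow, mul_assoc,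
    mul_inv_cancel₀ (by positivity)]
  norm_num

lemma lintegral_rpow_neg_sixth :
    ∫⁻ w in Ioo (0 : ℝ) 1, ofReal (w ^ (-(1 / 6) : ℝ)) = ofReal (6 / 5) := by
  rw [setLIntegral_congr Ioo_ae_eq_Ioc, ← ofReal_integral_eq_lintegral_ofReal,
    ← intervalIntegral.integral_of_le zero_le_one, integral_rpow (Or.inl (by norm_num))]
  · norm_num
  · exact (intervalIntegrable_iff_integrableOn_Ioc_of_le zero_le_one).1
      (intervalIntegral.intervalIntegrable_rpow' (by norm_num))
  · filter_upwards [ae_restrict_mem measurableSet_Ioc] with w hw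
    exact rpow_nonneg hw.1.le _

namespace Cub

/-- The real periods attached to the two signatures. -/
def period (σ : ℤ) : ℝ≥0∞ :=
  ∫⁻ t : ℝ, ofReal (|1 + σ * t ^ 2| ^ (-(2 / 3) : ℝ))

lemma volume_depressed {σ : ℤ} (hσ : (σ : ℝ) ^ 2 = 1) : volume (depressed σ) =
    ofReal (4 ^ (2 / 3 : ℝ) / 10 * (√27)⁻¹) * period σ := by
  have hσ1 : |(σ : ℝ)| = 1 := (sq_eq_sq_iff_abs_eq_abs _ 1).1 (hσ.trans (one_pow 2).symm) |>.trans
    abs_one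
  have hσ0 : (σ : ℝ) ≠ 0 := fun h => by norm_num [h] at hσ
  have hI : Measurable ((Ioo (0 : ℝ) 1).indicator (1 : ℝ → ℝ≥0∞)) :=
    measurable_one.indicator measurableSet_Ioo
  have h4 : (4 : ℝ) ^ (2 / 3 : ℝ) * 4 ^ (-(2 / 3) : ℝ) = 1 := by
    rw [← rpow_add (by norm_num)]; norm_num
  set F : ℝ → ℝ → ℝ≥0∞ := fun d w => ofReal (|w + 27 * σ * d ^ 2| ^ (-(2 / 3) : ℝ)) *
    (Set.Ioo 0 1).indicator 1 w with hF
  have hFm : Measurable fun p : ℝ × ℝ => F p.1 p.2 := by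
    simp only [hF]; fun_prop
  have h1 : ∀ d : ℝ, volume ((fun c : ℝ => (c, d)) ⁻¹' depressed σ) =
      ofReal (4 ^ (2 / 3 : ℝ) / 12) * ∫⁻ w, F d w := fun d => by
    have e := lintegral_comp_affine (hFm.comp (measurable_prodMk_left (x := d)))
      (mul_ne_zero (by norm_num : (-4 : ℝ) ≠ 0) hσ0) (-27 * σ * d ^ 2)
    have e2 := lintegral_comp_cube fun v : ℝ => (Ioo (0 : ℝ) 1).indicator (1 : ℝ → ℝ≥0∞)
      (-4 * σ * v + -27 * σ * d ^ 2)
    have e3 : ∫⁻ v : ℝ, F d (-4 * σ * v + -27 * σ * d ^ 2) = ofReal (4 ^ (-(2 / 3) : ℝ)) *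
        ∫⁻ v : ℝ, ofReal (|v| ^ (-(2 / 3) : ℝ)) *
          (Set.Ioo (0 : ℝ) 1).indicator (1 : ℝ → ℝ≥0∞) (-4 * σ * v + -27 * σ * d ^ 2) := by
      rw [← lintegral_const_mul' _ _ ofReal_ne_top]
      refine lintegral_congr fun v => ?_
      rw [hF, ← mul_assoc, ← ofReal_mul (by positivity), ← mul_rpow (by norm_num)
        (abs_nonneg v)]
      simp only
      congr 4
      rw [show -4 * σ * v + -27 * σ * d ^ 2 + 27 * σ * d ^ 2 = -4 * σ * v by ring, abs_mul, abs_mul,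
        hσ1]
      norm_num
    have e4 : volume ((fun c : ℝ => (c, d)) ⁻¹' depressed σ) = ∫⁻ c : ℝ, (Ioo (0 : ℝ) 1).indicator
        (1 : ℝ → ℝ≥0∞) (-4 * σ * c ^ 3 + -27 * σ * d ^ 2) := by
      rw [← lintegral_indicator_one (measurable_prodMk_right (measurableSet_depressed σ))]
      refine lintegral_congr fun c => ?_
      rw [show -4 * σ * c ^ 3 + -27 * σ * d ^ 2 = σ * (-4 * c ^ 3 - 27 * d ^ 2) by ring]
      rfl
    simp only [Function.comp_apply] at e
    rw [e3, e2, ← e4] at e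
    have h12 : ofReal (4 ^ (2 / 3 : ℝ) / 12) = ofReal (4 ^ (2 / 3 : ℝ) / 3) *
        ofReal |((-4 : ℝ) * σ)⁻¹| := by
      rw [← ofReal_mul (by positivity), abs_inv, abs_mul, hσ1]
      norm_num; ring_nf
    rw [h12, mul_assoc, ← e, ← mul_assoc, ← mul_assoc, show (3 : ℝ≥0∞) = ofReal 3 by simp,
      ← ofReal_mul (by positivity), ← ofReal_mul (by positivity),
      show (4 : ℝ) ^ (2 / 3 : ℝ) / 3 * 4 ^ (-(2 / 3) : ℝ) * 3 = 1 by linear_combination h4]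
    simp
  have h2 : ∀ w : ℝ, ∫⁻ d, F d w = (Ioo (0 : ℝ) 1).indicator (fun w =>
      ofReal (w ^ (-(1 / 6) : ℝ))) w * (ofReal (√27)⁻¹ * period σ) := fun w => by
    by_cases hw : w ∈ Set.Ioo (0 : ℝ) 1
    · have hw0 : 0 < w := hw.1
      have e := lintegral_comp_affine (F := fun t => ofReal (|1 + σ * t ^ 2| ^ (-(2 / 3) : ℝ)))
        (by fun_prop) (k := √27 * (√w)⁻¹) (by positivity) 0
      simp only [hF, indicator_of_mem hw, Pi.one_apply, mul_one]
      rw [show w ^ (-(1 / 6) : ℝ) = w ^ (-(2 / 3) : ℝ) * √w by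
        rw [sqrt_eq_rpow, ← rpow_add hw0]; norm_num, ofReal_mul (by positivity),
        mul_assoc, ← mul_assoc (ofReal √w), ← ofReal_mul (by positivity), period,
        show √w * (√27)⁻¹ = |(√27 * (√w)⁻¹)⁻¹| by rw [abs_of_pos (by positivity)]; field_simp, ← e,
        ← lintegral_const_mul' _ _ ofReal_ne_top]
      refine lintegral_congr fun d => ?_
      rw [← ofReal_mul (by positivity), ← mul_rpow hw0.le (abs_nonneg _)]
      congr 2
      nth_rw 2 [← abs_of_pos hw0]
      rw [← abs_mul, add_zero, mul_pow, mul_pow, inv_pow, sq_sqrt (by norm_num),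
        Real.sq_sqrt hw0.le]
      congr 1
      field_simp
    · simp [hF, hw]
  rw [Measure.volume_eq_prod, Measure.prod_apply_symm (measurableSet_depressed σ)]
  simp_rw [h1]
  rw [lintegral_const_mul' _ _ ofReal_ne_top, lintegral_lintegral_swap hFm.aemeasurable]
  simp_rw [h2]
  rw [lintegral_mul_const _ (by fun_prop (disch := exact measurableSet_Ioo)),
    lintegral_indicator measurableSet_Ioo, lintegral_rpow_neg_sixth, ← mul_assoc, ← mul_assoc,
    ← ofReal_mul (by positivity), ← ofReal_mul (by positivity)]
  congr 2
  ring

end Cub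

lemma lintegral_rpow_mul_exp_neg_mul {a r : ℝ} (ha : 0 < a) (hr : 0 < r) :
    ∫⁻ s in Ioi (0 : ℝ), ofReal (s ^ (a - 1) * exp (-(r * s))) =
      ofReal (r ^ (-a) * Gamma a) := by
  have h := integral_rpow_mul_exp_neg_mul_Ioi ha hr
  have hg := Gamma_pos_of_pos ha
  rw [one_div, inv_rpow hr.le, ← rpow_neg hr.le] at h
  rw [← h, ofReal_integral_eq_lintegral_ofReal]
  · exact Integrable.of_integral_ne_zero (by rw [h]; positivity)
  · filter_upwards [ae_restrict_mem measurableSet_Ioi] with s hs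
    have hs : 0 < s := hs
    positivity

lemma lintegral_beta_third : ∫⁻ x in Ioo (0 : ℝ) 1,
    ofReal (x ^ (-(2 / 3) : ℝ) * (1 - x) ^ (-(2 / 3) : ℝ)) =
    ofReal (Gamma (1 / 3) ^ 2 / Gamma (2 / 3)) := by
  have hb := ProbabilityTheory.beta_pos (α := 1 / 3) (β := 1 / 3) (by norm_num) (by norm_num)
  have h := ProbabilityTheory.lintegral_betaPDF_eq_one (α := 1 / 3) (β := 1 / 3) (by norm_num)
    (by norm_num)
  simp only [ProbabilityTheory.lintegral_betaPDF, mul_assoc,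
    ofReal_mul (one_div_pos.2 hb).le] at h
  rw [lintegral_const_mul' _ _ ofReal_ne_top, one_div, ofReal_inv_of_pos hb] at h
  have h2 := ENNReal.eq_inv_of_mul_eq_one_left ((mul_comm _ _).trans h)
  rw [inv_inv] at h2
  norm_num at h2
  convert h2 using 2
  norm_num [ProbabilityTheory.beta, pow_two]

lemma Gamma_third_mul : Gamma (1 / 3) * Gamma (2 / 3) = 2 * π / √3 := by
  have h := Gamma_mul_Gamma_one_sub (1 / 3)
  rw [show (1 : ℝ) - 1 / 3 = 2 / 3 by norm_num, show π * (1 / 3) = π / 3 by ring,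
    sin_pi_div_three] at h
  rw [h]; field_simp

namespace Cub

lemma period_one : period 1 =
    ofReal (2 ^ (5 / 3 : ℝ) * π ^ 2 / (√3 * Gamma (2 / 3) ^ 3)) := by
  have hg : 0 < Gamma (2 / 3) := Gamma_pos_of_pos (by norm_num)
  have h1 : ∀ t : ℝ, ofReal (Gamma (2 / 3)) *
      ofReal (|1 + ((1 : ℤ) : ℝ) * t ^ 2| ^ (-(2 / 3) : ℝ)) =
      ∫⁻ s in Ioi (0 : ℝ), ofReal (s ^ (2 / 3 - 1 : ℝ) * exp (-((1 + t ^ 2) * s))) :=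
    fun t => by
      rw [lintegral_rpow_mul_exp_neg_mul (by norm_num) (by positivity), ← ofReal_mul hg.le,
        mul_comm, Int.cast_one, one_mul, abs_of_pos (by positivity)]
  have h2 : ∀ s ∈ Ioi (0 : ℝ), ∫⁻ t : ℝ, ofReal (s ^ (2 / 3 - 1 : ℝ) *
      exp (-((1 + t ^ 2) * s))) = ofReal √π *
      ofReal (s ^ (1 / 6 - 1 : ℝ) * exp (-(1 * s))) := fun s hs => by
    have hs : 0 < s := hs
    have e : ∀ t : ℝ, s ^ (2 / 3 - 1 : ℝ) * exp (-((1 + t ^ 2) * s)) =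
        s ^ (2 / 3 - 1 : ℝ) * exp (-(1 * s)) * exp (-s * t ^ 2) := fun t => by
      rw [mul_assoc, ← exp_add]; congr 2; ring
    simp_rw [e, ofReal_mul (by positivity : 0 ≤ s ^ (2 / 3 - 1 : ℝ) * exp (-(1 * s)))]
    rw [lintegral_const_mul' _ _ ofReal_ne_top, ← ofReal_integral_eq_lintegral_ofReal
      (integrable_exp_neg_mul_sq hs) (Eventually.of_forall fun t => (exp_pos _).le),
      integral_gaussian, ← ofReal_mul (by positivity), ← ofReal_mul (by positivity),
      sqrt_div pi_pos.le]
    congr 1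
    have : s ^ (2 / 3 - 1 : ℝ) / √s = s ^ (1 / 6 - 1 : ℝ) := by
      rw [sqrt_eq_rpow, ← rpow_sub hs]; norm_num
    rw [← this]; ring
  have h3 : ofReal (Gamma (2 / 3)) * period 1 =
      ofReal (√π * Gamma (1 / 6)) := by
    rw [period, ← lintegral_const_mul' _ _ ofReal_ne_top]
    simp_rw [h1]
    rw [lintegral_lintegral_swap (by fun_prop), setLIntegral_congr_fun measurableSet_Ioi h2,
      lintegral_const_mul' _ _ ofReal_ne_top,
      lintegral_rpow_mul_exp_neg_mul (by norm_num) one_pos, one_rpow, one_mul,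
      ← ofReal_mul (by positivity)]
  have hd := Gamma_mul_Gamma_add_half (1 / 6)
  norm_num at hd
  have h4 := Gamma_third_mul
  have h5 : √π * Gamma (1 / 6) = Gamma (2 / 3) *
      (2 ^ (5 / 3 : ℝ) * π ^ 2 / (√3 * Gamma (2 / 3) ^ 3)) := by
    have h6 : Gamma (1 / 3) = 2 * π / √3 / Gamma (2 / 3) := by
      rw [← h4]; field_simp
    have h7 : Gamma (1 / 6) = Gamma (1 / 3) * 2 ^ (2 / 3 : ℝ) * √π /
      Gamma (2 / 3) := by rw [← hd]; field_simp
    have h8 : (2 : ℝ) ^ (5 / 3 : ℝ) = 2 * 2 ^ (2 / 3 : ℝ) := by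
      rw [← rpow_one_add' (by norm_num) (by norm_num)]; norm_num
    have h9 := sq_sqrt pi_pos.le
    rw [h7, h6, h8]
    field_simp
    rw [h9]
  rw [h5, ofReal_mul hg.le] at h3
  exact (ENNReal.mul_right_inj (ofReal_pos.2 hg).ne' ofReal_ne_top).1 h3

lemma period_neg_one : period (-1) =
    ofReal (2 ^ (5 / 3 : ℝ) * π ^ 2 / Gamma (2 / 3) ^ 3) := by
  have hg : 0 < Gamma (2 / 3) := Gamma_pos_of_pos (by norm_num)
  set φ : ℝ → ℝ≥0∞ := fun t => ofReal (|1 + ((-1 : ℤ) : ℝ) * t ^ 2| ^ (-(2 / 3) : ℝ)) with hφ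
  have hφm : Measurable φ := by fun_prop
  have hneg : ∀ t, φ (-1 * t + 0) = φ t := fun t => by simp [hφ]
  set L := ofReal (2 * 4 ^ (-(2 / 3) : ℝ)) *
    ofReal (Gamma (1 / 3) ^ 2 / Gamma (2 / 3)) with hL
  have hr : ∫⁻ t in Ioi 1, φ t = L := by
    have himg : (fun x : ℝ => (1 + x) / (1 - x)) '' Ioo 0 1 = Set.Ioi 1 := by
      ext t
      constructor
      · rintro ⟨x, hx, rfl⟩
        exact Set.mem_Ioi.2 ((one_lt_div (by linarith [hx.2])).2 (by linarith [hx.1]))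
      · intro ht
        have ht : 1 < t := ht
        refine ⟨(t - 1) / (t + 1), ⟨div_pos (by linarith) (by linarith),
          (div_lt_one (by linarith)).2 (by linarith)⟩, ?_⟩
        have : t + 1 ≠ 0 := by linarith
        field_simp
        ring
    have h := lintegral_image_eq_lintegral_abs_deriv_mul (s := Ioo (0 : ℝ) 1)
      (f := fun x : ℝ => (1 + x) / (1 - x)) (f' := fun x => 2 / (1 - x) ^ 2) measurableSet_Ioo
      (fun x hx => by
        have hx' : 1 - x ≠ 0 := by linarith [hx.2]
        have := ((hasDerivAt_id x).const_add 1).div ((hasDerivAt_id x).const_sub 1) hx'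
        exact (this.congr_deriv (by simp; ring)).hasDerivWithinAt)
      (fun x hx y hy hxy => by
        have hx' : 1 - x ≠ 0 := by linarith [hx.2]
        have hy' : 1 - y ≠ 0 := by linarith [hy.2]
        simp only [div_eq_div_iff hx' hy'] at hxy
        linarith) φ
    rw [← himg, h, hL, ← lintegral_beta_third, ← lintegral_const_mul' _ _ ofReal_ne_top]
    refine setLIntegral_congr_fun measurableSet_Ioo fun x hx => ?_
    have h0 : 0 < x := hx.1
    have h1 : 0 < 1 - x := by linarith [hx.2]
    simp only [hφ]
    rw [← ofReal_mul (abs_nonneg _), ← ofReal_mul (by positivity)]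
    congr 1
    rw [show 1 + ((-1 : ℤ) : ℝ) * ((1 + x) / (1 - x)) ^ 2 = -(4 * x / (1 - x) ^ 2) by
      push_cast; field_simp; ring, abs_neg, abs_of_pos (by positivity), abs_of_pos (by positivity),
      div_rpow (by positivity) (by positivity), mul_rpow (by norm_num) h0.le]
    have e : (1 - x) ^ (-(2 / 3) : ℝ) = ((1 - x) ^ 2)⁻¹ * (((1 - x) ^ 2) ^ (-(2 / 3) : ℝ))⁻¹ := by
      rw [← rpow_natCast, ← rpow_mul h1.le, ← rpow_neg h1.le, ← rpow_neg h1.le,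
        ← rpow_add h1]; norm_num
    rw [e]; ring
  have hl : ∫⁻ t in Iio (-1), φ t = L := by
    have h := lintegral_comp_affine (hφm.indicator (measurableSet_Ioi (a := (1 : ℝ))))
      (by norm_num : (-1 : ℝ) ≠ 0) 0
    rw [lintegral_indicator measurableSet_Ioi, hr] at h
    rw [← lintegral_indicator measurableSet_Iio]
    simp only [inv_neg, inv_one, abs_neg, abs_one, ofReal_one, one_mul] at h
    rw [← h]
    refine lintegral_congr fun t => ?_
    rw [indicator_apply, indicator_apply, hneg]
    exact if_congr ⟨fun h => by simp at *; linarith,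
      fun h => by simp at *; linarith⟩ rfl rfl
  have hm : ∫⁻ t in Ioo (-1) 1, φ t = L := by
    have h := lintegral_comp_affine (hφm.indicator (measurableSet_Ioo (a := (-1 : ℝ)) (b := 1)))
      (by norm_num : (2 : ℝ) ≠ 0) (-1)
    rw [lintegral_indicator measurableSet_Ioo] at h
    have h2 : ofReal 2 * ofReal |(2 : ℝ)⁻¹| = 1 := by
      rw [← ofReal_mul (by norm_num)]; norm_num
    rw [← one_mul (∫⁻ t in Ioo (-1) 1, φ t), ← h2, mul_assoc, ← h, hL, ← lintegral_beta_third,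
      ofReal_mul (by norm_num), mul_assoc]
    congr 1
    rw [← lintegral_const_mul' _ _ ofReal_ne_top, ← lintegral_indicator measurableSet_Ioo]
    refine lintegral_congr fun x => ?_
    rw [indicator_apply, indicator_apply]
    by_cases hx : x ∈ Ioo (0 : ℝ) 1
    · have h0 : 0 < x := hx.1
      have h1 : 0 < 1 - x := by linarith [hx.2]
      rw [if_pos hx, if_pos ⟨by linarith, by linarith⟩, ← ofReal_mul (by positivity),
        ← mul_rpow h0.le h1.le, ← mul_rpow (by norm_num) (by positivity)]
      simp only [hφ]
      rw [show 1 + ((-1 : ℤ) : ℝ) * (2 * x + -1) ^ 2 = 4 * (x * (1 - x)) by push_cast; ring,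
        abs_of_pos (by positivity)]
    · rw [if_neg hx, if_neg fun h => hx ⟨by linarith [h.1], by linarith [h.2]⟩]
  have hsum : period (-1) = L + L + L := by
    nth_rw 1 [← hl]
    rw [period, ← hm]
    nth_rw 2 [hm]
    rw [← hr, ← lintegral_indicator measurableSet_Iio, ← lintegral_indicator measurableSet_Ioo,
      ← lintegral_indicator measurableSet_Ioi, ← lintegral_add_left (hφm.indicator measurableSet_Iio),
      ← lintegral_add_left (by fun_prop (disch := measurability))]
    refine lintegral_congr fun t => ?_
    change φ t = _
    have h1 : φ 1 = 0 := by simp [hφ]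
    have h2 : φ (-1) = 0 := by simp [hφ]
    simp only [indicator_apply, Set.mem_Iio, Set.mem_Ioo, Set.mem_Ioi]
    rcases lt_trichotomy t (-1) with h | rfl | h
    · simp [h, not_lt.2 h.le, not_lt.2 (by linarith : t ≤ 1)]
    · norm_num [h2]
    rcases lt_trichotomy t 1 with h' | rfl | h'
    · simp [h, h', not_lt.2 h.le, not_lt.2 h'.le]
    · norm_num [h1]
    · simp [h, h', not_lt.2 h.le, not_lt.2 h'.le]
  have h4 := Gamma_third_mul
  have h6 : Gamma (1 / 3) = 2 * π / √3 / Gamma (2 / 3) := by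
    rw [← h4]; field_simp
  have h8 : (2 : ℝ) ^ (5 / 3 : ℝ) = 8 * 4 ^ (-(2 / 3) : ℝ) := by
    rw [show (4 : ℝ) = 2 ^ (2 : ℝ) by norm_num, ← rpow_mul (by norm_num),
      show (8 : ℝ) = 2 ^ (3 : ℝ) by norm_num, ← rpow_add (by norm_num)]; norm_num
  rw [hsum, hL, ← ofReal_mul (by positivity), ← ofReal_add (by positivity)
    (by positivity), ← ofReal_add (by positivity) (by positivity), h8, h6]
  congr 1
  have h9 : √(3 : ℝ) ^ 2 = 3 := sq_sqrt (by norm_num)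
  field_simp
  rw [h9]
  ring

/-- The real period attached to a form. -/
def linePeriod (f : Cub ℝ) : ℝ≥0∞ := ∫⁻ t : ℝ, ofReal (|f.ev t 1| ^ (-(2 / 3) : ℝ))

lemma linePeriod_scal {k : ℝ} (f : Cub ℝ) :
    linePeriod (scal k f) = ofReal (|k| ^ (-(2 / 3) : ℝ)) * linePeriod f := by
  rw [linePeriod, linePeriod, ← lintegral_const_mul' _ _ ofReal_ne_top]
  refine lintegral_congr fun t => ?_
  rw [ev_scal, abs_mul, mul_rpow (abs_nonneg _) (abs_nonneg _),
    ofReal_mul (by positivity)]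

lemma measurable_linePeriod_integrand (f : Cub ℝ) :
    Measurable fun t : ℝ => ofReal (|f.ev t 1| ^ (-(2 / 3) : ℝ)) := by
  unfold ev; fun_prop

lemma linePeriod_swap (f : Cub ℝ) : linePeriod (sub !![0, 1; 1, 0] f) = linePeriod f := by
  have hd : ∀ t ∈ ({0}ᶜ : Set ℝ), HasDerivWithinAt (fun t : ℝ => t⁻¹) (-(t ^ 2)⁻¹) {0}ᶜ t :=
    fun t ht => (hasDerivAt_inv ht).hasDerivWithinAt
  have h := lintegral_image_eq_lintegral_abs_deriv_mul (measurableSet_singleton 0).compl hd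
    inv_injective.injOn fun t => ofReal (|f.ev t 1| ^ (-(2 / 3) : ℝ))
  have himg : (fun t : ℝ => t⁻¹) '' {0}ᶜ = {0}ᶜ := by
    rw [Set.image_inv_eq_inv]; ext; simp
  have hae : ({0}ᶜ : Set ℝ) =ᵐ[volume] univ := by
    simp
  rw [himg, setLIntegral_congr hae, setLIntegral_univ] at h
  rw [linePeriod, linePeriod, h, ← setLIntegral_univ, ← setLIntegral_congr hae]
  refine setLIntegral_congr_fun (measurableSet_singleton 0).compl fun t ht => ?_
  have ht' : t ≠ 0 := ht
  have h0 : 0 < |t| := abs_pos.2 ht'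
  rw [ev_sub, ← ofReal_mul (abs_nonneg _), show f.ev (t * !![(0 : ℝ), 1; 1, 0] 0 0 +
    1 * !![(0 : ℝ), 1; 1, 0] 1 0) (t * !![(0 : ℝ), 1; 1, 0] 0 1 + 1 * !![(0 : ℝ), 1; 1, 0] 1 1) =
    t ^ 3 * f.ev t⁻¹ 1 by simp [ev]; field_simp, abs_mul, mul_rpow (abs_nonneg _) (abs_nonneg _),
    abs_neg, abs_inv, abs_pow, abs_pow, ← rpow_natCast, ← rpow_natCast,
    ← rpow_mul h0.le, ← rpow_neg h0.le]
  norm_num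

lemma linePeriod_eq {σ : ℤ} (hσ : (σ : ℝ) ^ 2 = 1) (f : Cub ℝ) (hf : 0 < (σ : ℝ) * f.disc) :
    linePeriod f = ofReal (4 ^ (1 / 6 : ℝ)) * period (-σ) *
      ofReal (((σ : ℝ) * f.disc) ^ (-(1 / 6) : ℝ)) := by
  have key : ∀ (M : Matrix (Fin 2) (Fin 2) ℝ) (_ : M.det ^ 2 = 1) (g : Cub ℝ),
      (sub M g).disc = g.disc := fun M hM g => by
    rw [disc_sub, show M.det ^ 6 = (M.det ^ 2) ^ 3 by ring, hM]; ring
  refine normalForm_induction (P := fun f => 0 < (σ : ℝ) * f.disc → linePeriod f =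
    ofReal (4 ^ (1 / 6 : ℝ)) * period (-σ) *
      ofReal (((σ : ℝ) * f.disc) ^ (-(1 / 6) : ℝ)))
    (fun t g h => ?_) (fun g h => ?_) (fun s hs g h => ?_) (fun k hk g h hg => ?_) hσ ?_ f hf hf
  · rw [key _ (by simp)] at h
    refine fun hg => .trans ?_ (h hg)
    rw [linePeriod, linePeriod, ← lintegral_add_right_eq_self _ t]
    refine lintegral_congr fun x => ?_
    rw [ev_sub]; simp
  · rwa [key _ (by simp), linePeriod_swap] at h
  · rw [key _ (by simp [hs.ne'])] at h
    refine fun hg => .trans ?_ (h hg)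
    have e : sub !![s, 0; 0, s⁻¹] g = scal (s⁻¹ ^ 3) (sub !![s ^ 2, 0; 0, 1] g) := by
      ext <;> simp [sub, scal, ev, evx, evy] <;> field_simp
    have e2 : linePeriod (sub !![s ^ 2, 0; 0, 1] g) = ofReal |(s ^ 2)⁻¹| * linePeriod g := by
      rw [linePeriod, linePeriod, ← lintegral_comp_affine (measurable_linePeriod_integrand g)
        (by positivity) 0]
      refine lintegral_congr fun x => ?_
      rw [ev_sub]; simp [mul_comm]
    rw [e, linePeriod_scal, e2, ← mul_assoc, ← ofReal_mul (by positivity),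
      abs_of_pos (by positivity), abs_of_pos (by positivity), ← rpow_natCast,
      ← rpow_mul (by positivity), inv_rpow hs.le, ← rpow_neg hs.le,
      ← rpow_natCast, ← rpow_neg hs.le, ← rpow_add hs]
    norm_num
  · have hk' : (0 : ℝ) < |k| := abs_pos.2 hk
    have hD : (σ : ℝ) * (scal k g).disc = |k| ^ (4 : ℝ) * (σ * g.disc) := by
      rw [disc_scal, show (4 : ℝ) = (4 : ℕ) by norm_num, rpow_natCast,
        (by decide : Even 4).pow_abs]
      ring
    have h1 := h (by rw [hD]; positivity)
    rw [linePeriod_scal, hD, mul_rpow (by positivity) hg.le, ← rpow_mul hk'.le,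
      ofReal_mul (by positivity), mul_left_comm] at h1
    norm_num at h1 ⊢
    refine (ENNReal.mul_right_inj ?_ ofReal_ne_top).1 h1
    rw [Ne, ENNReal.ofReal_eq_zero, not_le]; positivity
  · intro _
    have hD : (σ : ℝ) * (⟨0, 1, 0, -σ⟩ : Cub ℝ).disc = 4 := by
      simp only [disc]; linear_combination 4 * hσ
    rw [hD, mul_right_comm, ← ofReal_mul (by positivity), ← rpow_add (by norm_num)]
    norm_num
    refine lintegral_congr fun t => ?_
    simp only [ev]
    have h1 : |(-σ : ℝ)| = 1 := by
      rw [abs_neg, ← abs_one]; exact (sq_eq_sq_iff_abs_eq_abs _ 1).1 (hσ.trans (one_pow 2).symm)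
    rw [show 0 * t ^ 3 + 1 * t ^ 2 * 1 + 0 * t * 1 ^ 2 + -(σ : ℝ) * 1 ^ 3 =
      -σ * (1 + ((-σ : ℤ) : ℝ) * t ^ 2) by push_cast; linear_combination -t ^ 2 * hσ, abs_mul, h1,
      one_mul]

/-- A substitution as a linear map on coefficients. -/
def subLin (M : Matrix (Fin 2) (Fin 2) ℝ) : (ℝ × ℝ³) →ₗ[ℝ] ℝ × ℝ³ where
  toFun p := equivProd ℝ (sub M ((equivProd ℝ).symm p))
  map_add' p q := by ext <;> simp [equivProd, sub, ev, evx, evy] <;> ring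
  map_smul' k p := by ext <;> simp [equivProd, sub, ev, evx, evy] <;> ring

lemma symm_subLin (M : Matrix (Fin 2) (Fin 2) ℝ) (p : ℝ × ℝ³) :
    (equivProd ℝ).symm (subLin M p) = sub M ((equivProd ℝ).symm p) := (equivProd ℝ).symm_apply_apply _

lemma hN_I_sub {c s : ℝ} (h : c ^ 2 + s ^ 2 = 1) (f : Cub ℝ) :
    hN (sub !![c, s; -s, c] f) I = hN f I := by
  have e := hN_I (sub !![c, s; -s, c] f)
  rw [e, hN_I]
  simp [sub, ev, evx, evy]
  linear_combination (3 * f.a ^ 2 + f.b ^ 2 + f.c ^ 2 + 3 * f.d ^ 2) *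
    ((c ^ 2 + s ^ 2) ^ 2 + (c ^ 2 + s ^ 2) + 1) * h

/-- The forms of small norm. -/
def unitBall : Set (ℝ × ℝ³) := {p | 3 * p.1 ^ 2 + p.2.1 ^ 2 + p.2.2.1 ^ 2 + 3 * p.2.2.2 ^ 2 < 1}

lemma volume_unitBall : volume unitBall ≠ 0 ∧ volume unitBall ≠ ⊤ := by
  have ho : IsOpen unitBall := isOpen_lt (by fun_prop) continuous_const
  refine ⟨(ho.measure_pos _ ⟨0, by simp [unitBall]⟩).ne', ?_⟩
  refine (Bornology.IsBounded.measure_lt_top ((Metric.isBounded_closedBall (x := 0) (r := 1)).subset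
    fun p hp => ?_)).ne
  have hp : 3 * p.1 ^ 2 + p.2.1 ^ 2 + p.2.2.1 ^ 2 + 3 * p.2.2.2 ^ 2 < 1 := hp
  rw [mem_closedBall_zero_iff]
  have h1 : ∀ x : ℝ, x ^ 2 < 1 → ‖x‖ ≤ 1 := fun x hx => ((sq_lt_one_iff_abs_lt_one x).1 hx).le
  refine max_le (h1 _ ?_) (max_le (h1 _ ?_) (max_le (h1 _ ?_) (h1 _ ?_))) <;>
    nlinarith [sq_nonneg p.1, sq_nonneg p.2.1, sq_nonneg p.2.2.1, sq_nonneg p.2.2.2]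

instance instIsAddHaarMeasureVolume : (volume : Measure (ℝ × ℝ³)).IsAddHaarMeasure :=
  have _ : (volume : Measure ℝ³).IsAddHaarMeasure :=
    Measure.prod.instIsAddHaarMeasure volume (volume : Measure (ℝ × ℝ))
  Measure.prod.instIsAddHaarMeasure volume volume

lemma map_subLin {c s : ℝ} (h : c ^ 2 + s ^ 2 = 1) :
    Measure.map (subLin !![c, s; -s, c]) volume = volume := by
  have hcomp : subLin !![c, s; -s, c] ∘ₗ subLin !![c, -s; s, c] = LinearMap.id := by
    refine LinearMap.ext fun p => (equivProd ℝ).symm.injective ?_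
    rw [LinearMap.comp_apply, symm_subLin, symm_subLin, ← sub_mul]
    have : !![c, s; -s, c] * !![c, -s; s, c] = (1 : Matrix (Fin 2) (Fin 2) ℝ) := by
      ext i j; fin_cases i <;> fin_cases j <;> simp [mul_apply] <;>
        first | ring1 | linear_combination h
    rw [this, sub_one]; rfl
  have hdet : LinearMap.det (subLin !![c, s; -s, c]) ≠ 0 := fun h0 => by
    have := congrArg LinearMap.det hcomp
    rw [LinearMap.det_comp, h0, zero_mul, LinearMap.det_id] at this
    exact zero_ne_one this
  have hm := Measure.map_linearMap_addHaar_eq_smul_addHaar (volume : Measure (ℝ × ℝ³)) hdet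
  have hb : subLin !![c, s; -s, c] ⁻¹' unitBall = unitBall := by
    ext p
    have h1 : ∀ p, p ∈ unitBall ↔ hN ((equivProd ℝ).symm p) I < 1 := fun p => by
      rw [hN_I]; rfl
    rw [Set.mem_preimage, h1, h1, symm_subLin, hN_I_sub h]
  have h2 := Measure.addHaar_preimage_linearMap (volume : Measure (ℝ × ℝ³)) hdet unitBall
  rw [hb] at h2
  rw [hm, ← (ENNReal.mul_left_inj volume_unitBall.1 volume_unitBall.2).1
    (h2.symm.trans (one_mul _).symm).symm, one_smul]

/-- The coefficient vectors of the normalised region. -/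
def regSet (σ : ℤ) (Y : ℝ) : Set (ℝ × ℝ³) := {p | (equivProd ℝ).symm p ∈ reg σ Y I}

lemma measurableSet_regSet (σ : ℤ) (Y : ℝ) : MeasurableSet (regSet σ Y) :=
  (by fun_prop : Measurable fun p : ℝ × ℝ³ => (p, I)) (measurableSet_reg σ Y)

lemma lintegral_comp_leading (σ : ℤ) {G : ℝ → ℝ≥0∞} (hG : Measurable G) :
    ∫⁻ p in regSet σ 1, G p.1 = ∫⁻ u, G u * sliceVol σ u := by
  rw [← lintegral_indicator (measurableSet_regSet σ 1), Measure.volume_eq_prod,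
    lintegral_prod _ ((show Measurable fun p : ℝ × ℝ³ => G p.1 by fun_prop).indicator (measurableSet_regSet σ 1)).aemeasurable]
  refine lintegral_congr fun u => ?_
  rw [sliceVol, ← lintegral_slice, ← lintegral_const_mul _ (measurable_one.indicator
    (measurableSet_slice ..))]
  refine lintegral_congr fun q => ?_
  by_cases h : q ∈ slice σ 1 I u
  · rw [indicator_of_mem h, indicator_of_mem (show (u, q) ∈ regSet σ 1 from h)]; simp
  · rw [indicator_of_notMem h, indicator_of_notMem (show (u, q) ∉ regSet σ 1 from h), mul_zero]

lemma lintegral_even {F : ℝ → ℝ≥0∞} (hF : ∀ u, F (-u) = F u) :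
    ∫⁻ u, F u = 2 * ∫⁻ u in Ioi 0, F u := by
  have h : ∫⁻ u in Iic 0, F u = ∫⁻ u in Ioi 0, F u := by
    rw [← setLIntegral_congr Iio_ae_eq_Iic]
    have := (Measure.measurePreserving_neg (volume : Measure ℝ)).setLIntegral_comp_emb
      (Homeomorph.neg ℝ).measurableEmbedding F (Ioi 0)
    simpa [hF] using this.symm
  rw [← lintegral_add_compl F (measurableSet_Ioi (a := (0 : ℝ))), compl_Ioi, h, two_mul]

lemma lintegral_leading (σ : ℤ) (r : ℝ) :
    ∫⁻ p in regSet σ 1, ofReal (|p.1| ^ r) = 2 * moment σ r := by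
  rw [lintegral_comp_leading σ (G := fun u => ofReal (|u| ^ r)) (by fun_prop),
    lintegral_even fun u => by rw [abs_neg, sliceVol_neg], moment]
  congr 1
  refine setLIntegral_congr_fun measurableSet_Ioi fun u hu => ?_
  simp only [abs_of_pos (mem_Ioi.1 hu)]

lemma volume_regSet (σ : ℤ) : volume (regSet σ 1) = 2 * moment σ 0 := by
  rw [← lintegral_leading]; simp

lemma subLin_mem_regSet {c s : ℝ} (h : c ^ 2 + s ^ 2 = 1) {σ : ℤ} {p : ℝ × ℝ³} :
    subLin !![c, s; -s, c] p ∈ regSet σ 1 ↔ p ∈ regSet σ 1 := by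
  have hd : det !![c, s; -s, c] = 1 := by
    rw [det_fin_two_of]; linear_combination h
  simp only [regSet, mem_ofPred_eq, symm_subLin, reg, hN_I_sub h, disc_sub, hd, one_pow, one_mul]

lemma lintegral_rotate (σ : ℤ) (t : ℝ) :
    ∫⁻ p in regSet σ 1, ofReal (|((equivProd ℝ).symm p).ev t 1| ^ (-(2 / 3) : ℝ)) =
      ofReal ((1 + t ^ 2)⁻¹) * (2 * moment σ (-(2 / 3))) := by
  have hq : 0 < 1 + t ^ 2 := by positivity
  set w := √(1 + t ^ 2) with hw
  have hw0 : 0 < w := sqrt_pos.2 hq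
  have hw2 : w ^ 2 = 1 + t ^ 2 := sq_sqrt hq.le
  have h : (t / w) ^ 2 + (1 / w) ^ 2 = 1 := by
    field_simp; linarith
  have hG : Measurable fun p : ℝ × ℝ³ => ofReal (|p.1| ^ (-(2 / 3) : ℝ)) := by fun_prop
  rw [← lintegral_leading, ← lintegral_indicator (measurableSet_regSet σ 1),
    ← lintegral_indicator (measurableSet_regSet σ 1)]
  nth_rw 2 [← map_subLin h]
  have hT : Measurable (subLin !![t / w, 1 / w; -(1 / w), t / w]) :=
    (LinearMap.continuous_of_finiteDimensional _).measurable
  rw [lintegral_map (hG.indicator (measurableSet_regSet σ 1)) hT,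
    ← lintegral_const_mul' _ _ ofReal_ne_top]
  refine lintegral_congr fun p => ?_
  by_cases hp : p ∈ regSet σ 1
  · rw [indicator_of_mem hp, indicator_of_mem ((subLin_mem_regSet h).2 hp),
      ← ofReal_mul (by positivity)]
    have e : ((equivProd ℝ).symm p).ev t 1 =
        w ^ 3 * (subLin !![t / w, 1 / w; -(1 / w), t / w] p).1 := by
      simp [subLin, equivProd, sub, ev]; field_simp
    rw [e, abs_mul, mul_rpow (abs_nonneg _) (abs_nonneg _), abs_of_pos (by positivity),
      ← rpow_natCast, ← rpow_mul hw0.le, ← hw2, ← rpow_natCast w 2,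
      ← rpow_neg hw0.le]
    norm_num
  · rw [indicator_of_notMem hp, indicator_of_notMem (mt (subLin_mem_regSet h).1 hp), mul_zero]

lemma measurable_ev : Measurable fun p : (ℝ × ℝ³) × ℝ =>
    ofReal (|((equivProd ℝ).symm p.1).ev p.2 1| ^ (-(2 / 3) : ℝ)) := by
  simp only [ev, equivProd, Equiv.coe_fn_symm_mk]; fun_prop

lemma lintegral_linePeriod (σ : ℤ) : ∫⁻ p in regSet σ 1, linePeriod ((equivProd ℝ).symm p) =
    ofReal π * (2 * moment σ (-(2 / 3))) := by
  simp only [linePeriod]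
  rw [lintegral_lintegral_swap (f := fun (p : ℝ × ℝ³) (t : ℝ) =>
    ofReal (|((equivProd ℝ).symm p).ev t 1| ^ (-(2 / 3) : ℝ))) measurable_ev.aemeasurable]
  simp only [lintegral_rotate]
  rw [lintegral_mul_const _ (by fun_prop), ← ofReal_integral_eq_lintegral_ofReal
    integrable_inv_one_add_sq (ae_of_all _ fun t => by positivity), integral_univ_inv_one_add_sq]

lemma volume_regSet_scale (σ : ℤ) {y : ℝ} (hy : 0 < y) :
    volume (regSet σ y) = ofReal y * volume (regSet σ 1) := by
  set k := y ^ (1 / 4 : ℝ) with hk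
  have hk0 : 0 < k := by positivity
  have hk4 : k ^ 4 = y := by rw [hk, ← rpow_natCast, ← rpow_mul hy.le]; norm_num
  have e : regSet σ y = (fun p => k⁻¹ • p) ⁻¹' regSet σ 1 := by
    ext p
    have h1 : (equivProd ℝ).symm (k⁻¹ • p) = scal k⁻¹ ((equivProd ℝ).symm p) := rfl
    simp only [regSet, mem_ofPred_eq, Set.mem_preimage, h1, reg, hN_scal, disc_scal]
    generalize hN _ _ = n
    generalize disc (R := ℝ) _ = D
    have h2 : (k⁻¹) ^ 4 = y⁻¹ := by rw [inv_pow, hk4]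
    rw [mul_pow, ← pow_mul, h2, mul_left_comm (σ : ℝ) y⁻¹, mul_left_comm (100 : ℝ) y⁻¹, mul_le_mul_iff_right₀ (by positivity),
      mul_pos_iff_of_pos_left (a := y⁻¹) (by positivity), inv_mul_lt_iff₀ hy, mul_one]
  rw [e, Measure.addHaar_preimage_smul _ (by positivity)]
  simp [Module.finrank_prod, hk4, abs_of_pos hy]

lemma lintegral_disc (σ : ℤ) : ∫⁻ p in regSet σ 1,
    ofReal (((σ : ℝ) * ((equivProd ℝ).symm p).disc) ^ (-(1 / 6) : ℝ)) =
      ofReal (6 / 5) * volume (regSet σ 1) := by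
  have hD : Measurable fun p : ℝ × ℝ³ => (σ : ℝ) * ((equivProd ℝ).symm p).disc := by
    simp only [disc, equivProd, Equiv.coe_fn_symm_mk]; fun_prop
  have hR := measurableSet_regSet σ 1
  rw [lintegral_eq_lintegral_meas_lt _ ((ae_restrict_mem hR).mono fun p hp =>
    rpow_nonneg hp.2.1.le _) (hD.pow_const _).aemeasurable]
  have h1 : ∀ t ∈ Ioi (0 : ℝ), (volume.restrict (regSet σ 1)) {p | t <
      ((σ : ℝ) * ((equivProd ℝ).symm p).disc) ^ (-(1 / 6) : ℝ)} =
      (if t ≤ 1 then 1 else ofReal (t ^ (-6 : ℝ))) * volume (regSet σ 1) := fun t ht => by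
    have ht0 : 0 < t := ht
    rw [Measure.restrict_apply (measurableSet_lt measurable_const (hD.pow_const _))]
    have hlt : ∀ D : ℝ, 0 < D → (t < D ^ (-(1 / 6) : ℝ) ↔ D < t ^ (-6 : ℝ)) := fun D hD => by
      rw [show (-6 : ℝ) = (-(1 / 6))⁻¹ by norm_num, ← lt_rpow_inv_iff_of_neg hD ht0 (by norm_num)]
    split_ifs with h
    · rw [one_mul]
      congr 1
      refine inter_eq_right.2 fun p hp => (hlt _ hp.2.1).2 (hp.2.2.trans_le ?_)
      exact one_le_rpow_of_pos_of_le_one_of_nonpos ht0 h (by norm_num)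
    · rw [← volume_regSet_scale σ (by positivity)]
      congr 1
      have h6 : t ^ (-6 : ℝ) ≤ 1 := rpow_le_one_of_one_le_of_nonpos (not_le.1 h).le (by norm_num)
      ext p
      exact ⟨fun hp => ⟨hp.2.1, hp.2.2.1, (hlt _ hp.2.2.1).1 hp.1⟩,
        fun hp => ⟨(hlt _ hp.2.1).2 hp.2.2, hp.1, hp.2.1, hp.2.2.trans_le h6⟩⟩
  rw [setLIntegral_congr_fun measurableSet_Ioi h1, lintegral_mul_const _ (.ite measurableSet_Iic
    measurable_const (by fun_prop))]
  congr 1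
  rw [← Ioc_union_Ioi_eq_Ioi zero_le_one, lintegral_union measurableSet_Ioi
    (Ioc_disjoint_Ioi le_rfl), setLIntegral_congr_fun (g := fun _ => 1) measurableSet_Ioc
      fun t ht => if_pos ht.2, setLIntegral_congr_fun measurableSet_Ioi
      fun t ht => if_neg (not_le.2 ht), ← ofReal_integral_eq_lintegral_ofReal
      (integrableOn_Ioi_rpow_of_lt (by norm_num) one_pos) ((ae_restrict_mem measurableSet_Ioi).mono
        fun t ht => rpow_nonneg (zero_le_one.trans (mem_Ioi.1 ht).le) _),
    integral_Ioi_rpow_of_lt (by norm_num) one_pos]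
  simp
  rw [← ofReal_one, ← ofReal_add (by norm_num) (by norm_num)]
  norm_num

lemma moment_relation {σ : ℤ} (hσ : (σ : ℝ) ^ 2 = 1) :
    ofReal π * (2 * moment σ (-(2 / 3))) =
      ofReal (4 ^ (1 / 6 : ℝ)) * period (-σ) * (ofReal (6 / 5) * (2 * moment σ 0)) := by
  rw [← lintegral_linePeriod, ← volume_regSet, ← lintegral_disc, setLIntegral_congr_fun
    (measurableSet_regSet σ 1) fun p hp => linePeriod_eq hσ _ hp.2.1, lintegral_const_mul]
  simp only [disc, equivProd, Equiv.coe_fn_symm_mk]; fun_prop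

lemma moment_zero_ne_zero {σ : ℤ} (hσ : (σ : ℝ) ^ 2 = 1) : moment σ 0 ≠ 0 := by
  have ho : IsOpen {p : ℝ × ℝ³ | hN ((equivProd ℝ).symm p) I ^ 2 <
      100 * (σ * ((equivProd ℝ).symm p).disc) ∧ 0 < (σ : ℝ) * ((equivProd ℝ).symm p).disc ∧
      (σ : ℝ) * ((equivProd ℝ).symm p).disc < 1} := by
    have hD : Continuous fun p : ℝ × ℝ³ => (σ : ℝ) * ((equivProd ℝ).symm p).disc := by
      simp only [disc, equivProd, Equiv.coe_fn_symm_mk]; fun_prop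
    have hN : Continuous fun p : ℝ × ℝ³ => hN ((equivProd ℝ).symm p) I := by
      simp only [hN_I, equivProd, Equiv.coe_fn_symm_mk]; fun_prop
    exact (isOpen_lt (hN.pow 2) (hD.const_mul 100)).inter
      ((isOpen_lt continuous_const hD).inter (isOpen_lt hD continuous_const))
  have h1 := ho.measure_pos volume ⟨(0, 1 / 2, 0, -σ / 2), by
    have hD : (σ : ℝ) * ((equivProd ℝ).symm (0, 1 / 2, 0, -(σ : ℝ) / 2)).disc = 1 / 4 := by
      simp only [disc, equivProd, Equiv.coe_fn_symm_mk]
      linear_combination hσ / 4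
    rw [mem_ofPred_eq, hD, hN_I]
    simp only [equivProd, Equiv.coe_fn_symm_mk, div_pow, neg_sq, hσ]
    norm_num⟩
  have h2 : 0 < volume (regSet σ 1) := h1.trans_le (measure_mono fun p hp => ⟨hp.1.le, hp.2⟩)
  rw [volume_regSet] at h2
  exact fun h => by simp [h] at h2

lemma toReal_moments {σ : ℤ} (hσ : (σ : ℝ) ^ 2 = 1) {P Q : ℝ} (hP : 0 < P) (hQ : 0 < Q)
    (hPσ : period σ = ofReal P) (hQσ : period (-σ) = ofReal Q) :
    balVol ⟨0, 1, 0, -σ⟩ ≠ 0 ∧ balVol ⟨0, 1, 0, -σ⟩ ≠ ⊤ ∧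
    (moment σ 0).toReal = π / (4 * √3) * (P / Q) * (balVol ⟨0, 1, 0, -σ⟩).toReal ∧
    (moment σ (-(2 / 3))).toReal =
      3 / (20 * √3) * 4 ^ (2 / 3 : ℝ) * P * (balVol ⟨0, 1, 0, -σ⟩).toReal := by
  have hA := balVol_mul_depressed hσ
  have hB := moment_relation hσ
  have h0 := moment_zero_ne_zero hσ
  have hv : moment σ 0 ≠ ⊤ := moment_ne_top σ (by norm_num)
  have hj : moment σ (-(2 / 3)) ≠ ⊤ := moment_ne_top σ (by norm_num)
  rw [volume_depressed hσ, hPσ] at hA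
  rw [hQσ] at hB
  set c := balVol ⟨0, 1, 0, -σ⟩
  set v := moment σ 0
  set j := moment σ (-(2 / 3))
  have pos : ∀ {x : ℝ}, 0 < x → ofReal x ≠ 0 := fun hx => (ofReal_pos.2 hx).ne'
  have hj0 : j ≠ 0 := fun h => by
    rw [h, mul_zero, mul_zero, eq_comm] at hB
    exact mul_ne_zero (mul_ne_zero (pos (by positivity)) (pos hQ))
      (mul_ne_zero (pos (by positivity)) (mul_ne_zero two_ne_zero h0)) hB
  have hc0 : c ≠ 0 := fun h => by
    rw [h, zero_mul, eq_comm] at hA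
    exact mul_ne_zero (pos (by positivity)) hj0 hA
  have hct : c ≠ ⊤ := fun h => by
    rw [h, top_mul (mul_ne_zero (pos (by positivity)) (pos hP))] at hA
    exact mul_ne_top ofReal_ne_top hj hA.symm
  have hA' := congrArg ENNReal.toReal hA
  have hB' := congrArg ENNReal.toReal hB
  simp only [toReal_mul, toReal_ofReal hP.le, toReal_ofReal hQ.le,
    toReal_ofReal pi_pos.le, toReal_ofNat,
    toReal_ofReal (show (0 : ℝ) ≤ 4 ^ (2 / 3 : ℝ) / 10 * (√27)⁻¹ by positivity),
    toReal_ofReal (show (0 : ℝ) ≤ 2 / 9 by norm_num),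
    toReal_ofReal (show (0 : ℝ) ≤ 6 / 5 by norm_num),
    toReal_ofReal (show (0 : ℝ) ≤ 4 ^ (1 / 6 : ℝ) by positivity)] at hA' hB'
  have h27 : √(27 : ℝ) = 3 * √3 := by
    rw [show (27 : ℝ) = 3 ^ 2 * 3 by norm_num, sqrt_mul (by norm_num), sqrt_sq (by norm_num)]
  have h4 : (4 : ℝ) ^ (2 / 3 : ℝ) = 2 * 4 ^ (1 / 6 : ℝ) := by
    rw [show (2 : ℝ) / 3 = 1 / 2 + 1 / 6 by norm_num, rpow_add (by norm_num), ← sqrt_eq_rpow,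
      show (4 : ℝ) = 2 ^ 2 by norm_num, sqrt_sq (by norm_num)]
  have hj' : j.toReal = 3 / (20 * √3) * 4 ^ (2 / 3 : ℝ) * P * c.toReal := by
    rw [h27] at hA'
    have : j.toReal = 9 / 2 * (2 / 9 * j.toReal) := by ring
    rw [this, ← hA']; field_simp; ring
  refine ⟨hc0, hct, ?_, hj'⟩
  rw [hj', h4] at hB'
  have hq : (0 : ℝ) < 4 ^ (1 / 6 : ℝ) := by positivity
  have : v.toReal = (5 / 12) * (4 ^ (1 / 6 : ℝ) * Q)⁻¹ *
    (4 ^ (1 / 6 : ℝ) * Q * (6 / 5 * (2 * v.toReal))) := by field_simp; ring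
  rw [this, ← hB']; field_simp; ring

end Cub

lemma countCubic_estimate {σ : ℤ} (hσ : σ = 1 ∨ σ = -1) {P Q : ℝ} (hP : 0 < P) (hQ : 0 < Q)
    (hPσ : Cub.period σ = ofReal P) (hQσ : Cub.period (-σ) = ofReal Q) :
    ∃ C : ℝ, 0 ≤ C ∧ ∀ ε : ℝ, 0 < ε → ∀ X : ℝ, 1 ≤ X →
      |(countCubic (fun d => 0 < σ * d ∧ ((σ * d : ℤ) : ℝ) < X) : ℝ) -
        P / (4 * √3 * Q) * X / (riemannZeta 3).re - 3 * 4 ^ (2 / 3 : ℝ) * P / (10 * √3 * π ^ 2) *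
          ((riemannZeta (1 / 3)).re / (riemannZeta (5 / 3)).re) * X ^ (5 / 6 : ℝ)| ≤
      C * X ^ ((7 : ℝ) / 9 + ε) := by
  have hσ2 : σ ^ 2 = 1 := by rcases hσ with rfl | rfl <;> norm_num
  have hσR : (σ : ℝ) ^ 2 = 1 := by exact_mod_cast hσ2
  obtain ⟨hc0, hct, hv, hj⟩ := Cub.toReal_moments hσR hP hQ hPσ hQσ
  have hu := Cub.orbitWeight_redWeight hc0 hct (Cub.balVol_eq hσR)
  obtain ⟨C, hC⟩ := (Cub.levelEstimate_redWeight hσ hc0).maxSum hu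
  have hz2 : (riemannZeta ((2 : ℝ) : ℂ)).re = π ^ 2 / 6 := by
    rw [show ((2 : ℝ) : ℂ) = 2 by norm_num, riemannZeta_two]
    norm_cast
  have hcR : 0 < (Cub.balVol ⟨0, 1, 0, -σ⟩).toReal := toReal_pos hc0 hct
  refine ⟨|C| + 15, by positivity, fun ε hε X hX => ?_⟩
  obtain ⟨hfin, h1⟩ := hC X hX
  have h2 := Cub.countCubic_sub_maxSum hu hσ2 hX hfin
  rw [hv, hj, hz2, toReal_inv, toReal_mul, toReal_ofNat] at h1
  rw [show ((3 : ℝ) : ℂ) = 3 by norm_num, show ((1 / 3 : ℝ) : ℂ) = 1 / 3 by norm_num,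
    show ((5 / 3 : ℝ) : ℂ) = 5 / 3 by norm_num] at h1
  have e1 : X ^ (7 / 9 : ℝ) ≤ X ^ ((7 : ℝ) / 9 + ε) := rpow_le_rpow_of_exponent_le hX (by linarith)
  have e2 : X ^ (1 / 2 : ℝ) ≤ X ^ ((7 : ℝ) / 9 + ε) := rpow_le_rpow_of_exponent_le hX (by linarith)
  set c := (Cub.balVol ⟨0, 1, 0, -σ⟩).toReal
  rw [show (4 * c)⁻¹ * (2 * (π / 3) * (π / (4 * √3) * (P / Q) * c)) * X *
      ((π ^ 2 / 6)⁻¹ * (riemannZeta 3).re⁻¹) = P / (4 * √3 * Q) * X / (riemannZeta 3).re by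
    rw [div_eq_mul_inv _ (riemannZeta 3).re]; field_simp; ring,
    show (4 * c)⁻¹ * (4 / 3 * (riemannZeta (1 / 3)).re * (3 / (20 * √3) * 4 ^ (2 / 3 : ℝ) * P * c)) *
      X ^ (5 / 6 : ℝ) * ((riemannZeta (5 / 3)).re⁻¹ * (π ^ 2 / 6)⁻¹) =
      3 * 4 ^ (2 / 3 : ℝ) * P / (10 * √3 * π ^ 2) *
          ((riemannZeta (1 / 3)).re / (riemannZeta (5 / 3)).re) * X ^ (5 / 6 : ℝ) by
    rw [div_eq_mul_inv _ (riemannZeta (5 / 3)).re]; field_simp; ring] at h1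
  rw [abs_le] at h1 h2 ⊢
  have h3 : C * X ^ (7 / 9 : ℝ) ≤ |C| * X ^ ((7 : ℝ) / 9 + ε) :=
    mul_le_mul (le_abs_self C) e1 (by positivity) (abs_nonneg C)
  constructor <;> linarith

theorem cubic_count_secondary_error_seven_ninths :
    ∀ ε : ℝ, 0 < ε → ∃ Cε : ℝ, ∀ X : ℝ, 1 ≤ X →
      (|(countCubic (fun d => 0 < (d : ℝ) ∧ (d : ℝ) < X) : ℝ)
          - 1 * X / (12 * (riemannZeta 3).re)
          - 1 * (4 * (riemannZeta (1/3)).re / (5 * Gamma (2/3) ^ 3 * (riemannZeta (5/3)).re))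
              * X ^ ((5 : ℝ)/6)| ≤ Cε * X ^ ((7 : ℝ)/9 + ε)) ∧
      (|(countCubic (fun d => -X < (d : ℝ) ∧ (d : ℝ) < 0) : ℝ)
          - 3 * X / (12 * (riemannZeta 3).re)
          - sqrt 3 * (4 * (riemannZeta (1/3)).re / (5 * Gamma (2/3) ^ 3 * (riemannZeta (5/3)).re))
              * X ^ ((5 : ℝ)/6)| ≤ Cε * X ^ ((7 : ℝ)/9 + ε)) := by
  intro ε hε
  have hg : 0 < Gamma (2 / 3) := Gamma_pos_of_pos (by norm_num)
  have h3 : √(3 : ℝ) ^ 2 = 3 := sq_sqrt (by norm_num)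
  have h8 : (4 : ℝ) ^ (2 / 3 : ℝ) * 2 ^ (5 / 3 : ℝ) = 8 := by
    rw [show (4 : ℝ) = 2 ^ (2 : ℝ) by norm_num, ← rpow_mul (by norm_num),
      ← rpow_add (by norm_num), show (8 : ℝ) = 2 ^ (3 : ℝ) by norm_num]
    norm_num
  have hb : 0 < (2 : ℝ) ^ (5 / 3 : ℝ) := by positivity
  have hP : 0 < 2 ^ (5 / 3 : ℝ) * π ^ 2 / (√3 * Gamma (2 / 3) ^ 3) := by positivity
  have hQ : 0 < 2 ^ (5 / 3 : ℝ) * π ^ 2 / Gamma (2 / 3) ^ 3 := by positivity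
  obtain ⟨C₁, hC₁, H₁⟩ := countCubic_estimate (σ := 1) (.inl rfl) hP hQ Cub.period_one
    Cub.period_neg_one
  obtain ⟨C₂, hC₂, H₂⟩ := countCubic_estimate (σ := -1) (.inr rfl) hQ hP Cub.period_neg_one
    (by rw [neg_neg]; exact Cub.period_one)
  refine ⟨C₁ + C₂, fun X hX => ⟨?_, ?_⟩⟩
  · have H := H₁ ε hε X hX
    generalize (4 : ℝ) ^ (2 / 3 : ℝ) = a, (2 : ℝ) ^ (5 / 3 : ℝ) = b at *
    rw [show b * π ^ 2 / (√3 * Gamma (2 / 3) ^ 3) /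
        (4 * √3 * (b * π ^ 2 / Gamma (2 / 3) ^ 3)) = 1 / 12 by
      field_simp; linarith, show 3 * a * (b * π ^ 2 / (√3 * Gamma (2 / 3) ^ 3)) /
        (10 * √3 * π ^ 2) = 4 / (5 * Gamma (2 / 3) ^ 3) by
      field_simp; rw [h3]; linarith] at H
    refine le_trans (le_of_eq ?_) (H.trans (mul_le_mul_of_nonneg_right (by linarith) (by positivity)))
    congr 2
    · simp
      ring
    · ring
  · have H := H₂ ε hε X hX
    generalize (4 : ℝ) ^ (2 / 3 : ℝ) = a, (2 : ℝ) ^ (5 / 3 : ℝ) = b at *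
    rw [show b * π ^ 2 / Gamma (2 / 3) ^ 3 /
        (4 * √3 * (b * π ^ 2 / (√3 * Gamma (2 / 3) ^ 3))) = 1 / 4 by
      field_simp, show 3 * a * (b * π ^ 2 / Gamma (2 / 3) ^ 3) /
        (10 * √3 * π ^ 2) = √3 * (4 / (5 * Gamma (2 / 3) ^ 3)) by
      field_simp; rw [h3]; linarith] at H
    refine le_trans (le_of_eq ?_) (H.trans (mul_le_mul_of_nonneg_right (by linarith) (by positivity)))
    have hP : (fun d : ℤ => -X < (d : ℝ) ∧ (d : ℝ) < 0) =
        fun d => 0 < -1 * d ∧ ((-1 * d : ℤ) : ℝ) < X := by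
      ext d
      rw [neg_one_mul, neg_pos, Int.cast_neg, neg_lt, Int.cast_lt_zero, and_comm]
    rw [hP]
    congr 2
    · ring
    · ring

end
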